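/- Let D ⊂ ℂ^n be a bounded L²_h-domain of holomorphy and let H : D × ℂ^m → [0, ∞) be such that log H is plurisubharmonic on D × ℂ^m, H(z, λw) = |λ| H(z, w) for all (z, w) ∈ D × ℂ^m and λ ∈ ℂ, and there is C > 0 with H(z, w) ≥ C‖w‖ for all (z, w) ∈ D × ℂ^m (so that the Hartogs domain G_D := {(z, w) ∈ D × ℂ^m : H(z, w) < 1} is a bounded pseudoconvex domain). Then G_D is an L²_h-domain of holomorphy. -/

import Mathlib

open MeasureTheory Filter Topology Metric Set
open scoped ENNReal NNReal

/-- Truncated circle average of an `EReal`-valued function: the average over the circle of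
center `c` and radius `R` of the function truncated below at `-n`. -/
noncomputable def circleAvgTrunc (u : ℂ → EReal) (c : ℂ) (R : ℝ) (n : ℕ) : ℝ :=
  (2 * Real.pi)⁻¹ * ∫ θ in (0:ℝ)..(2 * Real.pi),
    (max (u (c + R * Complex.exp (θ * Complex.I))) (-(n : ℝ) : EReal)).toReal

/-- `u` is subharmonic on `Ω ⊆ ℂ`: values in `[-∞, ∞)`, upper semicontinuous on `Ω`, and for
every closed disc contained in `Ω` the value at the center is at most the mean over the
boundary circle (in the extended sense, via decreasing truncations). -/
def SubharmonicOn (u : ℂ → EReal) (Ω : Set ℂ) : Prop :=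
  UpperSemicontinuousOn u Ω ∧ (∀ z ∈ Ω, u z < ⊤) ∧
    ∀ c ∈ Ω, ∀ R : ℝ, 0 < R → Metric.closedBall c R ⊆ Ω →
      u c ≤ ⨅ n : ℕ, (circleAvgTrunc u c R n : EReal)

/-- `u` is plurisubharmonic on `Ω`: values in `[-∞, ∞)`, upper semicontinuous on `Ω`, and its
restriction to every complex line is subharmonic. -/
def PlurisubharmonicOn {E : Type*} [NormedAddCommGroup E] [NormedSpace ℂ E]
    (u : E → EReal) (Ω : Set E) : Prop :=
  UpperSemicontinuousOn u Ω ∧ (∀ z ∈ Ω, u z < ⊤) ∧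
    ∀ a b : E, SubharmonicOn (fun lam : ℂ => u (a + lam • b)) {lam : ℂ | a + lam • b ∈ Ω}

/-- A set `P ⊆ ℂ` is polar. -/
def PolarSet (P : Set ℂ) : Prop :=
  ∀ z ∈ P, ∃ U : Set ℂ, IsOpen U ∧ IsConnected U ∧ z ∈ U ∧
    ∃ u : ℂ → EReal, SubharmonicOn u U ∧ (∃ x ∈ U, u x ≠ ⊥) ∧ ∀ x ∈ P ∩ U, u x = ⊥

/-- A set `P ⊆ ℂⁿ` is pluripolar. -/
def PluripolarSet {E : Type*} [NormedAddCommGroup E] [NormedSpace ℂ E] (P : Set E) : Prop :=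
  ∀ z ∈ P, ∃ U : Set E, IsOpen U ∧ IsConnected U ∧ z ∈ U ∧
    ∃ u : E → EReal, PlurisubharmonicOn u U ∧ (∃ x ∈ U, u x ≠ ⊥) ∧ ∀ x ∈ P ∩ U, u x = ⊥

/-- A domain `D` is pseudoconvex if `z ↦ -log dist(z, ∂D)` is plurisubharmonic on `D`. -/
def IsPseudoconvex {E : Type*} [NormedAddCommGroup E] [NormedSpace ℂ E] (D : Set E) : Prop :=
  PlurisubharmonicOn (fun z => ((- Real.log (Metric.infDist z Dᶜ) : ℝ) : EReal)) D

/-- The square-integrable holomorphic functions on an open set `Ω`. -/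
def L2h {E : Type*} [NormedAddCommGroup E] [NormedSpace ℂ E] [MeasureSpace E]
    (Ω : Set E) : Set (E → ℂ) :=
  {f | DifferentiableOn ℂ f Ω ∧ (∫⁻ z in Ω, (‖f z‖₊ : ℝ≥0∞) ^ 2) < ⊤}

/-- The Bergman kernel of `Ω` on the diagonal,
`K_Ω(z) = sup { |f(z)|²/‖f‖²_{L²(Ω)} : f ∈ L²ₕ(Ω), f ≢ 0 }`. -/
noncomputable def bergmanKernel {E : Type*} [NormedAddCommGroup E] [NormedSpace ℂ E]
    [MeasureSpace E] (Ω : Set E) (z : E) : ℝ≥0∞ :=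
  ⨆ (f : E → ℂ) (_ : f ∈ L2h Ω) (_ : ∃ w ∈ Ω, f w ≠ 0),
    (‖f z‖₊ : ℝ≥0∞) ^ 2 / ∫⁻ w in Ω, (‖f w‖₊ : ℝ≥0∞) ^ 2

/-- `D` is an `L²ₕ`-domain of holomorphy: there are no domains `D₀, D₁` with
`∅ ≠ D₀ ⊆ D₁ ∩ D`, `D₁ ⊄ D`, such that every `f ∈ L²ₕ(D)` extends holomorphically to `D₁`
(agreeing with `f` on `D₀`). -/
def IsL2hDomainOfHolomorphy {E : Type*} [NormedAddCommGroup E] [NormedSpace ℂ E]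
    [MeasureSpace E] (D : Set E) : Prop :=
  ¬ ∃ D0 D1 : Set E, IsOpen D0 ∧ IsConnected D0 ∧ IsOpen D1 ∧ IsConnected D1 ∧
      D0 ⊆ D1 ∩ D ∧ ¬ (D1 ⊆ D) ∧
      ∀ f ∈ L2h D, ∃ F : E → ℂ, DifferentiableOn ℂ F D1 ∧ Set.EqOn F f D0

/-- `w` is a regular boundary point of the domain `D ⊆ ℂ`. -/
def RegularBoundaryPt (D : Set ℂ) (w : ℂ) : Prop :=
  ∃ U : Set ℂ, IsOpen U ∧ w ∈ U ∧ ∃ u : ℂ → EReal, SubharmonicOn u (U ∩ D) ∧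
    (∀ z ∈ U ∩ D, u z < 0) ∧ Tendsto u (𝓝[U ∩ D] w) (𝓝 (0 : EReal))

/-- The (pluricomplex) Green function of a domain `D ⊆ ℂ` with logarithmic pole at `p`. -/
noncomputable def greenFn (D : Set ℂ) (p z : ℂ) : EReal :=
  sSup {v : EReal | ∃ u : ℂ → EReal, SubharmonicOn u D ∧ (∀ x ∈ D, u x < 0) ∧
    (∃ C : ℝ, ∀ᶠ x in 𝓝 p, u x ≤ ((Real.log ‖x - p‖ + C : ℝ) : EReal)) ∧ v = u z}

/-- A polydisc in `ℂⁿ` with centre `c` and multiradius `r`. -/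
def polydisc {n : ℕ} (c : Fin n → ℂ) (r : Fin n → ℝ) : Set (Fin n → ℂ) :=
  {z | ∀ i, ‖z i - c i‖ < r i}


set_option linter.all false
namespace HD
open Complex
open scoped ContDiff ComplexConjugate Convolution
section calc1
variable {E : Type*} [NormedAddCommGroup E] [NormedSpace ℂ E]

noncomputable def DD (c : ℂ) (e : E) (f : E → ℂ) (x : E) : ℂ :=
  (fderiv ℝ f x e + c * fderiv ℝ f x (I • e)) / 2

noncomputable abbrev dz (e : E) (f : E → ℂ) : E → ℂ := DD (-I) e f
noncomputable abbrev dzb (e : E) (f : E → ℂ) : E → ℂ := DD I e f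

def TF (V : Set E) (g : E → ℂ) : Prop := ContDiff ℝ ∞ g ∧ HasCompactSupport g ∧ tsupport g ⊆ V

lemma DD_congr {c : ℂ} {e : E} {f g : E → ℂ} {x : E} (h : f =ᶠ[𝓝 x] g) :
    DD c e f x = DD c e g x := by
  simp only [DD, h.fderiv_eq]

lemma DD_add {c : ℂ} {e : E} {f g : E → ℂ} {x : E} (hf : DifferentiableAt ℝ f x)
    (hg : DifferentiableAt ℝ g x) : DD c e (fun y => f y + g y) x = DD c e f x + DD c e g x := by
  simp only [DD, fderiv_fun_add hf hg, ContinuousLinearMap.add_apply]; ring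

lemma DD_sub {c : ℂ} {e : E} {f g : E → ℂ} {x : E} (hf : DifferentiableAt ℝ f x)
    (hg : DifferentiableAt ℝ g x) : DD c e (fun y => f y - g y) x = DD c e f x - DD c e g x := by
  simp only [DD, fderiv_fun_sub hf hg, ContinuousLinearMap.sub_apply]; ring

lemma DD_neg {c : ℂ} {e : E} {f : E → ℂ} {x : E} :
    DD c e (fun y => - f y) x = - DD c e f x := by
  simp only [DD, fderiv_fun_neg, ContinuousLinearMap.neg_apply]; ring

lemma DD_sum {c : ℂ} {e : E} {ι : Type*} {s : Finset ι} {f : ι → E → ℂ} {x : E}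
    (hf : ∀ i ∈ s, DifferentiableAt ℝ (f i) x) :
    DD c e (fun y => ∑ i ∈ s, f i y) x = ∑ i ∈ s, DD c e (f i) x := by
  simp only [DD, fderiv_fun_sum hf, ContinuousLinearMap.sum_apply]
  rw [Finset.mul_sum, ← Finset.sum_add_distrib, Finset.sum_div]

lemma DD_mul {c : ℂ} {e : E} {f g : E → ℂ} {x : E} (hf : DifferentiableAt ℝ f x)
    (hg : DifferentiableAt ℝ g x) :
    DD c e (fun y => f y * g y) x = DD c e f x * g x + f x * DD c e g x := by
  simp only [DD, fderiv_fun_mul hf hg, ContinuousLinearMap.add_apply,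
    ContinuousLinearMap.smul_apply, smul_eq_mul]; ring

lemma DD_const {c : ℂ} {e : E} {a : ℂ} {x : E} : DD c e (fun _ => a) x = 0 := by
  simp [DD]

lemma DD_const_mul {c : ℂ} {e : E} {f : E → ℂ} {x : E} (a : ℂ) (hf : DifferentiableAt ℝ f x) :
    DD c e (fun y => a * f y) x = a * DD c e f x := by
  rw [DD_mul (differentiableAt_const a) hf, DD_const]; ring

lemma DD_conj {c : ℂ} {e : E} {f : E → ℂ} {x : E} (hf : DifferentiableAt ℝ f x) :
    DD c e (fun y => conj (f y)) x = conj (DD (conj c) e f x) := by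
  have h : HasFDerivAt (fun y => conj (f y))
      ((Complex.conjCLE : ℂ →L[ℝ] ℂ).comp (fderiv ℝ f x)) x :=
    (Complex.conjCLE : ℂ →L[ℝ] ℂ).hasFDerivAt.comp x hf.hasFDerivAt
  simp only [DD, h.fderiv]
  simp [map_ofNat]

lemma dz_conj {e : E} {f : E → ℂ} {x : E} (hf : DifferentiableAt ℝ f x) :
    dz e (fun y => conj (f y)) x = conj (dzb e f x) := by
  rw [dz, DD_conj hf]; simp

lemma dzb_conj {e : E} {f : E → ℂ} {x : E} (hf : DifferentiableAt ℝ f x) :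
    dzb e (fun y => conj (f y)) x = conj (dz e f x) := by
  rw [dzb, DD_conj hf]; simp

lemma DD_comp {c : ℂ} {e : E} {h : ℝ → ℝ} {h' : ℝ} {φ : E → ℝ} {x : E}
    (hh : HasDerivAt h h' (φ x)) (hφ : DifferentiableAt ℝ φ x) :
    DD c e (fun y => ((h (φ y) : ℝ) : ℂ)) x = h' * DD c e (fun y => (φ y : ℂ)) x := by
  have h1 : HasFDerivAt (fun y => ((φ y : ℝ) : ℂ)) (Complex.ofRealCLM.comp (fderiv ℝ φ x)) x :=
    Complex.ofRealCLM.hasFDerivAt.comp x hφ.hasFDerivAt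
  have h2 : HasFDerivAt (fun y => ((h (φ y) : ℝ) : ℂ))
      (Complex.ofRealCLM.comp (h' • (fderiv ℝ φ x))) x :=
    Complex.ofRealCLM.hasFDerivAt.comp x (hh.comp_hasFDerivAt x hφ.hasFDerivAt)
  simp only [DD, h1.fderiv, h2.fderiv]
  simp
  ring

lemma dzb_real {e : E} {φ : E → ℝ} {x : E} (hφ : DifferentiableAt ℝ φ x) :
    dzb e (fun y => (φ y : ℂ)) x = conj (dz e (fun y => (φ y : ℂ)) x) := by
  have h1 : DifferentiableAt ℝ (fun y => ((φ y : ℝ) : ℂ)) x :=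
    Complex.ofRealCLM.differentiableAt.comp x hφ
  rw [← dzb_conj h1]
  simp

lemma contDiff_DD {c : ℂ} {e : E} {f : E → ℂ} (hf : ContDiff ℝ ∞ f) :
    ContDiff ℝ ∞ (DD c e f) := by
  have h : ∀ v : E, ContDiff ℝ ∞ (fun x => fderiv ℝ f x v) := fun v =>
    (hf.fderiv_right (m := ∞) (by simp)).clm_apply contDiff_const
  exact ((h e).add (contDiff_const.mul (h _))).div_const 2

lemma support_DD {c : ℂ} {e : E} {f : E → ℂ} : tsupport (DD c e f) ⊆ tsupport f := by
  apply closure_minimal _ (isClosed_tsupport f)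
  intro x hx
  by_contra h
  apply hx
  have : fderiv ℝ f x = 0 := by
    by_contra h'
    exact h (support_fderiv_subset ℝ h')
  simp [DD, this]

lemma DD_eq_zero_of_notMem {c : ℂ} {e : E} {f : E → ℂ} {x : E} (h : x ∉ tsupport f) :
    DD c e f x = 0 := by
  by_contra h'
  exact h (support_DD (subset_tsupport _ h'))

lemma TF.DD {V : Set E} {g : E → ℂ} (hg : TF V g) (c : ℂ) (e : E) : TF V (DD c e g) := by
  refine ⟨contDiff_DD hg.1, ?_, support_DD.trans hg.2.2⟩
  exact hg.2.1.mono' (subset_tsupport _ |>.trans support_DD)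

lemma TF.mono {V W : Set E} {g : E → ℂ} (hg : TF V g) (h : V ⊆ W) : TF W g :=
  ⟨hg.1, hg.2.1, hg.2.2.trans h⟩

lemma TF.mul_left {V : Set E} {g f : E → ℂ} (hg : TF V g) (hf : ContDiff ℝ ∞ f) :
    TF V (fun x => f x * g x) := by
  have hs : tsupport (fun x => f x * g x) ⊆ tsupport g := tsupport_mul_subset_right
  exact ⟨hf.mul hg.1, hg.2.1.mul_left, hs.trans hg.2.2⟩

lemma TF.mul_right {V : Set E} {g f : E → ℂ} (hg : TF V g) (hf : ContDiff ℝ ∞ f) :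
    TF V (fun x => g x * f x) := by
  have := hg.mul_left hf
  simpa only [mul_comm] using this

lemma TF.add {V : Set E} {g f : E → ℂ} (hg : TF V g) (hf : TF V f) :
    TF V (fun x => g x + f x) := by
  refine ⟨hg.1.add hf.1, hg.2.1.add hf.2.1, ?_⟩
  exact (tsupport_add (f := g) (g := f)).trans (union_subset hg.2.2 hf.2.2)

lemma TF.zero {V : Set E} : TF V (fun _ : E => (0 : ℂ)) := by
  refine ⟨contDiff_const, HasCompactSupport.zero, ?_⟩
  have : tsupport (fun _ : E => (0 : ℂ)) = ∅ := by
    rw [tsupport_eq_empty_iff]; rfl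
  simp [this]

lemma TF.sum {V : Set E} {ι : Type*} {s : Finset ι} {g : ι → E → ℂ} (hg : ∀ i, TF V (g i)) :
    TF V (fun x => ∑ i ∈ s, g i x) := by
  classical
  induction s using Finset.induction_on with
  | empty => simpa using TF.zero
  | insert a s ha ih => simpa [Finset.sum_insert ha] using (hg a).add ih

lemma TF.conj {V : Set E} {g : E → ℂ} (hg : TF V g) : TF V (fun x => conj (g x)) := by
  refine ⟨(Complex.conjCLE : ℂ →L[ℝ] ℂ).contDiff.comp hg.1, ?_, ?_⟩
  · exact hg.2.1.comp_left (g := fun z => (starRingEnd ℂ) z) (by simp)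
  · exact (closure_mono (Function.support_comp_subset (g := fun z => (starRingEnd ℂ) z) (by simp) g)).trans
      hg.2.2

lemma TF.differentiableAt {V : Set E} {g : E → ℂ} (hg : TF V g) {x : E} :
    DifferentiableAt ℝ g x := (hg.1.differentiable (by simp)).differentiableAt

lemma cdAt {F : Type*} [NormedAddCommGroup F] [NormedSpace ℝ F]
    {g : E → F} (hg : ContDiff ℝ ∞ g) {x : E} :
    DifferentiableAt ℝ g x := (hg.differentiable (by simp)).differentiableAt

lemma contDiff_ofReal {φ : E → ℝ} (h : ContDiff ℝ ∞ φ) : ContDiff ℝ ∞ (fun x => (φ x : ℂ)) :=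
  Complex.ofRealCLM.contDiff.comp h

lemma DD_comm {c d : ℂ} {e e' : E} {f : E → ℂ} (hf : ContDiff ℝ ∞ f) (x : E) :
    DD c e (DD d e' f) x = DD d e' (DD c e f) x := by
  have hs : ∀ u v : E, fderiv ℝ (fderiv ℝ f) x u v = fderiv ℝ (fderiv ℝ f) x v u := by
    intro u v
    exact (hf.contDiffAt.isSymmSndFDerivAt (by simp; exact WithTop.coe_le_coe.2 (le_top : (2:ℕ∞) ≤ ⊤))).eq u v
  have hd : DifferentiableAt ℝ (fderiv ℝ f) x :=
    ((hf.fderiv_right (m := ∞) (by simp)).differentiable (by simp)).differentiableAt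
  have h1 : ∀ (d : ℂ) (e' u : E), fderiv ℝ (DD d e' f) x u =
      (fderiv ℝ (fderiv ℝ f) x u e' + d * fderiv ℝ (fderiv ℝ f) x u (I • e')) / 2 := by
    intro d e' u
    have h2 : ∀ v, HasFDerivAt (fun y => fderiv ℝ f y v)
        ((fderiv ℝ (fderiv ℝ f) x).flip v) x := by
      intro v
      have := hd.hasFDerivAt.clm_apply (hasFDerivAt_const v x)
      simpa using this
    have h3 : HasFDerivAt (DD d e' f)
      ((2 : ℂ)⁻¹ • (((fderiv ℝ (fderiv ℝ f) x).flip e') +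
        d • ((fderiv ℝ (fderiv ℝ f) x).flip (I • e')))) x := by
      have := ((h2 e').add ((h2 (I • e')).const_mul d)).const_mul (2 : ℂ)⁻¹
      refine this.congr_of_eventuallyEq (Eventually.of_forall fun y => ?_)
      simp [HD.DD]; ring
    rw [h3.fderiv]
    simp; ring
  unfold DD
  change (fderiv ℝ (DD d e' f) x e + c * fderiv ℝ (DD d e' f) x (I • e)) / 2 =
    (fderiv ℝ (DD c e f) x e' + d * fderiv ℝ (DD c e f) x (I • e')) / 2
  rw [h1, h1, h1, h1, hs e e', hs (I • e) e', hs e (I • e'), hs (I • e) (I • e')]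
  ring

end calc1

section calc2
variable {E : Type*} [NormedAddCommGroup E] [NormedSpace ℂ E] [FiniteDimensional ℂ E]
  [MeasureSpace E] [BorelSpace E] [(volume : Measure E).IsAddHaarMeasure]

lemma TF.integrable {V : Set E} {g : E → ℂ} (hg : TF V g) : Integrable g volume :=
  hg.1.continuous.integrable_of_hasCompactSupport hg.2.1

lemma integral_fderiv_zero {g : E → ℂ} (hg : TF univ g) (v : E) :
    ∫ x, fderiv ℝ g x v = 0 := by
  have : Continuous (fun x => fderiv ℝ g x v) :=
    ((hg.1.fderiv_right (m := ∞) (by simp)).clm_apply contDiff_const).continuous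
  have hi : Integrable (fun x => fderiv ℝ g x v) volume :=
    this.integrable_of_hasCompactSupport (hg.2.1.fderiv_apply ℝ v)
  have := integral_mul_fderiv_eq_neg_fderiv_mul_of_integrable (μ := (volume : Measure E))
    (𝕜 := ℂ) (f := fun _ => (1 : ℂ)) (g := g) (v := v) (by simp) (by simpa using hi)
    (by simpa using hg.integrable) (fun x _ => differentiableAt_const _) (fun x _ => hg.differentiableAt)
  simpa using this

lemma integral_DD {g : E → ℂ} (hg : TF univ g) (c : ℂ) (e : E) : ∫ x, DD c e g x = 0 := by
  have hc : ∀ v, Integrable (fun x => fderiv ℝ g x v) volume := fun v =>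
    ((hg.1.fderiv_right (m := ∞) (by simp)).clm_apply
      contDiff_const).continuous.integrable_of_hasCompactSupport (hg.2.1.fderiv_apply ℝ v)
  simp only [DD]
  rw [integral_div, integral_add (hc e) ((hc _).const_mul c), integral_const_mul,
    integral_fderiv_zero hg, integral_fderiv_zero hg]
  simp

lemma integral_DD_mul {f g : E → ℂ} (hf : ContDiff ℝ ∞ f) (hg : TF univ g) (c : ℂ) (e : E) :
    ∫ x, DD c e f x * g x = - ∫ x, f x * DD c e g x := by
  have h := integral_DD (hg.mul_left hf) c e
  have h2 : ∀ x, DD c e (fun y => f y * g y) x = DD c e f x * g x + f x * DD c e g x :=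
    fun x => DD_mul (cdAt hf) hg.differentiableAt
  simp only [h2] at h
  rw [integral_add] at h
  · exact eq_neg_of_add_eq_zero_left h
  · exact (hg.mul_left (contDiff_DD hf)).integrable
  · exact ((hg.DD c e).mul_left hf).integrable

end calc2

section basic
variable {E : Type*} [NormedAddCommGroup E] [NormedSpace ℂ E]

noncomputable abbrev rdz (e : E) (Φ : E → ℝ) : E → ℂ := dz e (fun y => (Φ y : ℂ))

noncomputable def Lev {ι : Type*} (e : ι → E) (Φ : E → ℝ) (j k : ι) : E → ℂ :=
  dzb (e k) (rdz (e j) Φ)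

lemma contDiff_rdz {e : E} {Φ : E → ℝ} (h : ContDiff ℝ ∞ Φ) : ContDiff ℝ ∞ (rdz e Φ) :=
  contDiff_DD (contDiff_ofReal h)

lemma contDiff_Lev {ι : Type*} {e : ι → E} {Φ : E → ℝ} (h : ContDiff ℝ ∞ Φ) (j k : ι) :
    ContDiff ℝ ∞ (Lev e Φ j k) := contDiff_DD (contDiff_rdz h)

noncomputable def del (e : E) (Φ : E → ℝ) (a : E → ℂ) (x : E) : ℂ :=
  dz e a x - rdz e Φ x * a x

lemma rdz_exp {e : E} {Φ : E → ℝ} (h : ContDiff ℝ ∞ Φ) (x : E) :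
    DD (-I) e (fun y => ((Real.exp (-Φ y) : ℝ) : ℂ)) x = - rdz e Φ x * (Real.exp (-Φ x) : ℝ) := by
  have h1 : HasDerivAt (fun t : ℝ => Real.exp (-t)) (- Real.exp (-Φ x)) (Φ x) := by
    simpa using (hasDerivAt_neg (Φ x)).exp
  have := DD_comp (c := -I) (e := e) h1 (cdAt h)
  rw [this]
  push_cast; ring

lemma contDiff_W {Φ : E → ℝ} (h : ContDiff ℝ ∞ Φ) :
    ContDiff ℝ ∞ (fun y => ((Real.exp (-Φ y) : ℝ) : ℂ)) := contDiff_ofReal h.neg.exp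

lemma TF_del {V : Set E} {e : E} {Φ : E → ℝ} (h : ContDiff ℝ ∞ Φ) {a : E → ℂ} (ha : TF V a) :
    TF V (del e Φ a) := by
  have := (ha.DD (-I) e).add ((ha.mul_left (contDiff_rdz (e := e) h)).mul_left
    (contDiff_const (c := (-1 : ℂ))))
  convert this using 2
  simp [del]; ring

variable [FiniteDimensional ℂ E]
  [MeasureSpace E] [BorelSpace E] [(volume : Measure E).IsAddHaarMeasure]

lemma del_parts {e : E} {Φ : E → ℝ} (h : ContDiff ℝ ∞ Φ) {a b : E → ℂ} (ha : TF univ a)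
    (hb : TF univ b) :
    ∫ x, del e Φ a x * conj (b x) * (Real.exp (-Φ x) : ℝ) =
      - ∫ x, a x * conj (dzb e b x) * (Real.exp (-Φ x) : ℝ) := by
  have h1 := integral_DD_mul (ha.mul_right (contDiff_W h)).1 hb.conj (-I) e
  have e1 : ∀ x, DD (-I) e (fun y => a y * ((Real.exp (-Φ y) : ℝ) : ℂ)) x =
      del e Φ a x * (Real.exp (-Φ x) : ℝ) := by
    intro x
    rw [DD_mul ha.differentiableAt (cdAt (contDiff_W h)), rdz_exp h, del]
    ring
  have e2 : ∀ x, DD (-I) e (fun y => conj (b y)) x = conj (dzb e b x) :=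
    fun x => dz_conj hb.differentiableAt
  simp only [e1, e2] at h1
  calc _ = ∫ x, del e Φ a x * (Real.exp (-Φ x) : ℝ) * conj (b x) := by
        congr 1; ext x; ring
    _ = _ := h1
    _ = _ := by congr 1; congr 1; ext x; ring

lemma del_parts' {e : E} {Φ : E → ℝ} (h : ContDiff ℝ ∞ Φ) {a b : E → ℂ} (ha : TF univ a)
    (hb : TF univ b) :
    ∫ x, b x * conj (del e Φ a x) * (Real.exp (-Φ x) : ℝ) =
      - ∫ x, dzb e b x * conj (a x) * (Real.exp (-Φ x) : ℝ) := by
  have h1 := congrArg conj (del_parts (e := e) h ha hb)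
  rw [← integral_conj, map_neg, ← integral_conj] at h1
  simp only [map_mul, conj_conj, conj_ofReal] at h1
  calc _ = _ := by congr 1; ext x; ring
    _ = _ := h1
    _ = _ := by congr 1; congr 1; ext x; ring

lemma commut {ι : Type*} {e : ι → E} {Φ : E → ℝ} (h : ContDiff ℝ ∞ Φ) {a : E → ℂ}
    (ha : TF univ a) (j k : ι) (x : E) :
    dzb (e k) (del (e j) Φ a) x = del (e j) Φ (dzb (e k) a) x - Lev e Φ j k x * a x := by
  have h1 : del (e j) Φ a = fun x => dz (e j) a x - rdz (e j) Φ x * a x := rfl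
  rw [h1, dzb, DD_sub (ha.DD _ _).differentiableAt
    (ha.mul_left (contDiff_rdz h)).differentiableAt,
    DD_mul (cdAt (contDiff_rdz h)) ha.differentiableAt, DD_comm ha.1, del, Lev]
  ring

lemma basic_jk {ι : Type*} {e : ι → E} {Φ : E → ℝ} (h : ContDiff ℝ ∞ Φ) {a b : E → ℂ}
    (ha : TF univ a) (hb : TF univ b) (j k : ι) :
    ∫ x, del (e j) Φ a x * conj (del (e k) Φ b x) * (Real.exp (-Φ x) : ℝ) =
     ∫ x, (dzb (e k) a x * conj (dzb (e j) b x) + Lev e Φ j k x * a x * conj (b x)) *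
      (Real.exp (-Φ x) : ℝ) := by
  rw [del_parts' h hb (TF_del h ha)]
  have e1 : ∀ x, dzb (e k) (del (e j) Φ a) x * conj (b x) * (Real.exp (-Φ x) : ℝ) =
      del (e j) Φ (dzb (e k) a) x * conj (b x) * (Real.exp (-Φ x) : ℝ) -
      Lev e Φ j k x * a x * conj (b x) * (Real.exp (-Φ x) : ℝ) := by
    intro x; rw [commut h ha]; ring
  have i1 : Integrable (fun x => del (e j) Φ (dzb (e k) a) x * conj (b x) *
      (Real.exp (-Φ x) : ℝ)) volume :=
    ((hb.conj.mul_left (TF_del h (ha.DD _ _)).1).mul_right (contDiff_W h)).integrable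
  have i2 : Integrable (fun x => Lev e Φ j k x * a x * conj (b x) *
      (Real.exp (-Φ x) : ℝ)) volume :=
    ((hb.conj.mul_left ((contDiff_Lev h j k).mul ha.1)).mul_right (contDiff_W h)).integrable
  have i3 : Integrable (fun x => dzb (e k) a x * conj (dzb (e j) b x) *
      (Real.exp (-Φ x) : ℝ)) volume :=
    (((hb.DD _ _).conj.mul_left (ha.DD _ _).1).mul_right (contDiff_W h)).integrable
  simp only [e1, add_mul]
  rw [integral_sub i1 i2, integral_add i3 i2, del_parts h (ha.DD _ _) hb]
  ring

lemma alg1 {ι : Type*} [Fintype ι] (a : ι → ι → ℂ) :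
    0 ≤ (∑ j, ∑ k, a k j * conj (a j k)).re + ∑ j, ∑ k, ‖a j k - a k j‖ ^ 2 := by
  have h1 : ∀ j k, ‖a j k - a k j‖ ^ 2 = ‖a j k‖ ^ 2 + ‖a k j‖^2
      - 2 * (a k j * conj (a j k)).re := by
    intro j k
    rw [norm_sub_sq (𝕜 := ℂ)]
    simp only [inner, RCLike.re_eq_complex_re]
    simp only [← starRingEnd_apply]
    ring
  have h4 : ∀ j k, 2 * (a k j * conj (a j k)).re ≤ (‖a j k‖ ^ 2 + ‖a k j‖^2) := by
    intro j k
    have := sq_nonneg ‖a j k - a k j‖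
    rw [h1] at this
    linarith
  have h3 : (∑ j, ∑ k, ‖a k j‖ ^ 2) = ∑ j, ∑ k, ‖a j k‖ ^ 2 := Finset.sum_comm
  rw [Complex.re_sum]
  simp only [Complex.re_sum]
  rw [← Finset.sum_add_distrib]
  apply Finset.sum_nonneg; intro j _
  rw [← Finset.sum_add_distrib]
  apply Finset.sum_nonneg; intro k _
  rw [h1]
  nlinarith [h4 j k]

lemma TF.re_integrable {V : Set E} {g : E → ℂ} (hg : TF V g) :
    Integrable (fun x => (g x).re) volume := hg.integrable.re

lemma basic_ineq {ι : Type*} [Fintype ι] (e : ι → E) {Φ : E → ℝ} (h : ContDiff ℝ ∞ Φ)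
    {v : ι → E → ℂ} (hv : ∀ j, TF univ (v j)) :
    ∫ x, (∑ j, ∑ k, Lev e Φ j k x * v j x * conj (v k x)).re * Real.exp (-Φ x) ≤
     ∫ x, (‖∑ j, del (e j) Φ (v j) x‖ ^ 2 +
      ∑ j, ∑ k, ‖dzb (e j) (v k) x - dzb (e k) (v j) x‖ ^ 2) * Real.exp (-Φ x) := by
  have key : ∫ x, (∑ j, ∑ k, del (e j) Φ (v j) x * conj (del (e k) Φ (v k) x)) *
        (Real.exp (-Φ x) : ℝ) =
      ∫ x, (∑ j, ∑ k, (dzb (e k) (v j) x * conj (dzb (e j) (v k) x) +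
        Lev e Φ j k x * v j x * conj (v k x))) * (Real.exp (-Φ x) : ℝ) := by
    simp only [Finset.sum_mul]
    rw [integral_finsetSum, integral_finsetSum]
    · refine Finset.sum_congr rfl fun j _ => ?_
      rw [integral_finsetSum, integral_finsetSum]
      · refine Finset.sum_congr rfl fun k _ => ?_
        exact basic_jk h (hv j) (hv k) j k
      · intro k _
        exact ((((hv k).DD _ _).conj.mul_left ((hv j).DD _ _).1).add
          ((hv k).conj.mul_left ((contDiff_Lev h j k).mul (hv j).1))
            |>.mul_right (contDiff_W h)).integrable
      · intro k _
        exact (((TF_del h (hv k)).conj.mul_left (TF_del h (hv j)).1).mul_right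
          (contDiff_W h)).integrable
    · intro j _
      refine integrable_finset_sum _ fun k _ => ?_
      exact ((((hv k).DD _ _).conj.mul_left ((hv j).DD _ _).1).add
          ((hv k).conj.mul_left ((contDiff_Lev h j k).mul (hv j).1))
            |>.mul_right (contDiff_W h)).integrable
    · intro j _
      refine integrable_finset_sum _ fun k _ => ?_
      exact (((TF_del h (hv k)).conj.mul_left (TF_del h (hv j)).1).mul_right
          (contDiff_W h)).integrable
  have key2 := congrArg Complex.re key
  have t1 : TF univ (fun x => (∑ j, ∑ k, del (e j) Φ (v j) x * conj (del (e k) Φ (v k) x)) *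
        ((Real.exp (-Φ x) : ℝ) : ℂ)) :=
    (TF.sum fun j => TF.sum fun k => (TF_del h (hv k)).conj.mul_left (TF_del h (hv j)).1).mul_right
      (contDiff_W h)
  have t2 : TF univ (fun x => (∑ j, ∑ k, (dzb (e k) (v j) x * conj (dzb (e j) (v k) x) +
        Lev e Φ j k x * v j x * conj (v k x))) * ((Real.exp (-Φ x) : ℝ) : ℂ)) :=
    (TF.sum fun j => TF.sum fun k => ((((hv k).DD _ _).conj.mul_left ((hv j).DD _ _).1).add
          ((hv k).conj.mul_left ((contDiff_Lev h j k).mul (hv j).1)))).mul_right (contDiff_W h)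
  have t3 : TF univ (fun x => (∑ j, ∑ k, (dzb (e j) (v k) x - dzb (e k) (v j) x) *
      conj (dzb (e j) (v k) x - dzb (e k) (v j) x)) * ((Real.exp (-Φ x) : ℝ) : ℂ)) := by
    refine (TF.sum fun j => TF.sum fun k => ?_).mul_right (contDiff_W h)
    have : TF univ (fun x => dzb (e j) (v k) x - dzb (e k) (v j) x) := by
      have := ((hv k).DD I (e j)).add (((hv j).DD I (e k)).mul_left
        (contDiff_const (c := (-1 : ℂ))))
      convert this using 2; ring
    exact this.conj.mul_left this.1
  have t4 : TF univ (fun x => (∑ j, ∑ k, Lev e Φ j k x * v j x * conj (v k x)) *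
      ((Real.exp (-Φ x) : ℝ) : ℂ)) :=
    (TF.sum fun j => TF.sum fun k => ((hv k).conj.mul_left ((contDiff_Lev h j k).mul
      (hv j).1))).mul_right (contDiff_W h)
  have hre : ∀ {g : E → ℂ}, Integrable g volume → (∫ x, g x).re = ∫ x, (g x).re := by
    intro g hg
    exact (integral_re hg).symm
  rw [hre t1.integrable, hre t2.integrable] at key2
  have e1 : ∀ x, ((∑ j, ∑ k, del (e j) Φ (v j) x * conj (del (e k) Φ (v k) x)) *
        ((Real.exp (-Φ x) : ℝ) : ℂ)).re = ‖∑ j, del (e j) Φ (v j) x‖ ^ 2 * Real.exp (-Φ x) := by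
    intro x
    rw [Complex.re_mul_ofReal]
    congr 1
    rw [← Finset.sum_mul_sum, ← map_sum, Complex.mul_conj, Complex.normSq_eq_norm_sq]
    simp only [Complex.ofReal_re]
  have e3 : ∀ x, ((∑ j, ∑ k, (dzb (e j) (v k) x - dzb (e k) (v j) x) *
      conj (dzb (e j) (v k) x - dzb (e k) (v j) x)) * ((Real.exp (-Φ x) : ℝ) : ℂ)).re =
      (∑ j, ∑ k, ‖dzb (e j) (v k) x - dzb (e k) (v j) x‖ ^ 2) * Real.exp (-Φ x) := by
    intro x
    rw [Complex.re_mul_ofReal]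
    congr 1
    simp only [Complex.mul_conj, Complex.normSq_eq_norm_sq, Complex.re_sum, Complex.ofReal_re]
  have e4 : ∀ x, ((∑ j, ∑ k, Lev e Φ j k x * v j x * conj (v k x)) *
      ((Real.exp (-Φ x) : ℝ) : ℂ)).re =
      (∑ j, ∑ k, Lev e Φ j k x * v j x * conj (v k x)).re * Real.exp (-Φ x) := by
    intro x; rw [Complex.re_mul_ofReal]
  have i1 := t1.re_integrable
  have i2 := t2.re_integrable
  have i3 := t3.re_integrable
  have i4 := t4.re_integrable
  simp only [e1, e3, e4] at i1 i3 i4 key2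
  simp only [add_mul]
  rw [integral_add i1 i3, key2, ← integral_add i2 i3]
  refine integral_mono i4 (i2.add i3) fun x => ?_
  have ha := alg1 (fun j k => dzb (e j) (v k) x)
  have hE := Real.exp_pos (-Φ x)
  simp only [Complex.re_mul_ofReal, Finset.sum_add_distrib, Complex.add_re]
  nlinarith [mul_nonneg ha hE.le]

noncomputable def LF {ι : Type*} [Fintype ι] (e : ι → E) (Φ : E → ℝ) (x : E) (ζ : ι → ℂ) : ℝ :=
  (∑ j, ∑ k, Lev e Φ j k x * ζ j * conj (ζ k)).re

lemma rdz_twist {e : E} {Φ τ : E → ℝ} (h : ContDiff ℝ ∞ Φ) (hτ : ContDiff ℝ ∞ τ)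
    (hp : ∀ x, 0 < τ x) (x : E) :
    rdz e (fun y => Φ y - Real.log (τ y)) x = rdz e Φ x - rdz e τ x / τ x := by
  have h1 := DD_comp (c := -I) (e := e) (Real.hasDerivAt_log (hp x).ne') (cdAt hτ)
  have hl : ContDiff ℝ ∞ (fun y => Real.log (τ y)) := hτ.log fun x => (hp x).ne'
  have : (fun y => ((Φ y - Real.log (τ y) : ℝ) : ℂ)) =
    fun y => (Φ y : ℂ) - ((Real.log (τ y) : ℝ) : ℂ) := by ext y; push_cast; rfl
  rw [rdz, dz, this, DD_sub (cdAt (contDiff_ofReal h)) (cdAt (contDiff_ofReal hl)), h1]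
  push_cast; simp only [rdz, dz]; ring

lemma Lev_twist {ι : Type*} {e : ι → E} {Φ τ : E → ℝ} (h : ContDiff ℝ ∞ Φ)
    (hτ : ContDiff ℝ ∞ τ) (hp : ∀ x, 0 < τ x) (j k : ι) (x : E) :
    Lev e (fun y => Φ y - Real.log (τ y)) j k x = Lev e Φ j k x - Lev e τ j k x / τ x
      + rdz (e j) τ x * conj (rdz (e k) τ x) / (τ x) ^ 2 := by
  have h0 : rdz (e j) (fun y => Φ y - Real.log (τ y)) = fun x =>
      rdz (e j) Φ x - rdz (e j) τ x * (((τ x)⁻¹ : ℝ) : ℂ) := by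
    ext x; rw [rdz_twist h hτ hp]; push_cast; rfl
  have hi : ContDiff ℝ ∞ (fun y => (τ y)⁻¹) := hτ.inv fun x => (hp x).ne'
  have h1 := DD_comp (c := I) (e := e k) (hasDerivAt_inv (hp x).ne') (cdAt hτ)
  have h2 : DD I (e k) (fun y => (τ y : ℂ)) x = conj (rdz (e k) τ x) := dzb_real (cdAt hτ)
  rw [Lev, h0, dzb, DD_sub (cdAt (contDiff_rdz h)) (cdAt ((contDiff_rdz hτ).mul
    (contDiff_ofReal hi))), DD_mul (cdAt (contDiff_rdz hτ)) (cdAt (contDiff_ofReal hi)), h1, h2]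
  simp only [Lev, dzb]
  push_cast; ring

lemma twisted {ι : Type*} [Fintype ι] (e : ι → E) {Φ τ A θ : E → ℝ} (h : ContDiff ℝ ∞ Φ)
    (hτ : ContDiff ℝ ∞ τ) (hp : ∀ x, 0 < τ x) (hA : Continuous A) (hAp : ∀ x, 0 < A x)
    (hθ : Continuous θ) {V : Set E}
    (hV : ∀ x ∈ V, ∀ ζ : ι → ℂ, θ x * ∑ j, ‖ζ j‖ ^ 2 + ‖∑ j, rdz (e j) τ x * ζ j‖ ^ 2 / A x ≤
      τ x * LF e Φ x ζ - LF e τ x ζ)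
    {v : ι → E → ℂ} (hv : ∀ j, TF V (v j)) :
    ∫ x, (θ x * ∑ j, ‖v j x‖ ^ 2) * Real.exp (-Φ x) ≤
     ∫ x, ((τ x + A x) * ‖∑ j, del (e j) Φ (v j) x‖ ^ 2 +
      τ x * ∑ j, ∑ k, ‖dzb (e j) (v k) x - dzb (e k) (v j) x‖ ^ 2) * Real.exp (-Φ x) := by
  have hv' : ∀ j, TF univ (v j) := fun j => (hv j).mono (subset_univ _)
  have hl : ContDiff ℝ ∞ (fun y => Real.log (τ y)) := hτ.log fun x => (hp x).ne'
  have hΨ : ContDiff ℝ ∞ (fun y => Φ y - Real.log (τ y)) := h.sub hl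
  have hb := basic_ineq e hΨ hv'
  have hexp : ∀ x, Real.exp (-(Φ x - Real.log (τ x))) = τ x * Real.exp (-Φ x) := by
    intro x
    rw [neg_sub, sub_eq_add_neg, Real.exp_add, Real.exp_log (hp x)]
  have hdel : ∀ x, ∑ j, del (e j) (fun y => Φ y - Real.log (τ y)) (v j) x =
      ∑ j, del (e j) Φ (v j) x + (∑ j, rdz (e j) τ x * v j x) / τ x := by
    intro x
    rw [Finset.sum_div, ← Finset.sum_add_distrib]
    refine Finset.sum_congr rfl fun j _ => ?_
    rw [del, del, rdz_twist h hτ hp]; ring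
  have hlev : ∀ x, (∑ j, ∑ k, Lev e (fun y => Φ y - Real.log (τ y)) j k x * v j x *
      conj (v k x)).re = LF e Φ x (fun j => v j x) - LF e τ x (fun j => v j x) / τ x +
      ‖∑ j, rdz (e j) τ x * v j x‖ ^ 2 / (τ x) ^ 2 := by
    intro x
    have : (‖∑ j, rdz (e j) τ x * v j x‖ ^ 2 : ℝ) =
        (∑ j, ∑ k, (rdz (e j) τ x * conj (rdz (e k) τ x)) * v j x * conj (v k x)).re := by
      have h5 : (∑ j, ∑ k, (rdz (e j) τ x * conj (rdz (e k) τ x)) * v j x * conj (v k x)) =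
        ((‖∑ j, rdz (e j) τ x * v j x‖ ^ 2 : ℝ) : ℂ) := by
        rw [← Complex.normSq_eq_norm_sq, ← Complex.mul_conj, map_sum, Finset.sum_mul_sum]
        refine Finset.sum_congr rfl fun j _ => Finset.sum_congr rfl fun k _ => ?_
        rw [map_mul]; ring
      rw [h5, Complex.ofReal_re]
    rw [this, LF, LF]
    have e1 : ∀ (z : ℂ) (t : ℝ), z.re / t = (z / t).re := fun z t => (Complex.div_ofReal_re z t).symm
    rw [e1, ← Complex.sub_re]
    rw [show ((τ x) ^ 2 : ℝ) = ((τ x) ^ 2 : ℝ) from rfl, e1, ← Complex.add_re]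
    congr 1
    simp only [Finset.sum_div]
    rw [← Finset.sum_sub_distrib, ← Finset.sum_add_distrib]
    refine Finset.sum_congr rfl fun j _ => ?_
    rw [← Finset.sum_sub_distrib, ← Finset.sum_add_distrib]
    refine Finset.sum_congr rfl fun k _ => ?_
    rw [Lev_twist h hτ hp]
    push_cast; ring
  simp only [hexp, hdel, hlev] at hb
  have cS : ∀ j, Continuous (v j) := fun j => (hv j).1.continuous
  have hz : ∀ x, x ∉ ⋃ j, tsupport (v j) → ∀ j, v j x = 0 := by
    intro x hx j
    by_contra h0
    exact hx (mem_iUnion.2 ⟨j, subset_tsupport _ h0⟩)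
  have hzd : ∀ x, x ∉ ⋃ j, tsupport (v j) → ∀ j c d, DD c d (v j) x = 0 := by
    intro x hx j c d
    exact DD_eq_zero_of_notMem (fun h0 => hx (mem_iUnion.2 ⟨j, h0⟩))
  have hK : IsCompact (⋃ j, tsupport (v j)) := isCompact_iUnion fun j => (hv j).2.1
  have intg : ∀ g : E → ℝ, Continuous g → (∀ x, x ∉ ⋃ j, tsupport (v j) → g x = 0) →
      Integrable g volume := by
    intro g hg hg0
    exact hg.integrable_of_hasCompactSupport (HasCompactSupport.intro hK hg0)
  have ccexp : Continuous fun x => Real.exp (-Φ x) := h.neg.exp.continuous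
  have cdel : ∀ j, Continuous (fun x => del (e j) Φ (v j) x) :=
    fun j => (TF_del h (hv j)).1.continuous
  have cD : ∀ j c d, Continuous (fun x => DD c d (v j) x) :=
    fun j c d => ((hv j).DD c d).1.continuous
  have cr : ∀ j, Continuous (fun x => rdz (e j) τ x) := fun j => (contDiff_rdz hτ).continuous
  have cL : ∀ (Φ : E → ℝ), ContDiff ℝ ∞ Φ →
      Continuous fun x => LF e Φ x (fun j => v j x) := by
    intro Φ h
    refine Complex.continuous_re.comp (continuous_finset_sum _ fun j _ =>
      continuous_finset_sum _ fun k _ => ?_)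
    exact ((contDiff_Lev h j k).continuous.mul (cS j)).mul
      (Complex.continuous_conj.comp (cS k))
  have cτ := hτ.continuous
  have cci : Continuous fun x => (τ x)⁻¹ := cτ.inv₀ fun x => (hp x).ne'
  have ccA : Continuous fun x => (A x)⁻¹ := hA.inv₀ fun x => (hAp x).ne'
  -- difference of integrands
  have hi1 : Integrable (fun x => (LF e Φ x (fun j => v j x) - LF e τ x (fun j => v j x) / τ x +
      ‖∑ j, rdz (e j) τ x * v j x‖ ^ 2 / (τ x) ^ 2) * (τ x * Real.exp (-Φ x))) volume := by
    apply intg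
    · have := cL Φ h
      have := cL τ hτ
      simp only [div_eq_mul_inv, ← inv_pow]
      fun_prop
    · intro x hx
      have := hz x hx
      simp [LF, this]
  have hi2 : Integrable (fun x => (‖∑ j, del (e j) Φ (v j) x + (∑ j, rdz (e j) τ x * v j x) / τ x‖ ^ 2 +
      ∑ j, ∑ k, ‖dzb (e j) (v k) x - dzb (e k) (v j) x‖ ^ 2) * (τ x * Real.exp (-Φ x))) volume := by
    apply intg
    · have : Continuous fun x => ((τ x : ℂ))⁻¹ := by
        have := Complex.continuous_ofReal.comp cci
        simpa [Function.comp_def] using this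
      simp only [div_eq_mul_inv]
      fun_prop
    · intro x hx
      have := hz x hx
      have := hzd x hx
      simp [del, *]
  have hi3 : Integrable (fun x => (θ x * ∑ j, ‖v j x‖ ^ 2) * Real.exp (-Φ x)) volume := by
    apply intg
    · fun_prop
    · intro x hx
      simp [hz x hx]
  have hi4 : Integrable (fun x => ((τ x + A x) * ‖∑ j, del (e j) Φ (v j) x‖ ^ 2 +
      τ x * ∑ j, ∑ k, ‖dzb (e j) (v k) x - dzb (e k) (v j) x‖ ^ 2) * Real.exp (-Φ x)) volume := by
    apply intg
    · fun_prop
    · intro x hx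
      have := hz x hx
      have := hzd x hx
      simp [del, *]
  rw [← sub_nonneg, ← integral_sub hi2 hi1] at hb
  rw [← sub_nonneg, ← integral_sub hi4 hi3]
  refine hb.trans (integral_mono (hi2.sub hi1) (hi4.sub hi3) fun x => ?_)
  have hE := Real.exp_pos (-Φ x)
  have ht := hp x
  have hAx := hAp x
  have main : θ x * ∑ j, ‖v j x‖ ^ 2 + ‖∑ j, rdz (e j) τ x * v j x‖ ^ 2 / A x ≤
      τ x * LF e Φ x (fun j => v j x) - LF e τ x (fun j => v j x) := by
    by_cases hx : x ∈ V
    · exact hV x hx _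
    · have : ∀ j, v j x = 0 := fun j => by
        by_contra h0
        exact hx ((hv j).2.2 (subset_tsupport _ h0))
      simp [LF, this]
  simp only [Pi.sub_apply]
  set S := ∑ j, rdz (e j) τ x * v j x with hS
  set d := ∑ j, del (e j) Φ (v j) x with hd
  set cu := ∑ j, ∑ k, ‖dzb (e j) (v k) x - dzb (e k) (v j) x‖ ^ 2 with hcu
  set L1 := LF e Φ x (fun j => v j x)
  set L2 := LF e τ x (fun j => v j x)
  have n1 : τ x * ‖d + S / τ x‖ ^ 2 = τ x * ‖d‖ ^ 2 + 2 * (S * conj d).re + ‖S‖ ^ 2 / τ x := by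
    rw [norm_add_sq (𝕜 := ℂ)]
    simp only [inner, RCLike.re_eq_complex_re, ← starRingEnd_apply]
    rw [show S / (τ x : ℂ) * conj d = (S * conj d) / (τ x : ℂ) by ring, Complex.div_ofReal_re,
      norm_div, Complex.norm_real, Real.norm_of_nonneg ht.le]
    field_simp
  have n2 : 2 * (S * conj d).re ≤ A x * ‖d‖ ^ 2 + ‖S‖ ^ 2 / A x := by
    have a1 : (S * conj d).re ≤ ‖S‖ * ‖d‖ := by
      refine (Complex.re_le_norm _).trans ?_
      rw [norm_mul, RCLike.norm_conj]
    have a2 : A x * ‖d‖ ^ 2 + ‖S‖ ^ 2 / A x - 2 * (‖S‖ * ‖d‖) = (A x * ‖d‖ - ‖S‖) ^ 2 / A x := by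
      field_simp; ring
    have a3 : 0 ≤ (A x * ‖d‖ - ‖S‖) ^ 2 / A x := by positivity
    linarith
  have e1 : (‖d + S / ↑(τ x)‖ ^ 2 + cu) * (τ x * Real.exp (-Φ x)) -
      (L1 - L2 / τ x + ‖S‖ ^ 2 / τ x ^ 2) * (τ x * Real.exp (-Φ x)) =
      (τ x * ‖d + S / ↑(τ x)‖ ^ 2 + τ x * cu - (τ x * L1 - L2) - ‖S‖ ^ 2 / τ x)
        * Real.exp (-Φ x) := by
    field_simp
    ring
  rw [e1, n1, ← sub_mul]
  apply mul_le_mul_of_nonneg_right _ hE.le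
  nlinarith

end basic

section moll
variable {E : Type*} [NormedAddCommGroup E] [NormedSpace ℂ E] [FiniteDimensional ℂ E]
  [MeasureSpace E] [BorelSpace E] [(volume : Measure E).IsAddHaarMeasure]

structure Moll (r : ℝ) (ρ : E → ℝ) : Prop where
  smooth : ContDiff ℝ ∞ ρ
  nonneg : ∀ x, 0 ≤ ρ x
  int : ∫ x, ρ x = 1
  supp : ∀ x, r < ‖x‖ → ρ x = 0
  circ : ∀ (c : ℂ) x, ‖c‖ = 1 → ρ (c • x) = ρ x

lemma Moll.hcs {r : ℝ} {ρ : E → ℝ} (h : Moll r ρ) : HasCompactSupport ρ := by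
  have : ProperSpace E := FiniteDimensional.proper ℂ E
  refine HasCompactSupport.intro (isCompact_closedBall (0 : E) r) fun x hx => h.supp x ?_
  simpa using hx

lemma Moll.integrable {r : ℝ} {ρ : E → ℝ} (h : Moll r ρ) : Integrable ρ volume :=
  h.smooth.continuous.integrable_of_hasCompactSupport h.hcs

noncomputable def QQ {ι : Type*} [Fintype ι] (b : Module.Basis ι ℂ E) (x : E) : ℝ :=
  ∑ j, ‖b.repr x j‖ ^ 2

lemma QQ_nonneg {ι : Type*} [Fintype ι] (b : Module.Basis ι ℂ E) (x : E) : 0 ≤ QQ b x :=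
  Finset.sum_nonneg fun j _ => sq_nonneg _

lemma QQ_contDiff {ι : Type*} [Fintype ι] (b : Module.Basis ι ℂ E) : ContDiff ℝ ∞ (QQ b) := by
  refine ContDiff.sum fun j _ => ?_
  have h1 : ContDiff ℝ ∞ (fun x => b.repr x j) := by
    have := (LinearMap.toContinuousLinearMap (b.coord j)).restrictScalars ℝ |>.contDiff (n := ∞)
    exact this
  exact h1.norm_sq ℝ

lemma QQ_smul {ι : Type*} [Fintype ι] (b : Module.Basis ι ℂ E) (c : ℂ) (x : E) :
    QQ b (c • x) = ‖c‖ ^ 2 * QQ b x := by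
  simp [QQ, mul_pow, Finset.mul_sum]

lemma QQ_bound {ι : Type*} [Fintype ι] (b : Module.Basis ι ℂ E) :
    ∃ C > 0, ∀ x, ‖x‖ ^ 2 ≤ C * QQ b x := by
  refine ⟨(Fintype.card ι : ℝ) * (∑ j, ‖b j‖ ^ 2) + 1, by positivity, fun x => ?_⟩
  have h1 : ‖x‖ ≤ ∑ j, ‖b.repr x j‖ * ‖b j‖ := by
    conv_lhs => rw [← b.sum_repr x]
    refine (norm_sum_le _ _).trans (Finset.sum_le_sum fun j _ => ?_)
    rw [norm_smul]
  have h2 : (∑ j, ‖b.repr x j‖ * ‖b j‖) ^ 2 ≤ QQ b x * ∑ j, ‖b j‖ ^ 2 :=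
    Finset.sum_mul_sq_le_sq_mul_sq _ _ _
  have h3 : ‖x‖ ^ 2 ≤ QQ b x * ∑ j, ‖b j‖ ^ 2 :=
    (pow_le_pow_left₀ (norm_nonneg _) h1 2).trans h2
  rcases isEmpty_or_nonempty ι with hι | hι
  · simp only [Finset.univ_eq_empty, Finset.sum_empty, mul_zero] at h3
    have := QQ_nonneg b x
    simp; linarith
  · have h4 : (1 : ℝ) ≤ Fintype.card ι := by exact_mod_cast Fintype.card_pos
    have := QQ_nonneg b x
    have h5 : 0 ≤ ∑ j, ‖b j‖ ^ 2 := Finset.sum_nonneg fun j _ => sq_nonneg _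
    nlinarith [mul_nonneg this h5]

lemma exists_bump_aux {ι : Type*} [Fintype ι] (b : Module.Basis ι ℂ E) (r : ℝ) (hr : 0 < r) :
    ∃ g : E → ℝ, ContDiff ℝ ∞ g ∧ (∀ x, 0 ≤ g x) ∧ (∀ x, r < ‖x‖ → g x = 0) ∧
      (∀ (c : ℂ) x, ‖c‖ = 1 → g (c • x) = g x) ∧ g 0 ≠ 0 := by
  obtain ⟨C, hC, hb⟩ := QQ_bound b
  have hs0 : 0 < r ^ 2 / C := by positivity
  refine ⟨fun x => Real.smoothTransition (1 - QQ b x / (r ^ 2 / C)),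
    Real.smoothTransition.contDiff.comp (contDiff_const.sub ((QQ_contDiff b).div_const _)),
    fun x => Real.smoothTransition.nonneg _, ?_, ?_, ?_⟩
  · intro x hx
    apply Real.smoothTransition.zero_of_nonpos
    have h1 : r ^ 2 ≤ ‖x‖ ^ 2 := pow_le_pow_left₀ hr.le hx.le 2
    have h2 := hb x
    rw [sub_nonpos, one_le_div hs0, div_le_iff₀ hC]
    linarith
  · intro c x hc
    beta_reduce
    rw [QQ_smul, hc, one_pow, one_mul]
  · have : QQ b (0 : E) = 0 := by simp [QQ]
    simp [this]

lemma exists_Moll_aux {ι : Type*} [Fintype ι] (b : Module.Basis ι ℂ E) (r : ℝ) (hr : 0 < r) :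
    ∃ ρ : E → ℝ, Moll r ρ := by
  have : ProperSpace E := FiniteDimensional.proper ℂ E
  obtain ⟨g, hg, hg0, hgs, hgr, hgz⟩ := exists_bump_aux b r hr
  have hgc : HasCompactSupport g := by
    refine HasCompactSupport.intro (isCompact_closedBall (0 : E) r) fun x hx => hgs x ?_
    simpa using hx
  have hi : 0 < ∫ x, g x :=
    hg.continuous.integral_pos_of_hasCompactSupport_nonneg_nonzero hgc hg0 hgz
  exact
  { smooth := contDiff_const.mul hg
    nonneg := fun x => mul_nonneg (inv_nonneg.2 hi.le) (hg0 x)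
    int := by rw [integral_const_mul, inv_mul_cancel₀ hi.ne']
    supp := fun x hx => by rw [hgs x hx, mul_zero]
    circ := fun c x hc => by rw [hgr c x hc] : Moll r (fun x => (∫ x, g x)⁻¹ * g x) } |> fun h =>
      ⟨_, h⟩

lemma exists_Moll (r : ℝ) (hr : 0 < r) : ∃ ρ : E → ℝ, Moll r ρ :=
  exists_Moll_aux (Module.finBasis ℂ E) r hr

noncomputable def mol {F : Type*} [NormedAddCommGroup F] [NormedSpace ℝ F] (ρ : E → ℝ)
    (f : E → F) (x : E) : F := ∫ t, ρ (x - t) • f t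

section gen
variable {F : Type*} [NormedAddCommGroup F] [NormedSpace ℝ F]

lemma mol_eq (ρ : E → ℝ) (f : E → F) : mol ρ f = ρ ⋆[ContinuousLinearMap.lsmul ℝ ℝ, volume] f := by
  ext x
  rw [convolution_lsmul_swap]; rfl

lemma mol_eq' (ρ : E → ℝ) (f : E → F) (x : E) : mol ρ f x = ∫ t, ρ t • f (x - t) := by
  rw [mol_eq, convolution_lsmul]

lemma mol_contDiff {r : ℝ} {ρ : E → ℝ} (h : Moll r ρ) {f : E → F}
    (hf : LocallyIntegrable f volume) : ContDiff ℝ ∞ (mol ρ f) := by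
  rw [mol_eq]
  exact h.hcs.contDiff_convolution_left _ h.smooth hf

lemma mol_zero {r : ℝ} {ρ : E → ℝ} (h : Moll r ρ) {f : E → F} {x : E}
    (hx : ∀ t, dist t x ≤ r → f t = 0) : mol ρ f x = 0 := by
  rw [mol]
  have : ∀ t, ρ (x - t) • f t = 0 := by
    intro t
    by_cases ht : dist t x ≤ r
    · rw [hx t ht, smul_zero]
    · rw [h.supp, zero_smul]
      rw [← dist_eq_norm, dist_comm]; linarith
  simp [this]
end gen

lemma TF_kernel {r : ℝ} {ρ : E → ℝ} (h : Moll r ρ) (x : E) :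
    TF (closedBall x r) (fun t => (ρ (x - t) : ℂ)) := by
  have : ProperSpace E := FiniteDimensional.proper ℂ E
  have h0 : ∀ t, t ∉ closedBall x r → (ρ (x - t) : ℂ) = 0 := by
    intro t ht
    rw [h.supp, ofReal_zero]
    rw [← dist_eq_norm, dist_comm]; simpa using ht
  refine ⟨contDiff_ofReal (h.smooth.comp (contDiff_const.sub contDiff_id)),
    HasCompactSupport.intro (isCompact_closedBall x r) h0, ?_⟩
  refine closure_minimal (fun t ht => ?_) isClosed_closedBall
  by_contra h1
  exact ht (h0 t h1)

lemma mol_DD {r : ℝ} {ρ : E → ℝ} (h : Moll r ρ) {f : E → ℂ}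
    (hf : LocallyIntegrable f volume) (c : ℂ) (e x : E) :
    DD c e (mol ρ f) x = - ∫ t, f t * DD c e (fun s => (ρ (x - s) : ℂ)) t := by
  have h1 := h.hcs.hasFDerivAt_convolution_left (ContinuousLinearMap.lsmul ℝ ℝ)
    (h.smooth.of_le (by simp)) hf x
  rw [← mol_eq] at h1
  have hcs2 : HasCompactSupport (fderiv ℝ ρ) := h.hcs.fderiv ℝ
  have hc2 : Continuous (fderiv ℝ ρ) := h.smooth.continuous_fderiv (by simp)
  have hint : Integrable (fun t => ((ContinuousLinearMap.lsmul ℝ ℝ : ℝ →L[ℝ] ℂ →L[ℝ] ℂ).precompL E)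
      (fderiv ℝ ρ (x - t)) (f t)) volume :=
    (hcs2.convolutionExists_left (L := (ContinuousLinearMap.lsmul ℝ ℝ : ℝ →L[ℝ] ℂ →L[ℝ] ℂ).precompL E)
      hc2 hf x).integrable_swap
  have h2 : ∀ v : E, fderiv ℝ (mol ρ f) x v = ∫ t, f t * (fderiv ℝ ρ (x - t) v : ℂ) := by
    intro v
    rw [h1.fderiv, convolution_eq_swap, ContinuousLinearMap.integral_apply hint]
    congr 1; ext t
    simp [ContinuousLinearMap.precompL_apply, mul_comm]
  have hint2 : ∀ v : E, Integrable (fun t => f t * (fderiv ℝ ρ (x - t) v : ℂ)) volume := by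
    intro v
    have := hint.apply_continuousLinearMap v
    refine this.congr (Eventually.of_forall fun t => ?_)
    simp [ContinuousLinearMap.precompL_apply, mul_comm]
  have h3 : ∀ t v : E, fderiv ℝ (fun s => (ρ (x - s) : ℂ)) t v = - (fderiv ℝ ρ (x - t) v : ℂ) := by
    intro t v
    have hd : HasFDerivAt ρ (fderiv ℝ ρ (x - t)) (x - t) := (cdAt h.smooth).hasFDerivAt
    have hs : HasFDerivAt (fun s : E => x - s) (-(ContinuousLinearMap.id ℝ E)) t :=
      (hasFDerivAt_id t).const_sub x
    have : HasFDerivAt (fun s => (ρ (x - s) : ℂ)) (Complex.ofRealCLM.comp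
      ((fderiv ℝ ρ (x - t)).comp (-(ContinuousLinearMap.id ℝ E)))) t :=
      Complex.ofRealCLM.hasFDerivAt.comp t (hd.comp t hs)
    rw [this.fderiv]; simp
  simp only [DD, h2, h3]
  rw [← integral_const_mul, ← integral_add (hint2 e) ((hint2 _).const_mul c), ← integral_div,
    ← integral_neg]
  congr 1; ext t; ring

lemma transl_L2 {f : E → ℂ} (hf : MemLp f 2 volume) :
    Tendsto (fun t : E => eLpNorm (fun x => f (x - t) - f x) 2 volume) (𝓝 0) (𝓝 0) := by
  have : ProperSpace E := FiniteDimensional.proper ℂ E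
  let G : C(E × E, E) := ⟨fun p => p.2 - p.1, by fun_prop⟩
  let g : C(E, C(E, E)) := G.curry
  have hgm : ∀ t, MeasurePreserving (g t) (volume : Measure E) volume := fun t =>
    measurePreserving_sub_right volume t
  have hc := ContinuousAt.compMeasurePreservingLp (p := 2) (f := fun _ : E => hf.toLp f)
    (g := g) (z := (0 : E)) continuousAt_const g.continuous.continuousAt hgm (by simp)
  have h2 : Tendsto (fun t => dist (Lp.compMeasurePreserving (g t) (hgm t) (hf.toLp f))
      (Lp.compMeasurePreserving (g 0) (hgm 0) (hf.toLp f))) (𝓝 0) (𝓝 0) :=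
    tendsto_iff_dist_tendsto_zero.1 hc
  have h3 : ∀ t, ENNReal.ofReal (dist (Lp.compMeasurePreserving (g t) (hgm t) (hf.toLp f))
      (Lp.compMeasurePreserving (g 0) (hgm 0) (hf.toLp f))) =
      eLpNorm (fun x => f (x - t) - f x) 2 volume := by
    intro t
    rw [Lp.dist_def, ENNReal.ofReal_toReal]
    · apply eLpNorm_congr_ae
      have a1 := Lp.coeFn_compMeasurePreserving (hf.toLp f) (hgm t)
      have a2 := Lp.coeFn_compMeasurePreserving (hf.toLp f) (hgm 0)
      have a3 := (hgm t).quasiMeasurePreserving.ae_eq_comp hf.coeFn_toLp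
      have a4 := (hgm 0).quasiMeasurePreserving.ae_eq_comp hf.coeFn_toLp
      filter_upwards [a1, a2, a3, a4] with x b1 b2 b3 b4
      simp only [Pi.sub_apply]
      rw [b1, b2, b3, b4]
      simp [g, G]
    · exact ((Lp.memLp _).sub (Lp.memLp _)).2.ne
  have h4 := ENNReal.tendsto_ofReal h2
  simp only [h3, ENNReal.ofReal_zero] at h4
  exact h4

lemma jensen2 {X : Type*} [MeasurableSpace X] (ν : Measure X) [IsProbabilityMeasure ν]
    {g : X → ℝ≥0∞} (hg : AEMeasurable g ν) : (∫⁻ x, g x ∂ν) ^ 2 ≤ ∫⁻ x, g x ^ 2 ∂ν := by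
  have h := ENNReal.lintegral_mul_le_Lp_mul_Lq ν (p := 2) (q := 2)
    (Real.holderConjugate_iff.2 ⟨by norm_num, by norm_num⟩) hg
    (g := fun _ => (1 : ℝ≥0∞)) aemeasurable_const
  simp only [Pi.mul_apply, mul_one, ENNReal.one_rpow, lintegral_const, measure_univ,
    ENNReal.rpow_two, one_pow] at h
  calc (∫⁻ x, g x ∂ν) ^ 2 ≤ ((∫⁻ x, g x ^ 2 ∂ν) ^ (1 / 2 : ℝ)) ^ 2 := by gcongr
    _ = _ := by
      rw [← ENNReal.rpow_natCast, ← ENNReal.rpow_mul]; norm_num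

lemma memLp_two_locInt {f : E → ℂ} (hf : MemLp f 2 volume) : LocallyIntegrable f volume :=
  hf.locallyIntegrable (by norm_num)

lemma mol_L2_bound {r : ℝ} {ρ : E → ℝ} (h : Moll r ρ) {f : E → ℂ} (hf : MemLp f 2 volume)
    (hm : Measurable f) {δ : ℝ≥0∞}
    (hδ : ∀ t : E, ‖t‖ ≤ r → eLpNorm (fun x => f (x - t) - f x) 2 volume ≤ δ) :
    ∫⁻ x, ‖mol ρ f x - f x‖ₑ ^ 2 ≤ δ ^ 2 := by
  have hL := memLp_two_locInt hf
  have : ProperSpace E := FiniteDimensional.proper ℂ E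
  let w : E → ℝ≥0∞ := fun t => ENNReal.ofReal (ρ t)
  have hw : Measurable w := h.smooth.continuous.measurable.ennreal_ofReal
  let ν : Measure E := volume.withDensity w
  have hν1 : ∫⁻ t, w t = 1 := by
    rw [← ofReal_integral_eq_lintegral_ofReal h.integrable (Eventually.of_forall h.nonneg), h.int]
    simp
  have hν : IsProbabilityMeasure ν := ⟨by
    rw [withDensity_apply _ MeasurableSet.univ, Measure.restrict_univ, hν1]⟩
  have hpt : ∀ x, ‖mol ρ f x - f x‖ₑ ^ 2 ≤ ∫⁻ t, w t * ‖f (x - t) - f x‖ₑ ^ 2 := by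
    intro x
    have hi1 : Integrable (fun t => ρ t • f (x - t)) volume :=
      h.hcs.convolutionExists_left (L := ContinuousLinearMap.lsmul ℝ ℝ) h.smooth.continuous hL x
    have hi2 : Integrable (fun t => ρ t • f x) volume := h.integrable.smul_const _
    have e1 : mol ρ f x - f x = ∫ t, ρ t • (f (x - t) - f x) := by
      simp only [smul_sub]
      rw [integral_sub hi1 hi2, integral_smul_const, h.int, one_smul, mol_eq']
    have hmx : Measurable fun t => f (x - t) - f x :=
      (hm.comp (measurable_const.sub measurable_id)).sub_const _
    calc ‖mol ρ f x - f x‖ₑ ^ 2 ≤ (∫⁻ t, ‖ρ t • (f (x - t) - f x)‖ₑ) ^ 2 := by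
          rw [e1]; gcongr; exact enorm_integral_le_lintegral_enorm _
      _ = (∫⁻ t, ‖f (x - t) - f x‖ₑ ∂ν) ^ 2 := by
          rw [lintegral_withDensity_eq_lintegral_mul _ hw hmx.enorm]
          congr 2; ext t
          rw [enorm_smul, Pi.mul_apply, Real.enorm_of_nonneg (h.nonneg t)]
      _ ≤ ∫⁻ t, ‖f (x - t) - f x‖ₑ ^ 2 ∂ν := jensen2 ν hmx.enorm.aemeasurable
      _ = _ := by
          rw [lintegral_withDensity_eq_lintegral_mul _ hw (hmx.enorm.pow_const 2)]; rfl
  calc _ ≤ ∫⁻ x, ∫⁻ t, w t * ‖f (x - t) - f x‖ₑ ^ 2 := lintegral_mono hpt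
    _ = ∫⁻ t, ∫⁻ x, w t * ‖f (x - t) - f x‖ₑ ^ 2 := by
        apply lintegral_lintegral_swap
        apply Measurable.aemeasurable
        simp only [Function.uncurry_def]
        fun_prop
    _ = ∫⁻ t, w t * ∫⁻ x, ‖f (x - t) - f x‖ₑ ^ 2 := by
        congr 1; ext t
        rw [lintegral_const_mul]
        fun_prop
    _ ≤ ∫⁻ t, w t * δ ^ 2 := by
        apply lintegral_mono; intro t
        by_cases ht : ‖t‖ ≤ r
        · refine mul_le_mul_right ?_ (w t)
          have := hδ t ht
          calc _ = eLpNorm (fun x => f (x - t) - f x) 2 volume ^ 2 := by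
                rw [eLpNorm_eq_lintegral_rpow_enorm_toReal (by norm_num) (by norm_num),
                  ← ENNReal.rpow_natCast, ← ENNReal.rpow_mul]
                norm_num
            _ ≤ _ := by gcongr
        · have : w t = 0 := by simp [w, h.supp t (not_le.1 ht)]
          simp [this]
    _ = δ ^ 2 := by rw [lintegral_mul_const _ hw, hν1, one_mul]

lemma mol_L2 {f : E → ℂ} (hf : MemLp f 2 volume) {ε : ℝ} (hε : 0 < ε) :
    ∃ r0 > 0, ∀ r ≤ r0, ∀ ρ : E → ℝ, Moll r ρ →
      MemLp (fun x => mol ρ f x - f x) 2 volume ∧ ∫ x, ‖mol ρ f x - f x‖ ^ 2 ≤ ε := by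
  let g := hf.1.mk f
  have hgf : f =ᵐ[volume] g := hf.1.ae_eq_mk
  have hg : MemLp g 2 volume := hf.ae_eq hgf
  have hgm : Measurable g := hf.1.stronglyMeasurable_mk.measurable
  have hε' : (0 : ℝ≥0∞) < ENNReal.ofReal (Real.sqrt ε) := by simpa using hε
  have h1 := (ENNReal.tendsto_nhds_zero.1 (transl_L2 hg)) _ hε'
  obtain ⟨r1, hr1, hb⟩ := Metric.eventually_nhds_iff.1 h1
  refine ⟨r1 / 2, by positivity, fun r hr ρ hρ => ?_⟩
  have hδ : ∀ t : E, ‖t‖ ≤ r → eLpNorm (fun x => g (x - t) - g x) 2 volume ≤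
      ENNReal.ofReal (Real.sqrt ε) := by
    intro t ht
    apply hb
    rw [dist_zero_right]; linarith
  have h2 := mol_L2_bound hρ hg hgm hδ
  have hmol : mol ρ f = mol ρ g := by
    ext x
    apply integral_congr_ae
    filter_upwards [hgf] with t ht
    rw [ht]
  have h3 : ∫⁻ x, ‖mol ρ f x - f x‖ₑ ^ 2 ≤ ENNReal.ofReal ε := by
    calc _ = ∫⁻ x, ‖mol ρ g x - g x‖ₑ ^ 2 := by
          apply lintegral_congr_ae
          filter_upwards [hgf] with t ht
          rw [hmol, ht]
      _ ≤ _ := h2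
      _ = _ := by
        rw [← ENNReal.ofReal_pow (Real.sqrt_nonneg _), Real.sq_sqrt hε.le]
  have hmeas : AEStronglyMeasurable (fun x => mol ρ f x - f x) volume :=
    (mol_contDiff hρ (memLp_two_locInt hf)).continuous.aestronglyMeasurable.sub hf.1
  have hmem : MemLp (fun x => mol ρ f x - f x) 2 volume := by
    refine ⟨hmeas, ?_⟩
    rw [eLpNorm_lt_top_iff_lintegral_rpow_enorm_lt_top (by norm_num) (by norm_num)]
    simpa using h3.trans_lt ENNReal.ofReal_lt_top
  refine ⟨hmem, ?_⟩
  rw [integral_eq_lintegral_of_nonneg_ae (Eventually.of_forall fun x => by positivity)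
    (f := fun x => ‖mol ρ f x - f x‖ ^ 2) (hmeas.norm.pow 2)]
  refine ENNReal.toReal_le_of_le_ofReal hε.le ?_
  convert h3 using 3 with x
  rw [← ofReal_norm_eq_enorm, ← ENNReal.ofReal_pow (norm_nonneg _)]

end moll

section weak
variable {E : Type*} [NormedAddCommGroup E] [NormedSpace ℂ E] [FiniteDimensional ℂ E]
  [MeasureSpace E] [BorelSpace E] [(volume : Measure E).IsAddHaarMeasure]

lemma locInt_mul {f g : E → ℂ} {V : Set E} (hf : LocallyIntegrable f volume) (hg : TF V g) :
    Integrable (fun x => f x * g x) volume := by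
  have := hf.integrable_smul_left_of_hasCompactSupport hg.1.continuous hg.2.1
  simpa only [smul_eq_mul, mul_comm] using this

lemma intK {g a : E → ℝ} {K : Set E} (hK : IsCompact K) (hg : Integrable g volume)
    (h0 : ∀ x, x ∉ K → g x = 0) (ha : Continuous a) :
    Integrable (fun x => a x * g x) volume := by
  have h1 : IntegrableOn (fun x => a x * g x) K volume :=
    (hg.integrableOn).continuousOn_mul ha.continuousOn hK
  refine (integrableOn_iff_integrable_of_support_subset ?_).1 h1
  intro x hx
  by_contra h
  exact hx (by simp [h0 x h])

lemma memLp_sq {f : E → ℂ} (hf : MemLp f 2 volume) : Integrable (fun x => ‖f x‖ ^ 2) volume := by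
  have := hf.integrable_norm_rpow (by norm_num) (by norm_num)
  simpa using this

lemma norm_add_sq_le (a b : ℂ) : ‖a + b‖ ^ 2 ≤ 2 * ‖a‖ ^ 2 + 2 * ‖b‖ ^ 2 := by
  have h := norm_add_le a b
  have := pow_le_pow_left₀ (norm_nonneg _) h 2
  nlinarith [sq_nonneg (‖a‖ - ‖b‖)]

lemma norm_sum_mul_sq_le {ι : Type*} [Fintype ι] (a b : ι → ℂ) :
    ‖∑ j, a j * b j‖ ^ 2 ≤ (∑ j, ‖a j‖ ^ 2) * ∑ j, ‖b j‖ ^ 2 := by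
  have h1 : ‖∑ j, a j * b j‖ ≤ ∑ j, ‖a j‖ * ‖b j‖ :=
    (norm_sum_le _ _).trans (Finset.sum_le_sum fun j _ => by rw [norm_mul])
  exact (pow_le_pow_left₀ (norm_nonneg _) h1 2).trans (Finset.sum_mul_sq_le_sq_mul_sq _ _ _)

lemma mol_TF {r : ℝ} {ρ : E → ℝ} (h : Moll r ρ) {f : E → ℂ} (hf : LocallyIntegrable f volume)
    {K K1 V : Set E} (hK1 : IsCompact K1) (hV : K1 ⊆ V) (hKK : ∀ x y, x ∈ K → dist x y ≤ r → y ∈ K1)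
    (h0 : ∀ x, x ∉ K → f x = 0) : TF V (mol ρ f) := by
  have hz : ∀ x, x ∉ K1 → mol ρ f x = 0 := fun x hx => mol_zero h fun t ht => by
    apply h0
    intro htK
    exact hx (hKK t x htK ht)
  refine ⟨mol_contDiff h hf, HasCompactSupport.intro hK1 hz, ?_⟩
  refine (closure_minimal (fun t ht => ?_) hK1.isClosed).trans hV
  by_contra h1
  exact ht (hz t h1)

lemma mol_apply_kernel (ρ : E → ℝ) (f : E → ℂ) (x : E) :
    mol ρ f x = ∫ t, f t * (ρ (x - t) : ℂ) := by
  rw [mol]; congr 1; ext t; rw [Complex.real_smul, mul_comm]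

lemma pt1_aux {ι : Type*} [Fintype ι] {θ E0 M err : ℝ} (y m : ι → ℂ) (h0 : 0 ≤ θ * E0)
    (h1 : θ * E0 ≤ M) (h2 : ∑ j, ‖m j - y j‖ ^ 2 ≤ err) :
    (θ * ∑ j, ‖y j‖ ^ 2) * E0 ≤ 2 * ((θ * ∑ j, ‖m j‖ ^ 2) * E0) + 2 * (M * err) := by
  have b1 : ∑ j, ‖y j‖ ^ 2 ≤ 2 * ∑ j, ‖m j‖ ^ 2 + 2 * ∑ j, ‖m j - y j‖ ^ 2 := by
    rw [Finset.mul_sum, Finset.mul_sum, ← Finset.sum_add_distrib]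
    refine Finset.sum_le_sum fun j _ => ?_
    have := norm_add_sq_le (m j) (-(m j - y j))
    rw [norm_neg] at this
    simpa using this
  have b5 := mul_le_mul_of_nonneg_left b1 h0
  have b6 : (θ * E0) * ∑ j, ‖m j - y j‖ ^ 2 ≤ M * err :=
    mul_le_mul h1 h2 (by positivity) (h0.trans h1)
  linarith

lemma pt2_aux {ι : Type*} [Fintype ι] {θ E0 M τ A : ℝ} (r y m : ι → ℂ) (Z mZ : ℂ)
    (Y mY : ι → ι → ℂ) (q1 : 0 < τ) (q2 : 0 < A) (h0 : 0 ≤ θ) (hE : 0 < E0)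
    (hM : (θ + 4 * (τ + A) * (1 + ∑ j, ‖r j‖ ^ 2) + 2 * τ) * E0 ≤ M) :
    ((τ + A) * ‖mZ - ∑ j, r j * m j‖ ^ 2 + τ * ∑ j, ∑ k, ‖mY j k‖ ^ 2) * E0 ≤
      2 * (((τ + A) * ‖Z - ∑ j, r j * y j‖ ^ 2 + τ * ∑ j, ∑ k, ‖Y j k‖ ^ 2) * E0) +
      M * (∑ j, ‖m j - y j‖ ^ 2 + ‖mZ - Z‖ ^ 2 + ∑ j, ∑ k, ‖mY j k - Y j k‖ ^ 2) := by
  have b1 : ‖mZ - ∑ j, r j * m j‖ ^ 2 ≤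
      2 * ‖Z - ∑ j, r j * y j‖ ^ 2 + 4 * (‖mZ - Z‖ ^ 2 + (∑ j, ‖r j‖ ^ 2) *
      ∑ j, ‖m j - y j‖ ^ 2) := by
    have c1 := norm_add_sq_le (Z - ∑ j, r j * y j) ((mZ - Z) + (-∑ j, r j * (m j - y j)))
    have c2 := norm_add_sq_le (mZ - Z) (-∑ j, r j * (m j - y j))
    rw [norm_neg] at c2
    have c3 := norm_sum_mul_sq_le r (fun j => m j - y j)
    have c4 : (Z - ∑ j, r j * y j) + ((mZ - Z) + (-∑ j, r j * (m j - y j))) =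
      mZ - ∑ j, r j * m j := by
      simp only [mul_sub, Finset.sum_sub_distrib]; ring
    rw [c4] at c1
    linarith
  have b2 : ∑ j, ∑ k, ‖mY j k‖ ^ 2 ≤ 2 * ∑ j, ∑ k, ‖Y j k‖ ^ 2 +
      2 * ∑ j, ∑ k, ‖mY j k - Y j k‖ ^ 2 := by
    simp only [Finset.mul_sum, ← Finset.sum_add_distrib]
    refine Finset.sum_le_sum fun j _ => Finset.sum_le_sum fun k _ => ?_
    have := norm_add_sq_le (Y j k) (mY j k - Y j k)
    simpa using this
  have hS0 : 0 ≤ ∑ j, ‖r j‖ ^ 2 := by positivity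
  have hey0 : 0 ≤ ∑ j, ‖m j - y j‖ ^ 2 := by positivity
  have heZ0 : 0 ≤ ‖mZ - Z‖ ^ 2 := by positivity
  have heY0 : 0 ≤ ∑ j, ∑ k, ‖mY j k - Y j k‖ ^ 2 := by positivity
  generalize ∑ j, ‖r j‖ ^ 2 = S at *
  generalize ∑ j, ‖m j - y j‖ ^ 2 = ey at *
  generalize ‖mZ - Z‖ ^ 2 = eZ at *
  generalize ∑ j, ∑ k, ‖mY j k - Y j k‖ ^ 2 = eY at *
  generalize ∑ j, ∑ k, ‖mY j k‖ ^ 2 = SY at *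
  generalize ∑ j, ∑ k, ‖Y j k‖ ^ 2 = TY at *
  generalize ‖mZ - ∑ j, r j * m j‖ ^ 2 = SZ at *
  generalize ‖Z - ∑ j, r j * y j‖ ^ 2 = TZ at *
  have b3 : (4 * (τ + A) * (eZ + S * ey) + 2 * τ * eY) * E0 ≤ M * (ey + eZ + eY) := by
    refine le_trans ?_ (mul_le_mul_of_nonneg_right hM (by positivity))
    have d3 : (4 * (τ + A) * (eZ + S * ey) + 2 * τ * eY) ≤
      (θ + 4 * (τ + A) * (1 + S) + 2 * τ) * (ey + eZ + eY) := by
      have w1 : 0 ≤ θ * (ey + eZ + eY) := by positivity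
      have w2 : 4 * (τ + A) * (eZ + S * ey) ≤ 4 * (τ + A) * ((1 + S) * (ey + eZ + eY)) := by
        gcongr
        nlinarith [mul_nonneg hS0 heZ0, mul_nonneg hS0 heY0]
      have w3 : 2 * τ * eY ≤ 2 * τ * (ey + eZ + eY) := by
        gcongr; linarith
      linarith
    have := mul_le_mul_of_nonneg_right d3 hE.le
    linarith
  have b4 := mul_le_mul_of_nonneg_left b1 (by positivity : 0 ≤ τ + A)
  have b5 := mul_le_mul_of_nonneg_left b2 q1.le
  have b6 := mul_le_mul_of_nonneg_right (add_le_add b4 b5) hE.le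
  linarith

set_option maxHeartbeats 800000 in
lemma weak_twisted {ι : Type*} [Fintype ι] (e : ι → E) {Φ τ A θ : E → ℝ} (h : ContDiff ℝ ∞ Φ)
    (hτ : ContDiff ℝ ∞ τ) (hp : ∀ x, 0 < τ x) (hA : Continuous A) (hAp : ∀ x, 0 < A x)
    (hθ : Continuous θ) (hθ0 : ∀ x, 0 ≤ θ x) {V K : Set E} (hVo : IsOpen V) (hK : IsCompact K)
    (hKV : K ⊆ V)
    (hV : ∀ x ∈ V, ∀ ζ : ι → ℂ, θ x * ∑ j, ‖ζ j‖ ^ 2 + ‖∑ j, rdz (e j) τ x * ζ j‖ ^ 2 / A x ≤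
      τ x * LF e Φ x ζ - LF e τ x ζ)
    {y : ι → E → ℂ} {Z : E → ℂ} {Y : ι → ι → E → ℂ} (hy : ∀ j, MemLp (y j) 2 volume)
    (hZ : MemLp Z 2 volume) (hY : ∀ j k, MemLp (Y j k) 2 volume)
    (hy0 : ∀ j x, x ∉ K → y j x = 0) (hZ0 : ∀ x, x ∉ K → Z x = 0)
    (hY0 : ∀ j k x, x ∉ K → Y j k x = 0)
    (wZ : ∀ g, TF univ g → ∫ x, ∑ j, y j x * dz (e j) g x = - ∫ x, Z x * g x)
    (wY : ∀ j k g, TF univ g →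
      ∫ x, (y k x * dzb (e j) g x - y j x * dzb (e k) g x) = - ∫ x, Y j k x * g x) :
    ∫ x, (θ x * ∑ j, ‖y j x‖ ^ 2) * Real.exp (-Φ x) ≤
     4 * ∫ x, ((τ x + A x) * ‖Z x - ∑ j, rdz (e j) Φ x * y j x‖ ^ 2 +
      τ x * ∑ j, ∑ k, ‖Y j k x‖ ^ 2) * Real.exp (-Φ x) := by
  have : ProperSpace E := FiniteDimensional.proper ℂ E
  obtain ⟨r1, hr1, hK1V⟩ := hK.exists_cthickening_subset_open hVo hKV
  set K1 := cthickening r1 K with hK1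
  have hK1c : IsCompact K1 := hK.cthickening
  have hKK1 : K ⊆ K1 := self_subset_cthickening K
  have ccexp : Continuous fun x => Real.exp (-Φ x) := h.neg.exp.continuous
  have cτ := hτ.continuous
  have cr : ∀ j, Continuous (rdz (e j) Φ) := fun j => (contDiff_rdz h).continuous
  have cW : Continuous fun x => (θ x + 4 * (τ x + A x) * (1 + ∑ j, ‖rdz (e j) Φ x‖ ^ 2) + 2 * τ x) *
      Real.exp (-Φ x) := by fun_prop
  obtain ⟨M, hM⟩ := (hK1c.image cW).bddAbove
  have hM' : ∀ x ∈ K1, (θ x + 4 * (τ x + A x) * (1 + ∑ j, ‖rdz (e j) Φ x‖ ^ 2) + 2 * τ x) *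
      Real.exp (-Φ x) ≤ M := fun x hx => hM (mem_image_of_mem _ hx)
  set M' := max M 0 with hM'def
  have hM'0 : 0 ≤ M' := le_max_right _ _
  -- integrability of limits
  have ily : ∀ j, LocallyIntegrable (y j) volume := fun j => memLp_two_locInt (hy j)
  have ilZ := memLp_two_locInt hZ
  have ilY : ∀ j k, LocallyIntegrable (Y j k) volume := fun j k => memLp_two_locInt (hY j k)
  have intLHS : Integrable (fun x => (θ x * ∑ j, ‖y j x‖ ^ 2) * Real.exp (-Φ x)) volume := by
    have := intK hK (integrable_finset_sum Finset.univ fun j _ => memLp_sq (hy j))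
      (fun x hx => by simp [hy0 _ x hx]) (a := fun x => θ x * Real.exp (-Φ x)) (by fun_prop)
    refine this.congr (Eventually.of_forall fun x => ?_)
    simp only; ring
  have mS : MemLp (fun x => Z x - ∑ j, rdz (e j) Φ x * y j x) 2 volume := by
    refine hZ.sub (memLp_finset_sum _ fun j _ => ?_)
    obtain ⟨B, hB⟩ := hK.exists_bound_of_continuousOn (cr j).continuousOn
    refine MemLp.of_le_mul (c := B) (hy j) ((cr j).aestronglyMeasurable.mul (hy j).1)
      (Eventually.of_forall fun x => ?_)
    by_cases hx : x ∈ K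
    · rw [norm_mul]; gcongr; exact hB x hx
    · simp [hy0 j x hx]
  have intRHS : Integrable (fun x => ((τ x + A x) * ‖Z x - ∑ j, rdz (e j) Φ x * y j x‖ ^ 2 +
      τ x * ∑ j, ∑ k, ‖Y j k x‖ ^ 2) * Real.exp (-Φ x)) volume := by
    have i1 := intK hK (memLp_sq mS)
      (fun x hx => by simp [hy0 _ x hx, hZ0 x hx])
      (a := fun x => (τ x + A x) * Real.exp (-Φ x)) (by fun_prop)
    have i2 := intK hK (integrable_finset_sum Finset.univ fun j _ =>
      (integrable_finset_sum Finset.univ fun k _ => memLp_sq (hY j k)))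
      (fun x hx => by simp [hY0 _ _ x hx])
      (a := fun x => τ x * Real.exp (-Φ x)) (by fun_prop)
    refine (i1.add i2).congr (Eventually.of_forall fun x => ?_)
    simp only [Pi.add_apply]; ring
  set N : ℝ := ((Fintype.card ι : ℕ) : ℝ) with hN
  have hN0 : 0 ≤ N := by positivity
  apply le_of_forall_pos_le_add
  intro ε hε
  set ε' := ε / (4 * M' * (N + 1 + N * N) + 1) with hε'
  have hden : 0 < 4 * M' * (N + 1 + N * N) + 1 := by positivity
  have hε'0 : 0 < ε' := by positivity
  choose ry hry hry' using fun j => mol_L2 (hy j) hε'0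
  obtain ⟨rZ, hrZ, hrZ'⟩ := mol_L2 hZ hε'0
  choose rY hrY hrY' using fun (p : ι × ι) => mol_L2 (hY p.1 p.2) hε'0
  obtain ⟨r, hr0, hrr1, hrry, hrrZ, hrrY⟩ : ∃ r > 0, r ≤ r1 ∧ (∀ j, r ≤ ry j) ∧ r ≤ rZ ∧
      ∀ p, r ≤ rY p := by
    have : ∀ᶠ r in 𝓝[>] (0:ℝ), 0 < r ∧ r ≤ r1 ∧ (∀ j, r ≤ ry j) ∧ r ≤ rZ ∧ ∀ p, r ≤ rY p := by
      have hh : ∀ s : ℝ, 0 < s → ∀ᶠ r in 𝓝[>] (0:ℝ), r ≤ s := fun s hs =>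
        (eventually_nhdsWithin_of_eventually_nhds (eventually_le_nhds hs))
      exact (eventually_mem_nhdsWithin).and ((hh _ hr1).and ((eventually_all.2 fun j => hh _ (hry j)).and
        ((hh _ hrZ).and (eventually_all.2 fun p => hh _ (hrY p)))))
    obtain ⟨r, h1, h2⟩ := this.exists
    exact ⟨r, h1, h2⟩
  obtain ⟨ρ, hρ⟩ := exists_Moll (E := E) r hr0
  have hKK : ∀ x y, x ∈ K → dist x y ≤ r → y ∈ K1 := by
    intro x y hx hxy
    exact mem_cthickening_of_dist_le y x r1 K hx (by rw [dist_comm]; linarith)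
  have tv : ∀ j, TF V (mol ρ (y j)) := fun j => mol_TF hρ (ily j) hK1c hK1V hKK (hy0 j)
  have tZ : TF V (mol ρ Z) := mol_TF hρ ilZ hK1c hK1V hKK hZ0
  have tY : ∀ j k, TF V (mol ρ (Y j k)) := fun j k => mol_TF hρ (ilY j k) hK1c hK1V hKK (hY0 j k)
  have z1 : ∀ {f : E → ℂ}, (∀ x, x ∉ K → f x = 0) → ∀ x, x ∉ K1 → mol ρ f x = 0 := by
    intro f hf x hx
    exact mol_zero hρ fun t ht => hf t fun htK => hx (hKK t x htK ht)
  have main := twisted e h hτ hp hA hAp hθ hV tv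
  have dZ : ∀ x, ∑ j, del (e j) Φ (mol ρ (y j)) x =
      mol ρ Z x - ∑ j, rdz (e j) Φ x * mol ρ (y j) x := by
    intro x
    simp only [del]
    rw [Finset.sum_sub_distrib]
    congr 1
    have hk := (TF_kernel hρ x).mono (subset_univ _)
    have e1 : ∀ j, dz (e j) (mol ρ (y j)) x = - ∫ t, y j t * dz (e j) (fun s => (ρ (x - s) : ℂ)) t :=
      fun j => mol_DD hρ (ily j) (-I) (e j) x
    simp only [e1]
    rw [Finset.sum_neg_distrib, ← integral_finset_sum, wZ _ hk, neg_neg, mol_apply_kernel]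
    intro j _
    exact locInt_mul (ily j) (hk.DD _ _)
  have dY : ∀ j k x, dzb (e j) (mol ρ (y k)) x - dzb (e k) (mol ρ (y j)) x = mol ρ (Y j k) x := by
    intro j k x
    have hk := (TF_kernel hρ x).mono (subset_univ _)
    have e1 : ∀ j k, dzb (e j) (mol ρ (y k)) x = - ∫ t, y k t * dzb (e j) (fun s => (ρ (x - s) : ℂ)) t :=
      fun j k => mol_DD hρ (ily k) I (e j) x
    rw [e1, e1, mol_apply_kernel, ← neg_eq_iff_eq_neg.2 (wY j k _ hk), integral_sub
      (locInt_mul (ily k) (hk.DD _ _)) (locInt_mul (ily j) (hk.DD _ _))]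
    ring
  simp only [dZ, dY] at main
  set err : E → ℝ := fun x => ∑ j, ‖mol ρ (y j) x - y j x‖ ^ 2 + ‖mol ρ Z x - Z x‖ ^ 2 +
    ∑ j, ∑ k, ‖mol ρ (Y j k) x - Y j k x‖ ^ 2 with herr
  have iy : ∀ j, Integrable (fun x => ‖mol ρ (y j) x - y j x‖ ^ 2) volume := fun j =>
    memLp_sq (hry' j r (hrry j) ρ hρ).1
  have iZ : Integrable (fun x => ‖mol ρ Z x - Z x‖ ^ 2) volume :=
    memLp_sq (hrZ' r hrrZ ρ hρ).1
  have iY : ∀ j k, Integrable (fun x => ‖mol ρ (Y j k) x - Y j k x‖ ^ 2) volume := fun j k =>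
    memLp_sq (hrY' (j, k) r (hrrY (j, k)) ρ hρ).1
  have ierr : Integrable err volume :=
    ((integrable_finset_sum _ fun j _ => iy j).add iZ).add
      (integrable_finset_sum _ fun j _ => integrable_finset_sum _ fun k _ => iY j k)
  have berr : ∫ x, err x ≤ (N + 1 + N * N) * ε' := by
    have i1 : Integrable (fun x => ∑ j, ‖mol ρ (y j) x - y j x‖ ^ 2) volume :=
      integrable_finset_sum _ fun j _ => iy j
    have i2 : Integrable (fun x => ∑ j, ∑ k, ‖mol ρ (Y j k) x - Y j k x‖ ^ 2) volume :=
      integrable_finset_sum _ fun j _ => integrable_finset_sum _ fun k _ => iY j k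
    have i12 : Integrable (fun x => ∑ j, ‖mol ρ (y j) x - y j x‖ ^ 2 + ‖mol ρ Z x - Z x‖ ^ 2)
      volume := i1.add iZ
    rw [herr, integral_add i12 i2, integral_add i1 iZ,
      integral_finset_sum _ (fun j _ => iy j),
      integral_finset_sum _ (fun j _ => integrable_finset_sum _ fun k _ => iY j k)]
    have a1 : ∑ j, ∫ x, ‖mol ρ (y j) x - y j x‖ ^ 2 ≤ N * ε' := by
      calc _ ≤ ∑ j : ι, ε' := Finset.sum_le_sum fun j _ => (hry' j r (hrry j) ρ hρ).2
        _ = _ := by simp [hN]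
    have a2 := (hrZ' r hrrZ ρ hρ).2
    have a3 : ∑ j, ∫ x, ∑ k, ‖mol ρ (Y j k) x - Y j k x‖ ^ 2 ≤ N * N * ε' := by
      calc _ ≤ ∑ j : ι, ∑ k : ι, ε' := Finset.sum_le_sum fun j _ => by
            rw [integral_finset_sum _ (fun k _ => iY j k)]
            exact Finset.sum_le_sum fun k _ => (hrY' (j, k) r (hrrY (j, k)) ρ hρ).2
        _ = _ := by simp [hN]; ring
    nlinarith
  have err0 : ∀ x, 0 ≤ err x := fun x => by positivity
  have pt1 : ∀ x, (θ x * ∑ j, ‖y j x‖ ^ 2) * Real.exp (-Φ x) ≤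
      2 * ((θ x * ∑ j, ‖mol ρ (y j) x‖ ^ 2) * Real.exp (-Φ x)) + 2 * (M' * err x) := by
    intro x
    have hE := Real.exp_pos (-Φ x)
    by_cases hx : x ∈ K1
    · refine pt1_aux (fun j => y j x) (fun j => mol ρ (y j) x) (mul_nonneg (hθ0 x) hE.le) ?_ ?_
      · refine le_trans ?_ ((hM' x hx).trans (le_max_left _ _))
        gcongr
        have q1 := hp x
        have q2 := hAp x
        have q3 : 0 ≤ ∑ j, ‖rdz (e j) Φ x‖ ^ 2 := by positivity
        have q4 : 0 ≤ 4 * (τ x + A x) * (1 + ∑ j, ‖rdz (e j) Φ x‖ ^ 2) := by positivity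
        linarith
      · simp only [herr]
        have q1 : 0 ≤ ∑ j, ∑ k, ‖mol ρ (Y j k) x - Y j k x‖ ^ 2 := by positivity
        have q2 : 0 ≤ ‖mol ρ Z x - Z x‖ ^ 2 := by positivity
        linarith
    · have hxK : x ∉ K := fun hh => hx (hKK1 hh)
      have e1 : ∀ j, y j x = 0 := fun j => hy0 j x hxK
      have e2 : ∀ j, mol ρ (y j) x = 0 := fun j => z1 (hy0 j) x hx
      simp only [e1, e2]
      have := mul_nonneg hM'0 (err0 x)
      simp; linarith
  have pt2 : ∀ x, ((τ x + A x) * ‖mol ρ Z x - ∑ j, rdz (e j) Φ x * mol ρ (y j) x‖ ^ 2 +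
      τ x * ∑ j, ∑ k, ‖mol ρ (Y j k) x‖ ^ 2) * Real.exp (-Φ x) ≤
      2 * (((τ x + A x) * ‖Z x - ∑ j, rdz (e j) Φ x * y j x‖ ^ 2 +
      τ x * ∑ j, ∑ k, ‖Y j k x‖ ^ 2) * Real.exp (-Φ x)) + M' * err x := by
    intro x
    have hE := Real.exp_pos (-Φ x)
    have q1 := hp x
    have q2 := hAp x
    by_cases hx : x ∈ K1
    · exact pt2_aux (fun j => rdz (e j) Φ x) (fun j => y j x) (fun j => mol ρ (y j) x)
        (Z x) (mol ρ Z x) (fun j k => Y j k x) (fun j k => mol ρ (Y j k) x) q1 q2 (hθ0 x) hE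
        ((hM' x hx).trans (le_max_left _ _))
    · have hxK : x ∉ K := fun hh => hx (hKK1 hh)
      have e1 : ∀ j, mol ρ (y j) x = 0 := fun j => z1 (hy0 j) x hx
      have e2 : mol ρ Z x = 0 := z1 hZ0 x hx
      have e3 : ∀ j k, mol ρ (Y j k) x = 0 := fun j k => z1 (hY0 j k) x hx
      have := mul_nonneg hM'0 (err0 x)
      have : 0 ≤ ((τ x + A x) * ‖Z x - ∑ j, rdz (e j) Φ x * y j x‖ ^ 2 +
        τ x * ∑ j, ∑ k, ‖Y j k x‖ ^ 2) * Real.exp (-Φ x) := by positivity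
      simp only [e1, e2, e3]
      simp
      linarith
  have c1 : ∀ j, Continuous (mol ρ (y j)) := fun j => (tv j).1.continuous
  have c2 : Continuous (mol ρ Z) := tZ.1.continuous
  have c3 : ∀ j k, Continuous (mol ρ (Y j k)) := fun j k => (tY j k).1.continuous
  have intL : Integrable (fun x => (θ x * ∑ j, ‖mol ρ (y j) x‖ ^ 2) * Real.exp (-Φ x)) volume := by
    refine Continuous.integrable_of_hasCompactSupport (by fun_prop)
      (HasCompactSupport.intro hK1c fun x hx => ?_)
    simp [z1 (hy0 _) x hx]
  have intR : Integrable (fun x => ((τ x + A x) * ‖mol ρ Z x - ∑ j, rdz (e j) Φ x * mol ρ (y j) x‖ ^ 2 +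
      τ x * ∑ j, ∑ k, ‖mol ρ (Y j k) x‖ ^ 2) * Real.exp (-Φ x)) volume := by
    refine Continuous.integrable_of_hasCompactSupport (by fun_prop)
      (HasCompactSupport.intro hK1c fun x hx => ?_)
    simp [z1 (hy0 _) x hx, z1 hZ0 x hx, z1 (hY0 _ _) x hx]
  have f1 := integral_mono intLHS ((intL.const_mul 2).add ((ierr.const_mul M').const_mul 2)) pt1
  have f2 := integral_mono intR ((intRHS.const_mul 2).add (ierr.const_mul M')) pt2
  simp only [Pi.add_apply] at f1 f2
  rw [integral_add (intL.const_mul 2) ((ierr.const_mul M').const_mul 2), integral_const_mul,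
    integral_const_mul, integral_const_mul] at f1
  rw [integral_add (intRHS.const_mul 2) (ierr.const_mul M'), integral_const_mul,
    integral_const_mul] at f2
  have f3 : 4 * M' * ∫ x, err x ≤ ε := by
    calc _ ≤ 4 * M' * ((N + 1 + N * N) * ε') := by gcongr
      _ = (4 * M' * (N + 1 + N * N)) * ε' := by ring
      _ ≤ (4 * M' * (N + 1 + N * N) + 1) * ε' := by gcongr; linarith
      _ = ε := by rw [hε']; field_simp
  linarith
end weak

section proj

variable {E : Type*} [NormedAddCommGroup E] [NormedSpace ℂ E] [FiniteDimensional ℂ E]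
  [MeasureSpace E] [BorelSpace E] [(volume : Measure E).IsAddHaarMeasure]

lemma abs_proj {H : Type*} [NormedAddCommGroup H] [InnerProductSpace ℂ H] [CompleteSpace H]
    (S : Set H) (v : H) : ∃ y : H, (∀ m ∈ S, inner ℂ m y = 0) ∧ ‖y‖ ≤ ‖v‖ ∧
      ∀ a, (∀ m ∈ S, inner ℂ m a = 0) → inner ℂ a y = inner ℂ a v := by
  set K := (Submodule.span ℂ S)ᗮ with hK
  have key : ∀ a, (∀ m ∈ S, inner ℂ m a = 0) → a ∈ K := by
    intro a ha
    rw [hK, Submodule.mem_orthogonal]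
    intro u hu
    induction hu using Submodule.span_induction with
    | mem x hx => exact ha x hx
    | zero => simp
    | add x y _ _ h1 h2 => rw [inner_add_left, h1, h2, add_zero]
    | smul c x _ h1 => rw [inner_smul_left, h1, mul_zero]
  refine ⟨K.starProjection v, ?_, ?_, ?_⟩
  · intro m hm
    have : K.starProjection v ∈ K := Submodule.starProjection_apply_mem K v
    exact (Submodule.mem_orthogonal _ _).1 this m (Submodule.subset_span hm)
  · exact K.norm_starProjection_apply_le v
  · intro a ha
    have h1 := K.inner_starProjection_left_eq_right a v
    rw [← h1, Submodule.starProjection_eq_self_iff.2 (key a ha)]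

noncomputable def emb {ι : Type*} [Fintype ι] (F : ι → E → ℂ) (hF : ∀ j, MemLp (F j) 2 volume) :
    PiLp 2 (fun _ : ι => Lp ℂ 2 (volume : Measure E)) :=
  WithLp.toLp 2 (fun j => (hF j).toLp (F j))

lemma inner_emb {ι : Type*} [Fintype ι] (F : ι → E → ℂ) (hF : ∀ j, MemLp (F j) 2 volume)
    (y : PiLp 2 (fun _ : ι => Lp ℂ 2 (volume : Measure E))) :
    inner ℂ (emb F hF) y = ∑ j, ∫ x, y j x * conj (F j x) := by
  rw [PiLp.inner_apply]
  refine Finset.sum_congr rfl fun j _ => ?_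
  rw [MeasureTheory.L2.inner_def]
  refine integral_congr_ae ?_
  filter_upwards [(hF j).coeFn_toLp] with x hx
  simp only [emb, RCLike.inner_apply]
  rw [hx]

lemma TF.memLp {V : Set E} {g : E → ℂ} (hg : TF V g) : MemLp g 2 volume :=
  hg.1.continuous.memLp_of_hasCompactSupport hg.2.1

lemma contDiff_half {Φ : E → ℝ} (h : ContDiff ℝ ∞ Φ) (c : ℝ) :
    ContDiff ℝ ∞ (fun x => ((Real.exp (c * Φ x) : ℝ) : ℂ)) :=
  contDiff_ofReal (contDiff_const.mul h).exp

lemma int_prod {z : E → ℂ} (hz : MemLp z 2 volume) {V : Set E} {g : E → ℂ} (hg : TF V g) :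
    Integrable (fun x => z x * g x) volume :=
  locInt_mul (memLp_two_locInt hz) hg

lemma proj_exists {ι : Type*} [Fintype ι] [DecidableEq ι] (e : ι → E) {Φ : E → ℝ}
    (h : ContDiff ℝ ∞ Φ) {V : Set E} {v : ι → E → ℂ} (hv : ∀ j, TF V (v j)) :
    ∃ y : ι → E → ℂ, (∀ j, MemLp (fun x => y j x * (Real.exp (-(1/2) * Φ x) : ℝ)) 2 volume) ∧
      (∀ g, TF V g → ∀ j k, ∫ x, (y k x * dzb (e j) g x - y j x * dzb (e k) g x) = 0) ∧
      (∫ x, (∑ j, ‖y j x‖ ^ 2) * Real.exp (-Φ x) ≤ ∫ x, (∑ j, ‖v j x‖ ^ 2) * Real.exp (-Φ x)) ∧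
      (∀ g, TF V g → ∫ x, (∑ j, y j x * conj (dzb (e j) g x)) * (Real.exp (-Φ x) : ℝ) =
        ∫ x, (∑ j, v j x * conj (dzb (e j) g x)) * (Real.exp (-Φ x) : ℝ)) := by
  have cm := contDiff_half h (-(1/2))
  have cp := contDiff_half h (1/2)
  set Wm : E → ℂ := fun x => ((Real.exp (-(1/2) * Φ x) : ℝ) : ℂ) with hWm
  set Wp : E → ℂ := fun x => ((Real.exp ((1/2) * Φ x) : ℝ) : ℂ) with hWp
  have wmp : ∀ x, Wp x * Wm x = 1 := fun x => by
    simp only [hWm, hWp]; rw [← Complex.ofReal_mul, ← Real.exp_add]; simp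
  have wmm : ∀ x, Wm x * Wm x = (Real.exp (-Φ x) : ℝ) := fun x => by
    simp only [hWm]; rw [← Complex.ofReal_mul, ← Real.exp_add]; ring_nf
  have conjm : ∀ x, conj (Wm x) = Wm x := fun x => Complex.conj_ofReal _
  have conjp : ∀ x, conj (Wp x) = Wp x := fun x => Complex.conj_ofReal _
  -- vectors
  have tv : ∀ j, TF V (fun x => v j x * Wm x) := fun j => (hv j).mul_right cm
  have ta : ∀ g, TF V g → ∀ j, TF V (fun x => dzb (e j) g x * Wm x) :=
    fun g hg j => (hg.DD _ _).mul_right cm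
  have tm : ∀ g, TF V g → ∀ j k i, TF V (fun x => ((if i = k then (1:ℂ) else 0) *
      conj (dzb (e j) g x) + (if i = j then (-1:ℂ) else 0) * conj (dzb (e k) g x)) * Wp x) :=
    fun g hg j k i => (((hg.DD _ _).conj.mul_left contDiff_const).add
      ((hg.DD _ _).conj.mul_left contDiff_const)).mul_right cp
  let S : Set (PiLp 2 (fun _ : ι => Lp ℂ 2 (volume : Measure E))) :=
    {m | ∃ g, ∃ hg : TF V g, ∃ j k, m = emb _ (fun i => (tm g hg j k i).memLp)}
  obtain ⟨z, hz1, hz2, hz3⟩ := abs_proj S (emb _ (fun j => (tv j).memLp))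
  have hzL : ∀ j, MemLp (z j) 2 volume := fun j => Lp.memLp _
  -- curl formula
  have hcurl : ∀ g (hg : TF V g) j k (u : PiLp 2 (fun _ : ι => Lp ℂ 2 (volume : Measure E))),
      inner ℂ (emb _ (fun i => (tm g hg j k i).memLp)) u =
        ∫ x, (u k x * Wp x * dzb (e j) g x - u j x * Wp x * dzb (e k) g x) := by
    intro g hg j k u
    rw [inner_emb]
    have huL : ∀ j, MemLp (u j) 2 volume := fun j => Lp.memLp _
    rw [← integral_finset_sum _ (fun i _ => int_prod (huL i) (tm g hg j k i).conj)]
    congr 1; ext x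
    simp only [map_mul, map_add, conjp, apply_ite conj, map_one, map_zero, map_neg, Complex.conj_conj,
      add_mul, mul_add, Finset.sum_add_distrib, ite_mul, mul_ite, one_mul, zero_mul, mul_zero,
      Finset.sum_ite_eq', Finset.mem_univ, if_true]
    ring
  refine ⟨fun j x => z j x * Wp x, ?_, ?_, ?_, ?_⟩
  · intro j
    have e0 : (fun x => z j x * Wp x * (Real.exp (-(1/2) * Φ x) : ℝ)) = fun x => z j x := by
      ext x
      have := wmp x
      simp only [hWm] at this
      rw [mul_assoc, this, mul_one]
    rw [e0]; exact hzL j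
  · intro g hg j k
    rw [← hcurl g hg j k z]
    exact hz1 _ ⟨g, hg, j, k, rfl⟩
  · have e1 : ∀ x, (∑ j, ‖z j x * Wp x‖ ^ 2) * Real.exp (-Φ x) = ∑ j, ‖z j x‖ ^ 2 := by
      intro x
      rw [Finset.sum_mul]
      refine Finset.sum_congr rfl fun j _ => ?_
      have : ‖Wp x‖ ^ 2 * Real.exp (-Φ x) = 1 := by
        simp only [hWp, Complex.norm_real, Real.norm_eq_abs, Real.abs_exp]
        rw [← Real.exp_nat_mul, ← Real.exp_add]
        rw [show ((2:ℕ):ℝ) * (1/2 * Φ x) + -Φ x = 0 by push_cast; ring, Real.exp_zero]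
      rw [norm_mul, mul_pow, mul_assoc, this, mul_one]
    have e2 : ∀ x, (∑ j, ‖v j x‖ ^ 2) * Real.exp (-Φ x) = ∑ j, ‖v j x * Wm x‖ ^ 2 := by
      intro x
      rw [Finset.sum_mul]
      refine Finset.sum_congr rfl fun j _ => ?_
      have : ‖Wm x‖ ^ 2 = Real.exp (-Φ x) := by
        simp only [hWm, Complex.norm_real, Real.norm_eq_abs, Real.abs_exp]
        rw [← Real.exp_nat_mul]; congr 1; push_cast; ring
      rw [norm_mul, mul_pow, this]
    simp only [e1, e2]
    rw [integral_finset_sum _ (fun j _ => memLp_sq (hzL j)),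
      integral_finset_sum _ (fun j _ => memLp_sq (tv j).memLp)]
    have nn : ∀ u : Lp ℂ 2 (volume : Measure E), ‖u‖ ^ 2 = ∫ x, ‖u x‖ ^ 2 := by
      intro u
      have := inner_self_eq_norm_sq (𝕜 := ℂ) u
      rw [← this, MeasureTheory.L2.inner_def, ← integral_re (MeasureTheory.L2.integrable_inner u u)]
      congr 1; ext x
      exact inner_self_eq_norm_sq (𝕜 := ℂ) (u x)
    have hh : ‖z‖ ^ 2 ≤ ‖emb _ (fun j => (tv j).memLp)‖ ^ 2 := by gcongr
    rw [PiLp.norm_sq_eq_of_L2, PiLp.norm_sq_eq_of_L2] at hh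
    simp only [nn] at hh
    refine hh.trans (le_of_eq ?_)
    refine Finset.sum_congr rfl fun j _ => integral_congr_ae ?_
    filter_upwards [((tv j).memLp).coeFn_toLp] with x hx
    simp only [emb]
    rw [hx]
  · intro g hg
    have h1 := hz3 (emb _ (fun j => (ta g hg j).memLp)) ?_
    · rw [inner_emb, inner_emb,
        ← integral_finset_sum _ (fun i _ => int_prod (hzL i) (ta g hg i).conj),
        ← integral_finset_sum _ (fun i _ => int_prod (Lp.memLp _) (ta g hg i).conj)] at h1
      calc _ = _ := ?_
        _ = _ := h1
        _ = _ := ?_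
      · congr 1; ext x
        rw [Finset.sum_mul]
        refine Finset.sum_congr rfl fun j _ => ?_
        rw [← wmm, map_mul, conjm]
        linear_combination (z j x * conj (dzb (e j) g x) * Wm x) * wmp x
      · refine integral_congr_ae ?_
        have : ∀ᵐ x ∂(volume : Measure E), ∀ j, ((tv j).memLp).toLp _ x = v j x * Wm x :=
          ae_all_iff.2 fun j => ((tv j).memLp).coeFn_toLp
        filter_upwards [this] with x hx
        rw [Finset.sum_mul]
        refine Finset.sum_congr rfl fun j _ => ?_
        simp only [emb]
        rw [hx j, ← wmm, map_mul, conjm]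
        ring
    · rintro m ⟨g', hg', j, k, rfl⟩
      rw [hcurl g' hg' j k]
      have e0 : ∀ᵐ x ∂(volume : Measure E), ∀ j, ((ta g hg j).memLp).toLp _ x = dzb (e j) g x * Wm x :=
        ae_all_iff.2 fun j => ((ta g hg j).memLp).coeFn_toLp
      have e1 : ∫ x, ((emb _ (fun j => (ta g hg j).memLp)) k x * Wp x * dzb (e j) g' x -
          (emb _ (fun j => (ta g hg j).memLp)) j x * Wp x * dzb (e k) g' x) =
          ∫ x, (dzb (e k) g x * dzb (e j) g' x - dzb (e j) g x * dzb (e k) g' x) := by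
        refine integral_congr_ae ?_
        filter_upwards [e0] with x hx
        simp only [emb]
        rw [hx j, hx k]
        linear_combination (dzb (e k) g x * dzb (e j) g' x - dzb (e j) g x * dzb (e k) g' x) * wmp x
      rw [e1]
      have hgu := hg.mono (subset_univ _)
      have hgu' := hg'.mono (subset_univ _)
      have i1 : ∀ j k, Integrable (fun x => DD I (e k) g x * DD I (e j) g' x) volume := fun j k =>
        ((hg'.DD I (e j)).mul_left (contDiff_DD (c := I) (e := e k) hg.1)).integrable
      rw [integral_sub (i1 j k) (i1 k j),
        integral_DD_mul hg.1 (hgu'.DD _ _), integral_DD_mul hg.1 (hgu'.DD _ _)]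
      simp only [DD_comm hg'.1 (c := I) (d := I) (e := e k) (e' := e j)]
      simp
end proj

section cut
variable {E : Type*} [NormedAddCommGroup E] [NormedSpace ℂ E] [FiniteDimensional ℂ E]
  [MeasureSpace E] [BorelSpace E] [(volume : Measure E).IsAddHaarMeasure]

lemma memLp_mulTF {Φ : E → ℝ} (h : ContDiff ℝ ∞ Φ) {y : E → ℂ}
    (hy : MemLp (fun x => y x * (Real.exp (-(1/2) * Φ x) : ℝ)) 2 volume) {g : E → ℂ}
    (hg : Continuous g) (hc : HasCompactSupport g) : MemLp (fun x => g x * y x) 2 volume := by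
  have cp := (contDiff_half h (1/2)).continuous
  have c1 : Continuous (fun x => g x * (Real.exp ((1/2) * Φ x) : ℝ)) := hg.mul cp
  obtain ⟨C, hC⟩ := (hc.mul_right (f' := fun x => ((Real.exp ((1/2) * Φ x) : ℝ) : ℂ))).exists_bound_of_continuous c1
  have e0 : (fun x => g x * y x) = fun x => (g x * (Real.exp ((1/2) * Φ x) : ℝ)) *
      (y x * (Real.exp (-(1/2) * Φ x) : ℝ)) := by
    ext x
    have : ((Real.exp ((1/2) * Φ x) : ℝ) : ℂ) * (Real.exp (-(1/2) * Φ x) : ℝ) = 1 := by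
      rw [← Complex.ofReal_mul, ← Real.exp_add]; simp
    linear_combination (-(g x * y x)) * this
  rw [e0]
  refine hy.of_le_mul (c := C) (c1.aestronglyMeasurable.mul hy.1) (Eventually.of_forall fun x => ?_)
  rw [norm_mul]
  exact mul_le_mul_of_nonneg_right (hC x) (norm_nonneg _)

lemma locInt_of_mul {Φ : E → ℝ} (h : ContDiff ℝ ∞ Φ) {y : E → ℂ}
    (hy : MemLp (fun x => y x * (Real.exp (-(1/2) * Φ x) : ℝ)) 2 volume) {V : Set E} {g : E → ℂ}
    (hg : TF V g) : Integrable (fun x => y x * g x) volume := by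
  have e0 : (fun x => y x * g x) = fun x => (y x * (Real.exp (-(1/2) * Φ x) : ℝ)) *
      (g x * (Real.exp ((1/2) * Φ x) : ℝ)) := by
    ext x
    have : ((Real.exp ((1/2) * Φ x) : ℝ) : ℂ) * (Real.exp (-(1/2) * Φ x) : ℝ) = 1 := by
      rw [← Complex.ofReal_mul, ← Real.exp_add]; simp
    linear_combination (-(g x * y x)) * this
  rw [e0]
  exact int_prod hy (hg.mul_right (contDiff_half h (1/2)))

lemma cut_pt {ι : Type*} [Fintype ι] {τ A η : ℝ} (hτ : 0 < τ) (hA : 0 < A) (h0 : 0 ≤ η) (h1 : η ≤ 1)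
    (d : ℂ) (a y : ι → ℂ) :
    4 * ((τ + A) * ‖η * d + ∑ j, a j * y j‖ ^ 2 +
      τ * ∑ j, ∑ k, ‖conj (a j) * y k - conj (a k) * y j‖ ^ 2) ≤
    8 * ((τ + A) * ‖d‖ ^ 2) + (8 * (τ + A) + 16 * τ) * (∑ j, ‖a j‖ ^ 2) * ∑ j, ‖y j‖ ^ 2 := by
  have b1 : ‖η * d + ∑ j, a j * y j‖ ^ 2 ≤ 2 * ‖d‖ ^ 2 + 2 * ((∑ j, ‖a j‖ ^ 2) * ∑ j, ‖y j‖ ^ 2) := by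
    refine (norm_add_sq_le _ _).trans ?_
    have c1 := norm_sum_mul_sq_le a y
    have c2 : ‖(η:ℂ) * d‖ ^ 2 ≤ ‖d‖ ^ 2 := by
      rw [norm_mul, mul_pow, Complex.norm_real, Real.norm_eq_abs, sq_abs]
      exact mul_le_of_le_one_left (by positivity) (by nlinarith)
    linarith
  have b2 : ∑ j, ∑ k, ‖conj (a j) * y k - conj (a k) * y j‖ ^ 2 ≤
      4 * ((∑ j, ‖a j‖ ^ 2) * ∑ j, ‖y j‖ ^ 2) := by
    have c1 : ∀ j k, ‖conj (a j) * y k - conj (a k) * y j‖ ^ 2 ≤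
        2 * (‖a j‖ ^ 2 * ‖y k‖ ^ 2) + 2 * (‖a k‖ ^ 2 * ‖y j‖ ^ 2) := by
      intro j k
      have := norm_add_sq_le (conj (a j) * y k) (-(conj (a k) * y j))
      rw [norm_neg, ← sub_eq_add_neg] at this
      simpa [mul_pow] using this
    refine (Finset.sum_le_sum fun j _ => Finset.sum_le_sum fun k _ => c1 j k).trans (le_of_eq ?_)
    simp only [Finset.sum_add_distrib, ← Finset.mul_sum, ← Finset.sum_mul]
    ring
  have b3 := mul_le_mul_of_nonneg_left b1 (by positivity : 0 ≤ τ + A)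
  have b4 := mul_le_mul_of_nonneg_left b2 hτ.le
  linarith

set_option maxHeartbeats 400000 in
lemma cut_ineq {ι : Type*} [Fintype ι] (e : ι → E) {Φ τ A θ : E → ℝ} (h : ContDiff ℝ ∞ Φ)
    (hτ : ContDiff ℝ ∞ τ) (hp : ∀ x, 0 < τ x) (hA : Continuous A) (hAp : ∀ x, 0 < A x)
    (hθ : Continuous θ) (hθ0 : ∀ x, 0 ≤ θ x) {V : Set E} (hVo : IsOpen V)
    (hV : ∀ x ∈ V, ∀ ζ : ι → ℂ, θ x * ∑ j, ‖ζ j‖ ^ 2 + ‖∑ j, rdz (e j) τ x * ζ j‖ ^ 2 / A x ≤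
      τ x * LF e Φ x ζ - LF e τ x ζ)
    {y v : ι → E → ℂ} (hv : ∀ j, TF V (v j))
    (hy : ∀ j, MemLp (fun x => y j x * (Real.exp (-(1/2) * Φ x) : ℝ)) 2 volume)
    (hcurl : ∀ g, TF V g → ∀ j k, ∫ x, (y k x * dzb (e j) g x - y j x * dzb (e k) g x) = 0)
    (hdiv : ∀ g, TF V g → ∫ x, (∑ j, y j x * conj (dzb (e j) g x)) * (Real.exp (-Φ x) : ℝ) =
        ∫ x, (∑ j, v j x * conj (dzb (e j) g x)) * (Real.exp (-Φ x) : ℝ))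
    {η : E → ℝ} (hηs : ContDiff ℝ ∞ η) (hη : TF V (fun x => (η x : ℂ))) :
    ∫ x, (θ x * ∑ j, ‖(η x : ℂ) * y j x‖ ^ 2) * Real.exp (-Φ x) ≤
     4 * ∫ x, ((τ x + A x) * ‖(η x : ℂ) * (∑ j, del (e j) Φ (v j) x) +
        ∑ j, rdz (e j) η x * y j x‖ ^ 2 +
      τ x * ∑ j, ∑ k, ‖conj (rdz (e j) η x) * y k x - conj (rdz (e k) η x) * y j x‖ ^ 2) *
      Real.exp (-Φ x) := by
  have tη : ∀ c e', TF V (DD c e' (fun x => (η x : ℂ))) := fun c e' => hη.DD c e'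
  have tδ : TF V (fun x => ∑ j, del (e j) Φ (v j) x) := TF.sum fun j => TF_del h (hv j)
  have tr : ∀ j, TF V (rdz (e j) η) := fun j => tη _ _
  have cr : ∀ j, ContDiff ℝ ∞ (rdz (e j) Φ) := fun j => contDiff_rdz h
  have dzbη : ∀ e' x, DD I e' (fun x => (η x : ℂ)) x = conj (rdz e' η x) := fun e' x =>
    dzb_real (cdAt hηs)
  have mm : ∀ {g : E → ℂ} (j : ι), TF V g → MemLp (fun x => g x * y j x) 2 volume := fun j hg =>
    memLp_mulTF h (hy j) hg.1.continuous hg.2.1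
  set K := tsupport (fun x => (η x : ℂ)) with hK
  have k0 : ∀ x, x ∉ K → η x = 0 := fun x hx => by
    have := image_eq_zero_of_notMem_tsupport hx
    exact_mod_cast this
  have k1 : ∀ x, x ∉ K → ∀ j, rdz (e j) η x = 0 := fun x hx j => DD_eq_zero_of_notMem hx
  have key := weak_twisted e h hτ hp hA hAp hθ hθ0 hVo (K := K) hη.2.1 hη.2.2 hV
    (y := fun j x => (η x : ℂ) * y j x)
    (Z := fun x => (η x : ℂ) * (∑ j, del (e j) Φ (v j) x) + ∑ j, rdz (e j) η x * y j x +
      ∑ j, rdz (e j) Φ x * ((η x : ℂ) * y j x))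
    (Y := fun j k x => conj (rdz (e j) η x) * y k x - conj (rdz (e k) η x) * y j x)
    (fun j => mm j hη) ?_ (fun j k => (mm k (tr j).conj).sub (mm j (tr k).conj))
    (fun j x hx => by simp [k0 x hx]) (fun x hx => by simp [k0 x hx, k1 x hx])
    (fun j k x hx => by simp [k1 x hx]) ?_ ?_
  · simpa only [add_sub_cancel_right] using key
  · refine ((tδ.mul_left (contDiff_ofReal hηs)).memLp.add
      (memLp_finset_sum _ fun j _ => mm j (tr j))).add (memLp_finset_sum _ fun j _ => ?_)
    refine (mm j (hη.mul_left (cr j))).ae_eq (Eventually.of_forall fun x => ?_)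
    simp only [mul_assoc]
  · intro g hg
    -- test function conj h = η g e^Φ
    have cE : ContDiff ℝ ∞ (fun x => ((Real.exp (Φ x) : ℝ) : ℂ)) := contDiff_ofReal h.exp
    have tg : TF V (fun x => conj ((η x : ℂ) * g x * (Real.exp (Φ x) : ℝ))) :=
      ((hη.mul_right hg.1).mul_right cE).conj
    have h1 := hdiv _ tg
    have dE : ∀ e' x, DD (-I) e' (fun x => ((Real.exp (Φ x) : ℝ) : ℂ)) x =
        rdz e' Φ x * (Real.exp (Φ x) : ℝ) := fun e' x => by
      rw [DD_comp (Real.hasDerivAt_exp (Φ x)) (cdAt h), rdz, mul_comm]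
    have ee : ∀ x, ((Real.exp (Φ x) : ℝ) : ℂ) * (Real.exp (-Φ x) : ℝ) = 1 := fun x => by
      rw [← Complex.ofReal_mul, ← Real.exp_add]; simp
    have dd : ∀ j x, conj (dzb (e j) (fun x => conj ((η x : ℂ) * g x * (Real.exp (Φ x) : ℝ))) x) *
        (Real.exp (-Φ x) : ℝ) =
        (η x : ℂ) * dz (e j) g x + (rdz (e j) η x + rdz (e j) Φ x * η x) * g x := by
      intro j x
      rw [dzb_conj (((hη.mul_right hg.1).mul_right cE).differentiableAt), Complex.conj_conj, dz,
        DD_mul (hη.mul_right hg.1).differentiableAt (cdAt cE),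
        DD_mul hη.differentiableAt hg.differentiableAt, dE]
      change ((rdz (e j) η x * g x + _) * _ + _) * _ = _
      linear_combination ((η x : ℂ) * dz (e j) g x + (rdz (e j) η x + rdz (e j) Φ x * η x) * g x) * ee x
    have h2 : ∫ x, (∑ j, v j x * conj (dzb (e j) (fun x => conj ((η x : ℂ) * g x * (Real.exp (Φ x) : ℝ))) x)) *
        (Real.exp (-Φ x) : ℝ) = - ∫ x, (η x : ℂ) * (∑ j, del (e j) Φ (v j) x) * g x := by
      have hu := tg.mono (subset_univ _)
      have e1 : ∀ j, ∫ x, v j x * conj (dzb (e j) (fun x => conj ((η x : ℂ) * g x * (Real.exp (Φ x) : ℝ))) x) *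
        (Real.exp (-Φ x) : ℝ) = - ∫ x, (η x : ℂ) * del (e j) Φ (v j) x * g x := by
        intro j
        rw [← neg_eq_iff_eq_neg, ← del_parts h ((hv j).mono (subset_univ _)) hu]
        congr 1; ext x
        rw [Complex.conj_conj]
        linear_combination (del (e j) Φ (v j) x * η x * g x) * ee x
      simp only [Finset.sum_mul, Finset.mul_sum]
      rw [integral_finset_sum, integral_finset_sum, ← Finset.sum_neg_distrib]
      · exact Finset.sum_congr rfl fun j _ => e1 j
      · intro j _
        exact (((TF_del h (hv j)).mul_left (contDiff_ofReal hηs)).mul_right hg.1).integrable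
      · intro j _
        exact (((hv j).mul_right (tg.DD _ _).conj.1).mul_right (contDiff_W h)).integrable
    rw [h2] at h1
    have h3 : ∀ x, (∑ j, y j x * conj (dzb (e j) (fun x => conj ((η x : ℂ) * g x * (Real.exp (Φ x) : ℝ))) x)) *
        (Real.exp (-Φ x) : ℝ) = (∑ j, (η x : ℂ) * y j x * dz (e j) g x) +
        ((∑ j, rdz (e j) η x * y j x) + ∑ j, rdz (e j) Φ x * ((η x : ℂ) * y j x)) * g x := by
      intro x
      rw [Finset.sum_mul, ← Finset.sum_add_distrib, Finset.sum_mul, ← Finset.sum_add_distrib]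
      refine Finset.sum_congr rfl fun j _ => ?_
      rw [mul_assoc, dd]; ring
    simp only [h3] at h1
    have i1 : Integrable (fun x => ∑ j, (η x : ℂ) * y j x * dz (e j) g x) volume := by
      refine integrable_finset_sum _ fun j _ => ?_
      refine (locInt_of_mul h (hy j) ((hη.mul_right (hg.DD (-I) (e j)).1))).congr
        (Eventually.of_forall fun x => ?_)
      simp only; ring
    have i2 : Integrable (fun x => ((∑ j, rdz (e j) η x * y j x) +
        ∑ j, rdz (e j) Φ x * ((η x : ℂ) * y j x)) * g x) volume := by
      simp only [← Finset.sum_add_distrib, Finset.sum_mul]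
      refine integrable_finset_sum _ fun j _ => ?_
      refine (locInt_of_mul h (hy j) (((tr j).add (hη.mul_left (cr j))).mul_right hg.1)).congr
        (Eventually.of_forall fun x => ?_)
      simp only; ring
    rw [integral_add i1 i2] at h1
    have i3 : Integrable (fun x => (η x : ℂ) * (∑ j, del (e j) Φ (v j) x) * g x) volume :=
      ((tδ.mul_left (contDiff_ofReal hηs)).mul_right hg.1).integrable
    have h4 : ∫ x, ((η x : ℂ) * (∑ j, del (e j) Φ (v j) x) + ∑ j, rdz (e j) η x * y j x +
      ∑ j, rdz (e j) Φ x * ((η x : ℂ) * y j x)) * g x =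
      (∫ x, (η x : ℂ) * (∑ j, del (e j) Φ (v j) x) * g x) + ∫ x, ((∑ j, rdz (e j) η x * y j x) +
        ∑ j, rdz (e j) Φ x * ((η x : ℂ) * y j x)) * g x := by
      rw [← integral_add i3 i2]
      congr 1; ext x; ring
    rw [h4]
    linear_combination h1
  · intro j k g hg
    have h1 := hcurl _ (hη.mul_right hg.1) j k
    have h2 : ∀ j x, dzb (e j) (fun x => (η x : ℂ) * g x) x = conj (rdz (e j) η x) * g x +
        η x * dzb (e j) g x := by
      intro j x
      rw [dzb, DD_mul hη.differentiableAt hg.differentiableAt, dzbη]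
    simp only [h2] at h1
    have i1 : ∀ j k, Integrable (fun x => (η x : ℂ) * y k x * dzb (e j) g x) volume := fun j k => by
      refine (locInt_of_mul h (hy k) ((hη.mul_right (hg.DD I (e j)).1))).congr
        (Eventually.of_forall fun x => ?_)
      simp only; ring
    have i2 : ∀ j k, Integrable (fun x => conj (rdz (e j) η x) * y k x * g x) volume := fun j k => by
      refine (locInt_of_mul h (hy k) (((tr j).conj.mul_right hg.1))).congr
        (Eventually.of_forall fun x => ?_)
      simp only; ring
    rw [← sub_eq_zero, sub_neg_eq_add, ← h1]
    simp only [sub_mul]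
    have i3 : Integrable (fun x => (η x : ℂ) * y k x * dzb (e j) g x - η x * y j x * dzb (e k) g x)
      volume := (i1 j k).sub (i1 k j)
    have i4 : Integrable (fun x => conj (rdz (e j) η x) * y k x * g x -
      conj (rdz (e k) η x) * y j x * g x) volume := (i2 j k).sub (i2 k j)
    rw [← integral_add i3 i4]
    congr 1; ext x
    ring
end cut

section levi
variable {E : Type*} [NormedAddCommGroup E] [NormedSpace ℂ E]
lemma rdz_comp {e : E} {φ : E → ℝ} (hφ : ContDiff ℝ ∞ φ) {h h1 : ℝ → ℝ}
    (d1 : ∀ x, HasDerivAt h (h1 (φ x)) (φ x)) (x : E) :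
    rdz e (fun y => h (φ y)) x = h1 (φ x) * rdz e φ x := DD_comp (d1 x) (cdAt hφ)

lemma Lev_comp {ι : Type*} (e : ι → E) {φ : E → ℝ} (hφ : ContDiff ℝ ∞ φ) {h h1 h2 : ℝ → ℝ}
    (d1 : ∀ x, HasDerivAt h (h1 (φ x)) (φ x)) (d2 : ∀ x, HasDerivAt h1 (h2 (φ x)) (φ x)) (j k : ι)
    (x : E) : Lev e (fun y => h (φ y)) j k x =
      h1 (φ x) * Lev e φ j k x + h2 (φ x) * (rdz (e j) φ x * conj (rdz (e k) φ x)) := by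
  have e1 : rdz (e j) (fun y => h (φ y)) = fun x => ((h1 (φ x) : ℝ) : ℂ) * rdz (e j) φ x :=
    funext fun x => rdz_comp hφ d1 x
  have dd : DifferentiableAt ℝ (fun x => ((h1 (φ x) : ℝ) : ℂ)) x :=
    Complex.ofRealCLM.differentiableAt.comp x
      ((d2 x).differentiableAt.comp x (cdAt hφ))
  have q : DD I (e k) (fun y => (φ y : ℂ)) x = conj (rdz (e k) φ x) := dzb_real (cdAt hφ)
  rw [Lev, e1, dzb, DD_mul dd (cdAt (contDiff_rdz hφ)), DD_comp (d2 x) (cdAt hφ), q]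
  simp only [Lev, rdz]
  ring

lemma LF_comp {ι : Type*} [Fintype ι] (e : ι → E) {φ : E → ℝ} (hφ : ContDiff ℝ ∞ φ)
    {h h1 h2 : ℝ → ℝ}
    (d1 : ∀ x, HasDerivAt h (h1 (φ x)) (φ x)) (d2 : ∀ x, HasDerivAt h1 (h2 (φ x)) (φ x))
    (x : E) (ζ : ι → ℂ) : LF e (fun y => h (φ y)) x ζ =
      h1 (φ x) * LF e φ x ζ + h2 (φ x) * ‖∑ j, rdz (e j) φ x * ζ j‖ ^ 2 := by
  have e1 : ((‖∑ j, rdz (e j) φ x * ζ j‖ ^ 2 : ℝ) : ℂ) =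
      ∑ j, ∑ k, rdz (e j) φ x * ζ j * conj (rdz (e k) φ x * ζ k) := by
    rw [Complex.ofReal_pow, ← Complex.mul_conj', map_sum, Finset.sum_mul_sum]
  have e2 : ∑ j, ∑ k, Lev e (fun y => h (φ y)) j k x * ζ j * conj (ζ k) =
      h1 (φ x) * (∑ j, ∑ k, Lev e φ j k x * ζ j * conj (ζ k)) +
      h2 (φ x) * ((‖∑ j, rdz (e j) φ x * ζ j‖ ^ 2 : ℝ) : ℂ) := by
    rw [e1]
    simp only [Finset.mul_sum, ← Finset.sum_add_distrib]
    refine Finset.sum_congr rfl fun j _ => Finset.sum_congr rfl fun k _ => ?_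
    rw [Lev_comp e hφ d1 d2, map_mul]; ring
  rw [LF, e2, Complex.add_re, Complex.re_ofReal_mul, Complex.re_ofReal_mul, Complex.ofReal_re, LF]

lemma rdz_add {e : E} {Φ Ψ : E → ℝ} (h : ContDiff ℝ ∞ Φ) (h' : ContDiff ℝ ∞ Ψ) (x : E) :
    rdz e (fun y => Φ y + Ψ y) x = rdz e Φ x + rdz e Ψ x := by
  simp only [rdz, Complex.ofReal_add]
  exact DD_add (cdAt (contDiff_ofReal h)) (cdAt (contDiff_ofReal h'))

lemma LF_add {ι : Type*} [Fintype ι] (e : ι → E) {Φ Ψ : E → ℝ} (h : ContDiff ℝ ∞ Φ)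
    (h' : ContDiff ℝ ∞ Ψ) (x : E) (ζ : ι → ℂ) :
    LF e (fun y => Φ y + Ψ y) x ζ = LF e Φ x ζ + LF e Ψ x ζ := by
  have e1 : ∀ j k, Lev e (fun y => Φ y + Ψ y) j k x = Lev e Φ j k x + Lev e Ψ j k x := by
    intro j k
    have : rdz (e j) (fun y => Φ y + Ψ y) = fun x => rdz (e j) Φ x + rdz (e j) Ψ x :=
      funext fun x => rdz_add h h' x
    rw [Lev, this]
    exact DD_add (cdAt (contDiff_rdz h)) (cdAt (contDiff_rdz h'))
  simp only [LF, e1, ← Complex.add_re, ← Finset.sum_add_distrib, add_mul]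

lemma LF_pow {ι : Type*} [Fintype ι] (e : ι → E) {ψ : E → ℝ} (hψ : ContDiff ℝ ∞ ψ) (p : ℕ)
    (x : E) (ζ : ι → ℂ) (h0 : 0 ≤ ψ x) :
    (p + 2 : ℝ) * ψ x ^ (p + 1) * LF e ψ x ζ ≤ LF e (fun y => ψ y ^ (p + 2)) x ζ := by
  rw [LF_comp e hψ (h := fun t => t ^ (p + 2)) (h1 := fun t => (p + 2 : ℝ) * t ^ (p + 1))
    (h2 := fun t => (p + 2 : ℝ) * ((p + 1 : ℝ) * t ^ p))
    (fun x => by simpa using hasDerivAt_pow (p + 2) (ψ x))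
    (fun x => by simpa using (hasDerivAt_pow (p + 1) (ψ x)).const_mul (p + 2 : ℝ))]
  have : 0 ≤ (p + 2 : ℝ) * ((p + 1 : ℝ) * ψ x ^ p) * ‖∑ j, rdz (e j) ψ x * ζ j‖ ^ 2 := by positivity
  linarith
end levi

section dual
variable {E : Type*} [NormedAddCommGroup E] [NormedSpace ℂ E] [FiniteDimensional ℂ E]
  [MeasureSpace E] [BorelSpace E] [(volume : Measure E).IsAddHaarMeasure]

lemma cut2 {ι : Type*} [Fintype ι] (e : ι → E) {Φ τ A θ : E → ℝ} (h : ContDiff ℝ ∞ Φ)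
    (hτ : ContDiff ℝ ∞ τ) (hp : ∀ x, 0 < τ x) (hA : Continuous A) (hAp : ∀ x, 0 < A x)
    (hθ : Continuous θ) (hθ0 : ∀ x, 0 ≤ θ x) {V : Set E} (hVo : IsOpen V)
    (hV : ∀ x ∈ V, ∀ ζ : ι → ℂ, θ x * ∑ j, ‖ζ j‖ ^ 2 + ‖∑ j, rdz (e j) τ x * ζ j‖ ^ 2 / A x ≤
      τ x * LF e Φ x ζ - LF e τ x ζ)
    {y v : ι → E → ℂ} (hv : ∀ j, TF V (v j))
    (hy : ∀ j, MemLp (fun x => y j x * (Real.exp (-(1/2) * Φ x) : ℝ)) 2 volume)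
    (hcurl : ∀ g, TF V g → ∀ j k, ∫ x, (y k x * dzb (e j) g x - y j x * dzb (e k) g x) = 0)
    (hdiv : ∀ g, TF V g → ∫ x, (∑ j, y j x * conj (dzb (e j) g x)) * (Real.exp (-Φ x) : ℝ) =
        ∫ x, (∑ j, v j x * conj (dzb (e j) g x)) * (Real.exp (-Φ x) : ℝ))
    {η : E → ℝ} (hηs : ContDiff ℝ ∞ η) (hη : TF V (fun x => (η x : ℂ)))
    (hη0 : ∀ x, 0 ≤ η x) (hη1 : ∀ x, η x ≤ 1) {L : Set E} (hL : MeasurableSet L)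
    (hηL : ∀ x, x ∉ L → ∀ j, rdz (e j) η x = 0) {M : ℝ}
    (hM : ∀ x, (8 * (τ x + A x) + 16 * τ x) * (∑ j, ‖rdz (e j) η x‖ ^ 2) ≤ M)
    (iy : Integrable (fun x => (∑ j, ‖y j x‖ ^ 2) * Real.exp (-Φ x)) volume) :
    ∫ x, (θ x * ∑ j, ‖(η x : ℂ) * y j x‖ ^ 2) * Real.exp (-Φ x) ≤
      8 * (∫ x, ((τ x + A x) * ‖∑ j, del (e j) Φ (v j) x‖ ^ 2) * Real.exp (-Φ x)) +
      M * ∫ x in L, (∑ j, ‖y j x‖ ^ 2) * Real.exp (-Φ x) := by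
  refine (cut_ineq e h hτ hp hA hAp hθ hθ0 hVo hV hv hy hcurl hdiv hηs hη).trans ?_
  have tδ : TF V (fun x => ∑ j, del (e j) Φ (v j) x) := TF.sum fun j => TF_del h (hv j)
  have i1 : Integrable (fun x => ((τ x + A x) * ‖∑ j, del (e j) Φ (v j) x‖ ^ 2) * Real.exp (-Φ x))
      volume := by
    have c1 := tδ.1.continuous
    have c2 := hτ.continuous
    have c3 := h.continuous
    refine Continuous.integrable_of_hasCompactSupport (by fun_prop)
      (HasCompactSupport.intro tδ.2.1 fun x hx => ?_)
    rw [image_eq_zero_of_notMem_tsupport hx]; simp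
  rw [← integral_const_mul, ← integral_const_mul, ← integral_indicator hL, ← integral_const_mul,
    ← integral_add (i1.const_mul 8) ((iy.indicator hL).const_mul M)]
  refine integral_mono_of_nonneg (Eventually.of_forall fun x => ?_)
    ((i1.const_mul 8).add ((iy.indicator hL).const_mul M)) (Eventually.of_forall fun x => ?_)
  · have := hp x
    have := hAp x
    simp only [Pi.zero_apply]; positivity
  · have hE := Real.exp_pos (-Φ x)
    simp only
    have c1 := mul_le_mul_of_nonneg_right (cut_pt (hp x) (hAp x) (hη0 x) (hη1 x)
      (∑ j, del (e j) Φ (v j) x) (fun j => rdz (e j) η x) (fun j => y j x)) hE.le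
    rw [← mul_assoc]
    refine c1.trans ?_
    rw [add_mul, mul_assoc 8]
    refine add_le_add le_rfl ?_
    by_cases hx : x ∈ L
    · rw [indicator_of_mem hx, mul_assoc]
      exact mul_le_mul_of_nonneg_right (hM x) (by positivity)
    · simp [indicator_of_notMem hx, hηL x hx]
end dual

lemma sq_le_of_amgm {X P R : ℝ} (hX : 0 ≤ X) (hP : 0 ≤ P) (hR : 0 ≤ R)
    (h : ∀ t > 0, X ≤ t / 2 * P + 1 / (2 * t) * R) : X ^ 2 ≤ P * R := by
  rcases hX.eq_or_lt with h0 | h0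
  · rw [← h0]; simp; positivity
  rcases hP.eq_or_lt with h1 | h1
  · exfalso
    have := h (R / X + 1) (by positivity)
    rw [← h1, mul_zero, zero_add, one_div, inv_mul_eq_div, le_div_iff₀ (by positivity)] at this
    have e : X * (2 * (R / X + 1)) = 2 * R + 2 * X := by field_simp
    linarith
  · have := h (X / P) (by positivity)
    have e : X / P / 2 * P + 1 / (2 * (X / P)) * R = X / 2 + P * R / (2 * X) := by
      field_simp
    rw [e] at this
    have h3 : X / 2 ≤ P * R / (2 * X) := by linarith
    rw [div_le_div_iff₀ (by positivity) (by positivity)] at h3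
    nlinarith

section dual
variable {E : Type*} [NormedAddCommGroup E] [NormedSpace ℂ E]

noncomputable def cutf (V : Set E) (ψ : E → ℝ) (t : ℝ) : E → ℝ :=
  V.indicator (fun x => Real.smoothTransition (t - ψ x))

lemma cutf_zero {V : Set E} {ψ : E → ℝ} (hψ : ContDiff ℝ ∞ ψ) {t : ℝ}
    (hfr : ∀ x ∈ closure V, x ∉ V → t < ψ x) {x : E} (hx : x ∉ V ∨ t < ψ x) :
    cutf V ψ t =ᶠ[𝓝 x] fun _ => 0 := by
  have : x ∈ {x | t < ψ x} ∪ (closure V)ᶜ := by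
    by_cases h : x ∈ closure V
    · rcases hx with hx | hx
      · exact Or.inl (hfr x h hx)
      · exact Or.inl hx
    · exact Or.inr h
  have ho : IsOpen ({x | t < ψ x} ∪ (closure V)ᶜ) :=
    (isOpen_lt continuous_const hψ.continuous).union isClosed_closure.isOpen_compl
  filter_upwards [ho.mem_nhds this] with y hy
  rcases hy with hy | hy
  · by_cases h : y ∈ V
    · rw [cutf, indicator_of_mem h]; exact Real.smoothTransition.zero_of_nonpos (by simp at hy; linarith)
    · rw [cutf, indicator_of_notMem h]
  · rw [cutf, indicator_of_notMem fun h => hy (subset_closure h)]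

lemma cutf_contDiff {V : Set E} (hVo : IsOpen V) {ψ : E → ℝ} (hψ : ContDiff ℝ ∞ ψ) {t : ℝ}
    (hfr : ∀ x ∈ closure V, x ∉ V → t < ψ x) : ContDiff ℝ ∞ (cutf V ψ t) := by
  rw [contDiff_iff_contDiffAt]
  intro x
  by_cases hx : x ∈ V
  · have : ContDiff ℝ ∞ (fun x => Real.smoothTransition (t - ψ x)) :=
      Real.smoothTransition.contDiff.comp (contDiff_const.sub hψ)
    refine this.contDiffAt.congr_of_eventuallyEq ?_
    filter_upwards [hVo.mem_nhds hx] with y hy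
    rw [cutf, indicator_of_mem hy]
  · exact contDiffAt_const.congr_of_eventuallyEq (cutf_zero hψ hfr (Or.inl hx))

lemma cutf_TF {V : Set E} (hVo : IsOpen V) (hVc : IsCompact (closure V)) {ψ : E → ℝ}
    (hψ : ContDiff ℝ ∞ ψ) {t : ℝ} (hfr : ∀ x ∈ closure V, x ∉ V → t < ψ x) :
    TF V (fun x => (cutf V ψ t x : ℂ)) := by
  have hsub : tsupport (fun x => (cutf V ψ t x : ℂ)) ⊆ V := by
    intro x hx
    by_contra h
    have h0 := cutf_zero hψ hfr (Or.inl h)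
    refine (notMem_tsupport_iff_eventuallyEq.2 ?_) hx
    filter_upwards [h0] with y hy
    simp [hy]
  refine ⟨contDiff_ofReal (cutf_contDiff hVo hψ hfr), ?_, hsub⟩
  exact hVc.of_isClosed_subset (isClosed_tsupport _) (hsub.trans subset_closure)

lemma cutf_one {V : Set E} {ψ : E → ℝ} {t : ℝ} {x : E} (hx : x ∈ V) (h : ψ x ≤ t - 1) :
    cutf V ψ t x = 1 := by
  rw [cutf, indicator_of_mem hx]; exact Real.smoothTransition.one_of_one_le (by linarith)

lemma cutf_nonneg {V : Set E} {ψ : E → ℝ} {t : ℝ} (x : E) : 0 ≤ cutf V ψ t x :=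
  indicator_nonneg (fun _ _ => Real.smoothTransition.nonneg _) _

lemma cutf_le_one {V : Set E} {ψ : E → ℝ} {t : ℝ} (x : E) : cutf V ψ t x ≤ 1 :=
  indicator_le' (fun _ _ => Real.smoothTransition.le_one _) (fun _ _ => zero_le_one) _

lemma cutf_rdz {V : Set E} (hVo : IsOpen V) {ψ : E → ℝ} (hψ : ContDiff ℝ ∞ ψ) {t : ℝ}
    (hfr : ∀ x ∈ closure V, x ∉ V → t < ψ x) {x : E}
    (hx : x ∉ {x | x ∈ V ∧ t - 1 ≤ ψ x ∧ ψ x ≤ t}) (e : E) : rdz e (cutf V ψ t) x = 0 := by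
  have cst : ∀ a : ℝ, (cutf V ψ t =ᶠ[𝓝 x] fun _ => a) → rdz e (cutf V ψ t) x = 0 := by
    intro a ha
    have : (fun y => ((cutf V ψ t y : ℝ) : ℂ)) =ᶠ[𝓝 x] fun _ => (a : ℂ) := by
      filter_upwards [ha] with y hy; rw [hy]
    exact (DD_congr this).trans DD_const
  by_cases h : x ∉ V ∨ t < ψ x
  · exact cst 0 (cutf_zero hψ hfr h)
  · push Not at h
    refine cst 1 ?_
    have h1 : ψ x < t - 1 := by
      by_contra h2
      exact hx ⟨h.1, by linarith, h.2⟩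
    filter_upwards [hVo.mem_nhds h.1, (isOpen_lt hψ.continuous continuous_const).mem_nhds h1] with y hy hy2
    exact cutf_one hy (le_of_lt hy2)
end dual

section dual
variable {E : Type*} [NormedAddCommGroup E] [NormedSpace ℂ E] [FiniteDimensional ℂ E]
  [MeasureSpace E] [BorelSpace E] [(volume : Measure E).IsAddHaarMeasure]

lemma del_conj_exp {e : E} {Φ : E → ℝ} (h : ContDiff ℝ ∞ Φ) {V : Set E} {w : E → ℂ} (hw : TF V w)
    (x : E) : del e Φ (fun y => conj (w y) * (Real.exp (Φ y) : ℝ)) x =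
      conj (dzb e w x) * (Real.exp (Φ x) : ℝ) := by
  have h1 : ContDiff ℝ ∞ (fun y => ((Real.exp (Φ y) : ℝ) : ℂ)) := by
    simpa using contDiff_half h 1
  rw [del, dz, DD_mul hw.conj.differentiableAt (cdAt h1), DD_comp (Real.hasDerivAt_exp _) (cdAt h)]
  have := dz_conj (e := e) (hw.differentiableAt (x := x))
  rw [dz] at this
  rw [this, rdz, dz]; ring

lemma exists_bd {f : E → ℝ} (hf : Continuous f) (hc : HasCompactSupport f) : ∃ M, 0 ≤ M ∧ ∀ x, f x ≤ M := by
  obtain ⟨C, hC⟩ := hc.exists_bound_of_continuous hf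
  exact ⟨max C 0, le_max_right _ _, fun x => (le_abs_self _).trans ((hC x).trans (le_max_left _ _))⟩

lemma TF.cint {V : Set E} {g : E → ℂ} (hg : TF V g) {a : E → ℝ} (ha : Continuous a) :
    Integrable (fun x => a x * ‖g x‖ ^ 2) volume := by
  have c1 := hg.1.continuous
  refine Continuous.integrable_of_hasCompactSupport (by fun_prop)
      (HasCompactSupport.intro hg.2.1 fun x hx => ?_)
  rw [image_eq_zero_of_notMem_tsupport hx]; simp

lemma dual_p {ι : Type*} [Fintype ι] [DecidableEq ι] (e : ι → E) {Φ0 τ A θ ψ : E → ℝ} (h : ContDiff ℝ ∞ Φ0)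
    (hτ : ContDiff ℝ ∞ τ) (hp : ∀ x, 1 ≤ τ x) (hA : Continuous A) (hAp : ∀ x, 0 < A x)
    (hθ : Continuous θ) (hθ0 : ∀ x, 0 ≤ θ x) {V : Set E} (hVo : IsOpen V) (hVc : IsCompact (closure V))
    (hψ : ContDiff ℝ ∞ ψ) (hψ0 : ∀ x, 0 ≤ ψ x) (hfr : ∀ x ∈ closure V, x ∉ V → 3 < ψ x)
    {c : ℝ} (hc : 0 < c) (hLψ : ∀ x ∈ V, ∀ ζ : ι → ℂ, c * ∑ j, ‖ζ j‖ ^ 2 ≤ LF e ψ x ζ)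
    (hLΦ : ∀ x ∈ V, ∀ ζ : ι → ℂ, 0 ≤ LF e Φ0 x ζ)
    (hV : ∀ x ∈ V, ∀ ζ : ι → ℂ, θ x * ∑ j, ‖ζ j‖ ^ 2 + ‖∑ j, rdz (e j) τ x * ζ j‖ ^ 2 / A x ≤
      - LF e τ x ζ)
    {χ : E → ℂ} (hχ : TF (V ∩ {x | ψ x < 1}) χ) {θ0 : ℝ} (ht0 : 0 < θ0)
    (hχθ : ∀ x ∈ tsupport χ, θ0 ≤ θ x)
    {w : ι → E → ℂ} (hw : ∀ j, TF (V ∩ {x | ψ x < 1}) (w j)) {M1 M2 : ℝ} (hM10 : 0 ≤ M1) (hM20 : 0 ≤ M2)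
    (hM1 : ∀ x, (8 * (τ x + A x) + 16 * τ x) * (∑ j, ‖rdz (e j) (cutf V ψ 2) x‖ ^ 2) ≤ M1)
    (hM2 : ∀ x, (8 * (τ x + A x) + 16 * τ x) * (∑ j, ‖rdz (e j) (cutf V ψ 3) x‖ ^ 2) ≤ M2)
    (p : ℕ) :
    ‖∫ x, ∑ j, dzb (e j) χ x * w j x‖ ^ 2 ≤ (∫ x, (∑ j, ‖dzb (e j) χ x‖ ^ 2) * Real.exp (-Φ0 x)) *
      ((1 / θ0) * (8 * (Real.exp 1 * ∫ x, ((τ x + A x) * ‖∑ j, dzb (e j) (w j) x‖ ^ 2) * Real.exp (Φ0 x)) +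
       M1 * ((8 * (Real.exp 1 * ∫ x, ((τ x + A x) * ‖∑ j, dzb (e j) (w j) x‖ ^ 2) * Real.exp (Φ0 x)) +
         M2 * (Real.exp 1 * ∫ x, (∑ j, ‖w j x‖ ^ 2) * Real.exp (Φ0 x))) / (c * (p + 2))))) := by
  have cτ := hτ.continuous
  have cΦ0 := h.continuous
  have cψ := hψ.continuous
  have hτp : ∀ x, 0 < τ x := fun x => lt_of_lt_of_le one_pos (hp x)
  set Φ : E → ℝ := fun x => Φ0 x + ψ x ^ (p + 2) with hΦdef
  have hΦ : ContDiff ℝ ∞ Φ := h.add (hψ.pow _)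
  have cΦ := hΦ.continuous
  have hEs : ContDiff ℝ ∞ (fun y => ((Real.exp (Φ y) : ℝ) : ℂ)) := by
    simpa using contDiff_half hΦ 1
  set v : ι → E → ℂ := fun j y => conj (w j y) * (Real.exp (Φ y) : ℝ) with hvdef
  have hv : ∀ j, TF V (v j) := fun j => ((hw j).conj.mul_right hEs).mono inter_subset_left
  obtain ⟨y, hy, hcurl, hle, hdiv⟩ := proj_exists e hΦ hv
  have iy1 : ∀ j, Integrable (fun x => ‖y j x‖ ^ 2 * Real.exp (-Φ x)) volume := by
    intro j
    refine (memLp_sq (hy j)).congr (Eventually.of_forall fun x => ?_)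
    simp only [norm_mul, mul_pow, Complex.norm_real, Real.norm_eq_abs, Real.abs_exp]
    rw [← Real.exp_nat_mul]; congr 2; push_cast; ring
  have iy : Integrable (fun x => (∑ j, ‖y j x‖ ^ 2) * Real.exp (-Φ x)) volume := by
    simp_rw [Finset.sum_mul]
    exact integrable_finset_sum _ fun j _ => iy1 j
  -- weights on support of w
  have hexp : ∀ x, ψ x < 1 → Real.exp (Φ x) ≤ Real.exp 1 * Real.exp (Φ0 x) := by
    intro x hx
    rw [← Real.exp_add]
    apply Real.exp_le_exp.2
    have := pow_le_one₀ (n := p + 2) (hψ0 x) hx.le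
    simp only [hΦdef]; linarith
  have hexp2 : ∀ x, Real.exp (-Φ x) ≤ Real.exp (-Φ0 x) := by
    intro x
    apply Real.exp_le_exp.2
    have := pow_nonneg (hψ0 x) (p + 2)
    simp only [hΦdef]; linarith
  have tB : TF (V ∩ {x | ψ x < 1}) (fun x => ∑ j, dzb (e j) (w j) x) := TF.sum fun j => (hw j).DD _ _
  set B0 := ∫ x, ((τ x + A x) * ‖∑ j, dzb (e j) (w j) x‖ ^ 2) * Real.exp (Φ0 x) with hB0
  set N0 := ∫ x, (∑ j, ‖w j x‖ ^ 2) * Real.exp (Φ0 x) with hN0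
  have hB : ∫ x, ((τ x + A x) * ‖∑ j, del (e j) Φ (v j) x‖ ^ 2) * Real.exp (-Φ x) ≤ Real.exp 1 * B0 := by
    rw [hB0, ← integral_const_mul]
    refine integral_mono_of_nonneg (Eventually.of_forall fun x => ?_) ?_ (Eventually.of_forall fun x => ?_)
    · have := hτp x
      have := hAp x
      simp only [Pi.zero_apply]; positivity
    · refine ((tB.cint (a := fun x => (τ x + A x) * Real.exp (Φ0 x)) (by fun_prop)).const_mul (Real.exp 1)).congr
        (Eventually.of_forall fun x => ?_)
      simp only; ring
    · simp only
      have e1 : ∑ j, del (e j) Φ (v j) x = conj (∑ j, dzb (e j) (w j) x) * (Real.exp (Φ x) : ℝ) := by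
        rw [map_sum, Finset.sum_mul]
        exact Finset.sum_congr rfl fun j _ => del_conj_exp hΦ (hw j) x
      have e2 : ((τ x + A x) * ‖∑ j, del (e j) Φ (v j) x‖ ^ 2) * Real.exp (-Φ x) =
          (τ x + A x) * ‖∑ j, dzb (e j) (w j) x‖ ^ 2 * Real.exp (Φ x) := by
        rw [e1, norm_mul, RCLike.norm_conj, Complex.norm_real, Real.norm_eq_abs, Real.abs_exp, Real.exp_neg]
        have := Real.exp_pos (Φ x)
        field_simp
      rw [e2]
      by_cases hx : x ∈ tsupport (fun x => ∑ j, dzb (e j) (w j) x)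
      · have := mul_le_mul_of_nonneg_left (hexp x (tB.2.2 hx).2)
          (show 0 ≤ (τ x + A x) * ‖∑ j, dzb (e j) (w j) x‖ ^ 2 from
            mul_nonneg (add_pos (hτp x) (hAp x)).le (sq_nonneg _))
        linarith
      · have := image_eq_zero_of_notMem_tsupport hx
        rw [this]; simp
  have hN : ∫ x, (∑ j, ‖y j x‖ ^ 2) * Real.exp (-Φ x) ≤ Real.exp 1 * N0 := by
    refine hle.trans ?_
    rw [hN0, ← integral_const_mul]
    refine integral_mono_of_nonneg (Eventually.of_forall fun x => ?_) ?_ (Eventually.of_forall fun x => ?_)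
    · simp only [Pi.zero_apply]; positivity
    · refine Integrable.const_mul ?_ _
      simp only [Finset.sum_mul]
      refine integrable_finset_sum _ fun j _ => ?_
      refine ((hw j).cint (a := fun x => Real.exp (Φ0 x)) (by fun_prop)).congr
        (Eventually.of_forall fun x => ?_)
      simp only; ring
    · simp only
      have : (∑ j, ‖v j x‖ ^ 2) * Real.exp (-Φ x) = ∑ j, ‖w j x‖ ^ 2 * Real.exp (Φ x) := by
        rw [Finset.sum_mul]
        refine Finset.sum_congr rfl fun j _ => ?_
        rw [hvdef]
        simp only [norm_mul, RCLike.norm_conj, Complex.norm_real, Real.norm_eq_abs, Real.abs_exp, Real.exp_neg]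
        have := Real.exp_pos (Φ x)
        field_simp
      rw [this, mul_left_comm, Finset.sum_mul]
      refine Finset.sum_le_sum fun j _ => ?_
      by_cases hx : x ∈ tsupport (w j)
      · exact mul_le_mul_of_nonneg_left (hexp x ((hw j).2.2 hx).2) (sq_nonneg _)
      · rw [image_eq_zero_of_notMem_tsupport hx]; simp
  -- Levi form of Φ
  have hLF : ∀ x ∈ V, ∀ ζ : ι → ℂ, (c * (p + 2) * ψ x ^ (p + 1)) * ∑ j, ‖ζ j‖ ^ 2 ≤ LF e Φ x ζ := by
    intro x hx ζ
    rw [hΦdef, LF_add e h (hψ.pow _)]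
    have h1 := hLΦ x hx ζ
    have h2 := LF_pow e hψ p x ζ (hψ0 x)
    have h3 := mul_le_mul_of_nonneg_left (hLψ x hx ζ)
      (show 0 ≤ (p + 2 : ℝ) * ψ x ^ (p + 1) from mul_nonneg (by positivity) (pow_nonneg (hψ0 x) _))
    nlinarith
  have hcp : 0 < c * (p + 2) := by positivity
  have hS : ∀ ζ : ι → ℂ, 0 ≤ ∑ j, ‖ζ j‖ ^ 2 := fun ζ => by positivity
  have hfr2 : ∀ x ∈ closure V, x ∉ V → 2 < ψ x := fun x h1 h2 => by linarith [hfr x h1 h2]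
  set L1 : Set E := {x | x ∈ V ∧ 2 - 1 ≤ ψ x ∧ ψ x ≤ 2} with hL1
  set L2 : Set E := {x | x ∈ V ∧ 3 - 1 ≤ ψ x ∧ ψ x ≤ 3} with hL2
  have mL : ∀ a b : ℝ, MeasurableSet {x | x ∈ V ∧ a ≤ ψ x ∧ ψ x ≤ b} := fun a b =>
    hVo.measurableSet.inter ((measurableSet_le measurable_const cψ.measurable).inter
      (measurableSet_le cψ.measurable measurable_const))
  -- integrability of cut quantities
  have icut : ∀ (a : E → ℝ) (t : ℝ), Continuous a → (∀ x ∈ closure V, x ∉ V → t < ψ x) →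
      Integrable (fun x => (a x * ∑ j, ‖(cutf V ψ t x : ℂ) * y j x‖ ^ 2) * Real.exp (-Φ x)) volume := by
    intro a t ha ht
    have ct := (cutf_contDiff hVo hψ ht).continuous
    have := intK (a := fun x => a x * Real.exp (-Φ x)) (g := fun x => ∑ j, ‖(cutf V ψ t x : ℂ) * y j x‖ ^ 2)
      hVc (integrable_finset_sum _ fun j _ => memLp_sq (memLp_mulTF hΦ (hy j)
        (cutf_TF hVo hVc hψ ht).1.continuous (cutf_TF hVo hVc hψ ht).2.1))
      (fun x hx => by simp [cutf, indicator_of_notMem fun h => hx (subset_closure h)]) (by fun_prop)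
    refine this.congr (Eventually.of_forall fun x => ?_)
    simp only; ring
  -- step 1
  have s1 := cut2 e hΦ hτ hτp hA hAp (θ := fun x => θ x + c * (p + 2) * ψ x ^ (p + 1)) (by fun_prop)
    (fun x => add_nonneg (hθ0 x) (mul_nonneg hcp.le (pow_nonneg (hψ0 x) _))) hVo
    (fun x hx ζ => by
      have h1 := hLF x hx ζ
      have h2 := hV x hx ζ
      have h4 : 0 ≤ LF e Φ x ζ := (mul_nonneg (mul_nonneg hcp.le (pow_nonneg (hψ0 x) _)) (hS ζ)).trans h1
      have h3 := mul_le_mul_of_nonneg_right (hp x) h4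
      nlinarith) hv hy hcurl hdiv (cutf_contDiff hVo hψ hfr) (cutf_TF hVo hVc hψ hfr) cutf_nonneg
    cutf_le_one (mL _ _) (fun x hx j => cutf_rdz hVo hψ hfr hx _) hM2 iy
  have hlow : c * (p + 2) * ∫ x in L1, (∑ j, ‖y j x‖ ^ 2) * Real.exp (-Φ x) ≤
      8 * (Real.exp 1 * B0) + M2 * (Real.exp 1 * N0) := by
    have : ∫ x in {x | x ∈ V ∧ (3:ℝ) - 1 ≤ ψ x ∧ ψ x ≤ 3}, (∑ j, ‖y j x‖ ^ 2) * Real.exp (-Φ x) ≤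
        ∫ x, (∑ j, ‖y j x‖ ^ 2) * Real.exp (-Φ x) :=
      setIntegral_le_integral iy (Eventually.of_forall fun x => by simp only [Pi.zero_apply]; positivity)
    have h2 := mul_le_mul_of_nonneg_left (this.trans hN) hM20
    refine le_trans ?_ (s1.trans (add_le_add (mul_le_mul_of_nonneg_left hB (by norm_num)) h2))
    rw [← integral_const_mul, ← integral_indicator (mL _ _)]
    refine integral_mono ((iy.const_mul _).indicator (mL _ _)) (icut _ 3 (by fun_prop) hfr) fun x => ?_
    simp only
    by_cases hx : x ∈ L1
    · rw [indicator_of_mem hx, cutf_one hx.1 (by linarith [hx.2.2]), ← mul_assoc]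
      refine mul_le_mul_of_nonneg_right ?_ (Real.exp_pos _).le
      have : 1 ≤ ψ x ^ (p + 1) := one_le_pow₀ (by linarith [hx.2.1])
      simp only [ofReal_one, one_mul]
      refine mul_le_mul_of_nonneg_right ?_ (by positivity)
      nlinarith [hθ0 x]
    · rw [indicator_of_notMem hx]
      have := hθ0 x
      have := hψ0 x
      positivity
  have s2 := cut2 e hΦ hτ hτp hA hAp hθ hθ0 hVo
    (fun x hx ζ => by
      have h1 := hLF x hx ζ
      have h2 := hV x hx ζ
      have h4 : 0 ≤ LF e Φ x ζ := (mul_nonneg (mul_nonneg hcp.le (pow_nonneg (hψ0 x) _)) (hS ζ)).trans h1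
      have h3 := mul_nonneg (hτp x).le h4
      linarith) hv hy hcurl hdiv (cutf_contDiff hVo hψ hfr2) (cutf_TF hVo hVc hψ hfr2) cutf_nonneg
    cutf_le_one (mL _ _) (fun x hx j => cutf_rdz hVo hψ hfr2 hx _) hM1 iy
  have s3 : ∫ x, (θ x * ∑ j, ‖(cutf V ψ 2 x : ℂ) * y j x‖ ^ 2) * Real.exp (-Φ x) ≤
      8 * (Real.exp 1 * B0) + M1 * ((8 * (Real.exp 1 * B0) + M2 * (Real.exp 1 * N0)) / (c * (p + 2))) := by
    refine s2.trans (add_le_add (mul_le_mul_of_nonneg_left hB (by norm_num))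
      (mul_le_mul_of_nonneg_left ?_ hM10))
    rw [le_div_iff₀ hcp]; linarith
  have hR0 : 0 ≤ ∫ x, (θ x * ∑ j, ‖(cutf V ψ 2 x : ℂ) * y j x‖ ^ 2) * Real.exp (-Φ x) :=
    integral_nonneg fun x => by have := hθ0 x; simp only [Pi.zero_apply]; positivity
  have hP0 : 0 ≤ ∫ x, (∑ j, ‖dzb (e j) χ x‖ ^ 2) * Real.exp (-Φ0 x) :=
    integral_nonneg fun x => by simp only [Pi.zero_apply]; positivity
  refine le_trans ?_ (mul_le_mul_of_nonneg_left (mul_le_mul_of_nonneg_left s3 (by positivity)) hP0)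
  refine sq_le_of_amgm (norm_nonneg _) hP0 (mul_nonneg (by positivity) hR0) fun t ht => ?_
  have hd := hdiv χ (hχ.mono inter_subset_left)
  have e3 : ‖∫ x, ∑ j, dzb (e j) χ x * w j x‖ =
      ‖∫ x, (∑ j, y j x * conj (dzb (e j) χ x)) * (Real.exp (-Φ x) : ℝ)‖ := by
    rw [hd, ← RCLike.norm_conj (∫ x, ∑ j, dzb (e j) χ x * w j x), ← integral_conj]
    congr 2
    ext x
    rw [map_sum, Finset.sum_mul]
    refine Finset.sum_congr rfl fun j _ => ?_
    rw [hvdef]; simp only [map_mul]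
    have : ((Real.exp (Φ x) : ℝ) : ℂ) * (Real.exp (-Φ x) : ℝ) = 1 := by
      rw [← ofReal_mul, ← Real.exp_add]; simp
    linear_combination (-(conj (w j x) * conj (dzb (e j) χ x))) * this
  rw [e3]
  refine (norm_integral_le_integral_norm _).trans ?_
  have iχ : Integrable (fun x => (∑ j, ‖dzb (e j) χ x‖ ^ 2) * Real.exp (-Φ0 x)) volume := by
    simp_rw [Finset.sum_mul]
    refine integrable_finset_sum _ fun j _ => ?_
    refine ((hχ.DD I (e j)).cint (a := fun x => Real.exp (-Φ0 x)) (by fun_prop)).congr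
      (Eventually.of_forall fun x => ?_)
    simp only [dzb]; ring
  have ic := icut θ 2 hθ hfr2
  rw [← mul_assoc, ← integral_const_mul, ← integral_const_mul,
    ← integral_add (iχ.const_mul _) (ic.const_mul _)]
  refine integral_mono_of_nonneg (Eventually.of_forall fun x => norm_nonneg _)
    ((iχ.const_mul _).add (ic.const_mul _)) (Eventually.of_forall fun x => ?_)
  simp only
  have hE0 := Real.exp_pos (-Φ x)
  by_cases hx : x ∈ tsupport χ
  · have hxV := hχ.2.2 hx
    have hη : cutf V ψ 2 x = 1 := cutf_one hxV.1 (by have : ψ x < 1 := hxV.2; linarith)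
    rw [hη, norm_mul, Complex.norm_real, Real.norm_eq_abs, Real.abs_exp]
    simp only [ofReal_one, one_mul]
    set Y := ∑ j, ‖y j x‖ ^ 2 with hY
    set X := ∑ j, ‖dzb (e j) χ x‖ ^ 2 with hX
    have hY0 : 0 ≤ Y := by positivity
    have hX0 : 0 ≤ X := by positivity
    have cs := norm_sum_mul_sq_le (fun j => y j x) (fun j => conj (dzb (e j) χ x))
    simp only [RCLike.norm_conj] at cs
    rw [← hY, ← hX] at cs
    have k1 : ‖∑ j, y j x * conj (dzb (e j) χ x)‖ ≤ t / 2 * X + 1 / (2 * t) * Y := by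
      refine abs_le_of_sq_le_sq' (cs.trans ?_) (by positivity) |>.2
      have : (t / 2 * X + 1 / (2 * t) * Y) ^ 2 - Y * X = (t / 2 * X - 1 / (2 * t) * Y) ^ 2 := by
        field_simp; ring
      nlinarith [sq_nonneg (t / 2 * X - 1 / (2 * t) * Y)]
    have k2 : Y ≤ 1 / θ0 * (θ x * Y) := by
      rw [one_div, inv_mul_eq_div, le_div_iff₀ ht0, mul_comm]
      exact mul_le_mul_of_nonneg_right (hχθ x hx) hY0
    calc _ ≤ (t / 2 * X + 1 / (2 * t) * Y) * Real.exp (-Φ x) := mul_le_mul_of_nonneg_right k1 hE0.le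
      _ = t / 2 * (X * Real.exp (-Φ x)) + 1 / (2 * t) * (Y * Real.exp (-Φ x)) := by ring
      _ ≤ t / 2 * (X * Real.exp (-Φ0 x)) + 1 / (2 * t) * ((1 / θ0 * (θ x * Y)) * Real.exp (-Φ x)) := by
        have := hexp2 x
        gcongr
      _ = _ := by ring
  · have : ∀ j, dzb (e j) χ x = 0 := fun j => DD_eq_zero_of_notMem hx
    simp only [this]
    have := hθ0 x
    simp
    positivity

lemma dual {ι : Type*} [Fintype ι] [DecidableEq ι] (e : ι → E) {Φ0 τ A θ ψ : E → ℝ} (h : ContDiff ℝ ∞ Φ0)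
    (hτ : ContDiff ℝ ∞ τ) (hp : ∀ x, 1 ≤ τ x) (hA : Continuous A) (hAp : ∀ x, 0 < A x)
    (hθ : Continuous θ) (hθ0 : ∀ x, 0 ≤ θ x) {V : Set E} (hVo : IsOpen V) (hVc : IsCompact (closure V))
    (hψ : ContDiff ℝ ∞ ψ) (hψ0 : ∀ x, 0 ≤ ψ x) (hfr : ∀ x ∈ closure V, x ∉ V → 3 < ψ x)
    {c : ℝ} (hc : 0 < c) (hLψ : ∀ x ∈ V, ∀ ζ : ι → ℂ, c * ∑ j, ‖ζ j‖ ^ 2 ≤ LF e ψ x ζ)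
    (hLΦ : ∀ x ∈ V, ∀ ζ : ι → ℂ, 0 ≤ LF e Φ0 x ζ)
    (hV : ∀ x ∈ V, ∀ ζ : ι → ℂ, θ x * ∑ j, ‖ζ j‖ ^ 2 + ‖∑ j, rdz (e j) τ x * ζ j‖ ^ 2 / A x ≤
      - LF e τ x ζ)
    {χ : E → ℂ} (hχ : TF (V ∩ {x | ψ x < 1}) χ) {θ0 : ℝ} (ht0 : 0 < θ0)
    (hχθ : ∀ x ∈ tsupport χ, θ0 ≤ θ x)
    {w : ι → E → ℂ} (hw : ∀ j, TF (V ∩ {x | ψ x < 1}) (w j)) :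
    ‖∫ x, ∑ j, dzb (e j) χ x * w j x‖ ^ 2 ≤ (24 / θ0 * ∫ x, (∑ j, ‖dzb (e j) χ x‖ ^ 2) * Real.exp (-Φ0 x)) *
       ∫ x, ((τ x + A x) * ‖∑ j, dzb (e j) (w j) x‖ ^ 2) * Real.exp (Φ0 x) := by
  have bd : ∀ t, (∀ x ∈ closure V, x ∉ V → t < ψ x) → ∃ M, 0 ≤ M ∧
      ∀ x, (8 * (τ x + A x) + 16 * τ x) * (∑ j, ‖rdz (e j) (cutf V ψ t) x‖ ^ 2) ≤ M := by
    intro t ht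
    have c1 := hτ.continuous
    have c2 : ∀ j, Continuous (rdz (e j) (cutf V ψ t)) := fun j =>
      (contDiff_rdz (cutf_contDiff hVo hψ ht)).continuous
    refine exists_bd (by fun_prop) (HasCompactSupport.intro hVc fun x hx => ?_)
    have : ∀ j, rdz (e j) (cutf V ψ t) x = 0 := fun j =>
      cutf_rdz hVo hψ ht (fun h => hx (subset_closure h.1)) _
    simp [this]
  obtain ⟨M2, hM20, hM2⟩ := bd 3 hfr
  obtain ⟨M1, hM10, hM1⟩ := bd 2 fun x h1 h2 => by linarith [hfr x h1 h2]
  have key := dual_p e h hτ hp hA hAp hθ hθ0 hVo hVc hψ hψ0 hfr hc hLψ hLΦ hV hχ ht0 hχθ hw hM10 hM20 hM1 hM2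
  set P := ∫ x, (∑ j, ‖dzb (e j) χ x‖ ^ 2) * Real.exp (-Φ0 x)
  set B0 := ∫ x, ((τ x + A x) * ‖∑ j, dzb (e j) (w j) x‖ ^ 2) * Real.exp (Φ0 x) with hB0
  have hP : 0 ≤ P := integral_nonneg fun x => by simp only [Pi.zero_apply]; positivity
  have hB : 0 ≤ B0 := integral_nonneg fun x => by
    have := hp x; have := hAp x; have : 0 < τ x := by linarith
    simp only [Pi.zero_apply]; positivity
  have lim : ∀ K : ℝ, Tendsto (fun p : ℕ => K / (c * (p + 2 : ℝ))) atTop (𝓝 0) := fun K =>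
    Tendsto.div_atTop tendsto_const_nhds (Tendsto.const_mul_atTop hc
      (tendsto_atTop_add_const_right _ _ tendsto_natCast_atTop_atTop))
  have l2 := ge_of_tendsto' ((((lim _).const_mul M1).const_add _).const_mul (1 / θ0) |>.const_mul P) key
  refine l2.trans ?_
  rw [mul_zero, add_zero]
  have : Real.exp 1 ≤ 3 := by linarith [Real.exp_one_lt_d9]
  have e1 : 24 / θ0 * P * B0 = P * (1 / θ0 * (8 * (3 * B0))) := by ring
  rw [e1]; gcongr
end dual

section weyl
variable {E : Type*} [NormedAddCommGroup E] [NormedSpace ℂ E] [FiniteDimensional ℂ E]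
  [MeasureSpace E] [BorelSpace E] [(volume : Measure E).IsAddHaarMeasure]

lemma mp_circ (c : ℂ) (hc : ‖c‖ = 1) : MeasurePreserving (fun x : E => c • x) volume volume := by
  have hc0 : c ≠ 0 := by rintro rfl; simp at hc
  have : ProperSpace E := FiniteDimensional.proper ℂ E
  let L : E ≃L[ℂ] E := ContinuousLinearEquiv.smulLeft (Units.mk0 c hc0)
  have hL : (L : E → E) = fun x => c • x := rfl
  have hm : Measurable (fun x : E => c • x) := by fun_prop
  refine ⟨hm, ?_⟩
  have i1 : (Measure.map L (volume : Measure E)).IsAddHaarMeasure := L.isAddHaarMeasure_map volume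
  rw [hL] at i1
  have h1 := Measure.isAddLeftInvariant_eq_smul (Measure.map (fun x : E => c • x) volume) (volume : Measure E)
  set k := Measure.addHaarScalarFactor (Measure.map (fun x : E => c • x) volume) (volume : Measure E)
  have h2 := congrArg (fun μ => μ (closedBall (0 : E) 1)) h1
  have e : (fun x : E => c • x) ⁻¹' closedBall 0 1 = closedBall 0 1 := by
    ext x; simp [norm_smul, hc]
  have e' := Measure.map_apply (μ := (volume : Measure E)) hm (measurableSet_closedBall (x := (0 : E)) (ε := 1))
  rw [e] at e'
  replace h2 := e'.symm.trans h2
  have h3 : (volume (closedBall (0 : E) 1)) ≠ 0 := (measure_closedBall_pos _ _ one_pos).ne'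
  have h4 : (volume (closedBall (0 : E) 1)) ≠ ⊤ := (measure_closedBall_lt_top).ne
  have h5 : k = 1 := by
    have h6 : (k : ℝ≥0∞) * volume (closedBall (0 : E) 1) = 1 * volume (closedBall (0 : E) 1) := by
      rw [one_mul]; exact h2.symm
    exact_mod_cast (ENNReal.mul_left_inj h3 h4).1 h6
  rw [h1, h5, one_smul]

lemma circ_fubini {F : Type*} [NormedAddCommGroup F] [NormedSpace ℝ F] [CompleteSpace F] {g : E → F}
    (hg : Integrable g volume) :
    Integrable (fun t => ∫ θ in (0:ℝ)..(2 * Real.pi), g (Complex.exp (θ * I) • t)) volume ∧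
    ∫ t, ∫ θ in (0:ℝ)..(2 * Real.pi), g (Complex.exp (θ * I) • t) = (2 * Real.pi) • ∫ t, g t := by
  have hpi : (0:ℝ) ≤ 2 * Real.pi := by positivity
  simp_rw [intervalIntegral.integral_of_le hpi]
  set ν := (volume : Measure ℝ).restrict (Ioc 0 (2 * Real.pi)) with hν
  have hmeas : Measurable (fun p : ℝ × E => Complex.exp (p.1 * I) • p.2) := by
    have : Continuous (fun p : ℝ × E => Complex.exp (p.1 * I) • p.2) := by fun_prop
    exact this.measurable
  have mp : MeasurePreserving (fun p : ℝ × E => (p.1, Complex.exp (p.1 * I) • p.2))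
      (ν.prod volume) (ν.prod volume) := by
    refine MeasurePreserving.skew_product (g := fun (θ : ℝ) (t : E) => Complex.exp (θ * I) • t)
      (MeasurePreserving.id ν) hmeas ?_
    exact Eventually.of_forall fun θ => (mp_circ _ (Complex.norm_exp_ofReal_mul_I θ)).map_eq
  have i0 : Integrable (fun p : ℝ × E => g p.2) (ν.prod volume) := hg.comp_snd ν
  have i1 : Integrable (fun p : ℝ × E => g (Complex.exp (p.1 * I) • p.2)) (ν.prod volume) :=
    mp.integrable_comp_of_integrable i0
  have e1 : ∀ θ : ℝ, ∫ t, g (Complex.exp (θ * I) • t) = ∫ t, g t := by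
    intro θ
    have hc : Complex.exp (θ * I) ≠ 0 := Complex.exp_ne_zero _
    exact (mp_circ _ (Complex.norm_exp_ofReal_mul_I θ)).integral_comp
      (Homeomorph.smulOfNeZero _ hc).measurableEmbedding g
  refine ⟨i1.integral_prod_right, ?_⟩
  rw [integral_integral_swap (f := fun (t : E) (θ : ℝ) => g (Complex.exp (θ * I) • t)) i1.swap]
  simp_rw [e1]
  rw [integral_const]
  congr 1
  simp [hν, Measure.real, Real.pi_pos.le]

lemma mol_submean {r : ℝ} {ρ : E → ℝ} (h : Moll r ρ) {φ : E → ℝ} {x : E}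
    (hi : Integrable (fun t => ρ t * φ (x - t)) volume)
    (hs : ∀ t, ‖t‖ ≤ r → φ x ≤ (2 * Real.pi)⁻¹ * ∫ θ in (0:ℝ)..(2 * Real.pi), φ (x - Complex.exp (θ * I) • t)) :
    φ x ≤ mol ρ φ x := by
  have hpi : 0 < 2 * Real.pi := by positivity
  obtain ⟨h1, h2⟩ := circ_fubini hi
  have e0 : ∀ θ : ℝ, ∀ t, ρ (Complex.exp (θ * I) • t) = ρ t := fun θ t =>
    h.circ _ _ (Complex.norm_exp_ofReal_mul_I θ)
  simp only [e0, intervalIntegral.integral_const_mul] at h1 h2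
  have e2 : mol ρ φ x = (2 * Real.pi)⁻¹ * ∫ t, ρ t * ∫ θ in (0:ℝ)..(2 * Real.pi), φ (x - Complex.exp (θ * I) • t) := by
    rw [h2, mol_eq']; simp only [smul_eq_mul]; field_simp
  have e3 : φ x = ∫ t, ρ t * φ x := by rw [integral_mul_const, h.int, one_mul]
  rw [e2, ← integral_const_mul]
  refine e3.le.trans ?_
  refine integral_mono (h.integrable.mul_const _) (h1.const_mul _) fun t => ?_
  simp only
  by_cases ht : ‖t‖ ≤ r
  · have := mul_le_mul_of_nonneg_left (hs t ht) (h.nonneg t)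
    linarith
  · rw [h.supp t (by linarith)]; simp

lemma mol_integrand {r : ℝ} {ρ : E → ℝ} (h : Moll r ρ) {u : E → ℂ} {x : E}
    (hu : ContinuousOn u (closedBall x r)) : Integrable (fun t => ρ t • u (x - t)) volume := by
  have : ProperSpace E := FiniteDimensional.proper ℂ E
  have : IntegrableOn (fun t => ρ t • u (x - t)) (closedBall 0 r) volume := by
    refine ContinuousOn.integrableOn_compact (isCompact_closedBall _ _) ?_
    refine h.smooth.continuous.continuousOn.smul (hu.comp (by fun_prop) fun t ht => ?_)
    simpa [dist_eq_norm] using ht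
  refine (integrableOn_iff_integrable_of_support_subset fun t ht => ?_).1 this
  by_contra h1
  exact ht (by simp [h.supp t (by simpa using h1)])

lemma mol_mean {r : ℝ} {ρ : E → ℝ} (h : Moll r ρ) {u : E → ℂ} {x : E}
    (hu : ∀ z ∈ closedBall x r, DifferentiableAt ℂ u z) : mol ρ u x = u x := by
  have hpi : 0 < 2 * Real.pi := by positivity
  obtain ⟨h1, h2⟩ := circ_fubini (mol_integrand h
    (fun z hz => (hu z hz).continuousAt.continuousWithinAt))
  have e0 : ∀ θ : ℝ, ∀ t, ρ (Complex.exp (θ * I) • t) = ρ t := fun θ t =>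
    h.circ _ _ (Complex.norm_exp_ofReal_mul_I θ)
  simp only [e0] at h1 h2
  have e3 : ∀ t, ∫ θ in (0:ℝ)..(2 * Real.pi), ρ t • u (x - Complex.exp (θ * I) • t) =
      ρ t • ((2 * Real.pi) • u x) := by
    intro t
    rw [intervalIntegral.integral_smul]
    by_cases ht : ‖t‖ ≤ r
    · congr 1
      have hm : ∀ lam ∈ closedBall (0:ℂ) 1, x - lam • t ∈ closedBall x r := by
        intro lam hl
        have : ‖lam‖ ≤ 1 := by simpa using hl
        simp [dist_eq_norm, norm_smul]
        nlinarith [norm_nonneg t]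
      have hd : DifferentiableOn ℂ (fun lam : ℂ => u (x - lam • t)) (closedBall 0 1) := by
        intro lam hl
        exact ((hu _ (hm lam hl)).comp (f := fun lam : ℂ => x - lam • t) lam (by fun_prop)).differentiableWithinAt
      have hdc : DiffContOnCl ℂ (fun lam : ℂ => u (x - lam • t)) (ball 0 |1|) := by
        refine DifferentiableOn.diffContOnCl ?_
        rw [abs_one, closure_ball _ one_ne_zero]; exact hd
      have := hdc.circleAverage
      rw [Real.circleAverage] at this
      simp only [circleMap, ofReal_one, one_mul, zero_add, zero_smul, sub_zero] at this
      rw [← this, smul_smul, mul_inv_cancel₀ hpi.ne', one_smul]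
    · rw [h.supp t (by linarith)]; simp
  simp only [e3] at h2
  rw [integral_smul_const, h.int, one_smul] at h2
  rw [mol_eq']
  exact (smul_right_injective ℂ hpi.ne' h2).symm

lemma DD_smul_vec {f : E → ℂ} {x : E} (c : ℂ) (e : E) : DD I (c • e) f x = conj c * DD I e f x := by
  have h1 : c • e = c.re • e + c.im • (I • e) := by
    nth_rw 1 [← Complex.re_add_im c]
    rw [add_smul, mul_smul]; rfl
  have h2 : I • c • e = c.re • (I • e) - c.im • e := by
    rw [h1, smul_add, smul_comm I c.re, smul_comm I c.im, smul_smul I I, I_mul_I, neg_one_smul, smul_neg, sub_eq_add_neg]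
  have h3 : conj c = c.re - c.im * I := by apply Complex.ext <;> simp
  rw [DD, h2, h1, DD, h3]
  simp only [map_add, map_sub, map_smul, Complex.real_smul]
  linear_combination (c.im * fderiv ℝ f x (I • e) / 2 ) * I_mul_I

lemma DD_add_vec {f : E → ℂ} {x : E} (e e' : E) : DD I (e + e') f x = DD I e f x + DD I e' f x := by
  rw [DD, DD, DD, smul_add, map_add, map_add]; ring

lemma hol_of_dzb {ι : Type*} [Fintype ι] (b : Module.Basis ι ℂ E) {f : E → ℂ} {x : E}
    (hf : DifferentiableAt ℝ f x) (h : ∀ j, dzb (b j) f x = 0) : DifferentiableAt ℂ f x := by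
  have h1 : ∀ e, DD I e f x = 0 := by
    intro e
    rw [← b.sum_repr e]
    have : ∀ s : Finset ι, DD I (∑ j ∈ s, b.repr e j • b j) f x = 0 := by
      classical
      intro s
      induction s using Finset.induction_on with
      | empty => simp [DD]
      | insert a s ha ih => rw [Finset.sum_insert ha, DD_add_vec, ih, DD_smul_vec, show DD I (b a) f x = 0 from h a]; simp
    exact this _
  have h2 : ∀ e, fderiv ℝ f x (I • e) = I * fderiv ℝ f x e := by
    intro e
    have := h1 e
    rw [DD, div_eq_zero_iff] at this
    have h3 := this.resolve_right (by norm_num)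
    linear_combination (-I) * h3 + fderiv ℝ f x (I • e) * I_mul_I
  let L : E →L[ℂ] ℂ :=
    { toFun := fderiv ℝ f x
      map_add' := fun a b => map_add _ _ _
      map_smul' := fun c e => by
        have : c • e = c.re • e + c.im • (I • e) := by
          nth_rw 1 [← Complex.re_add_im c]
          rw [add_smul, mul_smul]; rfl
        rw [this, map_add, map_smul, map_smul, h2]
        simp only [Complex.real_smul, RingHom.id_apply, smul_eq_mul]
        nth_rw 3 [← Complex.re_add_im c]; ring
      cont := (fderiv ℝ f x).cont }
  exact (hasFDerivAt_of_restrictScalars ℝ hf.hasFDerivAt (show L.restrictScalars ℝ = fderiv ℝ f x from rfl)).differentiableAt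

lemma hol_dzb {f : E → ℂ} {x : E} (hf : DifferentiableAt ℂ f x) (e : E) : dzb e f x = 0 := by
  rw [dzb, DD, (hf.hasFDerivAt.restrictScalars ℝ).fderiv]
  simp only [ContinuousLinearMap.coe_restrictScalars', map_smul, smul_eq_mul]
  linear_combination (fderiv ℂ f x e) / 2 * I_mul_I

lemma mol_swap {r s : ℝ} {ρ σ : E → ℝ} (h : Moll r ρ) (h' : Moll s σ) {f : E → ℂ}
    (hf : LocallyIntegrable f volume) (x : E) : mol ρ (mol σ f) x = mol σ (mol ρ f) x := by
  have key : ∀ {r s : ℝ} {ρ σ : E → ℝ} (h : Moll r ρ) (h' : Moll s σ),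
      mol ρ (mol σ f) x = ((ρ ⋆[ContinuousLinearMap.lsmul ℝ ℝ, volume] σ)
        ⋆[ContinuousLinearMap.lsmul ℝ ℝ, volume] f) x := by
    intro r s ρ σ h h'
    rw [mol_eq, mol_eq]
    symm
    have c1 := h'.hcs.norm
    have hfn : LocallyIntegrable (fun x => ‖f x‖) volume := fun x => (hf x).norm
    refine convolution_assoc _ _ _ _ (fun a b z => by simp [mul_smul])
      h.smooth.continuous.aestronglyMeasurable h'.smooth.continuous.aestronglyMeasurable
      hf.aestronglyMeasurable ?_ ?_ ?_
    · exact Eventually.of_forall (h.hcs.convolutionExists_left _ h.smooth.continuous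
        h'.smooth.continuous.locallyIntegrable)
    · exact Eventually.of_forall (c1.convolutionExists_left _ h'.smooth.continuous.norm hfn)
    · refine h.hcs.norm.convolutionExists_left _ h.smooth.continuous.norm ?_ x
      exact (c1.continuous_convolution_left _ h'.smooth.continuous.norm hfn).locallyIntegrable
  rw [key h h', key h' h]
  congr 1
  ext y
  rw [convolution_lsmul, convolution_lsmul_swap]
  simp [mul_comm]

lemma weyl1 {ι : Type*} [Fintype ι] (b : Module.Basis ι ℂ E) {f : E → ℂ} (hf : LocallyIntegrable f volume)
    {Ω : Set E} (hw : ∀ g, TF Ω g → ∀ j, ∫ x, f x * dzb (b j) g x = 0) {r : ℝ} {ρ : E → ℝ}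
    (h : Moll r ρ) {x : E} (hx : closedBall x r ⊆ Ω) : DifferentiableAt ℂ (mol ρ f) x := by
  refine hol_of_dzb b (cdAt (mol_contDiff h hf)) fun j => ?_
  rw [dzb, mol_DD h hf]
  simpa using hw _ ((TF_kernel h x).mono hx) j

lemma weyl2 {ι : Type*} [Fintype ι] (b : Module.Basis ι ℂ E) {f : E → ℂ} (hf : MemLp f 2 volume)
    {Ω : Set E} (hw : ∀ g, TF Ω g → ∀ j, ∫ x, f x * dzb (b j) g x = 0) {r : ℝ} (hr : 0 < r) {ρ : E → ℝ}
    (h : Moll r ρ) {U : Set E} (hU : IsOpen U) (hUΩ : ∀ x ∈ U, closedBall x (r + r) ⊆ Ω) :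
    ∀ᵐ x, x ∈ U → mol ρ f x = f x := by
  have hl := memLp_two_locInt hf
  have i1 : ∀ ε > 0, ∫⁻ x in U, ‖mol ρ f x - f x‖ₑ ^ 2 ≤ ENNReal.ofReal ε := by
    intro ε hε
    obtain ⟨r0, hr0, h2⟩ := mol_L2 hf hε
    obtain ⟨σ, hσ⟩ := exists_Moll (E := E) (min r r0) (lt_min hr hr0)
    obtain ⟨h3, h4⟩ := h2 _ (min_le_right _ _) σ hσ
    have e1 : ∀ x ∈ U, mol ρ f x = mol σ f x := by
      intro x hx
      have a1 : mol σ (mol ρ f) x = mol ρ f x := mol_mean hσ fun z hz => by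
        refine weyl1 b hl hw h ((closedBall_subset_closedBall' ?_).trans (hUΩ x hx))
        have : dist z x ≤ min r r0 := hz
        linarith [min_le_left r r0]
      have a2 : mol ρ (mol σ f) x = mol σ f x := mol_mean h fun z hz => by
        refine weyl1 b hl hw hσ ((closedBall_subset_closedBall' ?_).trans (hUΩ x hx))
        have : dist z x ≤ r := hz
        linarith [min_le_left r r0]
      rw [← a1, ← a2, mol_swap h hσ hl]
    have e2 : ∫⁻ x in U, ‖mol ρ f x - f x‖ₑ ^ 2 = ∫⁻ x in U, ‖mol σ f x - f x‖ₑ ^ 2 :=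
      setLIntegral_congr_fun hU.measurableSet fun x hx => by simp only [e1 x hx]
    rw [e2]
    refine (setLIntegral_le_lintegral _ _).trans ?_
    have e3 : ∀ x, ‖mol σ f x - f x‖ₑ ^ 2 = ENNReal.ofReal (‖mol σ f x - f x‖ ^ 2) := fun x => by
      rw [ENNReal.ofReal_pow (norm_nonneg _), ofReal_norm_eq_enorm]
    simp_rw [e3]
    rw [← ofReal_integral_eq_lintegral_ofReal (memLp_sq h3) (Eventually.of_forall fun x => by positivity)]
    exact ENNReal.ofReal_le_ofReal h4
  have i2 : ∫⁻ x in U, ‖mol ρ f x - f x‖ₑ ^ 2 = 0 := by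
    refine le_antisymm (le_of_forall_pos_le_add ?_) zero_le'
    intro ε hε
    rw [zero_add]
    rcases eq_or_ne ε ⊤ with rfl | h'
    · exact le_top
    · have := i1 ε.toReal (ENNReal.toReal_pos hε.ne' h')
      rwa [ENNReal.ofReal_toReal h'] at this
  have hm : AEMeasurable (fun x => ‖mol ρ f x - f x‖ₑ ^ 2) (volume.restrict U) :=
    (((mol_contDiff h hl).continuous.aestronglyMeasurable.sub hf.1).enorm.pow_const 2).restrict
  rw [lintegral_eq_zero_iff' hm, EventuallyEq, ae_restrict_iff' hU.measurableSet] at i2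
  filter_upwards [i2] with x hx hxU
  have := hx hxU
  simpa [sub_eq_zero] using this

lemma weyl {ι : Type*} [Fintype ι] (b : Module.Basis ι ℂ E) {f : E → ℂ} {Ω : Set E} (hΩ : IsOpen Ω)
    (hf : ∀ x ∈ Ω, ∃ δ > 0, MemLp (indicator (ball x δ) f) 2 volume)
    (hw : ∀ g, TF Ω g → ∀ j, ∫ x, f x * dzb (b j) g x = 0) :
    ∃ F, DifferentiableOn ℂ F Ω ∧ ∀ᵐ x, x ∈ Ω → F x = f x := by
  have loc : ∀ x ∈ Ω, ∃ δ > 0, ∃ G : E → ℂ, DifferentiableOn ℂ G (ball x δ) ∧ ball x δ ⊆ Ω ∧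
      ∀ᵐ y, y ∈ ball x δ → G y = f y := by
    intro x hx
    obtain ⟨δ1, hδ1, hm⟩ := hf x hx
    obtain ⟨δ2, hδ2, hs⟩ := Metric.isOpen_iff.1 hΩ x hx
    set δ := min δ1 δ2 with hδ
    have hδ0 : 0 < δ := lt_min hδ1 hδ2
    have hb : ball x δ ⊆ Ω := (ball_subset_ball (min_le_right _ _)).trans hs
    have hm' : MemLp (indicator (ball x δ) f) 2 volume := by
      have := hm.indicator (s := ball x δ) measurableSet_ball
      rwa [indicator_indicator, inter_eq_left.2 (ball_subset_ball (min_le_left _ _))] at this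
    have hw' : ∀ g, TF (ball x δ) g → ∀ j, ∫ y, indicator (ball x δ) f y * dzb (b j) g y = 0 := by
      intro g hg j
      rw [← hw g (hg.mono hb) j]
      congr 1; ext y
      by_cases hy : y ∈ ball x δ
      · rw [indicator_of_mem hy]
      · rw [dzb, DD_eq_zero_of_notMem fun h => hy (hg.2.2 h)]; simp
    obtain ⟨ρ, hρ⟩ := exists_Moll (E := E) (δ / 4) (by positivity)
    have hsub : ∀ y ∈ ball x (δ / 4), closedBall y (δ / 4 + δ / 4) ⊆ ball x δ := by
      intro y hy z hz
      have h1 : dist y x < δ / 4 := hy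
      have h2 : dist z y ≤ δ / 4 + δ / 4 := hz
      have : dist z x ≤ dist z y + dist y x := dist_triangle _ _ _
      simp only [mem_ball]; linarith
    refine ⟨δ / 4, by positivity, mol ρ (indicator (ball x δ) f), fun y hy => ?_,
      (ball_subset_ball (by linarith)).trans hb, ?_⟩
    · exact (weyl1 b (memLp_two_locInt hm') hw' hρ
        ((closedBall_subset_closedBall (by linarith)).trans (hsub y hy))).differentiableWithinAt
    · filter_upwards [weyl2 b hm' hw' (by positivity) hρ isOpen_ball hsub] with y hy hyb
      rw [hy hyb, indicator_of_mem (ball_subset_ball (by linarith) hyb)]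
  choose! δ hδ G hG hsub hae using loc
  have eqG : ∀ x ∈ Ω, ∀ y ∈ ball x (δ x), G y y = G x y := by
    intro x hx y hy
    have hyΩ := hsub x hx hy
    have : EqOn (G y) (G x) (ball y (δ y) ∩ ball x (δ x)) := by
      refine Measure.eqOn_open_of_ae_eq (μ := volume) ?_ (isOpen_ball.inter isOpen_ball)
        ((hG y hyΩ).continuousOn.mono inter_subset_left) ((hG x hx).continuousOn.mono inter_subset_right)
      rw [EventuallyEq, ae_restrict_iff' (isOpen_ball.inter isOpen_ball).measurableSet]
      filter_upwards [hae x hx, hae y hyΩ] with z h1 h2 hz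
      rw [h1 hz.2, h2 hz.1]
    exact this ⟨mem_ball_self (hδ y hyΩ), hy⟩
  refine ⟨fun x => G x x, fun x hx => ?_, ?_⟩
  · have h1 : (fun x => G x x) =ᶠ[𝓝 x] G x := by
      filter_upwards [isOpen_ball.mem_nhds (mem_ball_self (hδ x hx))] with y hy
      exact eqG x hx y hy
    have h2 : DifferentiableAt ℂ (G x) x :=
      (hG x hx).differentiableAt (isOpen_ball.mem_nhds (mem_ball_self (hδ x hx)))
    exact (h2.congr_of_eventuallyEq h1).differentiableWithinAt
  · have : volume {x | ¬ (x ∈ Ω → G x x = f x)} = 0 := by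
      refine measure_null_of_locally_null _ fun x hx => ?_
      have hxΩ : x ∈ Ω := by by_contra h; exact hx fun h' => absurd h' h
      refine ⟨{y | ¬ (y ∈ ball x (δ x) → G x y = f y)}, ?_, hae x hxΩ⟩
      filter_upwards [inter_mem_nhdsWithin _ (isOpen_ball.mem_nhds (mem_ball_self (hδ x hxΩ)))] with y hy h
      exact hy.1 fun _ => (eqG x hxΩ y hy.2).trans (h hy.2)
    exact this

lemma hol_contDiffAt {u : E → ℂ} {Ω : Set E} (hΩ : IsOpen Ω) (hu : DifferentiableOn ℂ u Ω) {x : E} (hx : x ∈ Ω) :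
    ContDiffAt ℝ ∞ u x := by
  have : ProperSpace E := FiniteDimensional.proper ℂ E
  obtain ⟨δ, hδ0, hs⟩ := Metric.isOpen_iff.1 hΩ x hx
  obtain ⟨ρ, hρ⟩ := exists_Moll (E := E) (δ / 4) (by positivity)
  set u1 := indicator (closedBall x (δ / 2)) u with hu1
  have hl : LocallyIntegrable u1 volume := by
    refine Integrable.locallyIntegrable ?_
    rw [hu1, integrable_indicator_iff measurableSet_closedBall]
    exact (hu.continuousOn.mono ((closedBall_subset_ball (by linarith)).trans hs)).integrableOn_compact
      (isCompact_closedBall _ _)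
  refine (mol_contDiff hρ hl).contDiffAt.congr_of_eventuallyEq ?_
  filter_upwards [ball_mem_nhds x (show 0 < δ / 4 by positivity)] with y hy
  have hy1 : dist y x < δ / 4 := hy
  rw [mol_mean hρ]
  · rw [hu1, indicator_of_mem]
    simp only [mem_closedBall]; linarith
  · intro z hz
    have h2 : dist z y ≤ δ / 4 := hz
    have hz2 : z ∈ ball x (δ / 2) := by
      have : dist z x ≤ dist z y + dist y x := dist_triangle _ _ _
      simp only [mem_ball]; linarith
    have h3 : DifferentiableAt ℂ u z := hu.differentiableAt
      (hΩ.mem_nhds (hs (ball_subset_ball (by linarith) hz2)))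
    refine h3.congr_of_eventuallyEq ?_
    filter_upwards [isOpen_ball.mem_nhds hz2] with t ht
    rw [hu1, indicator_of_mem (ball_subset_closedBall ht)]
end weyl

section lev
variable {E : Type*} [NormedAddCommGroup E] [NormedSpace ℂ E] [FiniteDimensional ℂ E]
  [MeasureSpace E] [BorelSpace E] [(volume : Measure E).IsAddHaarMeasure]
variable {ι : Type*} [Fintype ι]

lemma rdz_congr {Φ Ψ : E → ℝ} {x : E} (h : Φ =ᶠ[𝓝 x] Ψ) (e : E) : rdz e Φ x = rdz e Ψ x := by
  refine DD_congr ?_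
  filter_upwards [h] with y hy; rw [hy]

lemma LF_congr (e : ι → E) {Φ Ψ : E → ℝ} {x : E} (h : Φ =ᶠ[𝓝 x] Ψ) (ζ : ι → ℂ) :
    LF e Φ x ζ = LF e Ψ x ζ := by
  have : ∀ j k, Lev e Φ j k x = Lev e Ψ j k x := by
    intro j k
    refine DD_congr ?_
    filter_upwards [h.eventuallyEq_nhds] with y hy
    exact rdz_congr hy _
  simp only [LF, this]

lemma rdz_normSq {F : E → ℂ} (hF : ContDiff ℝ ∞ F) {x : E} {e : E}
    (h : dzb e F x = 0) : rdz e (fun y => ‖F y‖ ^ 2) x = dz e F x * conj (F x) := by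
  have e1 : (fun y => ((‖F y‖ ^ 2 : ℝ) : ℂ)) = fun y => F y * conj (F y) := by
    ext y; rw [mul_conj, normSq_eq_norm_sq]
  have hc : DifferentiableAt ℝ (fun y => conj (F y)) x :=
    Complex.conjCLE.differentiable.differentiableAt.comp x (cdAt hF)
  have e2 : DD (-I) e (fun y => conj (F y)) x = conj (dzb e F x) := dz_conj (cdAt hF)
  rw [rdz, e1, dz, DD_mul (cdAt hF) hc, e2, h]; simp

lemma LF_normSq (e : ι → E) {F : E → ℂ} (hF : ContDiff ℝ ∞ F) {x : E}
    (h : ∀ᶠ y in 𝓝 x, ∀ j, dzb (e j) F y = 0) (ζ : ι → ℂ) :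
    LF e (fun y => ‖F y‖ ^ 2) x ζ = ‖∑ j, dz (e j) F x * ζ j‖ ^ 2 := by
  have hc : DifferentiableAt ℝ (fun y => conj (F y)) x :=
    Complex.conjCLE.differentiable.differentiableAt.comp x (cdAt hF)
  have e1 : ∀ j k, Lev e (fun y => ‖F y‖ ^ 2) j k x = dz (e j) F x * conj (dz (e k) F x) := by
    intro j k
    have h1 : rdz (e j) (fun y => ‖F y‖ ^ 2) =ᶠ[𝓝 x] fun y => dz (e j) F y * conj (F y) := by
      filter_upwards [h] with y hy
      exact rdz_normSq hF (hy j)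
    have h2 : DD I (e k) (dz (e j) F) x = 0 := by
      rw [dz, DD_comm hF]
      have : DD I (e k) F =ᶠ[𝓝 x] fun _ => 0 := by filter_upwards [h] with y hy; exact hy k
      rw [DD_congr this, DD_const]
    have h3 : DD I (e k) (fun y => conj (F y)) x = conj (dz (e k) F x) := dzb_conj (cdAt hF)
    rw [Lev, dzb, DD_congr h1, DD_mul (cdAt (contDiff_DD hF)) hc, h3, h2]; ring
  have e2 : (∑ j, ∑ k, Lev e (fun y => ‖F y‖ ^ 2) j k x * ζ j * conj (ζ k)) =
      (∑ j, dz (e j) F x * ζ j) * conj (∑ k, dz (e k) F x * ζ k) := by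
    rw [map_sum, Finset.sum_mul_sum]
    refine Finset.sum_congr rfl fun j _ => Finset.sum_congr rfl fun k _ => ?_
    rw [e1, map_mul]; ring
  rw [LF, e2, mul_conj, normSq_eq_norm_sq, ofReal_re]

variable (b : Module.Basis ι ℂ E) (q : E)

lemma coord_contDiff (i : ι) : ContDiff ℝ ∞ (fun x => b.repr (x - q) i) := by
  have : ContDiff ℝ ∞ (fun x : E => ((LinearMap.toContinuousLinearMap (b.coord i)).restrictScalars ℝ) (x - q)) :=
    (ContinuousLinearMap.contDiff _).comp (contDiff_id.sub contDiff_const)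
  exact this

lemma coord_DD [DecidableEq ι] (i j : ι) (c : ℂ) (x : E) : DD c (b j) (fun x => b.repr (x - q) i) x =
    if i = j then (1 + c * I) / 2 else 0 := by
  have h1 : HasFDerivAt (fun x : E => b.repr (x - q) i)
      ((LinearMap.toContinuousLinearMap (b.coord i)).restrictScalars ℝ) x :=
    ((LinearMap.toContinuousLinearMap (b.coord i)).restrictScalars ℝ).hasFDerivAt.comp x
      ((hasFDerivAt_id x).sub_const q)
  rw [DD, h1.fderiv]
  simp only [ContinuousLinearMap.coe_restrictScalars', LinearMap.coe_toContinuousLinearMap',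
    map_smul, Module.Basis.coord_apply, Module.Basis.repr_self, Finsupp.single_apply, smul_eq_mul]
  by_cases h : i = j <;> simp [h, eq_comm]

noncomputable def Qs (x : E) : ℝ := QQ b (x - q)

lemma Qs_contDiff : ContDiff ℝ ∞ (Qs b q) := (QQ_contDiff b).comp (contDiff_id.sub contDiff_const)
lemma Qs_nonneg (x : E) : 0 ≤ Qs b q x := QQ_nonneg _ _

lemma LF_sum {κ : Type*} (s : Finset κ) (e : ι → E) {Φ : κ → E → ℝ} (h : ∀ i, ContDiff ℝ ∞ (Φ i)) (x : E)
    (ζ : ι → ℂ) : LF e (fun y => ∑ i ∈ s, Φ i y) x ζ = ∑ i ∈ s, LF e (Φ i) x ζ := by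
  classical
  induction s using Finset.induction_on with
  | empty =>
    simp only [Finset.sum_empty]
    have : ∀ j k, Lev e (fun _ => (0:ℝ)) j k x = 0 := by
      intro j k
      have h1 : rdz (e j) (fun _ => (0:ℝ)) = fun _ => 0 := by
        ext y; rw [rdz, dz]; exact DD_const
      rw [Lev, h1, dzb, DD_const]
    simp [LF, this]
  | insert a s ha ih =>
    simp only [Finset.sum_insert ha]
    rw [LF_add e (h a) (ContDiff.sum fun i _ => h i), ih]

lemma rdz_Qs (j : ι) (x : E) : rdz (b j) (Qs b q) x = conj (b.repr (x - q) j) := by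
  classical
  have e1 : (fun y => ((Qs b q y : ℝ) : ℂ)) = fun y => ∑ i, ((‖b.repr (y - q) i‖ ^ 2 : ℝ) : ℂ) := by
    ext y; simp [Qs, QQ]
  have h0 : ∀ i, ContDiff ℝ ∞ (fun y => ((‖b.repr (y - q) i‖ ^ 2 : ℝ) : ℂ)) := fun i =>
    contDiff_ofReal ((coord_contDiff b q i).norm_sq ℝ)
  rw [rdz, e1, dz, DD_sum fun i _ => cdAt (h0 i)]
  have e2 : ∀ i, DD (-I) (b j) (fun y => ((‖b.repr (y - q) i‖ ^ 2 : ℝ) : ℂ)) x =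
      if i = j then conj (b.repr (x - q) i) else 0 := by
    intro i
    have := rdz_normSq (coord_contDiff b q i) (x := x) (e := b j)
      (by rw [dzb, coord_DD]; simp)
    rw [rdz, dz] at this
    rw [this, dz, coord_DD]
    by_cases h : i = j <;> simp [h]
  simp only [e2]
  simp only [Finset.sum_ite_eq', Finset.mem_univ, if_true]

lemma LF_Qs (x : E) (ζ : ι → ℂ) : LF b (Qs b q) x ζ = ∑ j, ‖ζ j‖ ^ 2 := by
  classical
  have e1 : Qs b q = fun y => ∑ i, ‖b.repr (y - q) i‖ ^ 2 := by ext y; simp [Qs, QQ]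
  rw [e1, LF_sum _ _ fun i => (coord_contDiff b q i).norm_sq ℝ]
  refine Finset.sum_congr rfl fun i _ => ?_
  rw [LF_normSq b (coord_contDiff b q i) (Eventually.of_forall fun y j => by rw [dzb, coord_DD]; simp)]
  congr 1
  have : ∀ j, dz (b j) (fun y => b.repr (y - q) i) x = if i = j then 1 else 0 := fun j => by
    rw [dz, coord_DD]; by_cases h : i = j <;> simp [h]
  simp only [this]
  simp

lemma xi_contDiff {s : ℝ} (hs : 0 < s) : ContDiff ℝ ∞ (fun x => Real.log (Qs b q x + s)) :=
  ((Qs_contDiff b q).add contDiff_const).log fun x => by have := Qs_nonneg b q x; positivity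

lemma LF_xi {s : ℝ} (hs : 0 < s) (x : E) (ζ : ι → ℂ) :
    s / (Qs b q x + s) ^ 2 * ∑ j, ‖ζ j‖ ^ 2 ≤ LF b (fun x => Real.log (Qs b q x + s)) x ζ := by
  have hp : ∀ x, 0 < Qs b q x + s := fun x => by have := Qs_nonneg b q x; positivity
  have d1 : ∀ x, HasDerivAt (fun t => Real.log (t + s)) ((Qs b q x + s)⁻¹) (Qs b q x) := fun x => by
    simpa using ((hasDerivAt_id (Qs b q x)).add_const s).log (hp x).ne'
  have d2 : ∀ x, HasDerivAt (fun t => (t + s)⁻¹) (-((Qs b q x + s) ^ 2)⁻¹) (Qs b q x) := fun x => by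
    have := ((hasDerivAt_id (Qs b q x)).add_const s).fun_inv (hp x).ne'
    simpa [neg_div] using this
  rw [LF_comp b (Qs_contDiff b q) (h1 := fun t => (t + s)⁻¹) (h2 := fun t => -((t + s) ^ 2)⁻¹) d1 d2, LF_Qs]
  have cs := norm_sum_mul_sq_le (fun j => rdz (b j) (Qs b q) x) ζ
  have e1 : ∑ j, ‖rdz (b j) (Qs b q) x‖ ^ 2 = Qs b q x := by
    simp only [rdz_Qs, RCLike.norm_conj]; rfl
  rw [e1] at cs
  have h1 := hp x
  set T := Qs b q x + s with hT
  have e2 : s / T ^ 2 * ∑ j, ‖ζ j‖ ^ 2 = T⁻¹ * ∑ j, ‖ζ j‖ ^ 2 - (T ^ 2)⁻¹ * (Qs b q x * ∑ j, ‖ζ j‖ ^ 2) := by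
    have : s = T - Qs b q x := by rw [hT]; ring
    rw [this]; field_simp
  rw [e2, neg_mul, ← sub_eq_add_neg]
  gcongr

lemma LF_const_mul (e : ι → E) (N : ℝ) {φ : E → ℝ} (hφ : ContDiff ℝ ∞ φ) (x : E) (ζ : ι → ℂ) :
    LF e (fun y => N * φ y) x ζ = N * LF e φ x ζ := by
  have := LF_comp e hφ (h := fun t => N * t) (h1 := fun _ => N) (h2 := fun _ => 0)
    (fun x => by simpa using (hasDerivAt_id (φ x)).const_mul N) (fun x => hasDerivAt_const _ _) x ζ
  simpa using this
end lev

section riesz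
lemma abs_riesz {H X : Type*} [NormedAddCommGroup H] [InnerProductSpace ℂ H] [CompleteSpace H]
    [AddCommGroup X] [Module ℂ X] (A : X →ₗ[ℂ] H) (l : X →ₗ[ℂ] ℂ) {M : ℝ} (hM : 0 ≤ M)
    (h : ∀ x, ‖l x‖ ^ 2 ≤ M * ‖A x‖ ^ 2) : ∃ y : H, ‖y‖ ^ 2 ≤ M ∧ ∀ x, l x = inner ℂ y (A x) := by
  have hb : ∀ x, ‖l x‖ ≤ Real.sqrt M * ‖A x‖ := by
    intro x
    refine abs_le_of_sq_le_sq' ?_ (by positivity) |>.2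
    rw [mul_pow, Real.sq_sqrt hM]; exact h x
  have hk : LinearMap.ker A ≤ LinearMap.ker l := by
    intro x hx
    rw [LinearMap.mem_ker] at hx ⊢
    have := hb x
    rw [hx, norm_zero, mul_zero] at this
    exact norm_le_zero_iff.1 this
  let g : LinearMap.range A →ₗ[ℂ] ℂ :=
    ((LinearMap.ker A).liftQ l hk).comp A.quotKerEquivRange.symm.toLinearMap
  have hg : ∀ x, g ⟨A x, LinearMap.mem_range_self A x⟩ = l x := by
    intro x
    have : A.quotKerEquivRange.symm ⟨A x, LinearMap.mem_range_self A x⟩ = (LinearMap.ker A).mkQ x :=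
      A.quotKerEquivRange_symm_apply_image x _
    simp [g, this]
  let gc : LinearMap.range A →L[ℂ] ℂ := g.mkContinuous (Real.sqrt M) (by
    rintro ⟨_, x, rfl⟩
    rw [hg]; exact hb x)
  obtain ⟨G, hG, hn⟩ := exists_extension_norm_eq (LinearMap.range A) gc
  refine ⟨(InnerProductSpace.toDual ℂ H).symm G, ?_, fun x => ?_⟩
  · rw [LinearIsometryEquiv.norm_map, hn]
    have : ‖gc‖ ≤ Real.sqrt M := g.mkContinuous_norm_le (Real.sqrt_nonneg _) _
    calc _ ≤ Real.sqrt M ^ 2 := by gcongr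
      _ = M := Real.sq_sqrt hM
  · rw [InnerProductSpace.toDual_symm_apply]
    rw [← hg x]
    exact (hG ⟨A x, LinearMap.mem_range_self A x⟩).symm

variable {E : Type*} [MeasureSpace E]

lemma cs_int {a g : E → ℂ} (ha : MemLp a 2 volume) (hg : MemLp g 2 volume) :
    ‖∫ x, a x * g x‖ ^ 2 ≤ (∫ x, ‖a x‖ ^ 2) * ∫ x, ‖g x‖ ^ 2 := by
  have i1 := (memLp_two_iff_integrable_sq_norm ha.1).1 ha
  have i2 := (memLp_two_iff_integrable_sq_norm hg.1).1 hg
  refine sq_le_of_amgm (norm_nonneg _) (integral_nonneg fun x => by positivity)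
    (integral_nonneg fun x => by positivity) fun t ht => ?_
  refine (norm_integral_le_integral_norm _).trans ?_
  rw [← integral_const_mul, ← integral_const_mul, ← integral_add (i1.const_mul _) (i2.const_mul _)]
  refine integral_mono_of_nonneg (Eventually.of_forall fun x => norm_nonneg _)
    ((i1.const_mul _).add (i2.const_mul _)) (Eventually.of_forall fun x => ?_)
  simp only [norm_mul]
  have : t / 2 * ‖a x‖ ^ 2 + 1 / (2 * t) * ‖g x‖ ^ 2 - ‖a x‖ * ‖g x‖ = (t * ‖a x‖ - ‖g x‖) ^ 2 / (2 * t) := by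
    field_simp; ring
  have h2 : 0 ≤ (t * ‖a x‖ - ‖g x‖) ^ 2 / (2 * t) := by positivity
  linarith

lemma riesz_L2 {X : Type*} [AddCommGroup X] [Module ℂ X] (T : X →ₗ[ℂ] (E → ℂ)) (l : X →ₗ[ℂ] ℂ)
    {Θ : E → ℝ} (hΘ : Measurable Θ) (hT : ∀ x, MemLp (fun y => T x y * (Real.exp (Θ y / 2) : ℝ)) 2 volume)
    {M : ℝ} (hM : 0 ≤ M) (h : ∀ x, ‖l x‖ ^ 2 ≤ M * ∫ y, ‖T x y‖ ^ 2 * Real.exp (Θ y)) :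
    ∃ u : E → ℂ, MemLp (fun y => u y * (Real.exp (-Θ y / 2) : ℝ)) 2 volume ∧
      (∫ y, ‖u y‖ ^ 2 * Real.exp (-Θ y) ≤ M) ∧ ∀ x, l x = ∫ y, u y * T x y := by
  let A : X →ₗ[ℂ] Lp ℂ 2 (volume : Measure E) :=
    { toFun := fun x => (hT x).toLp
      map_add' := fun x x' => by
        rw [← MemLp.toLp_add]
        congr 1; ext y; simp [add_mul]
      map_smul' := fun c x => by
        rw [RingHom.id_apply, ← MemLp.toLp_const_smul]
        congr 1; ext y; simp [mul_assoc] }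
  have hA : ∀ x, (A x : E → ℂ) =ᵐ[volume] fun y => T x y * (Real.exp (Θ y / 2) : ℝ) := fun x =>
    (hT x).coeFn_toLp
  have hnorm : ∀ f : Lp ℂ 2 (volume : Measure E), ‖f‖ ^ 2 = ∫ y, ‖f y‖ ^ 2 := by
    intro f
    have h1 := @inner_self_eq_norm_sq_to_K ℂ _ _ _ _ f
    rw [L2.inner_def] at h1
    simp only [inner_self_eq_norm_sq_to_K] at h1
    have h2 : ((∫ y, ‖f y‖ ^ 2 : ℝ) : ℂ) = ((‖f‖ ^ 2 : ℝ) : ℂ) := by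
      have h3 := integral_complex_ofReal (μ := (volume : Measure E)) (f := fun y => ‖f y‖ ^ 2)
      rw [← h3]; push_cast; exact h1
    exact_mod_cast h2.symm
  obtain ⟨z, hz, hl⟩ := abs_riesz A l hM fun x => by
    refine (h x).trans (le_of_eq ?_)
    rw [hnorm]
    congr 1
    refine integral_congr_ae ?_
    filter_upwards [hA x] with y hy
    rw [hy, norm_mul, mul_pow, Complex.norm_real, Real.norm_eq_abs, Real.abs_exp, ← Real.exp_nat_mul]
    congr 2; push_cast; ring
  have e1 : ∀ y, (Real.exp (Θ y / 2) : ℂ) * (Real.exp (-Θ y / 2) : ℝ) = 1 := fun y => by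
    rw [← ofReal_mul, ← Real.exp_add, neg_div, add_neg_cancel, Real.exp_zero, ofReal_one]
  have hzm : MemLp (fun y => conj (z y)) 2 volume := (Lp.memLp z).star
  refine ⟨fun y => conj (z y) * (Real.exp (Θ y / 2) : ℝ), ?_, ?_, fun x => ?_⟩
  · refine hzm.ae_eq (Eventually.of_forall fun y => ?_)
    simp only; rw [mul_assoc, e1, mul_one]
  · rw [hnorm] at hz
    refine le_trans (le_of_eq (integral_congr_ae (Eventually.of_forall fun y => ?_))) hz
    simp only
    rw [norm_mul, mul_pow, RCLike.norm_conj, Complex.norm_real, Real.norm_eq_abs, Real.abs_exp,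
      ← Real.exp_nat_mul, mul_assoc, ← Real.exp_add]
    have : ((2:ℕ):ℝ) * (Θ y / 2) + -Θ y = 0 := by push_cast; ring
    rw [this]; simp
  · rw [hl, L2.inner_def]
    refine integral_congr_ae ?_
    filter_upwards [hA x] with y hy
    rw [hy]
    simp [RCLike.inner_apply]; ring
end riesz

section cutoffs
noncomputable def Xc (e t : ℝ) : ℝ := Real.smoothTransition (2 - 2 * t / e)
noncomputable def Xd (e t : ℝ) : ℝ := deriv Real.smoothTransition (2 - 2 * t / e) * (-(2 / e))

lemma sT_diff (t : ℝ) : HasDerivAt Real.smoothTransition (deriv Real.smoothTransition t) t :=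
  ((Real.smoothTransition.contDiff (n := 1)).differentiable (by simp) t).hasDerivAt

lemma sT_deriv_zero {t : ℝ} (h : t < 0 ∨ 1 < t) : deriv Real.smoothTransition t = 0 := by
  rcases h with h | h
  · have : Real.smoothTransition =ᶠ[𝓝 t] fun _ => 0 := by
      filter_upwards [Iio_mem_nhds h] with y hy using Real.smoothTransition.zero_of_nonpos hy.le
    rw [this.deriv_eq]; simp
  · have : Real.smoothTransition =ᶠ[𝓝 t] fun _ => 1 := by
      filter_upwards [Ioi_mem_nhds h] with y hy using Real.smoothTransition.one_of_one_le (le_of_lt hy)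
    rw [this.deriv_eq]; simp

lemma sT_mono : Monotone Real.smoothTransition := by
  intro x y h
  unfold Real.smoothTransition
  have p1 := Real.smoothTransition.pos_denom x
  have p2 := Real.smoothTransition.pos_denom y
  rw [div_le_div_iff₀ p1 p2]
  have m := expNegInvGlue.monotone h
  have m2 := expNegInvGlue.monotone (show 1 - y ≤ 1 - x by linarith)
  nlinarith [mul_le_mul m m2 (expNegInvGlue.nonneg _) (expNegInvGlue.nonneg _)]

lemma sT_deriv_nonneg (t : ℝ) : 0 ≤ deriv Real.smoothTransition t := sT_mono.deriv_nonneg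

lemma sT_deriv_cont : Continuous (deriv Real.smoothTransition) :=
  (Real.smoothTransition.contDiff (n := 1)).continuous_deriv (by simp)

lemma sT_deriv_bd : ∃ K > 0, ∀ t, deriv Real.smoothTransition t ≤ K := by
  obtain ⟨K, hK⟩ := (isCompact_Icc (a := (0:ℝ)) (b := 1)).exists_bound_of_continuousOn sT_deriv_cont.continuousOn
  refine ⟨max K 1, by positivity, fun t => ?_⟩
  by_cases h : t ∈ Icc (0:ℝ) 1
  · exact ((le_abs_self _).trans (hK t h)).trans (le_max_left _ _)
  · rw [sT_deriv_zero (by rw [mem_Icc, not_and_or, not_le, not_le] at h; exact h)]; positivity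

lemma Xc_deriv (e t : ℝ) : HasDerivAt (Xc e) (Xd e t) t := by
  have h1 : HasDerivAt (fun t : ℝ => 2 - 2 * t / e) (-(2 / e)) t := by
    have := (((hasDerivAt_id t).const_mul 2).div_const e).const_sub 2
    simpa using this
  exact (sT_diff _).comp t h1

lemma Xc_nonneg (e t : ℝ) : 0 ≤ Xc e t := Real.smoothTransition.nonneg _
lemma Xc_le_one (e t : ℝ) : Xc e t ≤ 1 := Real.smoothTransition.le_one _
lemma Xc_one {e t : ℝ} (he : 0 < e) (h : t ≤ e / 2) : Xc e t = 1 :=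
  Real.smoothTransition.one_of_one_le (by
    have : 2 * t / e ≤ 1 := by rw [div_le_one he]; linarith
    linarith)
lemma Xc_zero {e t : ℝ} (he : 0 < e) (h : e ≤ t) : Xc e t = 0 :=
  Real.smoothTransition.zero_of_nonpos (by
    have : 2 ≤ 2 * t / e := by rw [le_div_iff₀ he]; linarith
    linarith)
lemma Xd_zero {e t : ℝ} (he : 0 < e) (h : t < e / 2 ∨ e < t) : Xd e t = 0 := by
  rw [Xd, sT_deriv_zero, zero_mul]
  rcases h with h | h
  · right
    have : 2 * t / e < 1 := by rw [div_lt_one he]; linarith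
    linarith
  · left
    have : 2 < 2 * t / e := by rw [lt_div_iff₀ he]; linarith
    linarith
lemma Xd_nonpos {e : ℝ} (t : ℝ) (he : 0 < e) : Xd e t ≤ 0 := by
  have := sT_deriv_nonneg (2 - 2 * t / e)
  have h2 : 0 ≤ 2 / e := by positivity
  rw [Xd]; nlinarith
lemma Xc_contDiff (e : ℝ) : ContDiff ℝ ∞ (Xc e) :=
  Real.smoothTransition.contDiff.comp (contDiff_const.sub ((contDiff_const.mul contDiff_id).div_const e))
lemma Xd_contDiff (e : ℝ) : ContDiff ℝ ∞ (Xd e) := by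
  have : Xd e = deriv (Xc e) := funext fun t => (Xc_deriv e t).deriv.symm
  rw [this]
  exact (contDiff_infty_iff_deriv.1 (Xc_contDiff e)).2

noncomputable def La (s t : ℝ) : ℝ := (Real.log (t + s) - Real.log s) / (-Real.log s)
noncomputable def aa (N : ℕ) (s t : ℝ) : ℝ := ((t + s) ^ N)⁻¹ * La s t
noncomputable def rho (N : ℕ) (s t : ℝ) : ℝ :=
  ((t + s) ^ N)⁻¹ * (N * La s t * (s / (t + s)) + t / ((t + s) * (-Real.log s)))

lemma aa_deriv (N : ℕ) {s t : ℝ} (hs : 0 < s) (h1 : s < 1) (ht : 0 ≤ t) :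
    ∃ a', HasDerivAt (aa N s) a' t ∧ N * aa N s t + t * a' = rho N s t := by
  have hp : 0 < t + s := by positivity
  have hl : -Real.log s ≠ 0 := by have := Real.log_neg hs h1; linarith
  have d0 : HasDerivAt (fun t : ℝ => t + s) 1 t := (hasDerivAt_id t).add_const s
  have d1 := ((d0.log hp.ne').sub_const (Real.log s)).div_const (-Real.log s)
  have d2 := (d0.fun_pow N).fun_inv (pow_ne_zero N hp.ne')
  refine ⟨_, d2.mul d1, ?_⟩
  unfold aa rho La
  generalize Real.log (t + s) - Real.log s = U
  generalize -Real.log s = l at hl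
  rcases N with _ | N
  · simp; field_simp
  · simp only [Nat.add_sub_cancel]
    generalize hT : t + s = T at *
    have : s = T - t := by rw [← hT]; ring
    rw [this]
    field_simp
    push_cast
    ring

lemma La_nonneg {s t : ℝ} (hs : 0 < s) (h1 : s < 1) (ht : 0 ≤ t) : 0 ≤ La s t :=
  div_nonneg (sub_nonneg.2 (Real.log_le_log hs (by linarith))) (by linarith [Real.log_neg hs h1])

lemma La_le {s t : ℝ} (hs : 0 < s) (h1 : s < 1) (ht : 0 ≤ t) : La s t * s ≤ t / (-Real.log s) := by
  have hl := Real.log_neg hs h1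
  rw [La, div_mul_eq_mul_div]
  gcongr
  · linarith
  rw [← Real.log_div (by positivity) hs.ne']
  have := Real.log_le_sub_one_of_pos (show 0 < (t + s) / s by positivity)
  calc _ ≤ ((t + s) / s - 1) * s := by gcongr
    _ = t := by field_simp; ring

lemma rho_nonneg (N : ℕ) {s t : ℝ} (hs : 0 < s) (h1 : s < 1) (ht : 0 ≤ t) : 0 ≤ rho N s t := by
  have hl : 0 < -Real.log s := by linarith [Real.log_neg hs h1]
  have := La_nonneg hs h1 ht
  unfold rho; positivity

lemma rho_le (N : ℕ) {s t : ℝ} (hs : 0 < s) (h1 : s < 1) (ht : 0 ≤ t) :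
    (t + s) ^ N * rho N s t ≤ (N + 1) / (-Real.log s) := by
  have hl : 0 < -Real.log s := by linarith [Real.log_neg hs h1]
  have h := La_le hs h1 ht
  have hp : 0 < t + s := by positivity
  rw [rho, ← mul_assoc, mul_inv_cancel₀ (by positivity), one_mul]
  have e1 : N * La s t * (s / (t + s)) ≤ N / (-Real.log s) := by
    calc N * La s t * (s / (t + s)) = N * (La s t * s) / (t + s) := by ring
      _ ≤ N * (t / (-Real.log s)) / (t + s) := by gcongr
      _ = N / (-Real.log s) * (t / (t + s)) := by ring
      _ ≤ N / (-Real.log s) * 1 := by gcongr; rw [div_le_one hp]; linarith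
      _ = _ := mul_one _
  have e2 : t / ((t + s) * (-Real.log s)) ≤ 1 / (-Real.log s) := by
    rw [← div_div]; gcongr; rw [div_le_one hp]; linarith
  calc _ ≤ N / (-Real.log s) + 1 / (-Real.log s) := add_le_add e1 e2
    _ = _ := by ring

lemma La_half {s t : ℝ} (hs : 0 < s) (h1 : s < 1) (ht : 0 ≤ t) (h : s ≤ t ^ 2) : 1 / 2 ≤ La s t := by
  have hl : 0 < -Real.log s := by linarith [Real.log_neg hs h1]
  rw [La, le_div_iff₀ hl]
  have : Real.log s ≤ 2 * Real.log (t + s) := by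
    have h3 : Real.log ((t + s) ^ 2) = 2 * Real.log (t + s) := by rw [Real.log_pow]; norm_num
    rw [← h3]
    exact Real.log_le_log hs (by nlinarith)
  linarith

lemma La_tendsto {t : ℝ} (ht : 0 < t) : Tendsto (fun s => La s t) (𝓝[>] 0) (𝓝 1) := by
  have l0 : Tendsto (fun s => -Real.log s) (𝓝[>] 0) atTop :=
    tendsto_neg_atBot_atTop.comp Real.tendsto_log_nhdsGT_zero
  have h1 : Tendsto (fun s => Real.log (t + s)) (𝓝[>] 0) (𝓝 (Real.log (t + 0))) :=
    ((Real.continuousAt_log (by linarith)).comp (f := fun s => t + s) (x := 0) (by fun_prop)).tendsto.mono_left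
      nhdsWithin_le_nhds
  have h2 : Tendsto (fun s => Real.log (t + s) / (-Real.log s) + 1) (𝓝[>] 0) (𝓝 (0 + 1)) :=
    (h1.div_atTop l0).add_const 1
  rw [zero_add] at h2
  refine h2.congr' ?_
  filter_upwards [self_mem_nhdsWithin, mem_nhdsWithin_of_mem_nhds (Iio_mem_nhds (show (0:ℝ) < 1 by norm_num))]
    with s hs hs1
  have hl : -Real.log s ≠ 0 := by have := Real.log_neg hs hs1; linarith
  rw [La, sub_eq_add_neg, add_div, div_self hl]

lemma La_le_two {s t : ℝ} (hs : 0 < s) (h1 : s < 1) (ht : 0 ≤ t) (h : (t + 1) * s ≤ 1) : La s t ≤ 2 := by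
  have hl : 0 < -Real.log s := by linarith [Real.log_neg hs h1]
  rw [La, div_le_iff₀ hl]
  have : Real.log (t + s) + Real.log s ≤ 0 := by
    rw [← Real.log_mul (by positivity) hs.ne']
    exact Real.log_nonpos (by positivity) (by nlinarith)
  linarith
end cutoffs

section kern
variable {E : Type*} [NormedAddCommGroup E] [NormedSpace ℂ E] [FiniteDimensional ℂ E] [MeasureSpace E] [BorelSpace E] [(volume : Measure E).IsAddHaarMeasure]
variable {ι : Type*} [Fintype ι] (b : Module.Basis ι ℂ E) (q : E)

lemma div_coord {F : ℝ → ℝ} {F' : ℝ} {x : E} (hF : HasDerivAt F F' (Qs b q x)) :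
    ∑ j, dzb (b j) (fun y => conj (b.repr (y - q) j) * (F (Qs b q y) : ℂ)) x =
      ((Fintype.card ι * F (Qs b q x) + Qs b q x * F' : ℝ) : ℂ) := by
  classical
  have dF : DifferentiableAt ℝ (fun y => (F (Qs b q y) : ℂ)) x :=
    Complex.ofRealCLM.differentiableAt.comp x (hF.differentiableAt.comp x (cdAt (Qs_contDiff b q)))
  have h : ∀ j, dzb (b j) (fun y => conj (b.repr (y - q) j) * (F (Qs b q y) : ℂ)) x =
      (F (Qs b q x) : ℂ) + F' * ((‖b.repr (x - q) j‖ ^ 2 : ℝ) : ℂ) := by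
    intro j
    have dc : DifferentiableAt ℝ (fun y => b.repr (y - q) j) x := cdAt (coord_contDiff b q j)
    have e1 : DD I (b j) (fun y => conj (b.repr (y - q) j)) x = 1 := by
      rw [DD_conj dc, coord_DD]; simp
    have e2 : DD I (b j) (fun y => (Qs b q y : ℂ)) x = b.repr (x - q) j := by
      have := dzb_real (e := b j) (cdAt (Qs_contDiff b q) (x := x))
      rw [dzb] at this
      rw [this, show dz (b j) (fun y => (Qs b q y : ℂ)) x = _ from rdz_Qs b q j x, conj_conj]
    have dcs : DifferentiableAt ℝ (fun y => conj (b.repr (y - q) j)) x := dc.star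
    rw [dzb, DD_mul dcs dF, e1, DD_comp hF (cdAt (Qs_contDiff b q)), e2, one_mul,
      Complex.ofReal_pow, ← Complex.conj_mul']
    ring
  simp only [h, Finset.sum_add_distrib, ← Finset.mul_sum, ← Complex.ofReal_sum]
  have : ∑ i, ‖b.repr (x - q) i‖ ^ 2 = Qs b q x := rfl
  rw [this]; simp; ring

lemma Qs_compact (e : ℝ) : IsCompact {x | Qs b q x ≤ e} := by
  obtain ⟨C, hC, h⟩ := QQ_bound b
  haveI : ProperSpace E := FiniteDimensional.proper ℂ E
  refine (isCompact_closedBall q (Real.sqrt (C * e))).of_isClosed_subset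
    (isClosed_le (Qs_contDiff b q).continuous continuous_const) fun x hx => ?_
  rw [mem_closedBall, dist_eq_norm]
  exact Real.le_sqrt_of_sq_le ((h _).trans (by gcongr; exact hx))

lemma TF_rad {V : Set E} {e : ℝ} (hV : {x | Qs b q x ≤ e} ⊆ V) {f : E → ℂ} (hf : ContDiff ℝ ∞ f)
    (h0 : ∀ x, e < Qs b q x → f x = 0) : TF V f := by
  have hs : tsupport f ⊆ {x | Qs b q x ≤ e} := by
    refine closure_minimal (fun x hx => ?_) (isClosed_le (Qs_contDiff b q).continuous continuous_const)
    by_contra hn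
    exact hx (h0 x (not_le.1 hn))
  exact ⟨hf, (Qs_compact b q e).of_isClosed_subset (isClosed_tsupport _) hs, hs.trans hV⟩

noncomputable def wS (e s : ℝ) (j : ι) (y : E) : ℂ :=
  conj (b.repr (y - q) j) * ((Xc e (Qs b q y) * aa (Fintype.card ι) s (Qs b q y) : ℝ) : ℂ)

noncomputable def kk (e : ℝ) (y : E) : ℝ := -Xd e (Qs b q y) * (Qs b q y * ((Qs b q y) ^ Fintype.card ι)⁻¹)
noncomputable def ks (e s : ℝ) (y : E) : ℝ := -Xd e (Qs b q y) * (Qs b q y * aa (Fintype.card ι) s (Qs b q y))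
noncomputable def Xr (e s : ℝ) (y : E) : ℝ := Xc e (Qs b q y) * rho (Fintype.card ι) s (Qs b q y)

variable {b q}

lemma aaQ_contDiff (N : ℕ) {s : ℝ} (hs : 0 < s) : ContDiff ℝ ∞ (fun y => aa N s (Qs b q y)) := by
  have h := Qs_contDiff b q
  have hp : ∀ x, Qs b q x + s ≠ 0 := fun x => by have := Qs_nonneg b q x; positivity
  unfold aa La
  exact (((h.add contDiff_const).pow N).inv fun x => pow_ne_zero _ (hp x)).mul
    ((((h.add contDiff_const).log hp).sub contDiff_const).div_const _)

lemma rhoQ_cont (N : ℕ) {s : ℝ} (hs : 0 < s) (h1 : s < 1) : Continuous (fun y => rho N s (Qs b q y)) := by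
  have h := (Qs_contDiff b q).continuous
  have hp : ∀ x, Qs b q x + s ≠ 0 := fun x => by have := Qs_nonneg b q x; positivity
  have hl : -Real.log s ≠ 0 := by have := Real.log_neg hs h1; linarith
  unfold rho La
  refine ((((h.add continuous_const).pow N).inv₀ fun x => pow_ne_zero _ (hp x))).mul
    (((continuous_const.mul ((((h.add continuous_const).log hp).sub continuous_const).div_const _)).mul
      (continuous_const.div (h.add continuous_const) hp)).add
      (h.div ((h.add continuous_const).mul continuous_const) fun x => mul_ne_zero (hp x) hl))

lemma wS_TF {V : Set E} {e s : ℝ} (he : 0 < e) (hV : {x | Qs b q x ≤ e} ⊆ V) (hs : 0 < s) (j : ι) :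
    TF V (wS b q e s j) := by
  refine TF_rad b q hV ?_ fun x hx => ?_
  · exact (Complex.conjCLE.contDiff.comp (coord_contDiff b q j)).mul
      (contDiff_ofReal (((Xc_contDiff e).comp (Qs_contDiff b q)).mul (aaQ_contDiff _ hs)))
  · simp [wS, Xc_zero he hx.le]

lemma wS_div {e s : ℝ} (hs : 0 < s) (h1 : s < 1) (x : E) :
    ∑ j, dzb (b j) (wS b q e s j) x = ((Xr b q e s x - ks b q e s x : ℝ) : ℂ) := by
  obtain ⟨a', d, h⟩ := aa_deriv (Fintype.card ι) hs h1 (Qs_nonneg b q x)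
  have := div_coord b q (F := fun t => Xc e t * aa (Fintype.card ι) s t) ((Xc_deriv e (Qs b q x)).mul d)
  refine (this.trans ?_)
  rw [Xr, ks, ← h]
  congr 1; ring

lemma kk_contDiff {e : ℝ} (he : 0 < e) : ContDiff ℝ ∞ (kk b q e) := by
  rw [contDiff_iff_contDiffAt]
  intro x
  have h := (Qs_contDiff b q)
  by_cases hx : Qs b q x = 0
  · have : kk b q e =ᶠ[𝓝 x] fun _ => 0 := by
      filter_upwards [h.continuous.continuousAt.eventually (Iio_mem_nhds (show Qs b q x < e / 2 by linarith))] with y hy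
      rw [kk, Xd_zero he (Or.inl hy)]; simp
    exact contDiffAt_const.congr_of_eventuallyEq this
  · exact ((Xd_contDiff e).comp h).neg.contDiffAt.mul (h.contDiffAt.mul
      ((h.pow _).contDiffAt.inv (pow_ne_zero _ hx)))

lemma kk_zero {e : ℝ} (he : 0 < e) {x : E} (h : Qs b q x < e / 2 ∨ e < Qs b q x) : kk b q e x = 0 := by
  rw [kk, Xd_zero he h]; simp

lemma ks_zero {e s : ℝ} (he : 0 < e) {x : E} (h : Qs b q x < e / 2 ∨ e < Qs b q x) : ks b q e s x = 0 := by
  rw [ks, Xd_zero he h]; simp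

lemma kk_nonneg {e : ℝ} (he : 0 < e) (x : E) : 0 ≤ kk b q e x := by
  have := Xd_nonpos (Qs b q x) he
  have h2 := Qs_nonneg b q x
  unfold kk
  exact mul_nonneg (by linarith) (by positivity)

lemma aa_nonneg {N : ℕ} {s t : ℝ} (hs : 0 < s) (h1 : s < 1) (ht : 0 ≤ t) : 0 ≤ aa N s t := by
  have := La_nonneg hs h1 ht
  unfold aa; positivity

lemma ks_nonneg {e s : ℝ} (he : 0 < e) (hs : 0 < s) (h1 : s < 1) (x : E) : 0 ≤ ks b q e s x := by
  have := Xd_nonpos (Qs b q x) he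
  have h2 := Qs_nonneg b q x
  have h3 := aa_nonneg (N := Fintype.card ι) hs h1 h2
  unfold ks
  exact mul_nonneg (by linarith) (by positivity)

lemma ks_le {e s : ℝ} (he : 0 < e) (hs : 0 < s) (h1 : s < 1) (h2 : (e + 1) * s ≤ 1) (x : E) :
    ks b q e s x ≤ 2 * kk b q e x := by
  by_cases h : Qs b q x < e / 2 ∨ e < Qs b q x
  · rw [ks_zero he h, kk_zero he h]; simp
  push Not at h
  have hQ : 0 < Qs b q x := by linarith [h.1]
  have := Xd_nonpos (Qs b q x) he
  have hL := La_le_two hs h1 hQ.le (by nlinarith [h.2])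
  have hL0 := La_nonneg hs h1 hQ.le
  unfold ks kk aa
  have : ((Qs b q x + s) ^ Fintype.card ι)⁻¹ ≤ (Qs b q x ^ Fintype.card ι)⁻¹ := by gcongr; linarith
  calc _ ≤ -Xd e (Qs b q x) * (Qs b q x * ((Qs b q x ^ Fintype.card ι)⁻¹ * 2)) := by
        gcongr; linarith
    _ = _ := by ring

lemma ks_tendsto {e : ℝ} (he : 0 < e) (x : E) : Tendsto (fun s => ks b q e s x) (𝓝[>] 0) (𝓝 (kk b q e x)) := by
  by_cases h : Qs b q x < e / 2 ∨ e < Qs b q x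
  · simp only [ks_zero he h, kk_zero he h]; exact tendsto_const_nhds
  push Not at h
  have hQ : 0 < Qs b q x := by linarith [h.1]
  have t1 : Tendsto (fun s => ((Qs b q x + s) ^ Fintype.card ι)⁻¹) (𝓝[>] 0) (𝓝 (((Qs b q x + 0) ^ Fintype.card ι)⁻¹)) := by
    refine (ContinuousAt.tendsto (x := (0:ℝ)) (f := fun s => ((Qs b q x + s) ^ Fintype.card ι)⁻¹) ?_).mono_left nhdsWithin_le_nhds
    exact ContinuousAt.inv₀ (by fun_prop) (by simp; intro h; linarith)
  have := ((t1.mul (La_tendsto hQ)).const_mul (Qs b q x)).const_mul (-Xd e (Qs b q x))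
  simpa [ks, kk, aa] using this

lemma rad_integrable {e : ℝ} {f : E → ℝ} (hf : Continuous f) (h0 : ∀ x, e < Qs b q x → f x = 0) :
    Integrable f volume :=
  hf.integrable_of_hasCompactSupport (HasCompactSupport.intro (Qs_compact b q e) fun x hx => h0 x (not_le.1 hx))

lemma kk_cont {e : ℝ} (he : 0 < e) : Continuous (kk b q e) := (kk_contDiff he).continuous
lemma ks_cont {e s : ℝ} (hs : 0 < s) : Continuous (ks b q e s) :=
  ((Xd_contDiff e).continuous.comp (Qs_contDiff b q).continuous).neg.mul
    ((Qs_contDiff b q).continuous.mul (aaQ_contDiff _ hs).continuous)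
lemma Xr_cont {e s : ℝ} (hs : 0 < s) (h1 : s < 1) : Continuous (Xr b q e s) :=
  ((Xc_contDiff e).continuous.comp (Qs_contDiff b q).continuous).mul (rhoQ_cont _ hs h1)
lemma Xr_zero {e s : ℝ} (he : 0 < e) {x : E} (h : e < Qs b q x) : Xr b q e s x = 0 := by
  rw [Xr, Xc_zero he h.le, zero_mul]
lemma Xr_nonneg {e s : ℝ} (hs : 0 < s) (h1 : s < 1) (x : E) : 0 ≤ Xr b q e s x :=
  mul_nonneg (Xc_nonneg _ _) (rho_nonneg _ hs h1 (Qs_nonneg b q x))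

lemma Xr_int {e s : ℝ} (he : 0 < e) (hs : 0 < s) (h1 : s < 1) : ∫ x, Xr b q e s x = ∫ x, ks b q e s x := by
  have i1 : Integrable (Xr b q e s) volume := rad_integrable (Xr_cont hs h1) fun x => Xr_zero he
  have i2 : Integrable (ks b q e s) volume := rad_integrable (ks_cont hs) fun x h => ks_zero he (Or.inr h)
  have h0 : ∫ x, ∑ j, dzb (b j) (wS b q e s j) x = 0 := by
    have ht : ∀ j, TF univ (wS b q e s j) := fun j => wS_TF he (subset_univ _) hs j
    rw [integral_finsetSum _ fun j _ => ((ht j).DD I (b j)).integrable]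
    exact Finset.sum_eq_zero fun j _ => integral_DD (ht j) _ _
  simp only [wS_div hs h1] at h0
  rw [integral_complex_ofReal, integral_sub i1 i2] at h0
  have := Complex.ofReal_eq_zero.1 h0
  linarith

noncomputable def Er (b : Module.Basis ι ℂ E) (q : E) (e s : ℝ) (y : E) : ℝ := Xr b q e s y + (kk b q e y - ks b q e s y)

lemma Er_cont {e s : ℝ} (he : 0 < e) (hs : 0 < s) (h1 : s < 1) : Continuous (Er b q e s) :=
  (Xr_cont hs h1).add ((kk_cont he).sub (ks_cont hs))
lemma Er_zero {e s : ℝ} (he : 0 < e) {x : E} (h : e < Qs b q x) : Er b q e s x = 0 := by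
  rw [Er, Xr_zero he h, ks_zero he (Or.inr h), kk_zero he (Or.inr h)]; simp

lemma J_tendsto {e : ℝ} (he : 0 < e) : Tendsto (fun s => ∫ y, Er b q e s y ^ 2 * (Qs b q y + s) ^ Fintype.card ι)
    (𝓝[>] 0) (𝓝 0) := by
  set N := Fintype.card ι
  have ikk : Integrable (kk b q e) volume := rad_integrable (kk_cont he) fun x h => kk_zero he (Or.inr h)
  have ikk2 : Integrable (fun y => kk b q e y ^ 2) volume := rad_integrable ((kk_cont he).pow 2) fun x h => by
    rw [kk_zero he (Or.inr h)]; simp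
  have ev : ∀ᶠ s in 𝓝[>] (0:ℝ), 0 < s ∧ s < 1 ∧ (e + 1) * s ≤ 1 := by
    have h1 : ∀ᶠ s in 𝓝 (0:ℝ), (e + 1) * s < 1 :=
      (ContinuousAt.eventually_lt (by fun_prop) (by fun_prop) (by simp))
    filter_upwards [self_mem_nhdsWithin, mem_nhdsWithin_of_mem_nhds (Iio_mem_nhds (show (0:ℝ) < 1 by norm_num)),
      nhdsWithin_le_nhds h1] with s a b c using ⟨a, b, c.le⟩
  have t1 : Tendsto (fun s => ∫ y, (kk b q e y - ks b q e s y) ^ 2) (𝓝[>] 0) (𝓝 (∫ y : E, (0:ℝ))) := by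
    refine tendsto_integral_filter_of_dominated_convergence (fun y => kk b q e y ^ 2) ?_ ?_ ikk2 ?_
    · filter_upwards [ev] with s hs
      exact (((kk_cont he).sub (ks_cont hs.1)).pow 2).aestronglyMeasurable
    · filter_upwards [ev] with s hs
      refine Eventually.of_forall fun y => ?_
      have h1 := ks_nonneg (b := b) (q := q) he hs.1 hs.2.1 y
      have h2 := ks_le (b := b) (q := q) he hs.1 hs.2.1 hs.2.2 y
      rw [Real.norm_eq_abs, abs_of_nonneg (sq_nonneg _)]
      nlinarith
    · refine Eventually.of_forall fun y => ?_
      have := ((ks_tendsto (b := b) (q := q) he y).const_sub (kk b q e y)).pow 2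
      simpa using this
  have l0 : Tendsto (fun s => -Real.log s) (𝓝[>] 0) atTop :=
    tendsto_neg_atBot_atTop.comp Real.tendsto_log_nhdsGT_zero
  have t2 : Tendsto (fun s => 2 * (((N:ℝ) + 1) / (-Real.log s)) * (2 * ∫ y, kk b q e y) +
      2 * (e + 1) ^ N * ∫ y, (kk b q e y - ks b q e s y) ^ 2) (𝓝[>] 0) (𝓝 0) := by
    have := (((tendsto_const_nhds (x := (N:ℝ) + 1)).div_atTop l0).const_mul 2 |>.mul_const (2 * ∫ y, kk b q e y)).add
      (t1.const_mul (2 * (e + 1) ^ N))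
    simpa using this
  refine squeeze_zero' ?_ ?_ t2
  · filter_upwards [ev] with s hs
    exact integral_nonneg fun y => by have := Qs_nonneg b q y; have := hs.1; positivity
  · filter_upwards [ev] with s ⟨hs, h1, h2⟩
    have hl : 0 < -Real.log s := by linarith [Real.log_neg hs h1]
    have iX : Integrable (Xr b q e s) volume := rad_integrable (Xr_cont hs h1) fun x => Xr_zero he
    have ik : Integrable (fun y => (kk b q e y - ks b q e s y) ^ 2) volume :=
      rad_integrable (((kk_cont he).sub (ks_cont hs)).pow 2) fun x h => by
        rw [kk_zero he (Or.inr h), ks_zero he (Or.inr h)]; simp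
    have iE : Integrable (fun y => Er b q e s y ^ 2 * (Qs b q y + s) ^ N) volume :=
      rad_integrable (((Er_cont he hs h1).pow 2).mul (((Qs_contDiff b q).continuous.add continuous_const).pow N))
        fun x h => by rw [Er_zero he h]; simp
    have pt : ∀ y, Er b q e s y ^ 2 * (Qs b q y + s) ^ N ≤
        2 * (((N:ℝ) + 1) / (-Real.log s)) * Xr b q e s y + 2 * (e + 1) ^ N * (kk b q e y - ks b q e s y) ^ 2 := by
      intro y
      have hX := Xr_nonneg (b := b) (q := q) (e := e) hs h1 y
      by_cases hy : e < Qs b q y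
      · rw [Er_zero he hy]; simp; positivity
      have hQ := Qs_nonneg b q y
      have a1 : Xr b q e s y * (Qs b q y + s) ^ N ≤ ((N:ℝ) + 1) / (-Real.log s) := by
        calc _ = Xc e (Qs b q y) * ((Qs b q y + s) ^ N * rho N s (Qs b q y)) := by rw [Xr]; ring
          _ ≤ 1 * ((Qs b q y + s) ^ N * rho N s (Qs b q y)) := by
            have := rho_nonneg N hs h1 hQ
            gcongr; exact Xc_le_one _ _
          _ ≤ _ := by rw [one_mul]; exact rho_le N hs h1 hQ
      have a2 : (Qs b q y + s) ^ N ≤ (e + 1) ^ N := by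
        push Not at hy
        gcongr
      have a3 : Er b q e s y ^ 2 ≤ 2 * Xr b q e s y ^ 2 + 2 * (kk b q e y - ks b q e s y) ^ 2 := by
        rw [Er]; nlinarith [sq_nonneg (Xr b q e s y - (kk b q e y - ks b q e s y))]
      calc _ ≤ (2 * Xr b q e s y ^ 2 + 2 * (kk b q e y - ks b q e s y) ^ 2) * (Qs b q y + s) ^ N := by gcongr
        _ = 2 * (Xr b q e s y * (Qs b q y + s) ^ N) * Xr b q e s y + 2 * (Qs b q y + s) ^ N * (kk b q e y - ks b q e s y) ^ 2 := by ring
        _ ≤ _ := by gcongr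
    calc _ ≤ ∫ y, (2 * (((N:ℝ) + 1) / (-Real.log s)) * Xr b q e s y + 2 * (e + 1) ^ N * (kk b q e y - ks b q e s y) ^ 2) :=
          integral_mono iE ((iX.const_mul _).add (ik.const_mul _)) pt
      _ = 2 * (((N:ℝ) + 1) / (-Real.log s)) * (∫ y, Xr b q e s y) + 2 * (e + 1) ^ N * ∫ y, (kk b q e y - ks b q e s y) ^ 2 := by
          rw [integral_add (iX.const_mul _) (ik.const_mul _), integral_const_mul, integral_const_mul]
      _ ≤ _ := by
          rw [Xr_int he hs h1]
          gcongr
          rw [← integral_const_mul]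
          exact integral_mono (rad_integrable (ks_cont hs) fun x h => ks_zero he (Or.inr h)) (ikk.const_mul _)
            fun y => ks_le he hs h1 h2 y
end kern

section ot
variable {E : Type*} [NormedAddCommGroup E] [NormedSpace ℂ E] [FiniteDimensional ℂ E] [MeasureSpace E] [BorelSpace E] [(volume : Measure E).IsAddHaarMeasure]
variable {ι : Type*} [Fintype ι] (b : Module.Basis ι ℂ E) (q : E)

lemma twist_exists [Nonempty ι] {V : Set E} {R0 d : ℝ} (hd : 0 < d) (hd1 : d ≤ 1) (hR : 0 < R0)
    (hV : ∀ x ∈ V, Qs b q x < R0) : ∃ τ A : E → ℝ, ContDiff ℝ ∞ τ ∧ (∀ x, 1 ≤ τ x) ∧ Continuous A ∧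
      (∀ x, 0 < A x) ∧ (∀ x ∈ V, ∀ ζ : ι → ℂ, d / (Qs b q x + d) ^ 2 * ∑ j, ‖ζ j‖ ^ 2 +
        ‖∑ j, rdz (b j) τ x * ζ j‖ ^ 2 / A x ≤ - LF b τ x ζ) ∧
      (∀ x ∈ V, ∀ s, 0 < s → s ≤ d → (τ x + A x) * (Qs b q x + s) ^ Fintype.card ι ≤
        12 * Real.exp (Fintype.card ι * (1 + Real.log (R0 + 3)))) := by
  have hQ := Qs_nonneg b q
  have hQc := Qs_contDiff b q
  set c0 := 1 + Real.log (R0 + 3) with hc0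
  let ξ : E → ℝ := fun x => Real.log (Qs b q x + d)
  have hξ : ContDiff ℝ ∞ ξ := xi_contDiff b q hd
  let σ : E → ℝ := fun x => 1 + Real.smoothTransition (R0 + 2 - Qs b q x) * (c0 - 1 - ξ x)
  have hσ : ContDiff ℝ ∞ σ := contDiff_const.add
    ((Real.smoothTransition.contDiff.comp (contDiff_const.sub hQc)).mul (contDiff_const.sub hξ))
  have hσ1 : ∀ x, 1 ≤ σ x := by
    intro x
    have : 0 ≤ Real.smoothTransition (R0 + 2 - Qs b q x) * (c0 - 1 - ξ x) := by
      by_cases h : R0 + 2 ≤ Qs b q x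
      · rw [Real.smoothTransition.zero_of_nonpos (by linarith), zero_mul]
      · push Not at h
        refine mul_nonneg (Real.smoothTransition.nonneg _) ?_
        have : ξ x ≤ Real.log (R0 + 3) := Real.log_le_log (by have := hQ x; positivity) (by linarith)
        linarith
    show 1 ≤ 1 + _
    linarith
  have hσp : ∀ x, 0 < σ x := fun x => by linarith [hσ1 x]
  have heq : ∀ x ∈ V, σ =ᶠ[𝓝 x] fun y => c0 - ξ y := by
    intro x hx
    filter_upwards [hQc.continuous.continuousAt.eventually (Iio_mem_nhds (show Qs b q x < R0 + 1 by linarith [hV x hx]))]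
      with y hy
    have hy : Qs b q y < R0 + 1 := hy
    show 1 + _ * _ = _
    rw [Real.smoothTransition.one_of_one_le (by linarith)]; ring
  refine ⟨fun x => σ x + Real.log (σ x), fun x => (1 + σ x) ^ 2, hσ.add (hσ.log fun x => (hσp x).ne'),
    fun x => by linarith [hσ1 x, Real.log_nonneg (hσ1 x)], (continuous_const.add hσ.continuous).pow 2,
    fun x => by have := hσp x; positivity, fun x hx ζ => ?_, fun x hx s hs hsd => ?_⟩
  · have d1 : ∀ x, HasDerivAt (fun t => t + Real.log t) (1 + (σ x)⁻¹) (σ x) := fun x =>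
      (hasDerivAt_id _).add (Real.hasDerivAt_log (hσp x).ne')
    have d2 : ∀ x, HasDerivAt (fun t : ℝ => 1 + t⁻¹) (-((σ x) ^ 2)⁻¹) (σ x) := fun x =>
      (hasDerivAt_inv (hσp x).ne').const_add 1
    rw [LF_comp b hσ (h1 := fun t => 1 + t⁻¹) (h2 := fun t => -(t ^ 2)⁻¹) d1 d2]
    have e1 : ∀ j, rdz (b j) (fun x => σ x + Real.log (σ x)) x = (1 + (σ x)⁻¹ : ℝ) * rdz (b j) σ x := fun j =>
      rdz_comp hσ (h1 := fun t => 1 + t⁻¹) d1 x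
    simp only [e1, mul_assoc, ← Finset.mul_sum, norm_mul, mul_pow, Complex.norm_real]
    have e2 : LF b σ x ζ = - LF b ξ x ζ := by
      rw [LF_congr b (heq x hx), LF_comp b hξ (h := fun t => c0 - t) (h1 := fun _ => -1) (h2 := fun _ => 0)
        (fun x => (hasDerivAt_id _).const_sub c0) (fun x => hasDerivAt_const _ _)]
      ring
    have e3 := LF_xi b q hd x ζ
    have hp := hσp x
    have e4 : 0 ≤ LF b ξ x ζ := le_trans (by have := hQ x; positivity) e3
    rw [e2]
    set X := ‖∑ j, rdz (b j) σ x * ζ j‖ ^ 2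
    have e5 : ‖1 + (σ x)⁻¹‖ ^ 2 * X / (1 + σ x) ^ 2 = (σ x ^ 2)⁻¹ * X := by
      rw [Real.norm_eq_abs, sq_abs]
      have : 1 + (σ x)⁻¹ = (1 + σ x) * (σ x)⁻¹ := by field_simp; ring
      rw [this, mul_pow]
      field_simp
    rw [e5]
    have e6 : 0 ≤ (σ x)⁻¹ * LF b ξ x ζ := by positivity
    have e7 : d / (Qs b q x + d) ^ 2 * ∑ j, ‖ζ j‖ ^ 2 ≤ LF b ξ x ζ := e3
    nlinarith
  · have hs1 := hσ1 x
    have hl : Real.log (σ x) ≤ σ x := (Real.log_le_sub_one_of_pos (hσp x)).trans (by linarith)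
    have h6 : σ x + Real.log (σ x) + (1 + σ x) ^ 2 ≤ 6 * σ x ^ 2 := by nlinarith
    have h2 : σ x ^ 2 ≤ 2 * Real.exp (σ x) := by
      have := Real.quadratic_le_exp_of_nonneg (hσp x).le
      nlinarith [hσp x]
    have hx2 : σ x = c0 - ξ x := (heq x hx).eq_of_nhds
    have hN : (1:ℝ) ≤ Fintype.card ι := by exact_mod_cast Fintype.card_pos
    have hpw : (Qs b q x + s) ^ Fintype.card ι ≤ Real.exp (Fintype.card ι * (c0 - σ x)) := by
      have : c0 - σ x = ξ x := by rw [hx2]; ring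
      rw [this, Real.exp_nat_mul, Real.exp_log (by have := hQ x; positivity)]
      have := hQ x
      gcongr
    calc _ ≤ 6 * (2 * Real.exp (σ x)) * Real.exp (Fintype.card ι * (c0 - σ x)) := by
          have := hQ x
          gcongr
          linarith
      _ = 12 * Real.exp (σ x + Fintype.card ι * (c0 - σ x)) := by rw [Real.exp_add (σ x)]; generalize σ x = u; ring
      _ ≤ _ := by gcongr; nlinarith

noncomputable def vq : ℝ := (volume {x | QQ b x ≤ 1}).toReal

lemma vq_pos : 0 < vq b := by
  have h0 : {x | Qs b (0:E) x ≤ 1} = {x | QQ b x ≤ 1} := by ext x; simp [Qs]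
  refine ENNReal.toReal_pos ?_ ?_
  · have : IsOpen {x | QQ b x < 1} := isOpen_lt (QQ_contDiff b).continuous continuous_const
    refine (this.measure_pos volume ⟨0, by simp [QQ]⟩).trans_le (measure_mono fun x (hx : QQ b x < 1) => (le_of_lt hx : QQ b x ≤ 1)) |>.ne'
  · rw [← h0]; exact (Qs_compact b 0 1).measure_lt_top.ne

lemma vol_Qs {e : ℝ} (he : 0 < e) : volume.real {x | Qs b q x ≤ e} = e ^ Fintype.card ι * vq b := by
  have hs : 0 < Real.sqrt e := Real.sqrt_pos.2 he
  have h1 : {x | Qs b q x ≤ e} = (fun x => x + -q) ⁻¹' ((fun x => (Real.sqrt e)⁻¹ • x) ⁻¹' {x | QQ b x ≤ 1}) := by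
    have hsm : ∀ (r : ℝ) (x : E), QQ b (r • x) = r ^ 2 * QQ b x := fun r x => by
      have := QQ_smul b (r : ℂ) x
      rw [Complex.norm_real, Real.norm_eq_abs, sq_abs] at this
      rw [← this]; congr 1
    ext x
    rw [mem_preimage, mem_preimage, mem_setOf_eq, mem_setOf_eq,
      hsm, inv_pow, Real.sq_sqrt he.le, ← sub_eq_add_neg, inv_mul_le_one₀ he]
    rfl
  rw [h1, Measure.real, measure_preimage_add_right, Measure.addHaar_preimage_smul _ (by positivity),
    ENNReal.toReal_mul, ENNReal.toReal_ofReal (by positivity), finrank_real_of_complex,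
    Module.finrank_eq_card_basis b, inv_pow, inv_inv, pow_mul, Real.sq_sqrt he.le, abs_of_nonneg (by positivity)]
  rfl

lemma ks_low {d s : ℝ} (hd : 0 < d) (hs : 0 < s) (h1 : s < 1) (h2 : s ≤ d) (h3 : s ≤ (d / 2) ^ 2) :
    Fintype.card ι * vq b / (2 * 4 ^ Fintype.card ι) ≤ ∫ x, ks b q d s x := by
  set N := Fintype.card ι
  have hQc := (Qs_contDiff b q).continuous
  have iX : Integrable (fun x => Xc d (Qs b q x)) volume := rad_integrable (b := b) (q := q) (e := d)
    ((Xc_contDiff d).continuous.comp hQc) fun x h => Xc_zero hd h.le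
  have iD : Integrable (fun x => Qs b q x * Xd d (Qs b q x)) volume := rad_integrable (b := b) (q := q) (e := d)
    (hQc.mul ((Xd_contDiff d).continuous.comp hQc)) fun x h => by rw [Xd_zero hd (Or.inr h)]; simp
  have h0 : N * (∫ x, Xc d (Qs b q x)) = ∫ x, -Xd d (Qs b q x) * Qs b q x := by
    have ht : ∀ j, TF univ (fun y => conj (b.repr (y - q) j) * (Xc d (Qs b q y) : ℂ)) := fun j => by
      refine TF_rad b q (e := d) (subset_univ _) ?_ fun x hx => by simp [Xc_zero hd hx.le]
      exact (Complex.conjCLE.contDiff.comp (coord_contDiff b q j)).mul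
        (contDiff_ofReal (((Xc_contDiff d).comp (Qs_contDiff b q))))
    have h0 : ∫ x, ∑ j, dzb (b j) (fun y => conj (b.repr (y - q) j) * (Xc d (Qs b q y) : ℂ)) x = 0 := by
      rw [integral_finsetSum _ fun j _ => ((ht j).DD I (b j)).integrable]
      exact Finset.sum_eq_zero fun j _ => integral_DD (ht j) _ _
    simp only [div_coord b q (Xc_deriv d _)] at h0
    rw [integral_complex_ofReal, integral_add (iX.const_mul _) iD, integral_const_mul] at h0
    have := Complex.ofReal_eq_zero.1 h0
    have e : ∫ x, -Xd d (Qs b q x) * Qs b q x = - ∫ x, Qs b q x * Xd d (Qs b q x) := by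
      rw [← integral_neg]; congr 1; ext x; ring
    rw [e]; linarith
  have h4 : (d / 2) ^ N * vq b ≤ ∫ x, Xc d (Qs b q x) := by
    rw [← vol_Qs b q (by positivity : 0 < d / 2)]
    have hm : MeasurableSet {x | Qs b q x ≤ d / 2} := (isClosed_le hQc continuous_const).measurableSet
    rw [← integral_indicator_one hm]
    refine integral_mono ((integrable_indicator_iff hm).2 (integrableOn_const (Qs_compact b q _).measure_lt_top.ne)) iX fun x => ?_
    by_cases hx : x ∈ {x | Qs b q x ≤ d / 2}
    · rw [indicator_of_mem hx, Xc_one hd hx]; simp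
    · rw [indicator_of_notMem hx]; exact Xc_nonneg _ _
  have h5 : ∀ x, -Xd d (Qs b q x) * Qs b q x * (((2 * d) ^ N)⁻¹ * (1 / 2)) ≤ ks b q d s x := by
    intro x
    by_cases h : Qs b q x < d / 2 ∨ d < Qs b q x
    · rw [ks_zero hd h, Xd_zero hd h]; simp
    push Not at h
    have hQ : 0 < Qs b q x := by linarith [h.1]
    have hx := Xd_nonpos (Qs b q x) hd
    rw [ks, aa, mul_assoc]
    have := La_half hs h1 hQ.le (h3.trans (by gcongr; exact h.1))
    gcongr
    · linarith
    · linarith [h.2]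
  calc _ = N * ((d / 2) ^ N * vq b) * (((2 * d) ^ N)⁻¹ * (1 / 2)) := by
        rw [div_pow, mul_pow]
        have : (4:ℝ) ^ N = 2 ^ N * 2 ^ N := by rw [← mul_pow]; norm_num
        rw [this]; field_simp
    _ ≤ N * (∫ x, Xc d (Qs b q x)) * (((2 * d) ^ N)⁻¹ * (1 / 2)) := by gcongr
    _ = ∫ x, -Xd d (Qs b q x) * Qs b q x * (((2 * d) ^ N)⁻¹ * (1 / 2)) := by rw [h0, integral_mul_const]
    _ ≤ _ := by
      refine integral_mono ?_ (rad_integrable (ks_cont hs) fun x h => ks_zero hd (Or.inr h)) h5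
      have : Integrable (fun x => -Xd d (Qs b q x) * Qs b q x) volume := iD.neg.congr
        (Eventually.of_forall fun x => by simp; ring)
      exact this.mul_const _
end ot

section ot
variable {E : Type*} [NormedAddCommGroup E] [NormedSpace ℂ E] [FiniteDimensional ℂ E] [MeasureSpace E] [BorelSpace E] [(volume : Measure E).IsAddHaarMeasure]
variable {ι : Type*} [Fintype ι] (b : Module.Basis ι ℂ E)

lemma exists_d (q : E) {U : Set E} (hU : U ∈ 𝓝 q) {e : ℝ} (he : 0 < e) : ∃ d > 0, d < e ∧ {x | Qs b q x ≤ d} ⊆ U := by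
  obtain ⟨δ, hδ, h⟩ := Metric.mem_nhds_iff.1 hU
  obtain ⟨C, hC, hQ⟩ := QQ_bound b
  refine ⟨min (e / 2) (δ ^ 2 / (2 * C)), by positivity, (min_le_left _ _).trans_lt (by linarith), fun x hx => h ?_⟩
  have hx : Qs b q x ≤ min (e / 2) (δ ^ 2 / (2 * C)) := hx
  rw [mem_ball, dist_eq_norm]
  refine lt_of_pow_lt_pow_left₀ 2 hδ.le ((hQ _).trans_lt ?_)
  have : QQ b (x - q) ≤ δ ^ 2 / (2 * C) := hx.trans (min_le_right _ _)
  calc C * QQ b (x - q) ≤ C * (δ ^ 2 / (2 * C)) := by gcongr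
    _ = δ ^ 2 / 2 := by field_simp
    _ < δ ^ 2 := by have : 0 < δ ^ 2 := by positivity
                    linarith

lemma dzb_chi (q : E) (d : ℝ) (x : E) :
    ∑ j, ‖dzb (b j) (fun y => (Xc d (Qs b q y) : ℂ)) x‖ ^ 2 = Xd d (Qs b q x) ^ 2 * Qs b q x := by
  have h : ∀ j, dzb (b j) (fun y => (Xc d (Qs b q y) : ℂ)) x = Xd d (Qs b q x) * b.repr (x - q) j := by
    intro j
    have := dzb_real (e := b j) (cdAt (Qs_contDiff b q) (x := x))
    rw [dzb] at this
    rw [dzb, DD_comp (Xc_deriv d _) (cdAt (Qs_contDiff b q)), this,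
      show dz (b j) (fun y => (Qs b q y : ℂ)) x = _ from rdz_Qs b q j x, conj_conj]
  simp only [h, norm_mul, mul_pow, ← Finset.mul_sum, Complex.norm_real, Real.norm_eq_abs, sq_abs]
  rfl

lemma int_Qs_le {q : E} {d M : ℝ} (hd : 0 < d) {f : E → ℝ} (hf : ∀ x, f x ≤ M) (hM : 0 ≤ M)
    (h0 : ∀ x, d < Qs b q x → f x ≤ 0) : ∫ x, f x ≤ M * (d ^ Fintype.card ι * vq b) := by
  have hm : MeasurableSet {x | Qs b q x ≤ d} := (isClosed_le (Qs_contDiff b q).continuous continuous_const).measurableSet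
  have hi : Integrable (indicator {x | Qs b q x ≤ d} fun _ : E => M) volume :=
    (integrable_indicator_iff hm).2 (integrableOn_const (Qs_compact b q _).measure_lt_top.ne)
  have hle : ∀ x, f x ≤ indicator {x | Qs b q x ≤ d} (fun _ : E => M) x := fun x => by
    by_cases hx : x ∈ {x | Qs b q x ≤ d}
    · rw [indicator_of_mem hx]; exact hf x
    · rw [indicator_of_notMem hx]; exact h0 x (not_le.1 hx)
  have e1 : ∫ x, indicator {x | Qs b q x ≤ d} (fun _ : E => M) x = M * (d ^ Fintype.card ι * vq b) := by
    rw [integral_indicator hm, setIntegral_const, vol_Qs b q hd, smul_eq_mul, mul_comm]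
  by_cases hfi : Integrable f volume
  · rw [← e1]; exact integral_mono hfi hi hle
  · rw [integral_undef hfi]; have := vq_pos b; positivity

lemma ot_smooth [Nonempty ι] [DecidableEq ι] {R0 : ℝ} (hR : 0 < R0) : ∃ C > 0, ∀ (q : E) (V : Set E) (ψ φ : E → ℝ)
    (c e : ℝ) (w : ι → E → ℂ), IsOpen V → IsCompact (closure V) → (∀ x ∈ V, Qs b q x < R0) → ContDiff ℝ ∞ ψ →
    (∀ x, 0 ≤ ψ x) → (∀ x ∈ closure V, x ∉ V → 3 < ψ x) → 0 < c →
    (∀ x ∈ V, ∀ ζ : ι → ℂ, c * ∑ j, ‖ζ j‖ ^ 2 ≤ LF b ψ x ζ) → ContDiff ℝ ∞ φ →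
    (∀ x ∈ V, ∀ ζ : ι → ℂ, 0 ≤ LF b φ x ζ) → 0 < e → {x | Qs b q x ≤ e} ⊆ V ∩ {x | ψ x < 1} →
    (∀ j, TF (V ∩ {x | ψ x < 1}) (w j)) →
    1 ≤ C * Real.exp (-φ q) * ∫ x, ‖∑ j, dzb (b j) (w j) x + (kk b q e x : ℂ)‖ ^ 2 * Real.exp (φ x) := by
  obtain ⟨K, hK, hKb⟩ := sT_deriv_bd
  set N := Fintype.card ι with hN
  have hv := vq_pos b
  have hNp : (0:ℝ) < N := by exact_mod_cast Fintype.card_pos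
  set κ : ℝ := N * vq b / (2 * 4 ^ N) with hκ
  have hκp : 0 < κ := by positivity
  set P0 : ℝ := 768 * K ^ 2 * 2 ^ N * vq b with hP0
  set B : ℝ := 12 * Real.exp (N * (1 + Real.log (R0 + 3))) with hB
  refine ⟨(4 * vq b + 4 * P0 * B) / κ ^ 2, by positivity, fun q V ψ φ c e w hVo hVc hVR hψ hψ0 hfr hc hLψ hφ hLφ he heV hw => ?_⟩
  have hQ := Qs_nonneg b q
  have hQc := Qs_contDiff b q
  obtain ⟨d, hd, hde, hdU⟩ := exists_d b q (U := {x | Real.exp (-φ x) < 2 * Real.exp (-φ q)})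
    ((isOpen_lt (hφ.continuous.neg.rexp) continuous_const).mem_nhds (by
      show Real.exp (-φ q) < 2 * Real.exp (-φ q); linarith [Real.exp_pos (-φ q)])) (show 0 < min 1 (e / 2) by positivity)
  have hd1 : d ≤ 1 := hde.le.trans (min_le_left _ _)
  have hde2 : d < e / 2 := hde.trans_le (min_le_right _ _)
  obtain ⟨τ, A, hτ, hτ1, hA, hAp, htw, htB⟩ := twist_exists b q hd hd1 hR hVR
  set V1 := V ∩ {x | ψ x < 1}
  set g : E → ℂ := fun x => ∑ j, dzb (b j) (w j) x + (kk b q e x : ℂ) with hg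
  have hdV : {x | Qs b q x ≤ d} ⊆ V1 := fun x hx => heV (show _ ≤ e by have : Qs b q x ≤ d := hx; linarith)
  have gTF : TF V1 g := TF.add (TF.sum fun j => (hw j).DD I (b j))
    (TF_rad b q heV (contDiff_ofReal (kk_contDiff he)) fun x hx => by
      simp [kk_zero (b := b) (q := q) he (Or.inr hx)])
  have hφc := hφ.continuous
  set I0 := ∫ x, ‖g x‖ ^ 2 * Real.exp (φ x) with hI0
  have gi : Integrable (fun x => Real.exp (φ x) * ‖g x‖ ^ 2) volume := gTF.cint hφc.rexp
  set χ : E → ℂ := fun y => (Xc d (Qs b q y) : ℂ) with hχd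
  have hχ : TF V1 χ := TF_rad b q hdV (contDiff_ofReal ((Xc_contDiff d).comp hQc)) (fun x hx => by
    simp [χ, Xc_zero hd hx.le])
  have hExp : ∀ x, Qs b q x ≤ d → Real.exp (-φ x) ≤ 2 * Real.exp (-φ q) := fun x hx => (hdU hx).le
  have hep := Real.exp_pos (-φ q)
  have hI00 : 0 ≤ I0 := integral_nonneg fun x => by positivity
  have t1 : ‖∫ x, χ x * g x‖ ^ 2 ≤ 2 * Real.exp (-φ q) * vq b * I0 := by
    have := cs_int (hχ.mul_right (contDiff_half hφ (-1/2))).memLp (gTF.mul_right (contDiff_half hφ (1/2))).memLp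
    have e1 : ∀ x, χ x * (Real.exp (-1/2 * φ x) : ℝ) * (g x * (Real.exp (1/2 * φ x) : ℝ)) = χ x * g x := fun x => by
      have : ((Real.exp (-1/2 * φ x) : ℝ) : ℂ) * (Real.exp (1/2 * φ x) : ℝ) = 1 := by
        rw [← ofReal_mul, ← Real.exp_add]; ring_nf; simp
      linear_combination (χ x * g x) * this
    simp only [e1] at this
    refine this.trans ?_
    have e2 : ∀ c x, ∀ z : ℂ, ‖z * (Real.exp (c * φ x) : ℝ)‖ ^ 2 = ‖z‖ ^ 2 * Real.exp (2 * c * φ x) := fun c x z => by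
      rw [norm_mul, mul_pow, Complex.norm_real, Real.norm_eq_abs, sq_abs, ← Real.exp_nat_mul]
      push_cast; ring_nf
    simp only [e2]
    have e3 : ∀ x, 2 * (1/2) * φ x = φ x := fun x => by ring
    have e4 : ∀ x, 2 * (-1/2) * φ x = -φ x := fun x => by ring
    simp only [e3, e4]
    refine mul_le_mul_of_nonneg_right ?_ hI00
    have hχ1 : ∀ x, ‖χ x‖ ^ 2 ≤ 1 := fun x => by
      simp only [χ, Complex.norm_real, Real.norm_eq_abs, sq_abs]
      have := Xc_le_one d (Qs b q x); have := Xc_nonneg d (Qs b q x); nlinarith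
    have hχ0 : ∀ x, d < Qs b q x → χ x = 0 := fun x hx => by simp [χ, Xc_zero hd hx.le]
    refine (int_Qs_le b (q := q) hd (M := 2 * Real.exp (-φ q)) (fun x => ?_) (by positivity) fun x hx => by simp [hχ0 x hx]).trans ?_
    · by_cases hx : Qs b q x ≤ d
      · calc _ ≤ 1 * Real.exp (-φ x) := by gcongr; exact hχ1 x
          _ ≤ _ := by rw [one_mul]; exact hExp x hx
      · simp [hχ0 x (not_le.1 hx)]; positivity
    · have : d ^ Fintype.card ι ≤ 1 := pow_le_one₀ hd.le hd1
      have : d ^ Fintype.card ι * vq b ≤ 1 * vq b := by gcongr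
      nlinarith
  obtain ⟨M, hM0, hM⟩ : ∃ M, 0 ≤ M ∧ ∀ x, Qs b q x ≤ e → (τ x + A x) * Real.exp (φ x) ≤ M := by
    obtain ⟨M, hM⟩ := (Qs_compact b q e).bddAbove_image (f := fun x => (τ x + A x) * Real.exp (φ x))
      ((hτ.continuous.add hA).mul hφc.rexp).continuousOn
    exact ⟨max M 0, le_max_right _ _, fun x hx => (hM (mem_image_of_mem _ hx)).trans (le_max_left _ _)⟩
  set J : ℝ → ℝ := fun s => ∫ y, Er b q e s y ^ 2 * (Qs b q y + s) ^ Fintype.card ι with hJ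
  have main : ∀ s, 0 < s → s < 1 → s ≤ d → s ≤ (d / 2) ^ 2 → κ ^ 2 ≤ 2 * (2 * Real.exp (-φ q) * vq b * I0) +
      2 * ((P0 * Real.exp (-φ q)) * (2 * B * I0 + 2 * M * J s)) := by
    intro s hs h1 h2 h3
    have hlow := ks_low b q hd hs h1 h2 h3
    set w2 : ι → E → ℂ := fun j x => w j x + (-1) * wS b q e s j x with hw2
    have w2T : ∀ j, TF V1 (w2 j) := fun j => (hw j).add ((wS_TF (b := b) (q := q) he heV hs j).mul_left contDiff_const)
    have hdiv : ∀ x, ∑ j, dzb (b j) (w2 j) x = g x - (Er b q e s x : ℂ) := fun x => by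
      have : ∀ j, dzb (b j) (w2 j) x = dzb (b j) (w j) x - dzb (b j) (wS b q e s j) x := fun j => by
        have hT := wS_TF (b := b) (q := q) he heV hs j
        rw [dzb, DD_add (hw j).differentiableAt (hT.mul_left contDiff_const).differentiableAt, DD_const_mul _ hT.differentiableAt]
        ring
      simp only [this, Finset.sum_sub_distrib]
      rw [wS_div (b := b) (q := q) hs h1 x]
      simp only [g, Er]; push_cast; ring
    have hQs : ∀ x, 0 < Qs b q x + s := fun x => by linarith [hQ x]
    have hErT : ∫ x, χ x * (Er b q e s x : ℂ) = ((∫ x, ks b q d s x : ℝ) : ℂ) := by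
      rw [← Xr_int (b := b) (q := q) hd hs h1, ← integral_complex_ofReal]
      refine integral_congr_ae (Eventually.of_forall fun x => ?_)
      show χ x * (Er b q e s x : ℂ) = (Xr b q d s x : ℂ)
      rw [hχd, ← ofReal_mul, ofReal_inj, Er, Xr, Xr]
      by_cases hx : Qs b q x ≤ d
      · have h4 : Qs b q x < e / 2 := by linarith
        rw [kk_zero (b := b) (q := q) he (Or.inl h4), ks_zero (b := b) (q := q) he (Or.inl h4), Xc_one he h4.le]; ring
      · rw [Xc_zero hd (not_le.1 hx).le]; ring
    have hErc : Integrable (fun x => χ x * (Er b q e s x : ℂ)) volume := by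
      refine Continuous.integrable_of_hasCompactSupport (hχ.1.continuous.mul (continuous_ofReal.comp (Er_cont (b := b) (q := q) he hs h1))) hχ.2.1.mul_right
    have hparts : ∫ x, ∑ j, dzb (b j) χ x * w2 j x = - ∫ x, χ x * (g x - (Er b q e s x : ℂ)) := by
      have i1 : ∀ j, Integrable (fun x => dzb (b j) χ x * w2 j x) volume := fun j =>
        ((w2T j).mul_left (contDiff_DD hχ.1)).integrable
      have i2 : ∀ j, Integrable (fun x => χ x * dzb (b j) (w2 j) x) volume := fun j =>
        (((w2T j).DD I (b j)).mul_left hχ.1).integrable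
      rw [integral_finset_sum _ fun j _ => i1 j]
      simp only [← hdiv, Finset.mul_sum]
      rw [integral_finset_sum _ fun j _ => i2 j, ← Finset.sum_neg_distrib]
      exact Finset.sum_congr rfl fun j _ => integral_DD_mul hχ.1 ((w2T j).mono (subset_univ _)) I (b j)
    have hsplit : ((∫ x, ks b q d s x : ℝ) : ℂ) = (∫ x, χ x * g x) + ∫ x, ∑ j, dzb (b j) χ x * w2 j x := by
      rw [hparts, ← hErT]
      simp only [mul_sub]
      rw [integral_sub (gTF.mul_left hχ.1).integrable hErc]; ring
    have hk : κ ^ 2 ≤ 2 * ‖∫ x, χ x * g x‖ ^ 2 + 2 * ‖∫ x, ∑ j, dzb (b j) χ x * w2 j x‖ ^ 2 := by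
      refine le_trans ?_ (norm_add_sq_le _ _)
      rw [← hsplit, Complex.norm_real, Real.norm_eq_abs, sq_abs]
      exact pow_le_pow_left₀ hκp.le hlow 2
    have hΦ : ContDiff ℝ ∞ (fun x => φ x + N * Real.log (Qs b q x + s)) :=
      hφ.add (contDiff_const.mul (xi_contDiff b q hs))
    have hN2 : ∀ x, Real.exp (N * Real.log (Qs b q x + s)) = (Qs b q x + s) ^ N := fun x => by
      rw [Real.exp_nat_mul, Real.exp_log (hQs x)]
    have hdu := dual b hΦ hτ hτ1 hA hAp (θ := fun x => d / (Qs b q x + d) ^ 2)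
      (continuous_const.div ((hQc.continuous.add continuous_const).pow 2) fun x => by have := hQ x; positivity)
      (fun x => by have := hQ x; positivity) hVo hVc hψ hψ0 hfr hc hLψ (fun x hx ζ => by
        rw [LF_add b hφ (contDiff_const.mul (xi_contDiff b q hs)), LF_const_mul b _ (xi_contDiff b q hs)]
        have h5 := LF_xi b q hs x ζ
        have : 0 ≤ s / (Qs b q x + s) ^ 2 * ∑ j, ‖ζ j‖ ^ 2 := by have := hQs x; positivity
        have h6 := mul_nonneg hNp.le (this.trans h5)
        linarith [hLφ x hx ζ]) htw hχ (θ0 := 1 / (4 * d)) (by positivity) (fun x hx => by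
        have hx' : Qs b q x ≤ d := by
          refine closure_minimal (s := Function.support χ) (t := {x | Qs b q x ≤ d}) (fun y hy => ?_) (isClosed_le hQc.continuous continuous_const) hx
          by_contra hn
          exact hy (by simp [χ, Xc_zero hd (not_le.1 hn).le])
        have := hQ x
        rw [div_le_div_iff₀ (by positivity) (by positivity)]
        nlinarith) w2T
    have f1 : 24 / (1 / (4 * d)) * ∫ x, (∑ j, ‖dzb (b j) χ x‖ ^ 2) * Real.exp (-(φ x + N * Real.log (Qs b q x + s))) ≤
        P0 * Real.exp (-φ q) := by
      have := int_Qs_le b (q := q) hd (M := (2 * K / d) ^ 2 * d * (2 * Real.exp (-φ q) * (2 / d) ^ N))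
        (f := fun x => (∑ j, ‖dzb (b j) χ x‖ ^ 2) * Real.exp (-(φ x + N * Real.log (Qs b q x + s)))) (fun x => ?_) (by positivity) (fun x hx => ?_)
      · refine (mul_le_mul_of_nonneg_left this (by positivity)).trans_eq ?_
        rw [← hN, hP0, div_pow, div_pow]; field_simp; ring
      · simp only [hχd, dzb_chi]
        rw [neg_add, Real.exp_add, Real.exp_neg (N * _), hN2]
        by_cases hx : Qs b q x < d / 2 ∨ d < Qs b q x
        · rw [Xd_zero hd hx]; simp; positivity
        · push Not at hx
          have hQx := hQ x
          have b1 : 0 ≤ ((Qs b q x + s) ^ N)⁻¹ := inv_nonneg.2 (pow_nonneg (hQs x).le _)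
          refine mul_le_mul (mul_le_mul ?_ hx.2 hQx (by positivity)) (mul_le_mul (hExp x hx.2) ?_ b1 (by positivity)) (mul_nonneg (Real.exp_pos _).le b1) (by positivity)
          · have a1 := sT_deriv_nonneg (2 - 2 * Qs b q x / d)
            have a2 := hKb (2 - 2 * Qs b q x / d)
            rw [show Xd d (Qs b q x) = deriv Real.smoothTransition (2 - 2 * Qs b q x / d) * (-(2 / d)) from rfl, mul_pow, neg_sq, ← mul_pow, show 2 * K / d = K * (2 / d) by ring]
            gcongr
          · rw [← inv_pow]
            gcongr
            rw [inv_le_comm₀ (hQs x) (by positivity), inv_div]; linarith [hx.1]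
      · simp only [hχd, dzb_chi]
        rw [Xd_zero hd (Or.inr hx)]; simp
    have f2 : ∫ x, ((τ x + A x) * ‖∑ j, dzb (b j) (w2 j) x‖ ^ 2) * Real.exp (φ x + N * Real.log (Qs b q x + s)) ≤
        2 * B * I0 + 2 * M * J s := by
      have i1 : Integrable (fun x => 2 * B * (‖g x‖ ^ 2 * Real.exp (φ x))) volume := by
        refine Integrable.const_mul ?_ _
        simpa only [mul_comm] using gi
      have i2 : Integrable (fun x => 2 * M * (Er b q e s x ^ 2 * (Qs b q x + s) ^ Fintype.card ι)) volume := by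
        refine Integrable.const_mul (rad_integrable (b := b) (q := q) (e := e) ?_ fun x hx => by simp [Er_zero (b := b) (q := q) he hx]) _
        exact ((Er_cont (b := b) (q := q) he hs h1).pow 2).mul ((hQc.continuous.add continuous_const).pow _)
      rw [hI0, hJ]; simp only
      rw [← integral_const_mul, ← integral_const_mul, ← integral_add i1 i2]
      refine integral_mono_of_nonneg (Eventually.of_forall fun x => ?_) (i1.add i2) (Eventually.of_forall fun x => ?_)
      · have := hτ1 x; have := hAp x; show 0 ≤ _; positivity
      · show _ ≤ 2 * B * (‖g x‖ ^ 2 * Real.exp (φ x)) + 2 * M * (Er b q e s x ^ 2 * (Qs b q x + s) ^ Fintype.card ι)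
        simp only [hdiv]
        rw [Real.exp_add, hN2]
        have hT := hτ1 x; have hAx := hAp x; have hy := hQs x
        have a1 : ‖g x - (Er b q e s x : ℂ)‖ ^ 2 ≤ 2 * ‖g x‖ ^ 2 + 2 * Er b q e s x ^ 2 := by
          have := norm_add_sq_le (g x) (-(Er b q e s x : ℂ))
          rwa [← sub_eq_add_neg, norm_neg, Complex.norm_real, Real.norm_eq_abs, sq_abs] at this
        have a2 : (τ x + A x) * (Qs b q x + s) ^ N * ‖g x‖ ^ 2 ≤ B * ‖g x‖ ^ 2 := by
          by_cases hg0 : g x = 0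
          · simp [hg0]
          · gcongr
            exact htB x (gTF.2.2 (subset_tsupport _ hg0)).1 s hs h2
        have a3 : (τ x + A x) * Real.exp (φ x) * Er b q e s x ^ 2 ≤ M * Er b q e s x ^ 2 := by
          by_cases hg0 : Er b q e s x = 0
          · simp [hg0]
          · gcongr
            exact hM x (not_lt.1 fun hn => hg0 (Er_zero (b := b) (q := q) he hn))
        calc _ ≤ (τ x + A x) * (2 * ‖g x‖ ^ 2 + 2 * Er b q e s x ^ 2) * (Real.exp (φ x) * (Qs b q x + s) ^ N) := by gcongr
          _ = 2 * ((τ x + A x) * (Qs b q x + s) ^ N * ‖g x‖ ^ 2) * Real.exp (φ x) +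
            2 * ((τ x + A x) * Real.exp (φ x) * Er b q e s x ^ 2) * (Qs b q x + s) ^ N := by ring
          _ ≤ 2 * (B * ‖g x‖ ^ 2) * Real.exp (φ x) + 2 * (M * Er b q e s x ^ 2) * (Qs b q x + s) ^ N := by gcongr
          _ = _ := by ring
    have f0 : 0 ≤ ∫ x, ((τ x + A x) * ‖∑ j, dzb (b j) (w2 j) x‖ ^ 2) * Real.exp (φ x + N * Real.log (Qs b q x + s)) :=
      integral_nonneg fun x => by have := hτ1 x; have := hAp x; show 0 ≤ _; positivity
    have := hdu.trans (mul_le_mul f1 f2 f0 (by positivity))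
    linarith
  have hlim : κ ^ 2 ≤ 2 * (2 * Real.exp (-φ q) * vq b * I0) +
      2 * ((P0 * Real.exp (-φ q)) * (2 * B * I0 + 2 * M * 0)) := by
    have hJt : Tendsto J (𝓝[>] 0) (𝓝 0) := J_tendsto (b := b) (q := q) he
    refine ge_of_tendsto (f := fun s => 2 * (2 * Real.exp (-φ q) * vq b * I0) +
      2 * ((P0 * Real.exp (-φ q)) * (2 * B * I0 + 2 * M * J s)))
      (((((hJt.const_mul _).const_add _).const_mul _).const_mul _).const_add _) ?_
    have hs0 : 0 < min (1/2) (min d ((d / 2) ^ 2)) := by positivity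
    filter_upwards [Ioo_mem_nhdsGT hs0] with s hs
    have h1 := hs.2.le
    exact main s hs.1 (by linarith [h1.trans (min_le_left _ _)]) (h1.trans ((min_le_right _ _).trans (min_le_left _ _)))
      (h1.trans ((min_le_right _ _).trans (min_le_right _ _)))
  rw [div_mul_eq_mul_div, div_mul_eq_mul_div, one_le_div (by positivity)]
  linarith
end ot

section psh1
variable {E : Type*} [NormedAddCommGroup E] [NormedSpace ℂ E] [FiniteDimensional ℂ E] [MeasureSpace E] [BorelSpace E] [(volume : Measure E).IsAddHaarMeasure]

lemma snd_symm {F : E → ℂ} (hF : ContDiff ℝ ∞ F) (x u v : E) : fderiv ℝ (fderiv ℝ F) x u v = fderiv ℝ (fderiv ℝ F) x v u :=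
  (hF.contDiffAt.isSymmSndFDerivAt (by simp; exact WithTop.coe_le_coe.2 (le_top : (2:ℕ∞) ≤ ⊤))).eq u v

lemma fd_diff {F : E → ℂ} (hF : ContDiff ℝ ∞ F) (x : E) : DifferentiableAt ℝ (fderiv ℝ F) x :=
  ((hF.fderiv_right (m := ∞) (by simp)).differentiable (by simp)).differentiableAt

lemma taylor2 {F : E → ℂ} (hF : ContDiff ℝ ∞ F) (x : E) {ε : ℝ} (hε : 0 < ε) : ∃ δ > 0, ∀ h : E, ‖h‖ < δ →
    ‖F (x + h) - F x - fderiv ℝ F x h - (1 / 2 : ℝ) • fderiv ℝ (fderiv ℝ F) x h h‖ ≤ ε * ‖h‖ ^ 2 := by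
  set B := fderiv ℝ (fderiv ℝ F) x with hB
  have h1 := (hasFDerivAt_iff_isLittleO_nhds_zero.1 (fd_diff hF x).hasFDerivAt).bound hε
  obtain ⟨δ, hδ, h2⟩ := Metric.eventually_nhds_iff_ball.1 h1
  refine ⟨δ, hδ, fun h hh => ?_⟩
  set R : E → ℂ := fun h => F (x + h) - F x - fderiv ℝ F x h - (1 / 2 : ℝ) • B h h with hR
  have hd : ∀ y, HasFDerivAt R (fderiv ℝ F (x + y) - fderiv ℝ F x - B y) y := by
    intro y
    have a1 : HasFDerivAt (fun h => F (x + h)) (fderiv ℝ F (x + y)) y := by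
      have := (cdAt hF (x := x + y)).hasFDerivAt.comp y ((hasFDerivAt_id y).const_add x)
      exact this.congr_fderiv (by simp)
    have a2 : HasFDerivAt (fun h => B h h) (B y + B.flip y) y := by
      have := (B.hasFDerivAt (x := y)).clm_apply (hasFDerivAt_id y)
      exact this.congr_fderiv (by simp)
    have := ((a1.sub_const (F x)).sub (fderiv ℝ F x).hasFDerivAt).sub (a2.const_smul (1 / 2 : ℝ))
    refine this.congr_fderiv (ContinuousLinearMap.ext fun v => ?_)
    simp only [ContinuousLinearMap.sub_apply, ContinuousLinearMap.smul_apply, ContinuousLinearMap.add_apply, ContinuousLinearMap.flip_apply]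
    rw [hB, snd_symm hF x v y, ← two_smul ℝ, smul_smul]; norm_num
  have := (convex_closedBall (0:E) ‖h‖).norm_image_sub_le_of_norm_hasFDerivWithin_le (f := R) (C := ε * ‖h‖)
    (fun y hy => (hd y).hasFDerivWithinAt) (fun y hy => ?_) (mem_closedBall_self (norm_nonneg h)) (show h ∈ closedBall (0:E) ‖h‖ by simp)
  · have r0 : R 0 = 0 := by simp [hR]
    rw [r0, sub_zero, sub_zero] at this
    rw [pow_two, ← mul_assoc]; exact this
  · have hy' : ‖y‖ ≤ ‖h‖ := by simpa using hy
    refine (h2 y (by simpa using hy'.trans_lt hh)).trans ?_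
    gcongr

lemma DDm_smul_vec {f : E → ℂ} {x : E} (c : ℂ) (e : E) : DD (-I) (c • e) f x = c * DD (-I) e f x := by
  have h1 : c • e = c.re • e + c.im • (I • e) := by
    nth_rw 1 [← Complex.re_add_im c]
    rw [add_smul, mul_smul]; rfl
  have h2 : I • c • e = c.re • (I • e) - c.im • e := by
    rw [h1, smul_add, smul_comm I c.re, smul_comm I c.im, smul_smul I I, I_mul_I, neg_one_smul, smul_neg, sub_eq_add_neg]
  have h3 : c = c.re + c.im * I := (Complex.re_add_im c).symm
  rw [DD, h2, h1, DD]
  simp only [map_add, map_sub, map_smul, Complex.real_smul]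
  conv_rhs => rw [h3]
  linear_combination ((c.im:ℂ) / 2 * fderiv ℝ f x (I • e)) * I_mul_I

lemma DD_sum_vec {ι : Type*} [Fintype ι] {f : E → ℂ} {x : E} (c : ℂ) (e : ι → E) :
    DD c (∑ j, e j) f x = ∑ j, DD c (e j) f x := by
  simp only [DD, Finset.smul_sum, map_sum, Finset.mul_sum, ← Finset.sum_add_distrib, Finset.sum_div]

lemma LF_eq {ι : Type*} [Fintype ι] (e : ι → E) {u : E → ℝ} (hu : ContDiff ℝ ∞ u) (x : E) (ζ : ι → ℂ) :
    LF e u x ζ = (DD I (∑ j, ζ j • e j) (DD (-I) (∑ j, ζ j • e j) (fun y => (u y : ℂ))) x).re := by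
  have hF := contDiff_ofReal hu
  rw [LF, DD_comm hF, DD_sum_vec]
  congr 1
  refine Finset.sum_congr rfl fun j _ => ?_
  rw [DDm_smul_vec, DD_comm hF, DD_sum_vec, Finset.mul_sum]
  refine Finset.sum_congr rfl fun k _ => ?_
  rw [DD_smul_vec, Lev]; ring

lemma DD2 {F : E → ℂ} (hF : ContDiff ℝ ∞ F) (x v : E) : DD I v (DD (-I) v F) x =
    (fderiv ℝ (fderiv ℝ F) x v v + fderiv ℝ (fderiv ℝ F) x (I • v) (I • v)) / 4 := by
  have h1 : ∀ u : E, fderiv ℝ (DD (-I) v F) x u =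
      (fderiv ℝ (fderiv ℝ F) x u v + (-I) * fderiv ℝ (fderiv ℝ F) x u (I • v)) / 2 := by
    intro u
    have a1 : ∀ w, HasFDerivAt (fun y => fderiv ℝ F y w) ((fderiv ℝ (fderiv ℝ F) x).flip w) x := fun w =>
      by simpa using (fd_diff hF x).hasFDerivAt.clm_apply (hasFDerivAt_const w x)
    have a2 := ((a1 v).add ((a1 (I • v)).const_mul (-I))).mul_const (2:ℂ)⁻¹
    have a3 : HasFDerivAt (DD (-I) v F) _ x := a2.congr_of_eventuallyEq (Eventually.of_forall fun y => by
      simp [DD, div_eq_mul_inv])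
    rw [a3.fderiv]; simp; ring
  rw [DD, h1, h1, snd_symm hF x (I • v) v]
  linear_combination (-(1:ℂ) / 4 * fderiv ℝ (fderiv ℝ F) x (I • v) (I • v)) * I_mul_I

lemma circ_quad {x v : E} {F : E → ℂ} (hF : ContDiff ℝ ∞ F) {ε : ℝ} (hε : 0 < ε) : ∃ δ > 0, ∀ r : ℝ, 0 < r → r < δ →
    ‖(∫ θ in (0:ℝ)..(2 * Real.pi), F (x + Complex.exp (θ * I) • ((r:ℂ) • v))) - 2 * Real.pi * F x -
      2 * Real.pi * r ^ 2 * DD I v (DD (-I) v F) x‖ ≤ 2 * Real.pi * (ε * r ^ 2) := by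
  obtain ⟨δ, hδ, h⟩ := taylor2 hF x (show 0 < ε / (‖v‖ ^ 2 + 1) by positivity)
  set B := fderiv ℝ (fderiv ℝ F) x with hB
  have hex : ∀ (θ r : ℝ), Complex.exp (θ * I) • ((r:ℂ) • v) = (r * Real.cos θ) • v + (r * Real.sin θ) • (I • v) := by
    intro θ r
    rw [Complex.exp_mul_I, smul_smul, add_mul, add_smul, mul_right_comm, mul_smul _ I, ← ofReal_cos, ← ofReal_sin, ← ofReal_mul, ← ofReal_mul, mul_comm r, mul_comm r]
    rfl
  refine ⟨δ / (‖v‖ + 1), by positivity, fun r hr hrδ => ?_⟩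
  set γ : ℝ → E := fun θ => Complex.exp (θ * I) • ((r:ℂ) • v) with hγ
  have hγc : Continuous γ := by simp only [hγ]; fun_prop
  have hγn : ∀ θ, ‖γ θ‖ = r * ‖v‖ := fun θ => by
    simp [hγ, norm_smul, Complex.norm_exp_ofReal_mul_I, abs_of_pos hr]
  have hFc := hF.continuous
  have hI : ∫ θ in (0:ℝ)..(2 * Real.pi), (F (x + γ θ) - F x - fderiv ℝ F x (γ θ) - (1 / 2 : ℝ) • B (γ θ) (γ θ)) =
      (∫ θ in (0:ℝ)..(2 * Real.pi), F (x + γ θ)) - 2 * Real.pi * F x - 2 * Real.pi * r ^ 2 * DD I v (DD (-I) v F) x := by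
    have e1 : ∀ θ, fderiv ℝ F x (γ θ) = Real.cos θ * (r * fderiv ℝ F x v) + Real.sin θ * (r * fderiv ℝ F x (I • v)) := fun θ => by
      simp only [hγ, hex, map_add, map_smul, real_smul]; push_cast; ring
    have e2 : ∀ θ, (1 / 2 : ℝ) • B (γ θ) (γ θ) = (Real.cos θ ^ 2 : ℝ) * (r ^ 2 / 2 * B v v) + (Real.sin θ ^ 2 : ℝ) * (r ^ 2 / 2 * B (I • v) (I • v)) +
        (Real.sin θ * Real.cos θ : ℝ) * (r ^ 2 * B v (I • v)) := fun θ => by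
      have := snd_symm hF x (I • v) v
      rw [← hB] at this
      simp only [hγ, hex, map_add, map_smul, real_smul, ContinuousLinearMap.add_apply, ContinuousLinearMap.smul_apply, this]; push_cast; ring
    have ii : ∀ (f : ℝ → ℝ) (c : ℂ), Continuous f → IntervalIntegrable (fun θ => (f θ : ℂ) * c) volume 0 (2 * Real.pi) :=
      fun f c hf => by apply Continuous.intervalIntegrable; fun_prop
    have iv : ∀ (f : ℝ → ℝ) (c : ℂ), ∫ θ in (0:ℝ)..(2 * Real.pi), (f θ : ℂ) * c = ((∫ θ in (0:ℝ)..(2 * Real.pi), f θ : ℝ) : ℂ) * c := fun f c => by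
      rw [intervalIntegral.integral_mul_const, intervalIntegral.integral_ofReal]
    have c1 := iv Real.cos (r * fderiv ℝ F x v)
    have c2 := iv Real.sin (r * fderiv ℝ F x (I • v))
    have c3 := iv (fun θ => Real.cos θ ^ 2) (r ^ 2 / 2 * B v v)
    have c4 := iv (fun θ => Real.sin θ ^ 2) (r ^ 2 / 2 * B (I • v) (I • v))
    have c5 := iv (fun θ => Real.sin θ * Real.cos θ) (r ^ 2 * B v (I • v))
    have hs1 : ∫ θ in (0:ℝ)..(2 * Real.pi), fderiv ℝ F x (γ θ) = 0 := by
      simp only [e1]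
      rw [intervalIntegral.integral_add (ii _ _ Real.continuous_cos) (ii _ _ Real.continuous_sin), c1, c2]
      simp
    have hs2 : ∫ θ in (0:ℝ)..(2 * Real.pi), (1 / 2 : ℝ) • B (γ θ) (γ θ) = 2 * Real.pi * r ^ 2 * DD I v (DD (-I) v F) x := by
      simp only [e2]
      rw [intervalIntegral.integral_add ((ii (fun θ => Real.cos θ ^ 2) _ (by fun_prop)).add (ii (fun θ => Real.sin θ ^ 2) _ (by fun_prop)))
        (ii (fun θ => Real.sin θ * Real.cos θ) _ (by fun_prop)), intervalIntegral.integral_add (ii (fun θ => Real.cos θ ^ 2) _ (by fun_prop)) (ii (fun θ => Real.sin θ ^ 2) _ (by fun_prop)),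
        c3, c4, c5, DD2 hF]
      simp [integral_cos_sq, integral_sin_sq, integral_sin_mul_cos₁]
      ring
    have j1 : IntervalIntegrable (fun θ => F (x + γ θ)) volume 0 (2 * Real.pi) := by apply Continuous.intervalIntegrable; fun_prop
    have j2 : IntervalIntegrable (fun θ => fderiv ℝ F x (γ θ)) volume 0 (2 * Real.pi) := by apply Continuous.intervalIntegrable; fun_prop
    have j3 : IntervalIntegrable (fun θ => (1 / 2 : ℝ) • B (γ θ) (γ θ)) volume 0 (2 * Real.pi) := by
      simp only [e2]; apply Continuous.intervalIntegrable; fun_prop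
    rw [intervalIntegral.integral_sub ((j1.sub intervalIntegrable_const).sub j2) j3, intervalIntegral.integral_sub (j1.sub intervalIntegrable_const) j2,
      intervalIntegral.integral_sub j1 intervalIntegrable_const, hs1, hs2]
    simp
  rw [← hI]
  have hpi : (0:ℝ) ≤ 2 * Real.pi := by positivity
  have := intervalIntegral.norm_integral_le_of_norm_le_const (a := 0) (b := 2 * Real.pi) (C := ε * r ^ 2)
    (f := fun θ => F (x + γ θ) - F x - fderiv ℝ F x (γ θ) - (1 / 2 : ℝ) • B (γ θ) (γ θ)) (fun θ _ => ?_)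
  · rw [sub_zero, abs_of_nonneg hpi] at this; linarith
  · refine (h (γ θ) ?_).trans ?_
    · rw [hγn]
      calc r * ‖v‖ ≤ r * (‖v‖ + 1) := by gcongr; linarith
        _ < δ / (‖v‖ + 1) * (‖v‖ + 1) := by gcongr
        _ = δ := by field_simp
    · rw [hγn, mul_pow, div_mul_eq_mul_div, div_le_iff₀ (by positivity)]
      have : 0 ≤ ε * r ^ 2 := by positivity
      nlinarith

lemma LF_nonneg {ι : Type*} [Fintype ι] (e : ι → E) {u : E → ℝ} (hu : ContDiff ℝ ∞ u) (x : E) (ζ : ι → ℂ)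
    {η : ℝ} (hη : 0 < η) (h : ∀ v : E, ‖v‖ < η → u x ≤ (2 * Real.pi)⁻¹ * ∫ θ in (0:ℝ)..(2 * Real.pi), u (x + Complex.exp (θ * I) • v)) :
    0 ≤ LF e u x ζ := by
  rw [LF_eq e hu]
  set v := ∑ j, ζ j • e j
  have hF := contDiff_ofReal hu
  refine le_of_forall_pos_le_add fun ε hε => ?_
  obtain ⟨δ, hδ, h1⟩ := circ_quad (x := x) (v := v) hF hε
  set r := min (δ / 2) (η / (2 * (‖v‖ + 1)))
  have hr : 0 < r := by positivity
  have h2 := h1 r hr ((min_le_left _ _).trans_lt (by linarith))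
  have h3 := h ((r:ℂ) • v) (by
    rw [norm_smul, norm_real, Real.norm_eq_abs, abs_of_pos hr]
    calc r * ‖v‖ ≤ η / (2 * (‖v‖ + 1)) * ‖v‖ := by gcongr; exact min_le_right _ _
      _ < η := by rw [div_mul_eq_mul_div, div_lt_iff₀ (by positivity)]; have := norm_nonneg v; nlinarith)
  have hpi : 0 < 2 * Real.pi := by positivity
  rw [inv_mul_eq_div, le_div_iff₀ hpi] at h3
  rw [intervalIntegral.integral_ofReal] at h2
  have h4 := (Complex.re_le_norm _).trans h2
  have e3 : ∀ z : ℂ, (2 * (Real.pi : ℂ) * (r : ℂ) ^ 2 * z).re = 2 * Real.pi * r ^ 2 * z.re := fun z => by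
    rw [← re_ofReal_mul]; push_cast; rfl
  have e4 : (2 * (Real.pi : ℂ) * (u x : ℂ)).re = 2 * Real.pi * u x := by
    rw [← ofReal_re (2 * Real.pi * u x)]; push_cast; rfl
  rw [Complex.sub_re, Complex.sub_re, e3, e4, ofReal_re] at h4
  set L := (DD I v (DD (-I) v (fun y => (u y : ℂ))) x).re
  have : 2 * Real.pi * r ^ 2 * (L + ε) ≥ 0 := by nlinarith
  exact nonneg_of_mul_nonneg_right this (by positivity)
end psh1

section psh2
variable {E : Type*} [NormedAddCommGroup E] [NormedSpace ℂ E] [FiniteDimensional ℂ E] [MeasureSpace E] [BorelSpace E] [(volume : Measure E).IsAddHaarMeasure]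

lemma mol_circ {r M : ℝ} {ρ : E → ℝ} (h : Moll r ρ) {φ : E → ℝ} (hm : Measurable φ) (hb : ∀ x, |φ x| ≤ M) {x v : E}
    (hs : ∀ t, ‖t‖ ≤ r → φ (x - t) ≤ (2 * Real.pi)⁻¹ * ∫ θ in (0:ℝ)..(2 * Real.pi), φ (x - t + Complex.exp (θ * I) • v)) :
    mol ρ φ x ≤ (2 * Real.pi)⁻¹ * ∫ θ in (0:ℝ)..(2 * Real.pi), mol ρ φ (x + Complex.exp (θ * I) • v) := by
  have hpi : (0:ℝ) ≤ 2 * Real.pi := by positivity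
  simp_rw [intervalIntegral.integral_of_le hpi] at hs ⊢
  set ν := (volume : Measure ℝ).restrict (Ioc 0 (2 * Real.pi)) with hν
  have hρ := h.integrable
  have hρm := h.smooth.continuous.measurable
  have hi : Integrable (fun p : ℝ × E => ρ p.2 * φ (x - p.2 + Complex.exp (p.1 * I) • v)) (ν.prod volume) := by
    refine ((hρ.comp_snd ν).mul_const M).mono' ?_ (Eventually.of_forall fun p => ?_)
    · have c1 : Continuous (fun p : ℝ × E => x - p.2 + Complex.exp (p.1 * I) • v) := by fun_prop
      exact ((hρm.comp measurable_snd).mul (hm.comp c1.measurable)).aestronglyMeasurable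
    · rw [norm_mul, Real.norm_eq_abs, Real.norm_eq_abs, abs_of_nonneg (h.nonneg _)]
      exact mul_le_mul_of_nonneg_left (hb _) (h.nonneg _)
  have hi0 : Integrable (fun t => ρ t * φ (x - t)) volume := by
    refine (hρ.mul_const M).mono' ((hρm.mul (hm.comp (measurable_const.sub measurable_id))).aestronglyMeasurable) (Eventually.of_forall fun p => ?_)
    rw [norm_mul, Real.norm_eq_abs, Real.norm_eq_abs, abs_of_nonneg (h.nonneg _)]
    exact mul_le_mul_of_nonneg_left (hb _) (h.nonneg _)
  have e1 : ∀ θ : ℝ, mol ρ φ (x + Complex.exp (θ * I) • v) = ∫ t, ρ t * φ (x - t + Complex.exp (θ * I) • v) := fun θ => by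
    rw [mol_eq']; simp only [smul_eq_mul]
    congr 1; funext t; congr 2; abel
  simp only [e1]
  rw [integral_integral_swap (f := fun (θ : ℝ) (t : E) => ρ t * φ (x - t + Complex.exp (θ * I) • v)) hi, mol_eq', ← integral_const_mul]
  refine integral_mono hi0 (hi.integral_prod_right.const_mul _) fun t => ?_
  show ρ t * φ (x - t) ≤ (2 * Real.pi)⁻¹ * ∫ θ, ρ t * φ (x - t + Complex.exp (θ * I) • v) ∂ν
  rw [integral_const_mul]
  by_cases ht : ‖t‖ ≤ r
  · calc _ ≤ ρ t * ((2 * Real.pi)⁻¹ * ∫ θ, φ (x - t + Complex.exp (θ * I) • v) ∂ν) := mul_le_mul_of_nonneg_left (hs t ht) (h.nonneg t)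
      _ = _ := by ring
  · rw [h.supp t (not_le.1 ht)]; simp

variable {ι : Type*} [Fintype ι] (b : Module.Basis ι ℂ E)

def Exh (Ω : Set E) : Prop := ∀ K ⊆ Ω, IsCompact K → ∃ (V : Set E) (ψ : E → ℝ) (c : ℝ), IsOpen V ∧ IsCompact (closure V) ∧
  closure V ⊆ Ω ∧ ContDiff ℝ ∞ ψ ∧ (∀ x, 0 ≤ ψ x) ∧ (∀ x ∈ closure V, x ∉ V → 3 < ψ x) ∧ 0 < c ∧
  (∀ x ∈ V, ∀ ζ : ι → ℂ, c * ∑ j, ‖ζ j‖ ^ 2 ≤ LF b ψ x ζ) ∧ K ⊆ V ∩ {x | ψ x < 1}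

def Smean (Ω : Set E) (φ : E → ℝ) : Prop := ∀ x v : E, (∀ t : ℂ, ‖t‖ ≤ 1 → x + t • v ∈ Ω) →
  φ x ≤ (2 * Real.pi)⁻¹ * ∫ θ in (0:ℝ)..(2 * Real.pi), φ (x + Complex.exp (θ * I) • v)

lemma ot_psh [Nonempty ι] [DecidableEq ι] {R0 : ℝ} (hR : 0 < R0) : ∃ C > 0, ∀ (q : E) (Ω : Set E) (φ : E → ℝ)
    (e : ℝ) (w : ι → E → ℂ), IsOpen Ω → Exh b Ω → (∀ x ∈ Ω, Qs b q x < R0) → (∀ x ∈ Ω, 0 ≤ φ x) → UpperSemicontinuousOn φ Ω → Smean Ω φ →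
    0 < e → {x | Qs b q x ≤ e} ⊆ Ω → (∀ j, TF Ω (w j)) →
    1 ≤ C * Real.exp (-φ q) * ∫ x, ‖∑ j, dzb (b j) (w j) x + (kk b q e x : ℂ)‖ ^ 2 * Real.exp (φ x) := by
  obtain ⟨C, hC, hot⟩ := ot_smooth b hR
  refine ⟨C, hC, fun q Ω φ e w hΩ hex hΩR hφ0 hφu hφs he heΩ hw => ?_⟩
  have : ProperSpace E := FiniteDimensional.proper ℂ E
  set K := {x | Qs b q x ≤ e} ∪ ⋃ j, tsupport (w j) with hK
  have hKc : IsCompact K := (Qs_compact b q e).union (isCompact_iUnion fun j => (hw j).2.1)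
  have hKΩ : K ⊆ Ω := union_subset heΩ (iUnion_subset fun j => (hw j).2.2)
  obtain ⟨V, ψ, c, hVo, hVc, hVΩ, hψ, hψ0, hfr, hc, hLψ, hKV⟩ := hex K hKΩ hKc
  obtain ⟨r0, hr0, hT⟩ := hVc.exists_cthickening_subset_open hΩ hVΩ
  set T := cthickening r0 (closure V) with hTd
  have hTc : IsCompact T := hVc.cthickening
  have hTcl : IsClosed T := isClosed_cthickening
  have hVT : ∀ x ∈ V, ∀ y, dist y x ≤ r0 → y ∈ T := fun x hx y hy => mem_cthickening_of_dist_le y x r0 _ (subset_closure hx) hy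
  set φ' := indicator T φ with hφ'
  obtain ⟨M, hM⟩ : ∃ M, ∀ x, |φ' x| ≤ M := by
    obtain ⟨M, hM⟩ := UpperSemicontinuousOn.bddAbove_of_isCompact hTc (hφu.mono hT)
    refine ⟨max M 0, fun x => ?_⟩
    by_cases hx : x ∈ T
    · rw [hφ', indicator_of_mem hx, abs_of_nonneg (hφ0 x (hT hx))]
      exact (hM (mem_image_of_mem _ hx)).trans (le_max_left _ _)
    · simp [hφ', hx]
  have hφ'u : UpperSemicontinuous φ' := by
    intro x y hy
    by_cases hx : x ∈ T
    · have hy' : φ x < y := by simpa [hφ', hx] using hy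
      have h1 := (hΩ.mem_nhds (hT hx))
      have h2 := hφu x (hT hx) y hy'
      rw [hΩ.nhdsWithin_eq (hT hx)] at h2
      filter_upwards [h2] with z hz
      by_cases hzT : z ∈ T
      · simpa [hφ', hzT] using hz
      · simpa [hφ', hzT] using (hφ0 x (hT hx)).trans_lt hy'
    · filter_upwards [hTcl.isOpen_compl.mem_nhds hx] with z hz
      have : z ∉ T := hz
      simpa [hφ', this, hx] using hy
  have hφ'm : Measurable φ' := hφ'u.measurable
  have hloc : LocallyIntegrable φ' volume :=
    (locallyIntegrable_const M).mono hφ'm.aestronglyMeasurable (Eventually.of_forall fun x => by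
      simpa using (hM x).trans (le_abs_self M))
  have hφ'eq : ∀ x ∈ T, φ' x = φ x := fun x hx => by simp [hφ', hx]
  -- sub mean on V
  have hsm : ∀ x ∈ T, ∀ v : E, (∀ t : ℂ, ‖t‖ ≤ 1 → x + t • v ∈ T) →
      φ' x ≤ (2 * Real.pi)⁻¹ * ∫ θ in (0:ℝ)..(2 * Real.pi), φ' (x + Complex.exp (θ * I) • v) := fun x hx v hv => by
    have h1 := hφs x v fun t ht => hT (hv t ht)
    rw [hφ'eq x hx]
    refine h1.trans_eq ?_
    congr 1
    refine intervalIntegral.integral_congr fun θ _ => ?_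
    exact (hφ'eq _ (hv _ (Complex.norm_exp_ofReal_mul_I θ).le)).symm
  set g : E → ℂ := fun x => ∑ j, dzb (b j) (w j) x + (kk b q e x : ℂ) with hg
  have gTF : TF (V ∩ {x | ψ x < 1}) g := TF.add (TF.sum fun j => (show TF (V ∩ {x | ψ x < 1}) (w j) from
      ⟨(hw j).1, (hw j).2.1, (subset_iUnion (fun j => tsupport (w j)) j).trans (subset_union_right.trans hKV)⟩).DD I (b j))
    (TF_rad b q (subset_union_left.trans hKV) (contDiff_ofReal (kk_contDiff he)) fun x hx => by
      simp [kk_zero (b := b) (q := q) he (Or.inr hx)])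
  have hw' : ∀ j, TF (V ∩ {x | ψ x < 1}) (w j) := fun j =>
      ⟨(hw j).1, (hw j).2.1, (subset_iUnion (fun j => tsupport (w j)) j).trans (subset_union_right.trans hKV)⟩
  have hqV : q ∈ V := (hKV (Or.inl (show Qs b q q ≤ e by simp [Qs, QQ, he.le]))).1
  set rr : ℕ → ℝ := fun n => r0 / 2 / (n + 1) with hrr
  have hrp : ∀ n, 0 < rr n := fun n => by positivity
  have hrle : ∀ n, rr n ≤ r0 / 2 := fun n => div_le_self (by positivity) (by linarith [Nat.cast_nonneg (α := ℝ) n])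
  have hrt : Tendsto rr atTop (𝓝 0) := by
    have := (tendsto_one_div_add_atTop_nhds_zero_nat (𝕜 := ℝ)).const_mul (r0 / 2)
    simpa [hrr, div_eq_mul_inv] using this
  choose ρ hρ using fun n => exists_Moll (E := E) (rr n) (hrp n)
  have hmi : ∀ n x, Integrable (fun t => ρ n t * φ' (x - t)) volume := fun n x => by
    refine ((hρ n).integrable.mul_const M).mono' (((hρ n).smooth.continuous.measurable.mul (hφ'm.comp (measurable_const.sub measurable_id))).aestronglyMeasurable) (Eventually.of_forall fun p => ?_)
    rw [norm_mul, Real.norm_eq_abs, Real.norm_eq_abs, abs_of_nonneg ((hρ n).nonneg _)]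
    exact mul_le_mul_of_nonneg_left (hM _) ((hρ n).nonneg _)
  have hge : ∀ n, ∀ x ∈ V, φ x ≤ mol (ρ n) φ' x := fun n x hx => by
    have hxT := hVT x hx x (by simp [hr0.le])
    rw [← hφ'eq x hxT]
    refine mol_submean (hρ n) (hmi n x) fun t ht => ?_
    have := hsm x hxT (-t) fun s hs => hVT x hx _ (by
      rw [dist_eq_norm, add_sub_cancel_left, norm_smul, norm_neg]
      have := hrle n; nlinarith [norm_nonneg s, norm_nonneg t])
    simpa only [smul_neg, ← sub_eq_add_neg] using this
  have hle : ∀ n x (a : ℝ), (∀ y, dist y x ≤ rr n → φ' y ≤ a) → mol (ρ n) φ' x ≤ a := fun n x a ha => by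
    rw [mol_eq']
    have e1 : ∫ t, ρ n t * a = a := by rw [integral_mul_const, (hρ n).int, one_mul]
    rw [← e1]
    refine integral_mono (hmi n x) ((hρ n).integrable.mul_const a) fun t => ?_
    show ρ n t * φ' (x - t) ≤ ρ n t * a
    by_cases ht : ‖t‖ ≤ rr n
    · exact mul_le_mul_of_nonneg_left (ha _ (by simpa [dist_eq_norm] using ht)) ((hρ n).nonneg t)
    · rw [(hρ n).supp t (not_le.1 ht)]; simp
  have hL : ∀ n, ∀ x ∈ V, ∀ ζ : ι → ℂ, 0 ≤ LF b (mol (ρ n) φ') x ζ := fun n x hx ζ => by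
    refine LF_nonneg b (mol_contDiff (hρ n) hloc) x ζ (half_pos hr0) fun v hv => ?_
    refine mol_circ (hρ n) hφ'm hM fun t ht => ?_
    have h1 := hrle n
    refine hsm _ (hVT x hx _ (by simp [dist_eq_norm]; linarith)) v fun s hs => hVT x hx _ ?_
    rw [dist_eq_norm, show x - t + s • v - x = s • v - t by abel]
    refine (norm_sub_le _ _).trans ?_
    rw [norm_smul]; nlinarith [norm_nonneg s, norm_nonneg v]
  have hmain : ∀ n, 1 ≤ C * Real.exp (-φ q) * ∫ x, ‖g x‖ ^ 2 * Real.exp (mol (ρ n) φ' x) := fun n => by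
    refine (hot q V ψ (mol (ρ n) φ') c e w hVo hVc (fun x hx => hΩR x (hVΩ (subset_closure hx))) hψ hψ0 hfr hc hLψ
      (mol_contDiff (hρ n) hloc) (hL n) he (subset_union_left.trans hKV) hw').trans ?_
    refine mul_le_mul_of_nonneg_right ?_ (integral_nonneg fun x => by positivity)
    gcongr
    exact hge n q hqV
  have hlim : Tendsto (fun n => ∫ x, ‖g x‖ ^ 2 * Real.exp (mol (ρ n) φ' x)) atTop (𝓝 (∫ x, ‖g x‖ ^ 2 * Real.exp (φ x))) := by
    refine tendsto_integral_of_dominated_convergence (fun x => Real.exp M * ‖g x‖ ^ 2) (fun n => ?_) (gTF.cint continuous_const) (fun n => Eventually.of_forall fun x => ?_) (Eventually.of_forall fun x => ?_)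
    · exact ((gTF.1.continuous.norm.pow 2).mul (mol_contDiff (hρ n) hloc).continuous.rexp).aestronglyMeasurable
    · rw [norm_mul, Real.norm_eq_abs, Real.norm_eq_abs, Real.abs_exp, abs_of_nonneg (by positivity), mul_comm]
      gcongr
      exact hle n x M fun y _ => (le_abs_self _).trans (hM y)
    · by_cases hgx : g x = 0
      · simp [hgx]
      have hxV : x ∈ V := (gTF.2.2 (subset_tsupport _ hgx)).1
      refine Tendsto.const_mul _ ((Real.continuous_exp.tendsto _).comp ?_)
      have hxT := hVT x hxV x (by simp [hr0.le])
      refine tendsto_order.2 ⟨fun a ha => Eventually.of_forall fun n => ha.trans_le (hge n x hxV), fun a ha => ?_⟩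
      obtain ⟨a', h1, h2⟩ := exists_between ha
      have h3 := hφ'u x a' (by show φ' x < a'; rwa [hφ'eq x hxT])
      obtain ⟨δ, hδ, h4⟩ := Metric.eventually_nhds_iff_ball.1 h3
      filter_upwards [hrt.eventually (gt_mem_nhds hδ)] with n hn
      exact (hle n x a' fun y hy => (h4 y (hy.trans_lt hn)).le).trans_lt h2
  exact ge_of_tendsto (hlim.const_mul _) (Eventually.of_forall hmain)
end psh2

section pt
variable {E : Type*} [NormedAddCommGroup E] [NormedSpace ℂ E] [FiniteDimensional ℂ E] [MeasureSpace E] [BorelSpace E] [(volume : Measure E).IsAddHaarMeasure]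
variable {ι : Type*} [Fintype ι] (b : Module.Basis ι ℂ E)

def TS (Ω : Set E) : Submodule ℂ (ι → E → ℂ) where
  carrier := {w | ∀ j, TF Ω (w j)}
  add_mem' := fun h1 h2 j => (h1 j).add (h2 j)
  zero_mem' := fun j => TF.zero
  smul_mem' := fun c w h j => (h j).mul_left contDiff_const

noncomputable def TT (Ω : Set E) (k : E → ℂ) : (TS (ι := ι) Ω × ℂ) →ₗ[ℂ] (E → ℂ) where
  toFun p y := ∑ j, dzb (b j) (p.1.1 j) y + p.2 * k y
  map_add' p p' := by
    funext y
    have : ∀ j, dzb (b j) ((p + p').1.1 j) y = dzb (b j) (p.1.1 j) y + dzb (b j) (p'.1.1 j) y := fun j =>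
      DD_add (p.1.2 j).differentiableAt (p'.1.2 j).differentiableAt
    simp only [this, Finset.sum_add_distrib, Prod.snd_add, Pi.add_apply]; ring
  map_smul' c p := by
    funext y
    have : ∀ j, dzb (b j) ((c • p).1.1 j) y = c * dzb (b j) (p.1.1 j) y := fun j =>
      DD_const_mul c (p.1.2 j).differentiableAt
    simp only [this, Prod.smul_snd, Pi.smul_apply, smul_eq_mul, RingHom.id_apply, mul_add, Finset.mul_sum, mul_assoc]

lemma kk_mean [Nonempty ι] (q : E) {r : ℝ} (hr : 0 < r) : ∃ e > 0, {x | Qs b q x ≤ e} ⊆ closedBall q r ∧ 0 < ∫ x, kk b q e x ∧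
    ∀ F : E → ℂ, (∀ z ∈ closedBall q r, DifferentiableAt ℂ F z) → ∫ x, F x * kk b q e x = F q * (∫ x, kk b q e x : ℝ) := by
  obtain ⟨C, hC, hQ⟩ := QQ_bound b
  obtain ⟨e, he, hCe⟩ : ∃ e > 0, C * e = r ^ 2 := ⟨r ^ 2 / C, by positivity, by field_simp⟩
  have hin : ∀ x, QQ b x ≤ e → ‖x‖ ≤ r := fun x hx => (abs_le_of_sq_le_sq' ((hQ x).trans (by rw [← hCe]; gcongr)) hr.le).2
  obtain ⟨s, hs, hs1⟩ : ∃ s > 0, s < 1 ∧ s ≤ e ∧ s ≤ (e / 2) ^ 2 ∧ (e + 1) * s ≤ 1 := by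
    refine ⟨min (min (1/2) e) (min ((e/2)^2) (1 / (e+1))), by positivity, ?_, ?_, ?_, ?_⟩
    · exact ((min_le_left _ _).trans (min_le_left _ _)).trans_lt (by norm_num)
    · exact (min_le_left _ _).trans (min_le_right _ _)
    · exact (min_le_right _ _).trans (min_le_left _ _)
    · rw [mul_comm, ← le_div_iff₀ (by positivity)]; exact (min_le_right _ _).trans (min_le_right _ _)
  have hki : Integrable (kk b q e) volume := rad_integrable (kk_cont he) fun x hx => kk_zero he (Or.inr hx)
  have hκ : 0 < ∫ x, kk b q e x := by
    have h1 := ks_low (b := b) (q := q) he hs hs1.1 hs1.2.1 hs1.2.2.1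
    have h2 : ∫ x, ks b q e s x ≤ ∫ x, 2 * kk b q e x := integral_mono
      (rad_integrable (ks_cont hs) fun x hx => ks_zero he (Or.inr hx)) (hki.const_mul 2) fun x => ks_le he hs hs1.1 hs1.2.2.2 x
    rw [integral_const_mul] at h2
    have h3 : 0 < Fintype.card ι * vq b / (2 * 4 ^ Fintype.card ι) := by
      have := vq_pos b; have := Fintype.card_pos (α := ι); positivity
    linarith
  refine ⟨e, he, fun x hx => by rw [mem_closedBall, dist_eq_norm]; exact hin _ hx, hκ, fun F hF => ?_⟩
  set κ := ∫ x, kk b q e x with hκd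
  set ρ : E → ℝ := fun x => κ⁻¹ * kk b 0 e x with hρ
  have hk0 : ∀ x, kk b 0 e (q - x) = kk b q e x := fun x => by
    have : Qs b 0 (q - x) = Qs b q x := by
      have h := QQ_smul b (-1) (x - q)
      simp only [Qs, sub_zero]; simpa using h
    simp only [kk, this]
  have hM : Moll r ρ := by
    refine ⟨contDiff_const.mul (kk_contDiff he), fun x => mul_nonneg (inv_nonneg.2 hκ.le) (kk_nonneg he x), ?_, fun x hx => ?_, fun c x hc => ?_⟩
    · rw [hρ, integral_const_mul, ← integral_sub_left_eq_self _ _ q]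
      simp only [hk0, ← hκd]; exact inv_mul_cancel₀ hκ.ne'
    · rw [hρ]; simp only
      rw [kk_zero he (Or.inr ?_), mul_zero]
      by_contra hh
      exact absurd (hin x (by simpa [Qs] using hh)) (not_le.2 hx)
    · have : Qs b 0 (c • x) = Qs b 0 x := by simp [Qs, QQ_smul, hc]
      simp only [hρ, kk, this]
  have hint : ∀ u : E → ℂ, mol ρ u q = (κ⁻¹ : ℝ) * ∫ x, u x * kk b q e x := fun u => by
    rw [mol_apply_kernel, ← integral_const_mul]
    congr 1; funext t; simp only [hρ, hk0]; push_cast; ring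
  have hκ' : (κ : ℂ) ≠ 0 := by exact_mod_cast hκ.ne'
  have h := mol_mean hM hF
  rw [hint] at h; rw [← h]; push_cast; field_simp

lemma ext_pt [Nonempty ι] {R0 : ℝ} (hR : 0 < R0) {q : E} {Ω : Set E} (hΩ : IsOpen Ω) (hq : q ∈ Ω) (hex : Exh b Ω)
    (hΩR : ∀ x ∈ Ω, Qs b q x < R0) : ∃ C > 0, ∀ φ : E → ℝ, (∀ x ∈ Ω, 0 ≤ φ x) → UpperSemicontinuousOn φ Ω → Smean Ω φ →
    ∃ f : E → ℂ, DifferentiableOn ℂ f Ω ∧ f q = 1 ∧ ∀ G ⊆ Ω, MeasurableSet G → (∀ x ∈ G, φ x = 0) →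
      ∫⁻ x in G, (‖f x‖₊ : ℝ≥0∞) ^ 2 ≤ ENNReal.ofReal (C * Real.exp (-φ q)) := by
  classical
  have : ProperSpace E := FiniteDimensional.proper ℂ E
  obtain ⟨C, hC, hot⟩ := ot_psh b hR
  obtain ⟨r, hr, hrΩ⟩ := Metric.nhds_basis_closedBall.mem_iff.1 (hΩ.mem_nhds hq)
  obtain ⟨e, he, hek, hκ, hmean⟩ := kk_mean b q hr
  have heΩ := hek.trans hrΩ
  set κ := ∫ x, kk b q e x with hκd
  refine ⟨κ ^ 2 * C, by positivity, fun φ hφ0 hφu hφs => ?_⟩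
  set Θ := indicator Ω φ with hΘd
  have hΘe : ∀ x ∈ Ω, Θ x = φ x := fun x hx => indicator_of_mem hx _
  have hΘm : Measurable Θ := by
    refine measurable_of_Iio fun a => ?_
    have h1 : IsOpen {x | x ∈ Ω ∧ φ x < a} := isOpen_iff_mem_nhds.2 fun x hx => by
      have := hφu x hx.1 a hx.2
      rw [hΩ.nhdsWithin_eq hx.1] at this
      filter_upwards [this, hΩ.mem_nhds hx.1] with z h1 h2 using ⟨h2, h1⟩
    have h2 : Θ ⁻¹' Iio a = {x | x ∈ Ω ∧ φ x < a} ∪ (Ωᶜ ∩ {x | (0:ℝ) < a}) := by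
      ext x; by_cases hx : x ∈ Ω <;> simp [hΘd, hx]
    rw [h2]
    exact h1.measurableSet.union (hΩ.measurableSet.compl.inter (MeasurableSet.const _))
  have hbd : ∀ K ⊆ Ω, IsCompact K → ∃ M, ∀ x ∈ K, Θ x ≤ M := fun K hK hKc => by
    obtain ⟨M, hM⟩ := UpperSemicontinuousOn.bddAbove_of_isCompact hKc (hφu.mono hK)
    exact ⟨M, fun x hx => by rw [hΘe x (hK hx)]; exact hM (mem_image_of_mem _ hx)⟩
  have hkTF : TF Ω (fun x => (kk b q e x : ℂ)) := TF_rad b q heΩ (contDiff_ofReal (kk_contDiff he)) fun x hx => by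
      simp [kk_zero (b := b) (q := q) he (Or.inr hx)]
  have hTTF : ∀ p, TF Ω (TT b Ω (fun x => (kk b q e x : ℂ)) p) := fun p =>
    (TF.sum fun j => (p.1.2 j).DD I (b j)).add (hkTF.mul_left contDiff_const)
  have hTm : ∀ p, MemLp (fun y => TT b Ω (fun x => (kk b q e x : ℂ)) p y * (Real.exp (Θ y / 2) : ℝ)) 2 volume := fun p => by
    obtain ⟨M, hM⟩ := hbd _ (hTTF p).2.2 (hTTF p).2.1
    refine (hTTF p).memLp.of_le_mul (c := Real.exp (M / 2)) (((hTTF p).1.continuous.measurable.mul (Complex.measurable_ofReal.comp (Real.measurable_exp.comp (hΘm.div_const 2)))).aestronglyMeasurable) (Eventually.of_forall fun y => ?_)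
    rw [norm_mul, mul_comm]
    by_cases hy : y ∈ tsupport (TT b Ω (fun x => (kk b q e x : ℂ)) p)
    · gcongr
      rw [Complex.norm_real, Real.norm_eq_abs, Real.abs_exp]
      gcongr; exact hM y hy
    · simp [image_eq_zero_of_notMem_tsupport hy]
  obtain ⟨u, hu1, hu2, hu3⟩ := riesz_L2 (TT b Ω (fun x => (kk b q e x : ℂ))) (LinearMap.snd ℂ _ _) hΘm hTm
    (M := C * Real.exp (-φ q)) (by positivity) (fun p => by
      by_cases ha : p.2 = 0
      · simp only [LinearMap.snd_apply, ha, norm_zero]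
        have : 0 ≤ ∫ y, ‖TT b Ω (fun x => (kk b q e x : ℂ)) p y‖ ^ 2 * Real.exp (Θ y) := integral_nonneg fun y => by positivity
        simp only [ne_eq, OfNat.ofNat_ne_zero, not_false_eq_true, zero_pow]; positivity
      have h1 := hot q Ω φ e (fun j y => p.2⁻¹ * p.1.1 j y) hΩ hex hΩR hφ0 hφu hφs he heΩ (fun j => (p.1.2 j).mul_left contDiff_const)
      have h2 : ∀ x, ‖∑ j, dzb (b j) (fun y => p.2⁻¹ * p.1.1 j y) x + (kk b q e x : ℂ)‖ ^ 2 * Real.exp (φ x) =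
          (‖p.2‖ ^ 2)⁻¹ * (‖TT b Ω (fun x => (kk b q e x : ℂ)) p x‖ ^ 2 * Real.exp (Θ x)) := fun x => by
        have e1 : ∑ j, dzb (b j) (fun y => p.2⁻¹ * p.1.1 j y) x + (kk b q e x : ℂ) = p.2⁻¹ * TT b Ω (fun x => (kk b q e x : ℂ)) p x := by
          simp only [TT, LinearMap.coe_mk, AddHom.coe_mk, mul_add, Finset.mul_sum]
          congr 1
          · exact Finset.sum_congr rfl fun j _ => DD_const_mul _ (p.1.2 j).differentiableAt
          · field_simp
        rw [e1, norm_mul, norm_inv, mul_pow, inv_pow, mul_assoc]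
        by_cases hx : x ∈ Ω
        · rw [hΘe x hx]
        · rw [image_eq_zero_of_notMem_tsupport (f := TT b Ω (fun x => (kk b q e x : ℂ)) p) fun h => hx ((hTTF p).2.2 h)]; simp
      simp only [h2] at h1
      rw [integral_const_mul] at h1
      have hp : 0 < ‖p.2‖ ^ 2 := by positivity
      calc ‖p.2‖ ^ 2 = ‖p.2‖ ^ 2 * 1 := (mul_one _).symm
        _ ≤ _ := mul_le_mul_of_nonneg_left h1 hp.le
        _ = _ := by field_simp)
  have hum : AEStronglyMeasurable u volume := by
    have : u = fun y => (u y * (Real.exp (-Θ y / 2) : ℝ)) * (Real.exp (Θ y / 2) : ℝ) := by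
      funext y; rw [mul_assoc, ← Complex.ofReal_mul, ← Real.exp_add]; simp [neg_div]
    rw [this]
    exact hu1.1.mul (Complex.measurable_ofReal.comp (Real.measurable_exp.comp (hΘm.div_const 2))).aestronglyMeasurable
  obtain ⟨F, hF, hFu⟩ := weyl b hΩ (f := u) (fun x hx => by
      obtain ⟨δ, hδ, hδΩ⟩ := Metric.nhds_basis_closedBall.mem_iff.1 (hΩ.mem_nhds hx)
      obtain ⟨M, hM⟩ := hbd _ hδΩ (isCompact_closedBall _ _)
      refine ⟨δ, hδ, hu1.of_le_mul (c := Real.exp (M / 2)) (hum.indicator measurableSet_ball) (Eventually.of_forall fun y => ?_)⟩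
      by_cases hy : y ∈ ball x δ
      · rw [indicator_of_mem hy, norm_mul, Complex.norm_real, Real.norm_eq_abs, Real.abs_exp, mul_left_comm, ← Real.exp_add]
        refine le_mul_of_one_le_right (norm_nonneg _) (Real.one_le_exp ?_)
        linarith [hM y (ball_subset_closedBall hy)]
      · rw [indicator_of_notMem hy, norm_zero]; positivity) (fun g hg j => by
      have h1 := hu3 (⟨Pi.single j g, fun i => by
        by_cases h : i = j
        · subst h; simpa using hg
        · rw [Pi.single_eq_of_ne h]; exact TF.zero⟩, 0)
      rw [LinearMap.snd_apply] at h1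
      refine Eq.trans ?_ h1.symm; congr 1; funext y; congr 1
      simp only [TT, LinearMap.coe_mk, AddHom.coe_mk, zero_mul, add_zero]
      rw [Finset.sum_eq_single j (fun i _ hi => ?_) (by simp)]
      · simp
      · rw [Pi.single_eq_of_ne hi]; exact DD_const)
  have hFq : F q * κ = 1 := by
    rw [← hmean F fun z hz => hF.differentiableAt (hΩ.mem_nhds (hrΩ hz))]
    have h1 := hu3 (0, 1)
    rw [LinearMap.snd_apply] at h1
    rw [show (1:ℂ) = _ from h1]
    refine integral_congr_ae (hFu.mono fun x hx => ?_)
    have : TT b Ω (fun x => (kk b q e x : ℂ)) (0, 1) x = kk b q e x := by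
      have : ∀ j, dzb (b j) (0 : E → ℂ) x = 0 := fun j => DD_const
      simp [TT, this]
    simp only [this]
    by_cases h : x ∈ Ω
    · rw [hx h]
    · rw [image_eq_zero_of_notMem_tsupport (f := fun x => (kk b q e x : ℂ)) fun h' => h (hkTF.2.2 h')]; simp
  refine ⟨fun x => κ * F x, hF.const_mul _, (mul_comm _ _).trans hFq, fun G hG hGm hG0 => ?_⟩
  have h1 : ∫⁻ x in G, (‖(κ : ℂ) * F x‖₊ : ℝ≥0∞) ^ 2 ≤ ∫⁻ x, ENNReal.ofReal (κ ^ 2 * (‖u x‖ ^ 2 * Real.exp (-Θ x))) := by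
    refine (lintegral_mono_ae ((ae_restrict_iff' hGm).2 (hFu.mono fun x hx hxG => ?_))).trans (setLIntegral_le_lintegral G _)
    rw [hx (hG hxG), hΘe x (hG hxG), hG0 x hxG, ← enorm_eq_nnnorm, ← ofReal_norm, ← ENNReal.ofReal_pow (norm_nonneg _), norm_mul, mul_pow,
      Complex.norm_real, Real.norm_eq_abs, sq_abs]
    simp
  refine h1.trans ?_
  rw [← ofReal_integral_eq_lintegral_ofReal]
  · rw [integral_const_mul, mul_assoc]
    exact ENNReal.ofReal_le_ofReal (by gcongr)
  · refine Integrable.const_mul ?_ _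
    have := hu1.integrable_norm_pow (by norm_num)
    refine this.congr (Eventually.of_forall fun x => ?_)
    simp only [norm_mul, Complex.norm_real, Real.norm_eq_abs, Real.abs_exp, mul_pow, ENNReal.toReal_ofNat, ← Real.exp_nat_mul]
    congr 2; push_cast; ring
  · exact Eventually.of_forall fun x => by positivity

end pt

section ct
section gen
variable {E : Type*} [NormedAddCommGroup E] [NormedSpace ℂ E] [FiniteDimensional ℂ E] [MeasureSpace E] [BorelSpace E] [(volume : Measure E).IsAddHaarMeasure]

lemma fd_hol {Ω : Set E} (hΩ : IsOpen Ω) {f : E → ℂ} (hf : DifferentiableOn ℂ f Ω) (v : E) :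
    DifferentiableOn ℂ (fun z => fderiv ℂ f z v) Ω := by
  intro x hx
  refine DifferentiableAt.differentiableWithinAt ?_
  have hc := hol_contDiffAt hΩ hf hx
  have hev : ∀ᶠ y in 𝓝 x, ∀ w, fderiv ℂ f y w = fderiv ℝ f y w := by
    filter_upwards [hΩ.mem_nhds hx] with y hy w
    rw [((hf.differentiableAt (hΩ.mem_nhds hy)).hasFDerivAt.restrictScalars ℝ).fderiv]; rfl
  have hd : DifferentiableAt ℝ (fderiv ℝ f) x := (hc.fderiv_right (m := 1) (by norm_cast)).differentiableAt (by norm_num)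
  have hs := hc.isSymmSndFDerivAt (by simp; norm_cast)
  have e1 : ∀ w, (fun z => fderiv ℂ f z w) =ᶠ[𝓝 x] fun z => fderiv ℝ f z w := fun w => hev.mono fun y hy => hy w
  have e2 : ∀ w u, fderiv ℝ (fun z => fderiv ℝ f z w) x u = fderiv ℝ (fderiv ℝ f) x u w := fun w u => by
    rw [fderiv_clm_apply hd (differentiableAt_const w)]; simp
  refine DifferentiableAt.congr_of_eventuallyEq ?_ (e1 v)
  have hdv : ∀ w, DifferentiableAt ℝ (fun z => fderiv ℝ f z w) x := fun w => hd.clm_apply (differentiableAt_const w)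
  refine hol_of_dzb (Module.finBasis ℂ E) (hdv v) fun j => ?_
  set e := Module.finBasis ℂ E j
  have e3 : (fun z => fderiv ℝ f z (I • e)) =ᶠ[𝓝 x] fun z => I * fderiv ℝ f z e := hev.mono fun y hy => by
    simp only [← hy, map_smul, smul_eq_mul]
  have e4 : fderiv ℝ (fderiv ℝ f) x v (I • e) = I * fderiv ℝ (fderiv ℝ f) x v e := by
    rw [← e2, e3.fderiv_eq, fderiv_const_mul (hdv e), ← e2]; simp
  rw [dzb, DD, e2, e2, hs (I • e) v, e4, hs e v, ← mul_assoc, I_mul_I]; ring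

lemma hol_tsum {a : E} {r r' : ℝ} (hr : r < r') {f : ℕ → E → ℂ} {u : ℕ → ℝ} (hu : Summable u)
    (hf : ∀ k, DifferentiableOn ℂ (f k) (ball a r')) (hb : ∀ k, ∀ x ∈ ball a r', ‖f k x‖ ≤ u k) :
    DifferentiableOn ℂ (fun x => ∑' k, f k x) (ball a r) := by
  have hs : ∀ x ∈ ball a r, ball x (r' - r) ⊆ ball a r' := fun x hx => ball_subset_ball' (by have := mem_ball.1 hx; linarith)
  have hsub : ball a r ⊆ ball a r' := ball_subset_ball hr.le
  intro x hx
  refine (hasFDerivAt_tsum_of_isPreconnected (u := fun k => 2 * u k / (r' - r)) (f' := fun k x => fderiv ℂ (f k) x) (x₀ := x)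
    ((hu.mul_left 2).div_const _) isOpen_ball (convex_ball a r).isPreconnected
    (fun k y hy => ((hf k).differentiableAt (isOpen_ball.mem_nhds (hsub hy))).hasFDerivAt) (fun k y hy => ?_) hx
    (Summable.of_norm_bounded hu fun k => hb k x (hsub hx)) hx).differentiableAt.differentiableWithinAt
  refine Complex.norm_fderiv_le_div_of_mapsTo_ball ((hf k).mono (hs y hy)) (fun z hz => ?_) (by linarith)
  rw [mem_closedBall, dist_eq_norm]
  refine (norm_sub_le _ _).trans ?_
  linarith [hb k z (hs y hy hz), hb k y (hsub hy)]
end gen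

variable {n : ℕ}
instance haar_prod {n m : ℕ} : (volume : Measure ((Fin n → ℂ) × (Fin m → ℂ))).IsAddHaarMeasure :=
  Measure.prod.instIsAddHaarMeasure (volume : Measure (Fin n → ℂ)) (volume : Measure (Fin m → ℂ))
noncomputable def gk (f : (Fin n → ℂ) → ℂ) : ℕ → (Fin n → ℂ) × (Fin n → ℂ) → ℂ
  | 0 => fun p => f p.1
  | k + 1 => fun p => fderiv ℂ (gk f k) p (p.2, 0)

lemma gk_hol {Ω : Set (Fin n → ℂ)} (hΩ : IsOpen Ω) {f : (Fin n → ℂ) → ℂ} (hf : DifferentiableOn ℂ f Ω) (k : ℕ) :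
    DifferentiableOn ℂ (gk f k) (Ω ×ˢ univ) := by
  induction k with
  | zero => exact hf.comp differentiableOn_fst fun p hp => hp.1
  | succ k ih =>
    have : gk f (k + 1) = fun p => ∑ j, p.2 j * fderiv ℂ (gk f k) p (Pi.single j 1, 0) := by
      funext p
      have : (p.2, (0 : Fin n → ℂ)) = ∑ j, p.2 j • ((Pi.single j 1, 0) : (Fin n → ℂ) × (Fin n → ℂ)) := by
        refine Prod.ext ?_ ?_
        · simp only [Prod.fst_sum, Prod.smul_fst]; exact pi_eq_sum_univ' p.2
        · simp [Prod.snd_sum]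
      show fderiv ℂ (gk f k) p (p.2, 0) = _
      rw [this, map_sum]; simp only [map_smul, smul_eq_mul]
    rw [this]
    refine DifferentiableOn.fun_sum fun j _ => DifferentiableOn.mul ?_ (fd_hol (hΩ.prod isOpen_univ) ih _)
    have : Differentiable ℂ (fun p : (Fin n → ℂ) × (Fin n → ℂ) => p.2 j) := by fun_prop
    exact this.differentiableOn

lemma gk_line {Ω : Set (Fin n → ℂ)} (hΩ : IsOpen Ω) {f : (Fin n → ℂ) → ℂ} (hf : DifferentiableOn ℂ f Ω) (z v : Fin n → ℂ) (k : ℕ) :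
    ∀ t : ℂ, z + t • v ∈ Ω → iteratedDeriv k (fun t : ℂ => f (z + t • v)) t = gk f k (z + t • v, v) := by
  induction k with
  | zero => intro t _; simp [gk]
  | succ k ih =>
    intro t ht
    rw [iteratedDeriv_succ]
    have ho : IsOpen {t : ℂ | z + t • v ∈ Ω} := hΩ.preimage (by fun_prop)
    have : iteratedDeriv k (fun t : ℂ => f (z + t • v)) =ᶠ[𝓝 t] fun t => gk f k (z + t • v, v) := by
      filter_upwards [ho.mem_nhds ht] with s hs using ih s hs
    rw [this.deriv_eq]
    have h1 : HasDerivAt (fun t : ℂ => ((z + t • v, v) : (Fin n → ℂ) × (Fin n → ℂ))) (v, 0) t := by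
      refine HasDerivAt.prodMk ?_ (hasDerivAt_const _ _)
      simpa using ((hasDerivAt_id t).smul_const v).const_add z
    have h2 := ((gk_hol hΩ hf k).differentiableAt ((hΩ.prod isOpen_univ).mem_nhds (show (z + t • v, v) ∈ Ω ×ˢ univ from ⟨ht, trivial⟩))).hasFDerivAt
    exact (h2.comp_hasDerivAt t h1).deriv

lemma cartan {D : Set (Fin n → ℂ)} (hD : IsOpen D) (hL : IsL2hDomainOfHolomorphy D) {K : Set (Fin n → ℂ)} {δ : ℝ} (hδ : 0 < δ)
    (hK : IsCompact K) (hKD : cthickening (2 * δ) K ⊆ D) {a : Fin n → ℂ} (ha : a ∈ D)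
    (hull : ∀ f : (Fin n → ℂ) → ℂ, DifferentiableOn ℂ f D → ∀ c, 0 ≤ c → (∀ y ∈ K, ‖f y‖ ≤ c) → ‖f a‖ ≤ c) : ball a (δ / 2) ⊆ D := by
  by_contra hcon
  obtain ⟨ε, hε, hεD⟩ := Metric.isOpen_iff.1 hD a ha
  refine hL ⟨ball a (min ε (δ / 2)), ball a (δ / 2), isOpen_ball, (convex_ball _ _).isConnected (nonempty_ball.2 (by positivity)), isOpen_ball,
    (convex_ball _ _).isConnected (nonempty_ball.2 (by positivity)), subset_inter (ball_subset_ball (min_le_right _ _)) ((ball_subset_ball (min_le_left _ _)).trans hεD), hcon, fun f hf => ?_⟩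
  have hf := hf.1
  obtain ⟨M, hM⟩ := (hK.cthickening (r := 2 * δ)).exists_bound_of_continuousOn (hf.continuousOn.mono hKD)
  have hlin : ∀ v : Fin n → ℂ, ‖v‖ ≤ δ → ∀ y ∈ K, ∀ t ∈ closedBall (0:ℂ) 2, y + t • v ∈ cthickening (2 * δ) K := fun v hv y hy t ht => by
    refine mem_cthickening_of_dist_le _ y _ _ hy ?_
    rw [dist_eq_norm, add_sub_cancel_left, norm_smul]
    have : ‖t‖ ≤ 2 := by simpa using ht
    nlinarith [norm_nonneg t, norm_nonneg v]
  have hbd : ∀ k, ∀ v : Fin n → ℂ, ‖v‖ ≤ δ → ‖((k.factorial : ℂ))⁻¹ * gk f k (a, v)‖ ≤ |M| * (1 / 2) ^ k := fun k v hv => by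
    have h1 := hull (fun z => gk f k (z, v)) ((gk_hol hD hf k).comp (by fun_prop) fun z hz => ⟨hz, trivial⟩) (k.factorial * |M| / 2 ^ k) (by positivity)
      fun y hy => by
        have hs := hlin v hv y hy
        have hd : DifferentiableOn ℂ (fun t : ℂ => f (y + t • v)) (closedBall 0 2) := hf.comp (by fun_prop) fun t ht => hKD (hs t ht)
        have h2 := Complex.norm_iteratedDeriv_le_of_forall_mem_sphere_norm_le (c := 0) (R := 2) (C := |M|) (f := fun t : ℂ => f (y + t • v)) k (by norm_num)
          (DifferentiableOn.diffContOnCl (by rw [closure_ball _ (by norm_num)]; exact hd))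
          fun t ht => (hM _ (hs t (sphere_subset_closedBall ht))).trans (le_abs_self M)
        rw [gk_line hD hf y v k 0 (hKD (hs 0 (by simp)))] at h2
        simpa using h2
    rw [norm_mul, norm_inv, Complex.norm_natCast, inv_mul_le_iff₀ (by positivity)]
    refine h1.trans_eq ?_
    rw [one_div, inv_pow]; ring
  refine ⟨fun x => ∑' k, ((k.factorial : ℂ))⁻¹ * gk f k (a, x - a), ?_, fun x hx => ?_⟩
  · refine hol_tsum (half_lt_self hδ) (summable_geometric_two.mul_left |M|) (fun k => ?_) fun k x hx => hbd k _ (by rw [← dist_eq_norm]; exact (mem_ball.1 hx).le)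
    refine DifferentiableOn.const_mul ((gk_hol hD hf k).comp (by fun_prop) fun z hz => ⟨ha, trivial⟩) _
  · have hx' : ‖x - a‖ < ε := by rw [← dist_eq_norm]; exact (mem_ball.1 hx).trans_le (min_le_left _ _)
    obtain ⟨s, hs1, hs⟩ : ∃ s > 1, s * ‖x - a‖ < ε := by
      by_cases h0 : ‖x - a‖ = 0
      · exact ⟨2, by norm_num, by simpa [h0] using hε⟩
      have : 1 < ε / ‖x - a‖ := by rwa [one_lt_div (by positivity)]
      obtain ⟨s, h1, h2⟩ := exists_between this
      exact ⟨s, h1, by rwa [lt_div_iff₀ (by positivity)] at h2⟩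
    have hd : DifferentiableOn ℂ (fun t : ℂ => f (a + t • (x - a))) (ball 0 s) := hf.comp (by fun_prop) fun t ht => hεD (by
      rw [mem_ball, dist_eq_norm, add_sub_cancel_left, norm_smul]
      have : ‖t‖ < s := by simpa using ht
      nlinarith [norm_nonneg t, norm_nonneg (x - a)])
    have h1 := Complex.taylorSeries_eq_on_ball' (c := 0) (z := 1) (by simpa using hs1) hd
    simp only [sub_zero, one_pow, mul_one, one_smul, add_sub_cancel] at h1
    show ∑' k, ((k.factorial : ℂ))⁻¹ * gk f k (a, x - a) = f x
    rw [← h1]; congr 1; funext k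
    rw [gk_line hD hf a (x - a) k 0 (by simpa using ha)]; simp
end ct

def HC {E : Type*} [NormedAddCommGroup E] [NormedSpace ℂ E] (Ω : Set E) : Prop := ∀ K ⊆ Ω, IsCompact K → ∃ V : Set E, IsOpen V ∧ K ⊆ V ∧
  IsCompact (closure V) ∧ closure V ⊆ Ω ∧ ∀ x ∈ closure V, x ∉ V →
  ∃ f : E → ℂ, DifferentiableOn ℂ f Ω ∧ ∃ c, 0 ≤ c ∧ (∀ y ∈ K, ‖f y‖ ≤ c) ∧ c < ‖f x‖

lemma HC_dom {n : ℕ} {D : Set (Fin n → ℂ)} (hD : IsOpen D) (hL : IsL2hDomainOfHolomorphy D) (hb : Bornology.IsBounded D) : HC D := by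
  intro K hKD hK
  obtain ⟨δ', hδ', hKδ⟩ := hK.exists_cthickening_subset_open hD hKD
  obtain ⟨δ, rfl⟩ : ∃ δ, δ' = 2 * δ := ⟨δ' / 2, by ring⟩
  have hδ : 0 < δ := by linarith
  set S : Set (Fin n → ℂ) := {a | a ∈ D ∧ ∀ f : (Fin n → ℂ) → ℂ, DifferentiableOn ℂ f D → ∀ c, 0 ≤ c → (∀ y ∈ K, ‖f y‖ ≤ c) → ‖f a‖ ≤ c} with hS
  have hKS : K ⊆ S := fun a ha => ⟨hKD ha, fun f _ c _ h => h a ha⟩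
  have hSV : S ⊆ thickening (δ / 4) S := self_subset_thickening (by positivity) S
  have hcl : closure (thickening (δ / 4) S) ⊆ D := by
    intro x hx
    have : x ∈ thickening (δ / 2) S := (closure_thickening_subset_cthickening _ _).trans (cthickening_subset_thickening' (by positivity) (by linarith) _) hx
    obtain ⟨a, ha, hd⟩ := mem_thickening_iff.1 this
    exact cartan hD hL hδ hK hKδ ha.1 ha.2 hd
  refine ⟨thickening (δ / 4) S, isOpen_thickening, hKS.trans hSV, Metric.isCompact_of_isClosed_isBounded isClosed_closure (hb.subset hcl), hcl, fun x hx hxV => ?_⟩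
  have : x ∉ S := fun h => hxV (hSV h)
  simp only [hS, mem_setOf_eq, not_and] at this
  have := this (hcl hx)
  push Not at this
  obtain ⟨f, hf, c, hc, h1, h2⟩ := this
  exact ⟨f, hf, c, hc, h1, h2⟩

lemma HC_prod {n m : ℕ} {D : Set (Fin n → ℂ)} (hD : HC D) {R : ℝ} (hR : 0 < R) : HC (D ×ˢ (ball (0 : Fin m → ℂ) R)) := by
  intro K hKD hK
  obtain ⟨V, hV, hKV, hVc, hVD, hVf⟩ := hD (Prod.fst '' K) (by rintro _ ⟨p, hp, rfl⟩; exact (hKD hp).1) (hK.image continuous_fst)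
  obtain ⟨s, hs0, hsR, hs⟩ : ∃ s, 0 ≤ s ∧ s < R ∧ ∀ p ∈ K, ‖p.2‖ ≤ s := by
    rcases K.eq_empty_or_nonempty with rfl | hne
    · exact ⟨0, le_rfl, hR, by simp⟩
    · obtain ⟨p, hp, hm⟩ := hK.exists_isMaxOn hne (f := fun p => ‖p.2‖) (by fun_prop)
      exact ⟨‖p.2‖, norm_nonneg _, by simpa using (hKD hp).2, fun y hy => hm hy⟩
  set t := (s + R) / 2 with ht
  have hcl : closure (V ×ˢ ball (0 : Fin m → ℂ) t) = closure V ×ˢ closedBall 0 t := by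
    rw [closure_prod_eq, closure_ball _ (show t ≠ 0 by linarith)]
  refine ⟨V ×ˢ ball 0 t, hV.prod isOpen_ball, fun p hp => ⟨hKV ⟨p, hp, rfl⟩, ?_⟩, ?_, ?_, ?_⟩
  · rw [mem_ball_zero_iff]; linarith [hs p hp]
  · rw [hcl]; exact hVc.prod (isCompact_closedBall _ _)
  · rw [hcl]; exact prod_mono hVD (closedBall_subset_ball (by linarith))
  · rw [hcl]
    rintro ⟨x, w⟩ ⟨hx, hw⟩ hn
    by_cases hxV : x ∈ V
    · have hwt : t ≤ ‖w‖ := by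
        by_contra h
        exact hn ⟨hxV, by simpa using h⟩
      obtain ⟨j, hj⟩ : ∃ j, s < ‖w j‖ := by
        by_contra h
        push Not at h
        have := (pi_norm_le_iff_of_nonneg hs0).2 h
        linarith
      refine ⟨fun p => p.2 j, by fun_prop, s, hs0, fun y hy => (norm_le_pi_norm y.2 j).trans (hs y hy), hj⟩
    · obtain ⟨f, hf, c, hc, h1, h2⟩ := hVf x hx hxV
      exact ⟨fun p => f p.1, hf.comp differentiableOn_fst fun p hp => hp.1, c, hc, fun y hy => h1 _ ⟨y, hy, rfl⟩, h2⟩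

section exh
variable {E : Type*} [NormedAddCommGroup E] [NormedSpace ℂ E] [FiniteDimensional ℂ E] [MeasureSpace E] [BorelSpace E] [(volume : Measure E).IsAddHaarMeasure]
variable {ι : Type*} [Fintype ι] (b : Module.Basis ι ℂ E)

lemma sep {Ω K : Set E} {x : E} {f : E → ℂ} (hf : DifferentiableOn ℂ f Ω) {c : ℝ} (hc : 0 ≤ c) (h1 : ∀ y ∈ K, ‖f y‖ ≤ c) (h2 : c < ‖f x‖) :
    ∃ g : E → ℂ, DifferentiableOn ℂ g Ω ∧ (∀ y ∈ K, ‖g y‖ ≤ 1 / 2) ∧ 2 < ‖g x‖ := by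
  set d := (c + ‖f x‖) / 2 with hd
  have hd0 : 0 < d := by linarith
  have e1 := (tendsto_pow_atTop_nhds_zero_of_lt_one (r := c / d) (by positivity) ((div_lt_one hd0).2 (by linarith))).eventually_lt_const (by norm_num : (0:ℝ) < 1 / 2)
  have e2 := (tendsto_pow_atTop_atTop_of_one_lt ((one_lt_div hd0).2 (by linarith) : 1 < ‖f x‖ / d)).eventually_gt_atTop 2
  obtain ⟨k, k1, k2⟩ := (e1.and e2).exists
  have hn : ∀ y, ‖(f y / (d : ℂ)) ^ k‖ = (‖f y‖ / d) ^ k := fun y => by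
    rw [norm_pow, norm_div, Complex.norm_real, Real.norm_of_nonneg hd0.le]
  refine ⟨fun y => (f y / (d : ℂ)) ^ k, (by simp only [div_eq_mul_inv]; exact (hf.mul_const _).pow k), fun y hy => ?_, by rw [hn]; exact k2⟩
  rw [hn]
  refine le_trans ?_ k1.le
  gcongr
  exact h1 y hy

open scoped Manifold in
lemma cutoff {Ω A : Set E} (hΩ : IsOpen Ω) (hA : IsClosed A) (hAΩ : A ⊆ Ω) :
    ∃ χ : E → ℝ, ContDiff ℝ ∞ χ ∧ (∀ x ∈ A, ∀ᶠ y in 𝓝 x, χ y = 1) ∧ ∀ x ∉ Ω, ∀ᶠ y in 𝓝 x, χ y = 0 := by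
  haveI : FiniteDimensional ℝ E := FiniteDimensional.complexToReal E
  obtain ⟨χ, h0, h1, -⟩ := exists_contMDiffMap_zero_one_nhds_of_isClosed (n := (⊤ : ℕ∞)) 𝓘(ℝ, E) hΩ.isClosed_compl hA (disjoint_compl_left_iff_subset.2 hAΩ)
  exact ⟨χ, χ.contMDiff.contDiff, fun x hx => h1.filter_mono (nhds_le_nhdsSet hx), fun x hx => h0.filter_mono (nhds_le_nhdsSet hx)⟩

lemma HC_Exh {Ω : Set E} (hΩ : IsOpen Ω) (h : HC Ω) : Exh b Ω := by
  classical
  intro K hKΩ hK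
  obtain ⟨V, hV, hKV, hVc, hVΩ, hVf⟩ := h K hKΩ hK
  obtain ⟨χ, hχ, hχ1, hχ0⟩ := cutoff hΩ isClosed_closure hVΩ
  have hVf' : ∀ x ∈ closure V \ V, ∃ g : E → ℂ, DifferentiableOn ℂ g Ω ∧ (∀ y ∈ K, ‖g y‖ ≤ 1 / 2) ∧ 2 < ‖g x‖ := fun x hx => by
    obtain ⟨f, hf, c, hc, h1, h2⟩ := hVf x hx.1 hx.2
    exact sep hf hc h1 h2
  choose! g hg hgK hgx using hVf'
  have hcomp : IsCompact (closure V \ V) := hVc.diff hV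
  obtain ⟨t, ht, htc⟩ := hcomp.elim_nhdsWithin_subcover (fun x => {y | 2 < ‖g x y‖}) (fun x hx => by
    refine mem_nhdsWithin_of_mem_nhds ?_
    exact (((hg x hx).differentiableAt (hΩ.mem_nhds (hVΩ hx.1))).continuousAt.norm).eventually_const_lt (hgx x hx))
  obtain ⟨p, hp1, hp⟩ : ∃ p : ℕ, 1 ≤ p ∧ (t.card : ℝ) * (1 / 4) ^ p ≤ 1 / 4 := by
    have e1 := ((tendsto_pow_atTop_nhds_zero_of_lt_one (r := (1 / 4 : ℝ)) (by norm_num) (by norm_num)).const_mul (t.card : ℝ))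
    rw [mul_zero] at e1
    obtain ⟨p, a1, a2⟩ := ((e1.eventually_lt_const (by norm_num : (0:ℝ) < 1 / 4)).and (eventually_ge_atTop 1)).exists
    exact ⟨p, a2, a1.le⟩
  obtain ⟨M, hM⟩ := hK.exists_bound_of_continuousOn (Qs_contDiff b 0).continuous.continuousOn
  set c0 := 1 / (4 * (|M| + 1)) with hc0
  have hc0p : 0 < c0 := by positivity
  set F : E → E → ℂ := fun x y => if x ∈ closure V \ V then (χ y : ℂ) * (g x y) ^ p else 0 with hF
  have hFs : ∀ x, ContDiff ℝ ∞ (F x) := by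
    intro x
    by_cases hx : x ∈ closure V \ V
    · simp only [hF, if_pos hx]
      rw [contDiff_iff_contDiffAt]
      intro y
      by_cases hy : y ∈ Ω
      · exact (Complex.ofRealCLM.contDiff.comp hχ).contDiffAt.mul ((hol_contDiffAt hΩ (hg x hx) hy).pow p)
      · exact contDiffAt_const.congr_of_eventuallyEq (f := fun _ => (0:ℂ)) (by filter_upwards [hχ0 y hy] with z hz; simp [hz])
    · simp only [hF, if_neg hx]; exact contDiff_const
  have hFz : ∀ x, ∀ y ∈ closure V, ∀ᶠ z in 𝓝 y, ∀ j, dzb (b j) (F x) z = 0 := by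
    intro x y hy
    by_cases hx : x ∈ closure V \ V
    · simp only [hF, if_pos hx]
      filter_upwards [(hχ1 y hy).eventually_nhds, hΩ.mem_nhds (hVΩ hy)] with z hz hzΩ j
      have : DifferentiableAt ℂ (fun y => (χ y : ℂ) * g x y ^ p) z := by
        refine DifferentiableAt.congr_of_eventuallyEq (f := fun y => g x y ^ p) (((hg x hx).differentiableAt (hΩ.mem_nhds hzΩ)).pow p) ?_
        filter_upwards [hz] with w hw; simp [hw]
      exact hol_dzb this _
    · simp only [hF, if_neg hx]
      exact Eventually.of_forall fun z j => hol_dzb (differentiableAt_const _) _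
  have hnF : ∀ x, ContDiff ℝ ∞ fun y => ‖F x y‖ ^ 2 := fun x => (hFs x).norm_sq ℝ
  have hsF : ContDiff ℝ ∞ fun y => ∑ x ∈ t, ‖F x y‖ ^ 2 := ContDiff.sum fun x _ => hnF x
  have hcQ : ContDiff ℝ ∞ fun y => c0 * Qs b 0 y := contDiff_const.mul (Qs_contDiff b 0)
  refine ⟨V, fun y => ∑ x ∈ t, ‖F x y‖ ^ 2 + c0 * Qs b 0 y, c0, hV, hVc, hVΩ, hsF.add hcQ, fun x => ?_, fun x hx hxV => ?_, hc0p, fun x hx ζ => ?_, fun x hx => ⟨hKV hx, ?_⟩⟩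
  · have := Qs_nonneg b 0 x; positivity
  · have hm := htc ⟨hx, hxV⟩
    simp only [mem_iUnion] at hm
    obtain ⟨i, hi, hxi⟩ := hm
    have h1 : ‖F i x‖ ^ 2 ≤ ∑ x_1 ∈ t, ‖F x_1 x‖ ^ 2 := Finset.single_le_sum (f := fun i => ‖F i x‖ ^ 2) (fun _ _ => by positivity) hi
    have h2 : ‖F i x‖ = ‖g i x‖ ^ p := by
      have := ht i hi
      simp only [hF, if_pos this, (hχ1 x hx).self_of_nhds]; simp
    have h3 : 2 < ‖g i x‖ := hxi
    have h4 : ‖g i x‖ ≤ ‖g i x‖ ^ p := le_self_pow₀ (by linarith) (by omega)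
    have h5 := mul_nonneg hc0p.le (Qs_nonneg b 0 x)
    rw [h2] at h1
    nlinarith
  · rw [LF_add b hsF hcQ, LF_sum t b hnF, LF_const_mul b c0 (Qs_contDiff b 0), LF_Qs]
    have : 0 ≤ ∑ i ∈ t, LF b (fun y => ‖F i y‖ ^ 2) x ζ := Finset.sum_nonneg fun i _ => by
      rw [LF_normSq b (hFs i) (hFz i x (subset_closure hx))]; positivity
    linarith
  · have h1 : ∑ i ∈ t, ‖F i x‖ ^ 2 ≤ ∑ i ∈ t, (1 / 4 : ℝ) ^ p := Finset.sum_le_sum fun i hi => by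
      have h2 : ‖F i x‖ = ‖g i x‖ ^ p := by
        have := ht i hi
        simp only [hF, if_pos this, (hχ1 x (subset_closure (hKV hx))).self_of_nhds]; simp
      rw [h2, ← pow_mul, mul_comm, pow_mul]
      gcongr
      have := hgK i (ht i hi) x hx
      nlinarith [norm_nonneg (g i x)]
    rw [Finset.sum_const, nsmul_eq_mul] at h1
    have h2 : c0 * Qs b 0 x ≤ 1 / 4 := by
      have : Qs b 0 x ≤ |M| + 1 := by linarith [(le_abs_self _).trans (hM x hx), le_abs_self M]
      calc c0 * Qs b 0 x ≤ c0 * (|M| + 1) := by gcongr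
        _ = 1 / 4 := by rw [hc0]; field_simp
    show ∑ i ∈ t, ‖F i x‖ ^ 2 + c0 * Qs b 0 x < 1
    linarith
end exh

section idt
variable {E : Type*} [NormedAddCommGroup E] [NormedSpace ℂ E]
lemma id_thm {a : E} {r ρ : ℝ} (hρ : 0 < ρ) {f g : E → ℂ} (hf : DifferentiableOn ℂ f (ball a r)) (hg : DifferentiableOn ℂ g (ball a r))
    (h : EqOn f g (ball a ρ)) : EqOn f g (ball a r) := by
  intro x hx
  set L : ℂ → E := fun t => a + t • (x - a) with hL
  have hLc : Continuous L := by fun_prop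
  have hLd : Differentiable ℂ L := by fun_prop
  set s := L ⁻¹' ball a r with hs
  have hso : IsOpen s := isOpen_ball.preimage hLc
  have hsc : Convex ℝ s := by
    intro t ht t' ht' u v hu hv huv
    have e : L (u • t + v • t') = u • L t + v • L t' := by
      simp only [hL, smul_add, add_smul, smul_smul, Complex.real_smul]
      have : a = u • a + v • a := by rw [← add_smul, huv, one_smul]
      nth_rw 1 [this]
      simp only [mul_smul, Complex.coe_smul]; abel
    show L (u • t + v • t') ∈ ball a r
    rw [e]; exact convex_ball a r ht ht' hu hv huv
  have e1 : ∀ {f : E → ℂ}, DifferentiableOn ℂ f (ball a r) → AnalyticOnNhd ℂ (f ∘ L) s := fun hf =>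
    (hf.comp hLd.differentiableOn fun t ht => ht).analyticOnNhd hso
  have hr : 0 < r := pos_of_mem_ball hx
  have h0 : (0 : ℂ) ∈ s := by simp [hs, hL, hr]
  have := (e1 hf).eqOn_of_preconnected_of_eventuallyEq (e1 hg) hsc.isPreconnected h0 (by
    filter_upwards [(isOpen_ball.preimage hLc).mem_nhds (show (0:ℂ) ∈ L ⁻¹' ball a ρ by simp [hL, hρ])] with t ht using h ht)
  have h1 := this (show (1 : ℂ) ∈ s by simpa [hs, hL] using hx)
  simpa [hL] using h1
end idt

lemma gliding {h : ℕ → ℂ → ℂ} {s ρ : ℝ} (hs : 1 < s) (hρ : 0 < ρ) (hh : ∀ k, DifferentiableOn ℂ (h k) (ball 0 s))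
    {u : ℕ → ℝ} (hu : Summable u) (hb : ∀ k, ∀ t ∈ ball (0:ℂ) ρ, ‖h k t‖ ≤ u k) (h1 : ∀ k, ‖h k 1‖ = 2 ^ k)
    (hF : ∀ a : ℕ → ℂ, (∃ M, ∀ k, ‖a k‖ ≤ M) → ∃ F : ℂ → ℂ, DifferentiableOn ℂ F (ball 0 s) ∧ ∀ t ∈ ball (0:ℂ) ρ, F t = ∑' k, a k * h k t) : False := by
  classical
  let X := BoundedContinuousFunction ℕ ℂ
  let Y := C(closedBall (0:ℂ) 1, ℂ)
  have hcb : closedBall (0:ℂ) 1 ⊆ ball 0 s := closedBall_subset_ball hs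
  have hX : ∀ a : X, ∃ F : ℂ → ℂ, DifferentiableOn ℂ F (ball 0 s) ∧ ∀ t ∈ ball (0:ℂ) ρ, F t = ∑' k, a k * h k t := fun a => hF a ⟨‖a‖, a.norm_coe_le_norm⟩
  choose F hFd hFe using hX
  have hsum : ∀ (a : X), ∀ t ∈ ball (0:ℂ) ρ, Summable fun k => a k * h k t := fun a t ht =>
    Summable.of_norm_bounded (hu.mul_left ‖a‖) fun k => by
      rw [norm_mul]
      exact mul_le_mul (a.norm_coe_le_norm k) (hb k t ht) (norm_nonneg _) (norm_nonneg _)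
  let T : X →ₗ[ℂ] Y :=
    { toFun := fun a => ⟨fun t => F a t, (((hFd a).continuousOn.mono hcb).restrict)⟩
      map_add' := fun a c => by
        ext t
        refine id_thm hρ (hFd (a + c)) ((hFd a).add (hFd c)) (fun t ht => ?_) (hcb t.2)
        show F (a + c) t = F a t + F c t
        rw [hFe _ t ht, hFe _ t ht, hFe _ t ht, ← (hsum a t ht).tsum_add (hsum c t ht)]
        congr 1; funext k
        rw [BoundedContinuousFunction.add_apply]; ring
      map_smul' := fun c a => by
        ext t
        refine id_thm hρ (hFd (c • a)) ((hFd a).const_smul c) (fun t ht => ?_) (hcb t.2)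
        show F (c • a) t = c * F a t
        rw [hFe _ t ht, hFe _ t ht, ← tsum_mul_left]
        congr 1; funext k
        rw [BoundedContinuousFunction.smul_apply, smul_eq_mul]; ring }
  have hTa : ∀ a (t : closedBall (0:ℂ) 1), T a t = F a t := fun a t => rfl
  have hTc : Continuous T := by
    refine T.continuous_of_seq_closed_graph fun v a y hv hy => ?_
    -- extension of y
    let Z : ℂ → ℂ := fun t => if ht : t ∈ closedBall (0:ℂ) 1 then y ⟨t, ht⟩ else 0
    have hZ : ∀ t (ht : t ∈ closedBall (0:ℂ) 1), Z t = y ⟨t, ht⟩ := fun t ht => dif_pos ht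
    have hyu := (ContinuousMap.tendsto_iff_tendstoUniformly.1 hy)
    have hZu : TendstoUniformlyOn (fun j t => F (v j) t) Z atTop (closedBall (0:ℂ) 1) := by
      rw [Metric.tendstoUniformlyOn_iff]
      intro ε hε
      filter_upwards [Metric.tendstoUniformly_iff.1 hyu ε hε] with j hj t ht
      rw [hZ t ht]; exact hj ⟨t, ht⟩
    have hZd : DifferentiableOn ℂ Z (ball 0 1) := (hZu.mono ball_subset_closedBall).tendstoLocallyUniformlyOn.differentiableOn
      (Eventually.of_forall fun j => (hFd (v j)).mono (ball_subset_closedBall.trans hcb)) isOpen_ball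
    have hZF : EqOn Z (F a) (ball 0 1) := by
      refine id_thm (ρ := min ρ 1) (lt_min hρ one_pos) hZd ((hFd a).mono (ball_subset_closedBall.trans hcb)) fun t ht => ?_
      have ht1 : t ∈ ball (0:ℂ) ρ := ball_subset_ball (min_le_left _ _) ht
      have ht2 : t ∈ closedBall (0:ℂ) 1 := ball_subset_closedBall (ball_subset_ball (min_le_right _ _) ht)
      refine tendsto_nhds_unique (hZu.tendsto_at ht2) ?_
      have e : ∀ a : X, F a t = ∑' k, a k * h k t := fun a => hFe a t ht1
      simp only [e]
      have hus : 0 ≤ ∑' k, u k := tsum_nonneg fun k => (norm_nonneg _).trans (hb k t ht1)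
      have hv0 := (tendsto_iff_norm_sub_tendsto_zero.1 hv).mul_const (∑' k, u k)
      rw [zero_mul] at hv0
      refine tendsto_iff_norm_sub_tendsto_zero.2 (squeeze_zero (fun _ => norm_nonneg _) (fun j => ?_) hv0)
      rw [← (hsum (v j) t ht1).tsum_sub (hsum a t ht1), ← tsum_mul_left]
      refine tsum_of_norm_bounded (hu.mul_left _).hasSum fun k => ?_
      rw [← sub_mul, norm_mul]
      exact mul_le_mul ((v j - a).norm_coe_le_norm k) (hb k t ht1) (norm_nonneg _) (norm_nonneg _)
    have hYd : ContinuousOn Z (closedBall 0 1) := by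
      rw [continuousOn_iff_continuous_restrict]
      convert y.continuous using 1
      funext t; exact hZ t t.2
    have hcl : EqOn Z (F a) (closedBall 0 1) := by
      refine EqOn.of_subset_closure hZF hYd ((hFd a).continuousOn.mono hcb) ball_subset_closedBall ?_
      rw [closure_ball _ one_ne_zero]
    ext t
    rw [hTa, ← hcl t.2, hZ t t.2]
  obtain ⟨M, hM0, hM⟩ := (⟨T, hTc⟩ : X →L[ℂ] Y).bound
  obtain ⟨k, hk⟩ := pow_unbounded_of_one_lt M (one_lt_two (α := ℝ))
  let e : X := BoundedContinuousFunction.ofNormedAddCommGroup (fun i => if i = k then (1:ℂ) else 0) continuous_of_discreteTopology 1 fun i => by split_ifs <;> simp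
  have he : ‖e‖ ≤ 1 := BoundedContinuousFunction.norm_ofNormedAddCommGroup_le _ zero_le_one _
  have hek : EqOn (F e) (h k) (ball 0 s) := id_thm hρ (hFd e) (hh k) fun t ht => by
    rw [hFe e t ht, tsum_eq_single k fun i hi => ?_]
    · show (if k = k then (1:ℂ) else 0) * _ = _
      simp
    · show (if i = k then (1:ℂ) else 0) * _ = _
      simp [hi]
  have h2 := (T e).norm_coe_le_norm ⟨1, by simp⟩
  rw [hTa, hek (show (1:ℂ) ∈ ball 0 s by simpa using hs), h1] at h2
  have h3 : ‖T e‖ ≤ M * ‖e‖ := hM e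
  nlinarith

section l2
variable {E : Type*} [NormedAddCommGroup E] [NormedSpace ℂ E] [FiniteDimensional ℂ E] [MeasureSpace E] [BorelSpace E] [(volume : Measure E).IsAddHaarMeasure]

lemma lint_eq (f : E → ℂ) (G : Set E) : ∫⁻ z in G, (‖f z‖₊ : ℝ≥0∞) ^ 2 = eLpNorm f 2 (volume.restrict G) ^ 2 := by
  have := eLpNorm_nnreal_pow_eq_lintegral (f := f) (p := 2) (μ := volume.restrict G) (by norm_num)
  simp only [NNReal.coe_ofNat, ENNReal.coe_ofNat, ENNReal.rpow_ofNat] at this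
  rw [this]; rfl

lemma cm (c : ℂ) (f : E → ℂ) (μ : Measure E) : eLpNorm (fun x => c * f x) 2 μ = ‖c‖ₑ * eLpNorm f 2 μ := eLpNorm_const_smul c f 2 μ

lemma mv {r : ℝ} (hr : 0 < r) : ∃ C : ℝ, ∀ (G : Set E) (x : E) (f : E → ℂ), IsOpen G → closedBall x r ⊆ G → DifferentiableOn ℂ f G →
    ‖f x‖ₑ ≤ ENNReal.ofReal C * eLpNorm f 2 (volume.restrict G) := by
  haveI : ProperSpace E := FiniteDimensional.proper ℂ E
  obtain ⟨ρ, hρ⟩ := exists_Moll (E := E) r hr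
  obtain ⟨B, hB⟩ := (isCompact_closedBall (0:E) r).exists_bound_of_continuousOn hρ.smooth.continuous.continuousOn
  have hvol : volume (closedBall (0:E) r) ≠ ⊤ := (isCompact_closedBall _ _).measure_lt_top.ne
  set A : ℝ≥0∞ := ENNReal.ofReal B * volume (closedBall (0:E) r) ^ (1 / (1:ℝ≥0∞).toReal - 1 / (2:ℝ≥0∞).toReal) with hA
  have hAt : A ≠ ⊤ := ENNReal.mul_ne_top ENNReal.ofReal_ne_top (ENNReal.rpow_ne_top_of_nonneg (by norm_num) hvol)
  refine ⟨A.toReal, fun G x f hG hx hf => ?_⟩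
  rw [ENNReal.ofReal_toReal hAt]
  have hm := mol_mean hρ fun z hz => hf.differentiableAt (hG.mem_nhds (hx hz))
  have hms : AEStronglyMeasurable f (volume.restrict (closedBall x r)) := (hf.continuousOn.mono hx).aestronglyMeasurable measurableSet_closedBall
  calc ‖f x‖ₑ ≤ ∫⁻ t, ‖ρ (x - t) • f t‖ₑ := by rw [← hm]; exact enorm_integral_le_lintegral_enorm _
    _ ≤ ∫⁻ t, (closedBall x r).indicator (fun t => ENNReal.ofReal B * ‖f t‖ₑ) t := by
      refine lintegral_mono fun t => ?_
      by_cases ht : t ∈ closedBall x r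
      · rw [indicator_of_mem ht, enorm_smul]
        gcongr
        rw [← ofReal_norm]
        refine ENNReal.ofReal_le_ofReal (hB _ ?_)
        rw [mem_closedBall_zero_iff, ← dist_eq_norm, dist_comm]; exact ht
      · rw [indicator_of_notMem ht, hρ.supp, zero_smul, enorm_zero]
        rw [mem_closedBall, not_le, dist_comm, dist_eq_norm] at ht; exact ht
    _ = ENNReal.ofReal B * eLpNorm f 1 (volume.restrict (closedBall x r)) := by
      rw [lintegral_indicator measurableSet_closedBall, lintegral_const_mul' _ _ ENNReal.ofReal_ne_top, eLpNorm_one_eq_lintegral_enorm]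
    _ ≤ ENNReal.ofReal B * (eLpNorm f 2 (volume.restrict (closedBall x r)) * (volume.restrict (closedBall x r)) univ ^ (1 / (1:ℝ≥0∞).toReal - 1 / (2:ℝ≥0∞).toReal)) := by
      gcongr
      exact eLpNorm_le_eLpNorm_mul_rpow_measure_univ (by norm_num) hms
    _ ≤ A * eLpNorm f 2 (volume.restrict G) := by
      rw [Measure.restrict_apply_univ, Measure.addHaar_closedBall_center, hA, mul_comm (eLpNorm _ _ _), ← mul_assoc]
      gcongr

lemma loc_bd {G : Set E} (hG : IsOpen G) {h : ℕ → E → ℂ} (hh : ∀ k, DifferentiableOn ℂ (h k) G)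
    (hn : ∀ k, eLpNorm (h k) 2 (volume.restrict G) ≤ ENNReal.ofReal ((1 / 2) ^ k)) {x : E} (hx : x ∈ G) :
    ∃ r > 0, ∃ u : ℕ → ℝ, Summable u ∧ ball x r ⊆ G ∧ ∀ k, ∀ y ∈ ball x r, ‖h k y‖ ≤ u k := by
  obtain ⟨ε, hε, hεG⟩ := Metric.isOpen_iff.1 hG x hx
  obtain ⟨C, hC⟩ := mv (E := E) (r := ε / 3) (by positivity)
  refine ⟨ε / 3, by positivity, fun k => |C| * (1 / 2) ^ k, summable_geometric_two.mul_left _, (ball_subset_ball (by linarith)).trans hεG, fun k y hy => ?_⟩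
  have h1 := hC G y (h k) hG ((closedBall_subset_ball' (by have := mem_ball.1 hy; linarith)).trans hεG) (hh k)
  have h2 : ‖h k y‖ₑ ≤ ENNReal.ofReal (|C| * (1 / 2) ^ k) := by
    refine h1.trans ?_
    rw [ENNReal.ofReal_mul (abs_nonneg _)]
    gcongr
    · exact le_abs_self C
    · exact hn k
  rw [← ofReal_norm] at h2
  exact (ENNReal.ofReal_le_ofReal_iff (by positivity)).1 h2

lemma sum_L2h {G : Set E} (hG : IsOpen G) {h : ℕ → E → ℂ} (hh : ∀ k, DifferentiableOn ℂ (h k) G)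
    (hn : ∀ k, eLpNorm (h k) 2 (volume.restrict G) ≤ ENNReal.ofReal ((1 / 2) ^ k)) {a : ℕ → ℂ} {M : ℝ} (ha : ∀ k, ‖a k‖ ≤ M) :
    (fun x => ∑' k, a k * h k x) ∈ L2h G := by
  have hM : 0 ≤ M := (norm_nonneg _).trans (ha 0)
  have hbd : ∀ {x : E} {u : ℕ → ℝ}, (∀ k, ‖h k x‖ ≤ u k) → ∀ k, ‖a k * h k x‖ ≤ M * u k := fun hx k => by
    rw [norm_mul]; exact mul_le_mul (ha k) (hx k) (norm_nonneg _) hM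
  have hms : ∀ k, AEStronglyMeasurable (fun x => a k * h k x) (volume.restrict G) := fun k =>
    (continuousOn_const.mul (hh k).continuousOn).aestronglyMeasurable hG.measurableSet
  constructor
  · intro x hx
    obtain ⟨r, hr, u, hu, hrG, hb⟩ := loc_bd hG hh hn hx
    refine ((hol_tsum (a := x) (half_lt_self hr) (hu.mul_left M) (fun k => ((hh k).mono hrG).const_mul (a k)) fun k y hy => hbd (fun k => hb k y hy) k).differentiableAt
      (isOpen_ball.mem_nhds (mem_ball_self (by positivity)))).differentiableWithinAt
  · rw [lint_eq]
    refine ENNReal.pow_lt_top ?_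
    refine lt_of_le_of_lt (Lp.eLpNorm_lim_le_liminf_eLpNorm (f := fun N x => ∑ k ∈ Finset.range N, a k * h k x) (fun N => ?_) _ ?_) (lt_of_le_of_lt ?_ (ENNReal.ofReal_lt_top (r := M * 2)))
    · exact Finset.aestronglyMeasurable_fun_sum _ fun k _ => hms k
    · filter_upwards [ae_restrict_mem hG.measurableSet] with x hx
      obtain ⟨r, hr, u, hu, hrG, hb⟩ := loc_bd hG hh hn hx
      exact (Summable.of_norm_bounded (hu.mul_left M) (hbd fun k => hb k x (mem_ball_self hr))).hasSum.tendsto_sum_nat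
    · refine liminf_le_of_frequently_le' (Frequently.of_forall fun N => ?_)
      calc eLpNorm (fun x => ∑ k ∈ Finset.range N, a k * h k x) 2 (volume.restrict G) ≤ ∑ k ∈ Finset.range N, eLpNorm (fun x => a k * h k x) 2 (volume.restrict G) := by
            have := eLpNorm_sum_le (f := fun k x => a k * h k x) (s := Finset.range N) (p := 2) (fun k _ => hms k) (by norm_num)
            convert this using 2
            funext x; simp
        _ ≤ ∑ k ∈ Finset.range N, ENNReal.ofReal (M * (1 / 2) ^ k) := by
            refine Finset.sum_le_sum fun k _ => ?_
            have : eLpNorm (fun x => a k * h k x) 2 (volume.restrict G) = ‖a k‖ₑ * eLpNorm (h k) 2 (volume.restrict G) := cm _ _ _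
            rw [this, ENNReal.ofReal_mul hM, ← ofReal_norm]
            gcongr
            · exact ha k
            · exact hn k
        _ ≤ ENNReal.ofReal (M * 2) := by
            rw [← ENNReal.ofReal_sum_of_nonneg fun k _ => by positivity, ← Finset.mul_sum]
            refine ENNReal.ofReal_le_ofReal (mul_le_mul_of_nonneg_left ?_ hM)
            exact (Summable.sum_le_tsum (f := fun k : ℕ => (1 / 2 : ℝ) ^ k) (Finset.range N) (fun _ _ => by positivity) summable_geometric_two).trans_eq tsum_geometric_two

lemma blow {G D1 : Set E} (hG : IsOpen G) {x0 q : E} {r : ℝ} (hr : ball x0 r ⊆ D1) (hx0 : x0 ∈ G) (hq : q ∈ ball x0 r)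
    {ρ : ℝ} (hρ : 0 < ρ) (hext : ∀ f ∈ L2h G, ∃ F : E → ℂ, DifferentiableOn ℂ F D1 ∧ EqOn F f (ball x0 ρ))
    (hf : ∀ ε > 0, ∃ f : E → ℂ, DifferentiableOn ℂ f (G ∪ ball x0 r) ∧ f q = 1 ∧ ∫⁻ x in G, (‖f x‖₊ : ℝ≥0∞) ^ 2 ≤ ENNReal.ofReal ε) : False := by
  choose f hfd hfq hfn using fun k : ℕ => hf (((1 / 4 : ℝ) ^ k) ^ 2) (by positivity)
  set h : ℕ → E → ℂ := fun k x => (2 : ℂ) ^ k * f k x with hh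
  have hd : ∀ k, DifferentiableOn ℂ (h k) (G ∪ ball x0 r) := fun k => (hfd k).const_mul _
  have hdG : ∀ k, DifferentiableOn ℂ (h k) G := fun k => (hd k).mono subset_union_left
  have hn : ∀ k, eLpNorm (h k) 2 (volume.restrict G) ≤ ENNReal.ofReal ((1 / 2) ^ k) := fun k => by
    have h1 : eLpNorm (h k) 2 (volume.restrict G) = ‖(2 : ℂ) ^ k‖ₑ * eLpNorm (f k) 2 (volume.restrict G) := cm ((2 : ℂ) ^ k) (f k) _
    have h2 := hfn k
    rw [lint_eq, ENNReal.ofReal_pow (by positivity)] at h2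
    have h3 := (ENNReal.pow_le_pow_left_iff two_ne_zero).1 h2
    have h4 : ((1 / 2 : ℝ)) ^ k = 2 ^ k * (1 / 4) ^ k := by rw [← mul_pow]; norm_num
    rw [h1, h4, ENNReal.ofReal_mul (by positivity), ← ofReal_norm]
    gcongr
    simp
  obtain ⟨r', hr', u, hu, hrG, hb⟩ := loc_bd hG hdG hn hx0
  have hqd : dist q x0 < r := hq
  obtain ⟨s, hs1, hs⟩ : ∃ s > 1, s * ‖q - x0‖ < r := by
    rw [dist_eq_norm] at hqd
    by_cases h0 : ‖q - x0‖ = 0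
    · exact ⟨2, by norm_num, by simpa [h0] using pos_of_mem_ball hq⟩
    have : 1 < r / ‖q - x0‖ := by rwa [one_lt_div (by positivity)]
    obtain ⟨s, h1, h2⟩ := exists_between this
    exact ⟨s, h1, by rwa [lt_div_iff₀ (by positivity)] at h2⟩
  have hL : ∀ t ∈ ball (0:ℂ) s, x0 + t • (q - x0) ∈ ball x0 r := fun t ht => by
    rw [mem_ball, dist_eq_norm, add_sub_cancel_left, norm_smul]
    have : ‖t‖ < s := by simpa using ht
    nlinarith [norm_nonneg t, norm_nonneg (q - x0)]
  have hLc : Continuous fun t : ℂ => x0 + t • (q - x0) := by fun_prop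
  obtain ⟨ρ', hρ', hsub⟩ := Metric.isOpen_iff.1 ((isOpen_ball (x := x0) (ε := min ρ r')).preimage hLc) 0 (by simp [hρ, hr'])
  have hsub' : ∀ t ∈ ball (0:ℂ) ρ', x0 + t • (q - x0) ∈ ball x0 (min ρ r') := fun t ht => hsub ht
  refine gliding (h := fun k t => h k (x0 + t • (q - x0))) hs1 hρ' (fun k => (hd k).comp (by fun_prop) fun t ht => Or.inr (hL t ht)) hu
    (fun k t ht => hb k _ (ball_subset_ball (min_le_right _ _) (hsub' t ht))) (fun k => ?_) fun a ⟨M, ha⟩ => ?_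
  · simp [hh, hfq]
  · obtain ⟨F, hFd, hFe⟩ := hext _ (sum_L2h hG hdG hn ha)
    exact ⟨fun t => F (x0 + t • (q - x0)), hFd.comp (by fun_prop) fun t ht => hr (hL t ht), fun t ht => hFe (ball_subset_ball (min_le_left _ _) (hsub' t ht))⟩
end l2

lemma geom {E : Type*} [NormedAddCommGroup E] [NormedSpace ℂ E] {G D0 D1 : Set E} (h0 : IsOpen D0) (h0c : IsConnected D0) (h1 : IsOpen D1) (h1c : IsConnected D1)
    (h01 : D0 ⊆ D1 ∩ G) (hn : ¬ D1 ⊆ G) {S : Set (E → ℂ)} (hS : ∀ f ∈ S, DifferentiableOn ℂ f G) :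
    ∃ x0 ∈ G, ∃ r ρ : ℝ, 0 < ρ ∧ ball x0 ρ ⊆ G ∧ ball x0 r ⊆ D1 ∧ 0 < r ∧ ¬ ball x0 r ⊆ G ∧
      ∀ f ∈ S, ∀ F : E → ℂ, DifferentiableOn ℂ F D1 → EqOn F f D0 → EqOn F f (ball x0 ρ) := by
  set W : Set E := {x | ∃ ρ > 0, ball x ρ ⊆ D1 ∩ G ∧ ∀ f ∈ S, ∀ F : E → ℂ, DifferentiableOn ℂ F D1 → EqOn F f D0 → EqOn F f (ball x ρ)} with hW
  have hWo : IsOpen W := by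
    rw [Metric.isOpen_iff]
    rintro x ⟨ρ, hρ, ha, hb⟩
    refine ⟨ρ, hρ, fun y hy => ?_⟩
    have hs : ball y (ρ - dist y x) ⊆ ball x ρ := ball_subset_ball' (by linarith)
    exact ⟨ρ - dist y x, by have := mem_ball.1 hy; linarith, hs.trans ha, fun f hf F h2 h3 => (hb f hf F h2 h3).mono hs⟩
  have hWG : W ⊆ G := fun x ⟨ρ, hρ, ha, _⟩ => (ha (mem_ball_self hρ)).2
  have h0W : D0 ⊆ W := fun x hx => by
    obtain ⟨ρ, hρ, hs⟩ := Metric.isOpen_iff.1 h0 x hx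
    exact ⟨ρ, hρ, hs.trans h01, fun f _ F _ h => h.mono hs⟩
  have hcl : ¬ (closure W ∩ D1 ⊆ W) := fun h => by
    obtain ⟨x, hx⟩ := h0c.nonempty
    exact hn ((h1c.isPreconnected.subset_of_closure_inter_subset hWo ⟨x, (h01 hx).1, h0W hx⟩ h).trans hWG)
  obtain ⟨y, ⟨hyc, hy1⟩, hyW⟩ := not_subset.1 hcl
  obtain ⟨r2, hr2, hrs⟩ := Metric.isOpen_iff.1 h1 y hy1
  obtain ⟨x0, hx0W, hd⟩ := Metric.mem_closure_iff.1 hyc (r2 / 2) (by positivity)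
  obtain ⟨ρ, hρ, ha, hb⟩ := hx0W
  have hsub : ball x0 (r2 / 2) ⊆ D1 := (ball_subset_ball' (by rw [dist_comm]; linarith)).trans hrs
  refine ⟨x0, (ha (mem_ball_self hρ)).2, r2 / 2, ρ, hρ, fun x hx => (ha hx).2, hsub, by positivity, fun hG => hyW ?_, hb⟩
  have hs : ball y (r2 / 2 - dist y x0) ⊆ ball x0 (r2 / 2) := ball_subset_ball' (by linarith)
  exact ⟨r2 / 2 - dist y x0, by linarith, fun x hx => ⟨hsub (hs hx), hG (hs hx)⟩, fun f hf F h2 h3 =>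
    (id_thm hρ (h2.mono hsub) ((hS f hf).mono hG) (hb f hf F h2 h3)).mono hs⟩

lemma max_toReal (x : ℝ) : (max (if x = 0 then (⊥ : EReal) else ((Real.log x : ℝ) : EReal)) (-((0:ℕ):ℝ) : EReal)).toReal = max (Real.log x) 0 := by
  have e : (-(((0:ℕ):ℝ) : EReal)) = ((0:ℝ) : EReal) := by simp
  rw [e]
  split_ifs with h
  · simp [h]
  · rw [← EReal.coe_strictMono.monotone.map_max, EReal.toReal_coe]

section fin
variable {n m : ℕ} {D : Set (Fin n → ℂ)} {H : (Fin n → ℂ) × (Fin m → ℂ) → ℝ}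

lemma H_usc (hopen : IsOpen D) (hpos : ∀ z ∈ D, ∀ w : Fin m → ℂ, 0 ≤ H (z, w)) (hlog : PlurisubharmonicOn
      (fun p => if H p = 0 then (⊥ : EReal) else ((Real.log (H p) : ℝ) : EReal)) (D ×ˢ (Set.univ : Set (Fin m → ℂ))))
    {p : (Fin n → ℂ) × (Fin m → ℂ)} (hp : p.1 ∈ D) {y : ℝ} (hy : H p ≠ 0 → Real.log (H p) < y) :
    ∀ᶠ x in 𝓝 p, x.1 ∈ D ∧ (H x ≠ 0 → Real.log (H x) < y) := by
  have hΩ : IsOpen (D ×ˢ (Set.univ : Set (Fin m → ℂ))) := hopen.prod isOpen_univ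
  have h1 := hlog.1 p ⟨hp, trivial⟩ (y : EReal) (by
    show (if H p = 0 then (⊥ : EReal) else _) < _
    split_ifs with h
    · exact EReal.bot_lt_coe y
    · exact EReal.coe_lt_coe_iff.2 (hy h))
  rw [hΩ.nhdsWithin_eq ⟨hp, trivial⟩] at h1
  filter_upwards [h1, hΩ.mem_nhds ⟨hp, trivial⟩] with x hx hxD
  refine ⟨hxD.1, fun h0 => ?_⟩
  have hx : (if H x = 0 then (⊥ : EReal) else _) < _ := hx
  rw [if_neg h0] at hx
  exact EReal.coe_lt_coe_iff.1 hx

lemma G_open (hopen : IsOpen D) (hpos : ∀ z ∈ D, ∀ w : Fin m → ℂ, 0 ≤ H (z, w)) (hlog : PlurisubharmonicOn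
      (fun p => if H p = 0 then (⊥ : EReal) else ((Real.log (H p) : ℝ) : EReal)) (D ×ˢ (Set.univ : Set (Fin m → ℂ)))) :
    IsOpen {p : (Fin n → ℂ) × (Fin m → ℂ) | p.1 ∈ D ∧ H p < 1} := by
  rw [isOpen_iff_mem_nhds]
  rintro p ⟨hp, hp1⟩
  have := H_usc hopen hpos hlog hp (y := 0) (fun h => Real.log_neg ((hpos _ hp p.2).lt_of_ne' h) hp1)
  filter_upwards [this] with x hx
  refine ⟨hx.1, ?_⟩
  by_cases h : H x = 0
  · rw [h]; exact one_pos
  · exact (Real.log_neg_iff ((hpos _ hx.1 x.2).lt_of_ne' h)).1 (hx.2 h)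

lemma phi_usc (hopen : IsOpen D) (hpos : ∀ z ∈ D, ∀ w : Fin m → ℂ, 0 ≤ H (z, w)) (hlog : PlurisubharmonicOn
      (fun p => if H p = 0 then (⊥ : EReal) else ((Real.log (H p) : ℝ) : EReal)) (D ×ˢ (Set.univ : Set (Fin m → ℂ))))
    {Ω : Set ((Fin n → ℂ) × (Fin m → ℂ))} (hΩ : ∀ p ∈ Ω, p.1 ∈ D) {s : ℝ} (hs : 0 < s) :
    UpperSemicontinuousOn (fun p => s * max (Real.log (H p)) 0) Ω := by
  intro p hp y hy
  have hy : max (Real.log (H p)) 0 < y / s := by rw [lt_div_iff₀' hs]; exact hy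
  have hy0 : 0 < y / s := (le_max_right _ _).trans_lt hy
  refine mem_nhdsWithin_of_mem_nhds ?_
  filter_upwards [H_usc hopen hpos hlog (hΩ p hp) (fun _ => (le_max_left _ _).trans_lt hy)] with x hx
  show s * max (Real.log (H x)) 0 < y
  rw [← lt_div_iff₀' hs, max_lt_iff]
  refine ⟨?_, hy0⟩
  by_cases h : H x = 0
  · rw [h, Real.log_zero]; exact hy0
  · exact hx.2 h

lemma phi_smean (hlog : PlurisubharmonicOn
      (fun p => if H p = 0 then (⊥ : EReal) else ((Real.log (H p) : ℝ) : EReal)) (D ×ˢ (Set.univ : Set (Fin m → ℂ))))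
    {Ω : Set ((Fin n → ℂ) × (Fin m → ℂ))} (hΩ : ∀ p ∈ Ω, p.1 ∈ D) {s : ℝ} (hs : 0 < s) :
    Smean Ω (fun p => s * max (Real.log (H p)) 0) := by
  intro x v hx
  have hin : ∀ t : ℂ, ‖t‖ ≤ 1 → x + t • v ∈ D ×ˢ (Set.univ : Set (Fin m → ℂ)) := fun t ht => ⟨hΩ _ (hx t ht), trivial⟩
  have h := (hlog.2.2 x v).2.2 0 (hin 0 (by simp)) 1 one_pos (fun t ht => hin t (by simpa using ht))
  have h2 := h.trans (iInf_le _ 0)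
  have e : circleAvgTrunc (fun lam : ℂ => if H (x + lam • v) = 0 then (⊥ : EReal) else ((Real.log (H (x + lam • v)) : ℝ) : EReal)) 0 1 0
      = (2 * Real.pi)⁻¹ * ∫ θ in (0:ℝ)..(2 * Real.pi), max (Real.log (H (x + Complex.exp (θ * I) • v))) 0 := by
    unfold circleAvgTrunc
    congr 1
    refine intervalIntegral.integral_congr fun θ _ => ?_
    simp only [ofReal_one, one_mul, zero_add]
    exact max_toReal _
  have h3 : (if H x = 0 then (⊥ : EReal) else ((Real.log (H x) : ℝ) : EReal)) ≤ (((2 * Real.pi)⁻¹ * ∫ θ in (0:ℝ)..(2 * Real.pi), max (Real.log (H (x + Complex.exp (θ * I) • v))) 0 : ℝ) : EReal) := by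
    rw [← e]; simpa using h2
  have hnn : 0 ≤ (2 * Real.pi)⁻¹ * ∫ θ in (0:ℝ)..(2 * Real.pi), max (Real.log (H (x + Complex.exp (θ * I) • v))) 0 :=
    mul_nonneg (by positivity) (intervalIntegral.integral_nonneg (by positivity) fun _ _ => le_max_right _ _)
  have h4 : max (Real.log (H x)) 0 ≤ (2 * Real.pi)⁻¹ * ∫ θ in (0:ℝ)..(2 * Real.pi), max (Real.log (H (x + Complex.exp (θ * I) • v))) 0 := by
    refine max_le ?_ hnn
    by_cases h : H x = 0
    · rw [h, Real.log_zero]; exact hnn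
    · rw [if_neg h] at h3; exact EReal.coe_le_coe_iff.1 h3
  show s * max (Real.log (H x)) 0 ≤ _
  rw [intervalIntegral.integral_const_mul]
  calc s * max (Real.log (H x)) 0 ≤ s * _ := mul_le_mul_of_nonneg_left h4 hs.le
    _ = _ := by ring

theorem final (D : Set (Fin n → ℂ)) (hopen : IsOpen D) (hbd : Bornology.IsBounded D) (hD : IsL2hDomainOfHolomorphy D)
    (H : (Fin n → ℂ) × (Fin m → ℂ) → ℝ) (hpos : ∀ z ∈ D, ∀ w : Fin m → ℂ, 0 ≤ H (z, w))
    (hlog : PlurisubharmonicOn (fun p => if H p = 0 then (⊥ : EReal) else ((Real.log (H p) : ℝ) : EReal)) (D ×ˢ (Set.univ : Set (Fin m → ℂ))))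
    (hhom : ∀ z ∈ D, ∀ (w : Fin m → ℂ) (lam : ℂ), H (z, lam • w) = ‖lam‖ * H (z, w))
    (hlb : ∃ C > 0, ∀ z ∈ D, ∀ w : Fin m → ℂ, C * ‖w‖ ≤ H (z, w)) :
    IsL2hDomainOfHolomorphy {p : (Fin n → ℂ) × (Fin m → ℂ) | p.1 ∈ D ∧ H p < 1} := by
  obtain ⟨C, hC, hlb⟩ := hlb
  set G := {p : (Fin n → ℂ) × (Fin m → ℂ) | p.1 ∈ D ∧ H p < 1} with hGdef
  have hG : IsOpen G := G_open hopen hpos hlog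
  rintro ⟨D0, D1, h0, h0c, h1, h1c, h01, hn, hext⟩
  obtain ⟨x0, hx0, r, ρ, hρ, hρG, hr1, hr, hrG, hext2⟩ := geom h0 h0c h1 h1c h01 hn (S := L2h G) fun f hf => hf.1
  set R := max (1 / C) (‖x0.2‖ + r) + 1 with hR
  have hRp : 0 < R := by have := le_max_left (1 / C) (‖x0.2‖ + r); have : 0 < 1 / C := by positivity
                         linarith
  set Ω : Set ((Fin n → ℂ) × (Fin m → ℂ)) := D ×ˢ ball (0 : Fin m → ℂ) R with hΩ
  have hGΩ : G ⊆ Ω := fun p hp => ⟨hp.1, by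
    have h2 := (hlb p.1 hp.1 p.2).trans_lt hp.2
    have h3 : ‖p.2‖ < 1 / C := by rw [lt_div_iff₀' hC]; exact h2
    rw [mem_ball_zero_iff]; linarith [le_max_left (1 / C) (‖x0.2‖ + r)]⟩
  have hbp : ∀ t, ball x0 t = ball x0.1 t ×ˢ ball x0.2 t := fun t => (ball_prod_same _ _ _).symm
  by_cases hcase : ball x0.1 r ⊆ D
  · have hrΩ : ball x0 r ⊆ Ω := fun p hp => by
      rw [hbp] at hp
      refine ⟨hcase hp.1, ?_⟩
      have h2 : ‖p.2‖ ≤ ‖p.2 - x0.2‖ + ‖x0.2‖ := by simpa using norm_add_le (p.2 - x0.2) x0.2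
      have h3 := mem_ball.1 hp.2
      rw [dist_eq_norm] at h3
      rw [mem_ball_zero_iff]; linarith [le_max_right (1 / C) (‖x0.2‖ + r)]
    obtain ⟨q0, hq0, hq0G⟩ := not_subset.1 hrG
    have hq0D : q0.1 ∈ D := (hrΩ hq0).1
    have hH0 : 1 ≤ H q0 := by
      by_contra h
      exact hq0G ⟨hq0D, not_le.1 h⟩
    obtain ⟨q, hq, hHq⟩ : ∃ q ∈ ball x0 r, 1 < H q := by
      have hc : Continuous fun t : ℝ => ((q0.1, ((t : ℂ)) • q0.2) : (Fin n → ℂ) × (Fin m → ℂ)) := by fun_prop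
      have := (isOpen_ball.preimage hc).mem_nhds (show (1:ℝ) ∈ _ ⁻¹' ball x0 r by simpa using hq0)
      obtain ⟨ε, hε, hs⟩ := Metric.mem_nhds_iff.1 this
      refine ⟨_, hs (show 1 + ε / 2 ∈ ball (1:ℝ) ε by rw [mem_ball, Real.dist_eq]; rw [abs_of_pos] <;> linarith), ?_⟩
      show 1 < H (q0.1, _)
      rw [hhom _ hq0D, Complex.norm_real, Real.norm_of_nonneg (by positivity)]
      have : H (q0.1, q0.2) = H q0 := rfl
      rw [this]; nlinarith
    have hqΩ := hrΩ hq
    have hq2 : q.2 ≠ 0 := fun h => by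
      have h2 := hhom q.1 hqΩ.1 q.2 0
      rw [zero_smul, norm_zero, zero_mul, ← h] at h2
      have : H (q.1, q.2) = H q := rfl
      linarith
    haveI : Nontrivial ((Fin n → ℂ) × (Fin m → ℂ)) := ⟨(0, q.2), 0, fun h => hq2 (congrArg Prod.snd h)⟩
    let b := Module.finBasis ℂ ((Fin n → ℂ) × (Fin m → ℂ))
    haveI : Nonempty (Fin (Module.finrank ℂ ((Fin n → ℂ) × (Fin m → ℂ)))) := b.index_nonempty
    have hΩo : IsOpen Ω := hopen.prod isOpen_ball
    have hex : Exh b Ω := HC_Exh b hΩo (HC_prod (HC_dom hopen hD hbd) hRp)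
    have hΩb : Bornology.IsBounded Ω := hbd.prod isBounded_ball
    obtain ⟨B, hB⟩ := hΩb.isCompact_closure.exists_bound_of_continuousOn (Qs_contDiff b q).continuous.continuousOn
    obtain ⟨A, hA, hext3⟩ := ext_pt b (R0 := |B| + 1) (by positivity) hΩo hqΩ hex fun x hx => by
      linarith [(le_abs_self _).trans (hB x (subset_closure hx)), le_abs_self B]
    have hL : 0 < Real.log (H q) := Real.log_pos hHq
    refine blow hG hr1 hx0 hq hρ (fun f hf => ?_) fun ε hε => ?_
    · obtain ⟨F, hF, hFe⟩ := hext f hf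
      exact ⟨F, hF, hext2 f hf F hF hFe⟩
    · obtain ⟨s, hs, hsε⟩ : ∃ s > 0, A * Real.exp (-(s * max (Real.log (H q)) 0)) ≤ ε := by
        have h2 : Tendsto (fun s : ℝ => A * Real.exp (-(s * max (Real.log (H q)) 0))) atTop (𝓝 (A * 0)) :=
          (Real.tendsto_exp_neg_atTop_nhds_zero.comp (tendsto_id.atTop_mul_const (lt_max_of_lt_left hL))).const_mul A
        rw [mul_zero] at h2
        obtain ⟨s, h3, h4⟩ := ((h2.eventually_lt_const hε).and (eventually_gt_atTop 0)).exists
        exact ⟨s, h4, h3.le⟩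
      obtain ⟨f, hf, hfq, hfG⟩ := hext3 (fun p => s * max (Real.log (H p)) 0) (fun x _ => mul_nonneg hs.le (le_max_right _ _))
        (phi_usc hopen hpos hlog (fun p hp => hp.1) hs) (phi_smean hlog (fun p hp => hp.1) hs)
      refine ⟨f, hf.mono (union_subset hGΩ hrΩ), hfq, (hfG G hGΩ hG.measurableSet fun x hx => ?_).trans (ENNReal.ofReal_le_ofReal hsε)⟩
      show s * max (Real.log (H x)) 0 = 0
      rw [max_eq_right (Real.log_nonpos (hpos _ hx.1 x.2) hx.2.le), mul_zero]
  · refine hD ⟨ball x0.1 ρ ∩ ball x0.1 r, ball x0.1 r, isOpen_ball.inter isOpen_ball, ((convex_ball _ _).inter (convex_ball _ _)).isConnected ⟨x0.1, mem_ball_self hρ, mem_ball_self hr⟩,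
      isOpen_ball, (convex_ball _ _).isConnected (nonempty_ball.2 hr), fun z hz => ⟨hz.2, (hρG (show (z, x0.2) ∈ ball x0 ρ by rw [hbp]; exact ⟨hz.1, mem_ball_self hρ⟩)).1⟩, hcase, fun f hf => ?_⟩
    have hfG : (fun p : (Fin n → ℂ) × (Fin m → ℂ) => f p.1) ∈ L2h G := by
      refine ⟨hf.1.comp differentiableOn_fst fun p hp => hp.1, ?_⟩
      have hfm : AEMeasurable (fun z => (‖f z‖₊ : ℝ≥0∞) ^ 2) (volume.restrict D) :=
        ((hf.1.continuousOn.aestronglyMeasurable hopen.measurableSet).aemeasurable.enorm).pow_const 2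
      calc ∫⁻ p in G, (‖f p.1‖₊ : ℝ≥0∞) ^ 2 ≤ ∫⁻ p in Ω, (‖f p.1‖₊ : ℝ≥0∞) ^ 2 := lintegral_mono_set hGΩ
        _ = ∫⁻ p, (‖f p.1‖₊ : ℝ≥0∞) ^ 2 * 1 ∂((volume.restrict D).prod (volume.restrict (ball (0 : Fin m → ℂ) R))) := by
          rw [Measure.prod_restrict]; simp only [mul_one]; rfl
        _ = (∫⁻ z in D, (‖f z‖₊ : ℝ≥0∞) ^ 2) * ∫⁻ w in ball (0 : Fin m → ℂ) R, 1 := lintegral_prod_mul (g := fun _ => 1) hfm aemeasurable_const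
        _ < ⊤ := ENNReal.mul_lt_top hf.2 (by simpa using measure_ball_lt_top)
    obtain ⟨F, hF, hFe⟩ := hext _ hfG
    have hFe2 := hext2 _ hfG F hF hFe
    refine ⟨fun z => F (z, x0.2), hF.comp (by fun_prop) fun z hz => hr1 (by rw [hbp]; exact ⟨hz, mem_ball_self hr⟩), fun z hz => ?_⟩
    exact hFe2 (show (z, x0.2) ∈ ball x0 ρ by rw [hbp]; exact ⟨hz.1, mem_ball_self hρ⟩)
end fin

end HD

/-- **Proposition 12.** If `D ⊆ ℂⁿ` is a bounded `L²ₕ`-domain of holomorphy and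
`G_D = {(z,w) : H(z,w) < 1}` is a bounded Hartogs domain over `D` with `m`-dimensional
balanced fibers (`log H` plurisubharmonic, `H(z, λw) = |λ| H(z,w)`, `H(z,w) ≥ C‖w‖`),
then `G_D` is an `L²ₕ`-domain of holomorphy. -/
theorem hartogs_domain_l2h {n m : ℕ} (D : Set (Fin n → ℂ))
    (hopen : IsOpen D) (hconn : IsConnected D) (hbd : Bornology.IsBounded D)
    (hD : IsL2hDomainOfHolomorphy D)
    (H : (Fin n → ℂ) × (Fin m → ℂ) → ℝ)
    (hpos : ∀ z ∈ D, ∀ w : Fin m → ℂ, 0 ≤ H (z, w))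
    (hlog : PlurisubharmonicOn
      (fun p => if H p = 0 then (⊥ : EReal) else ((Real.log (H p) : ℝ) : EReal))
      (D ×ˢ (Set.univ : Set (Fin m → ℂ))))
    (hhom : ∀ z ∈ D, ∀ (w : Fin m → ℂ) (lam : ℂ), H (z, lam • w) = ‖lam‖ * H (z, w))
    (hlb : ∃ C > 0, ∀ z ∈ D, ∀ w : Fin m → ℂ, C * ‖w‖ ≤ H (z, w)) :
    IsL2hDomainOfHolomorphy {p : (Fin n → ℂ) × (Fin m → ℂ) | p.1 ∈ D ∧ H p < 1} := by
  exact HD.final D hopen hbd hD H hpos hlog hhom hlb
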